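/- Let (R,m) be a complete Noetherian local ring of dimension d ≥ 2 that is reduced and satisfies Serre's condition S₂, and let Q = (x₁,…,x_d) be a parameter ideal with ē₁(Q) = 0. Let R' = R[t₁,…,t_d]_{mR[t₁,…,t_d]}, let x = t₁x₁ + ⋯ + t_dx_d, and let R'' = R̂'/xR̂' (where R̂' is the completion of R'). Then R'' is reduced, equidimensional, and satisfies S₂ on the punctured spectrum, and moreover ē₁(QR'') = 0. -/

import Mathlib

open IsLocalRing

universe u

section BasicDefs

variable (R : Type*) [CommRing R]

/-- The length of a module, i.e. the Krull dimension of its lattice of submodules. -/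
noncomputable def moduleLength (M : Type*) [AddCommGroup M] [Module R M] : WithBot ℕ∞ :=
  Order.krullDim (Submodule R M)

/-- A system of parameters of a Noetherian local ring: `d` elements generating an
ideal whose radical is the maximal ideal, where `d` is the Krull dimension. -/
def IsSOP [IsLocalRing R] {d : ℕ} (x : Fin d → R) : Prop :=
  ringKrullDim R = (d : WithBot ℕ∞) ∧
    (Ideal.span (Set.range x)).radical = maximalIdeal R

/-- A parameter ideal is an ideal generated by a system of parameters. -/
def IsParameterIdeal [IsLocalRing R] (Q : Ideal R) : Prop :=
  ∃ (d : ℕ) (x : Fin d → R), IsSOP R x ∧ Q = Ideal.span (Set.range x)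

/-- `f : R →+* B` makes `B` a balanced big Cohen-Macaulay `R`-algebra if every system of
parameters of `R` maps to a regular sequence on `B` and `m·B ≠ B`. -/
def IsBalancedBigCMHom [IsLocalRing R] {B : Type*} [CommRing B] (f : R →+* B) : Prop :=
  (∀ (d : ℕ) (x : Fin d → R), IsSOP R x →
      RingTheory.Sequence.IsRegular B (List.ofFn fun i => f (x i))) ∧
    (maximalIdeal R).map f ≠ ⊤

/-- A balanced big Cohen-Macaulay algebra. -/
def IsBalancedBigCM [IsLocalRing R] (B : Type*) [CommRing B] [Algebra R B] : Prop :=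
  IsBalancedBigCMHom R (algebraMap R B)

/-- The integral closure of an ideal `I`, as a set: all `x` satisfying an equation
`x^n + a₁ x^{n-1} + ⋯ + aₙ = 0` with `aₖ ∈ I^k`. -/
def intClSet (I : Ideal R) : Set R :=
  { x | ∃ n : ℕ, 0 < n ∧ ∃ a : ℕ → R,
      (∀ k ∈ Finset.Icc 1 n, a k ∈ I ^ k) ∧
      x ^ n + ∑ k ∈ Finset.Icc 1 n, a k * x ^ (n - k) = 0 }

/-- `I^B := IB ∩ R`, the contraction of the extension of `I` along `f : R →+* B`. -/
def contractedExt {B : Type*} [CommRing B] (f : R →+* B) (I : Ideal R) : Ideal R :=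
  (I.map f).comap f

/-- Condition (†): `I^B ⊆ \bar I` for every m-primary ideal `I`. -/
def SatisfiesDagger [IsLocalRing R] {B : Type*} [CommRing B] (f : R →+* B) : Prop :=
  ∀ I : Ideal R, I.radical = maximalIdeal R →
    (contractedExt R f I : Set R) ⊆ intClSet R I

/-- `e` is the family of Hilbert coefficients of the filtration `J` (in dimension `d`):
for `n ≫ 0`, `ℓ(R/J (n+1)) = ∑_{i≤d} (-1)^i e i * choose (n+d-i) (d-i)`. -/
def HasHilbertSeries (d : ℕ) (J : ℕ → Ideal R) (e : ℕ → ℤ) : Prop :=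
  ∃ N : ℕ, ∀ n ≥ N, ∃ m : ℕ,
    moduleLength R (R ⧸ J (n + 1)) = (m : WithBot ℕ∞) ∧
    (m : ℤ) = ∑ i ∈ Finset.range (d + 1),
      (-1) ^ i * e i * ((n + d - i).choose (d - i) : ℤ)

/-- Module version of `HasHilbertSeries`, for the `J`-adic filtration of a module `M`. -/
def HasHilbertSeriesMod (M : Type*) [AddCommGroup M] [Module R M] (d : ℕ)
    (J : Ideal R) (e : ℕ → ℤ) : Prop :=
  ∃ N : ℕ, ∀ n ≥ N, ∃ m : ℕ,
    moduleLength R (M ⧸ (J ^ (n + 1) • (⊤ : Submodule R M))) = (m : WithBot ℕ∞) ∧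
    (m : ℤ) = ∑ i ∈ Finset.range (d + 1),
      (-1) ^ i * e i * ((n + d - i).choose (d - i) : ℤ)


/-- The limit closure `(x₁,…,x_d)^{lim} = ⋃ₜ ((x₁^{t+1},…,x_d^{t+1}) : (x₁⋯x_d)^t)`. -/
def limitClosure {d : ℕ} (x : Fin d → R) : Ideal R :=
  ⨆ t : ℕ, (Ideal.span (Set.range fun i => x i ^ (t + 1))).colon
    (Ideal.span {(∏ i, x i) ^ t})

/-- A ring is equidimensional if `dim (R/P) = dim R` for every minimal prime `P`. -/
def IsEquidimensional : Prop :=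
  ∀ P ∈ minimalPrimes R, ringKrullDim (R ⧸ P) = ringKrullDim R

/-- Depth at least `n`: there is a regular sequence of length `n` in the
(Jacobson) radical, i.e. in the maximal ideal when `R` is local. -/
def HasDepthGE (n : ℕ) : Prop :=
  ∃ rs : List R, rs.length = n ∧ (∀ r ∈ rs, r ∈ (⊥ : Ideal R).jacobson) ∧
    RingTheory.Sequence.IsRegular R rs

/-- A Cohen-Macaulay (Noetherian) local ring: depth = dimension. -/
def IsCohenMacaulayLocalRing : Prop :=
  IsLocalRing R ∧ IsNoetherianRing R ∧
    ∃ d : ℕ, ringKrullDim R = (d : WithBot ℕ∞) ∧ HasDepthGE R d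

/-- Serre's condition S₂: for every prime `P`,
`depth R_P ≥ min 2 (dim R_P)`. -/
def SerreS2 : Prop :=
  ∀ (P : Ideal R) (hP : P.IsPrime) (n : ℕ),
    (n : WithBot ℕ∞) ≤ min 2 (ringKrullDim (Localization.AtPrime P)) →
    HasDepthGE (Localization.AtPrime P) n

/-- A regular local ring: a Noetherian local ring whose maximal ideal is generated
by `dim R` elements. -/
def IsRegularLocal : Prop :=
  IsLocalRing R ∧ IsNoetherianRing R ∧ ∃ (d : ℕ) (x : Fin d → R),
    ringKrullDim R = (d : WithBot ℕ∞) ∧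
      Ideal.span (Set.range x) = (⊥ : Ideal R).jacobson

/-- A regular (not necessarily local) ring: Noetherian and all localizations at
primes are regular local rings. -/
def IsRegularCommRing : Prop :=
  IsNoetherianRing R ∧
    ∀ (P : Ideal R) (hP : P.IsPrime), IsRegularLocal (Localization.AtPrime P)

/-- The tight closure of an ideal `I` in characteristic `p`, as a set. -/
def tightClSet (p : ℕ) (I : Ideal R) : Set R :=
  { x | ∃ c : R, (∀ P ∈ minimalPrimes R, c ∉ P) ∧
      ∃ E : ℕ, ∀ e ≥ E, c * x ^ p ^ e ∈ Ideal.span ((fun a => a ^ p ^ e) '' (I : Set R)) }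

/-- F-rationality: every parameter ideal is tightly closed. -/
def IsFRational [IsLocalRing R] (p : ℕ) : Prop :=
  ∀ Q : Ideal R, IsParameterIdeal R Q → tightClSet R p Q ⊆ (Q : Set R)

end BasicDefs

section Excellence

open TensorProduct

/-- Geometrically regular `k`-algebra (for `k` a field): `L ⊗[k] A` is regular
for every finite field extension `L` of `k`. -/
def IsGeometricallyRegular (k : Type u) (A : Type u) [CommRing k] [CommRing A]
    [Algebra k A] : Prop :=
  ∀ (L : Type u) [Field L] [Algebra k L], Module.Finite k L → IsRegularCommRing (L ⊗[k] A)

/-- `R` is a G-ring: for every prime `p`, the fibers of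
`R_p → (R_p)^∧` are geometrically regular. -/
def IsGRing (R : Type u) [CommRing R] : Prop :=
  ∀ (p : Ideal R) (hp : p.IsPrime) (q : Ideal (Localization.AtPrime p)) (hq : q.IsPrime),
    IsGeometricallyRegular
      (ResidueField (Localization.AtPrime q))
      ((ResidueField (Localization.AtPrime q))
        ⊗[Localization.AtPrime p]
        AdicCompletion (maximalIdeal (Localization.AtPrime p)) (Localization.AtPrime p))

/-- `R` is J-2: the regular locus of every finitely generated `R`-algebra is open. -/
def IsJ2 (R : Type u) [CommRing R] : Prop :=
  ∀ (A : Type u) [CommRing A] [Algebra R A], Algebra.FiniteType R A →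
    IsOpen { P : PrimeSpectrum A | IsRegularLocal (Localization.AtPrime P.asIdeal) }

/-- A catenary ring: any two saturated chains of primes with the same endpoints
have the same length. -/
def IsCatenary (A : Type*) [CommRing A] : Prop :=
  ∀ c₁ c₂ : LTSeries (PrimeSpectrum A),
    c₁.head = c₂.head → c₁.last = c₂.last →
    (∀ i : Fin c₁.length, c₁.toFun i.castSucc ⋖ c₁.toFun i.succ) →
    (∀ i : Fin c₂.length, c₂.toFun i.castSucc ⋖ c₂.toFun i.succ) →
    c₁.length = c₂.length

/-- Universally catenary: every finitely generated `R`-algebra is catenary. -/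
def IsUniversallyCatenary (R : Type u) [CommRing R] : Prop :=
  ∀ (A : Type u) [CommRing A] [Algebra R A], Algebra.FiniteType R A → IsCatenary A

/-- An excellent ring: Noetherian, a G-ring, J-2 and universally catenary. -/
def IsExcellentRing (R : Type u) [CommRing R] : Prop :=
  IsNoetherianRing R ∧ IsGRing R ∧ IsJ2 R ∧ IsUniversallyCatenary R

end Excellence

/-- `R` is BCM_B-rational (in dimension `d`): Cohen-Macaulay and the natural map
`H^d_m(R) → H^d_m(B)` is injective. -/
def IsBCMRational (R : Type u) [CommRing R] [IsLocalRing R]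
    (B : Type u) [CommRing B] [Algebra R B] (d : ℕ) : Prop :=
  IsCohenMacaulayLocalRing R ∧
    Function.Injective
      ((localCohomology (maximalIdeal R) d).map (ModuleCat.ofHom (Algebra.linearMap R B)))

section GenericConstruction

variable (R : Type u) [CommRing R] [IsLocalRing R] (d : ℕ)

/-- The polynomial extension `R[t₁,…,t_d]`. -/
abbrev GenPoly : Type u := MvPolynomial (Fin d) R

/-- The prime `m·R[t₁,…,t_d]`. -/
noncomputable abbrev genPrime : Ideal (GenPoly R d) := (maximalIdeal R).map MvPolynomial.C

/-- `R′ = R[t₁,…,t_d]_{m R[t₁,…,t_d]}`. -/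
abbrev GenLoc (hP : (genPrime R d).IsPrime) : Type u :=
  Localization (genPrime R d).primeCompl

/-- The completion `R̂′` of `R′`. -/
abbrev GenLocHat (hP : (genPrime R d).IsPrime) : Type u :=
  AdicCompletion (maximalIdeal (GenLoc R d hP)) (GenLoc R d hP)

/-- The general element `x = t₁x₁ + ⋯ + t_d x_d`. -/
noncomputable def genElt (x : Fin d → R) : GenPoly R d :=
  ∑ i, MvPolynomial.X i * MvPolynomial.C (x i)

/-- The image of the general element in `R′`. -/
noncomputable def genEltLoc (hP : (genPrime R d).IsPrime) (x : Fin d → R) : GenLoc R d hP :=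
  algebraMap (GenPoly R d) (GenLoc R d hP) (genElt R d x)

/-- The image of the general element in `R̂′`. -/
noncomputable def genEltHat (hP : (genPrime R d).IsPrime) (x : Fin d → R) :
    GenLocHat R d hP :=
  algebraMap (GenLoc R d hP) (GenLocHat R d hP) (genEltLoc R d hP x)

/-- `R″ = R̂′/(x)`. -/
abbrev GenQuot (hP : (genPrime R d).IsPrime) (x : Fin d → R) : Type u :=
  GenLocHat R d hP ⧸ Ideal.span {genEltHat R d hP x}

/-- The natural map `R → R″`. -/
noncomputable def genMap (hP : (genPrime R d).IsPrime) (x : Fin d → R) :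
    R →+* GenQuot R d hP x :=
  (Ideal.Quotient.mk (Ideal.span {genEltHat R d hP x})).comp
    ((algebraMap (GenLoc R d hP) (GenLocHat R d hP)).comp (algebraMap R (GenLoc R d hP)))

end GenericConstruction


namespace X11
open Submodule
universe v w

theorem haus_iff {R : Type*} [CommRing R] {I : Ideal R} :
    IsHausdorff I R ↔ ∀ x : R, (∀ n : ℕ, x ∈ I ^ n) → x = 0 := by
  rw [isHausdorff_iff]
  simp [SModEq.zero]

theorem precomplete_iff {R : Type*} [CommRing R] {I : Ideal R} :
    IsPrecomplete I R ↔ ∀ f : ℕ → R, (∀ n, f (n + 1) - f n ∈ I ^ n) →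
      ∃ L, ∀ n, f n - L ∈ I ^ n := by
  rw [isPrecomplete_iff]
  constructor
  · intro h f hf
    obtain ⟨L, hL⟩ := h f (by
      intro m n hmn
      rw [SModEq.sub_mem]
      induction n, hmn using Nat.le_induction with
      | base => simp
      | succ n hn ih =>
        have := Ideal.pow_le_pow_right hn (hf n)
        simp only [smul_eq_mul, Ideal.mul_top] at ih ⊢
        have h2 := sub_mem ih this
        convert h2 using 1; ring)
    refine ⟨L, fun n => ?_⟩
    have := hL n
    rw [SModEq.sub_mem] at this
    simpa using this
  · intro h f hf
    obtain ⟨L, hL⟩ := h f (fun n => by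
      have := (hf (Nat.le_succ n)).symm
      rw [SModEq.sub_mem] at this
      simpa using this)
    refine ⟨L, fun n => ?_⟩
    rw [SModEq.sub_mem]
    simpa using hL n

theorem precomplete_pi {A : Type*} [CommRing A] (I : Ideal A) [IsPrecomplete I A] (n : ℕ) :
    IsPrecomplete I (Fin n → A) := by
  have key : ∀ (m : ℕ) (v : Fin n → A), v ∈ (I ^ m • ⊤ : Submodule A (Fin n → A)) ↔
      ∀ i, v i ∈ I ^ m := by
    intro m v
    constructor
    · intro hv i
      have := Submodule.mem_map_of_mem (f := LinearMap.proj (R := A) (φ := fun _ : Fin n => A) i) hv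
      rw [Submodule.map_smul''] at this
      have h2 := Submodule.smul_mono (le_refl (I ^ m)) (le_top : _ ≤ (⊤ : Submodule A A)) this
      simpa using h2
    · intro hv
      rw [pi_eq_sum_univ v]
      exact Submodule.sum_mem _ fun i _ => Submodule.smul_mem_smul (hv i) trivial
  have hp := precomplete_iff.1 (inferInstance : IsPrecomplete I A)
  rw [isPrecomplete_iff]
  intro f hf
  have := fun i => hp (fun k => f k i) (fun k => by
    have h := hf (Nat.le_succ k)
    have h := h.symm
    rw [SModEq.sub_mem, key] at h
    exact h i)
  choose L hL using this
  refine ⟨L, fun k => ?_⟩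
  rw [SModEq.sub_mem, key]
  exact fun i => hL i k

theorem finite_of_complete {A M : Type*} [CommRing A] [AddCommGroup M] [Module A M]
    (I : Ideal A) [IsPrecomplete I A] [IsHausdorff I M]
    [Module.Finite A (M ⧸ (I • ⊤ : Submodule A M))] : Module.Finite A M := by
  obtain ⟨n, f, hf⟩ := Module.Finite.exists_fin' A (M ⧸ (I • ⊤ : Submodule A M))
  obtain ⟨g, hg⟩ := Module.projective_lifting_property (mkQ (I • ⊤ : Submodule A M)) f (mkQ_surjective _)
  have : IsPrecomplete I (Fin n → A) := precomplete_pi I n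
  have : Function.Surjective g := surjective_of_mkQ_comp_surjective (I := I) (by rw [hg]; exact hf)
  exact Module.Finite.of_surjective g this

open PowerSeries in
theorem exists_evalHom {A B : Type*} [CommRing A] [CommRing B] (φ : A →+* B) (I : Ideal B)
    [IsAdicComplete I B] (z : B) (hz : z ∈ I) :
    ∃ ψ : A⟦X⟧ →+* B, (∀ a, ψ (C a) = φ a) ∧ ψ X = z := by
  have key : ∀ (n : ℕ) (P Q : Polynomial A), (∀ k < n, P.coeff k = Q.coeff k) →
      Ideal.Quotient.mk (I ^ n) (P.eval₂ φ z) = Ideal.Quotient.mk (I ^ n) (Q.eval₂ φ z) := by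
    intro n P Q h
    have : Polynomial.X ^ n ∣ P - Q := by
      rw [Polynomial.X_pow_dvd_iff]
      intro k hk
      simp [h k hk]
    obtain ⟨W, hW⟩ := this
    rw [Ideal.Quotient.eq, ← Polynomial.eval₂_sub, hW, Polynomial.eval₂_mul]
    exact Ideal.mul_mem_right _ _ (by simpa using Ideal.pow_mem_pow hz n)
  let f : (n : ℕ) → A⟦X⟧ →+* B ⧸ I ^ n := fun n =>
    { toFun := fun p => Ideal.Quotient.mk (I ^ n) ((trunc n p).eval₂ φ z)
      map_one' := by
        rw [key n (trunc n 1) 1]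
        · simp
        · intro k hk
          simp [coeff_trunc, hk, Polynomial.coeff_one, coeff_one]
      map_zero' := by simp
      map_add' := by intro p q; simp [Polynomial.eval₂_add]
      map_mul' := by
        intro p q
        rw [← map_mul, ← Polynomial.eval₂_mul]
        apply key
        intro k hk
        rw [coeff_trunc, if_pos hk, coeff_mul_eq_coeff_trunc_mul_trunc p q hk,
          ← Polynomial.coe_mul, Polynomial.coeff_coe] }
  have hf : ∀ {m n : ℕ} (hle : m ≤ n),
      (Ideal.Quotient.factorPow I hle).comp (f n) = f m := by
    intro m n hle
    ext p
    change Ideal.Quotient.mk (I ^ m) ((trunc n p).eval₂ φ z) =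
      Ideal.Quotient.mk (I ^ m) ((trunc m p).eval₂ φ z)
    apply key
    intro k hk
    simp [coeff_trunc, hk, hk.trans_le hle]
  have hH := haus_iff.1 (inferInstance : IsHausdorff I B)
  have uniq : ∀ a b : B, (∀ n, Ideal.Quotient.mk (I ^ n) a = Ideal.Quotient.mk (I ^ n) b) → a = b := by
    intro a b h
    rw [← sub_eq_zero]
    exact hH _ fun n => Ideal.Quotient.eq.1 (h n)
  refine ⟨IsAdicComplete.liftRingHom I f hf, fun a => uniq _ _ fun n => ?_, uniq _ _ fun n => ?_⟩
  · rw [IsAdicComplete.mk_liftRingHom]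
    change Ideal.Quotient.mk (I ^ n) ((trunc n _).eval₂ φ z) = _
    rw [key n _ (Polynomial.C a)]
    · simp
    · intro k hk
      simp [coeff_trunc, hk, Polynomial.coeff_C, coeff_C]
  · rw [IsAdicComplete.mk_liftRingHom]
    change Ideal.Quotient.mk (I ^ n) ((trunc n _).eval₂ φ z) = _
    rw [key n _ Polynomial.X]
    · simp
    · intro k hk
      simp [coeff_trunc, hk, Polynomial.coeff_X, coeff_X, eq_comm]

section PS
open PowerSeries
variable {A : Type*} [CommRing A]

/-- the ideal `(J, X)` of the power series ring -/
noncomputable def psIdeal (J : Ideal A) : Ideal A⟦X⟧ := J.map (C (R := A)) ⊔ Ideal.span {X}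

theorem mem_map_C_of_coeff [IsNoetherianRing A] (J : Ideal A) (f : A⟦X⟧)
    (h : ∀ n, coeff n f ∈ J) : f ∈ J.map (C (R := A)) := by
  obtain ⟨s, hs⟩ := IsNoetherian.noetherian J
  have : ∀ n, ∃ g : s → A, ∑ i, g i * (i : A) = coeff n f := by
    intro n
    have := h n
    rw [← hs, Submodule.mem_span_finset'] at this
    simpa using this
  choose g hg using this
  have hf : f = ∑ i : s, (PowerSeries.mk fun n => g n i) * C (i : A) := by
    ext n
    simp [coeff_mul_C, ← hg]
  rw [hf]
  refine Ideal.sum_mem _ fun i _ => Ideal.mul_mem_left _ _ (Ideal.mem_map_of_mem _ ?_)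
  rw [← hs]; exact Submodule.subset_span i.2

theorem mem_psIdeal_pow [IsNoetherianRing A] (J : Ideal A) (n : ℕ) (f : A⟦X⟧) :
    f ∈ psIdeal J ^ n ↔ ∀ j, coeff j f ∈ J ^ (n - j) := by
  constructor
  · intro h
    induction n generalizing f with
    | zero => simp
    | succ n ih =>
      rw [pow_succ, psIdeal, Ideal.mul_sup] at h
      obtain ⟨u, hu, v, hv, rfl⟩ := Submodule.mem_sup.1 h
      intro j
      rw [map_add]
      refine add_mem ?_ ?_
      · refine Submodule.mul_induction_on hu (fun a ha b hb => ?_) (fun a b ha hb => by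
          rw [map_add]; exact add_mem ha hb)
        have hb' : ∀ k, coeff k b ∈ J := by
          refine Submodule.span_induction (p := fun b _ => ∀ k, coeff k b ∈ J) ?_ ?_ ?_ ?_ hb
          · rintro _ ⟨c, hc, rfl⟩ k
            rw [coeff_C]; split_ifs
            · exact hc
            · simp
          · simp
          · intro x y _ _ hx hy k
            rw [map_add]; exact add_mem (hx k) (hy k)
          · intro r x _ hx k
            rw [smul_eq_mul, coeff_mul]
            exact sum_mem fun p _ => Ideal.mul_mem_left _ _ (hx _)
        rw [coeff_mul]
        refine sum_mem fun p hp => ?_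
        have hpj : p.1 ≤ j := by
          have := Finset.HasAntidiagonal.mem_antidiagonal.1 hp; omega
        have h1 := Ideal.mul_mem_mul (ih a ha p.1) (hb' p.2)
        rw [← pow_succ] at h1
        exact Ideal.pow_le_pow_right (by omega) h1
      · rw [Ideal.mem_mul_span_singleton] at hv
        obtain ⟨w, hw, rfl⟩ := hv
        cases j with
        | zero => simp
        | succ j =>
          rw [coeff_succ_mul_X]
          have := ih w hw j
          rwa [show n + 1 - (j + 1) = n - j by omega]
  · intro h
    induction n generalizing f with
    | zero => simp
    | succ n ih =>
      -- f = C (coeff 0 f) + X * g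
      have h0 : ∀ k, X ^ k * C (coeff k f) ∈ psIdeal J ^ (n + 1) ∨ n + 1 ≤ k := by
        intro k
        by_cases hk : n + 1 ≤ k
        · exact Or.inr hk
        left
        have e : n + 1 = k + (n + 1 - k) := by omega
        rw [e, pow_add]
        refine Ideal.mul_mem_mul (Ideal.pow_mem_pow (Ideal.mem_sup_right (Ideal.mem_span_singleton_self _)) k) ?_
        have h1 : C (coeff k f) ∈ (J ^ (n + 1 - k)).map (C (R := A)) := Ideal.mem_map_of_mem _ (h k)
        rw [Ideal.map_pow] at h1
        exact Ideal.pow_right_mono le_sup_left _ h1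
      have hsum : f - ∑ k ∈ Finset.range (n + 1), X ^ k * C (coeff k f) ∈ Ideal.span {(X : A⟦X⟧)} ^ (n + 1) := by
        rw [Ideal.span_singleton_pow, Ideal.mem_span_singleton, X_pow_dvd_iff]
        intro m hm
        rw [map_sub, map_sum, Finset.sum_eq_single m]
        · simp [coeff_mul_C]
        · intro b _ hb
          simp [coeff_mul_C, coeff_X_pow, hb.symm]
        · intro hm'
          exact absurd (Finset.mem_range.2 hm) hm'
      have h2 := Ideal.pow_right_mono (le_sup_right : Ideal.span {(X : A⟦X⟧)} ≤ psIdeal J) (n + 1) hsum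
      have h3 : ∑ k ∈ Finset.range (n + 1), X ^ k * C (coeff k f) ∈ psIdeal J ^ (n + 1) := by
        refine Ideal.sum_mem _ fun k hk => ?_
        rcases h0 k with h | h
        · exact h
        · have := Finset.mem_range.1 hk; omega
      have := add_mem h2 h3
      rw [sub_add_cancel] at this
      exact this

theorem psComplete [IsNoetherianRing A] (J : Ideal A) [IsAdicComplete J A] :
    IsAdicComplete (psIdeal J) A⟦X⟧ := by
  have hH := haus_iff.1 (inferInstance : IsHausdorff J A)
  have hp := precomplete_iff.1 (inferInstance : IsPrecomplete J A)
  refine { toIsHausdorff := haus_iff.2 ?_, toIsPrecomplete := precomplete_iff.2 ?_ }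
  · intro f hf
    ext j
    refine hH _ fun n => ?_
    have := (mem_psIdeal_pow J _ _).1 (hf (n + j)) j
    simpa using this
  · intro f hf
    have := fun j => hp (fun m => coeff j (f (m + j))) (fun m => by
      have := (mem_psIdeal_pow J _ _).1 (hf (m + j)) j
      simp only [Nat.add_sub_cancel, map_sub] at this
      rwa [show m + 1 + j = m + j + 1 by ring])
    choose L hL using this
    refine ⟨PowerSeries.mk L, fun n => (mem_psIdeal_pow J _ _).2 fun j => ?_⟩
    by_cases hj : j ≤ n
    · have := hL j (n - j)
      rw [Nat.sub_add_cancel hj] at this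
      simpa using this
    · rw [show n - j = 0 by omega]; simp

end PS

/-- complete + Noetherian mod `I` ⇒ Noetherian. -/
theorem noeth_aux {B : Type*} [CommRing B] (I : Ideal B) [IsAdicComplete I B] (s : Finset B)
    (hs : ∀ b ∈ s, b ∈ I) (R : Type v) [CommRing R] [IsNoetherianRing R] (f : R →+* B) :
    ∃ (A : Type v) (_ : CommRing A) (_ : IsNoetherianRing A) (J : Ideal A) (_ : IsAdicComplete J A)
      (g : A →+* B), J.map g = Ideal.span s ∧ f.range ≤ g.range := by
  classical
  induction s using Finset.induction_on with
  | empty =>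
    refine ⟨R, inferInstance, inferInstance, ⊥, ?_, f, by simp, le_refl _⟩
    infer_instance
  | insert b s hb ih =>
    obtain ⟨A, _, _, J, _, g, hJ, hr⟩ := ih (fun c hc => hs c (Finset.mem_insert_of_mem hc))
    obtain ⟨ψ, h1, h2⟩ := exists_evalHom g I b (hs b (Finset.mem_insert_self _ _))
    refine ⟨PowerSeries A, inferInstance, inferInstance, psIdeal J, psComplete J, ψ, ?_, ?_⟩
    · have hc : ψ.comp PowerSeries.C = g := by ext a; exact h1 a
      rw [psIdeal, Ideal.map_sup, Ideal.map_map, hc, hJ, Ideal.map_span, Set.image_singleton, h2,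
        Finset.coe_insert, Ideal.span_insert, sup_comm]
    · intro y hy
      obtain ⟨a, rfl⟩ := hr hy
      exact ⟨PowerSeries.C a, h1 a⟩

theorem isNoetherianRing_of_complete {B : Type*} [CommRing B] (I : Ideal B) [IsAdicComplete I B]
    (hI : I.FG) (R : Type*) [CommRing R] [IsNoetherianRing R] (f : R →+* B)
    (hf : ∀ b : B, ∃ r : R, b - f r ∈ I) : IsNoetherianRing B := by
  obtain ⟨s, rfl⟩ := hI
  obtain ⟨A, _, _, J, _, g, hJ, hr⟩ := noeth_aux (Ideal.span s) s (fun b hb => Ideal.subset_span hb) R f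
  have : IsHausdorff (J.map g) B := by rw [hJ]; infer_instance
  refine isNoetherianRing_of_surjective A B g (surjective_of_mk_map_comp_surjective (I := J) g ?_)
  intro y
  obtain ⟨b, rfl⟩ := Ideal.Quotient.mk_surjective y
  obtain ⟨r, hr'⟩ := hf b
  obtain ⟨a, ha⟩ := hr ⟨r, rfl⟩
  refine ⟨a, ?_⟩
  rw [RingHom.comp_apply, ha, eq_comm, Ideal.Quotient.eq, hJ]
  exact hr'

end X11

namespace X11
universe v w
open PowerSeries IsLocalRing nonZeroDivisors
section PS2
variable {A : Type*} [CommRing A]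

theorem ps_maximalIdeal [IsLocalRing A] : maximalIdeal A⟦X⟧ = psIdeal (maximalIdeal A) := by
  have hle : psIdeal (maximalIdeal A) ≤ maximalIdeal A⟦X⟧ := by
    refine sup_le ?_ ?_
    · rw [Ideal.map_le_iff_le_comap]
      intro a ha
      rw [Ideal.mem_comap, mem_maximalIdeal, mem_nonunits_iff, isUnit_iff_constantCoeff]
      simpa using ha
    · rw [Ideal.span_singleton_le_iff_mem, mem_maximalIdeal, mem_nonunits_iff, isUnit_iff_constantCoeff]
      simp
  refine le_antisymm (fun f hf => ?_) hle
  rw [mem_maximalIdeal, mem_nonunits_iff, isUnit_iff_constantCoeff, ← mem_nonunits_iff,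
    ← mem_maximalIdeal] at hf
  have h1 : f = C (constantCoeff f) + (f - C (constantCoeff f)) := by ring
  rw [h1]
  refine add_mem (Ideal.mem_sup_left (Ideal.mem_map_of_mem _ hf)) (Ideal.mem_sup_right ?_)
  rw [Ideal.mem_span_singleton, X_dvd_iff]
  simp

theorem ps_normal_aux [IsDomain A] [IsNoetherianRing A] [IsIntegrallyClosed A]
    {K : Type*} [Field K] [Algebra A K] [IsFractionRing A K]
    (w : K⟦X⟧) (hw : IsAlmostIntegral A⟦X⟧ w) (i : ℕ) : coeff i w ∈ (algebraMap A K).range := by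
  induction i using Nat.strong_induction_on with
  | _ i ih =>
  have : ∀ k, ∃ a : A, k < i → algebraMap A K a = coeff k w := by
    intro k
    by_cases hk : k < i
    · obtain ⟨a, ha⟩ := ih k hk
      exact ⟨a, fun _ => ha⟩
    · exact ⟨0, fun h => absurd h hk⟩
  choose a ha using this
  let t : A⟦X⟧ := PowerSeries.mk fun k => if k < i then a k else 0
  let v : K⟦X⟧ := w - algebraMap A⟦X⟧ K⟦X⟧ t
  have hv : IsAlmostIntegral A⟦X⟧ v :=
    (completeIntegralClosure A⟦X⟧ K⟦X⟧).sub_mem hw (Subalgebra.algebraMap_mem _ _)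
  have htc : ∀ (f : A⟦X⟧) k, coeff k (algebraMap A⟦X⟧ K⟦X⟧ f) = algebraMap A K (coeff k f) := by
    intro f k
    rfl
  have hvi : coeff i v = coeff i w := by
    simp only [v, map_sub, htc]
    simp [t]
  have hX : X ^ i ∣ v := by
    rw [X_pow_dvd_iff]
    intro m hm
    simp only [v, map_sub, htc]
    simp [t, hm, ha m hm]
  obtain ⟨v', hv'⟩ := hX
  have hc : coeff i v = constantCoeff v' := by
    rw [hv', ← coeff_zero_eq_constantCoeff_apply]
    simpa using coeff_X_pow_mul v' i 0
  rw [← hvi, hc]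
  obtain ⟨h, hh, hn⟩ := hv
  have hh0 : h ≠ 0 := nonZeroDivisors.ne_zero hh
  obtain ⟨e, he⟩ : ∃ e : ℕ, h.order = e := ⟨_, (ENat.natCast_toNat (by simpa [order_eq_top] using hh0)).symm⟩
  obtain ⟨h', hh'⟩ : X ^ e ∣ h := X_pow_dvd_iff.2 fun m hm => coeff_of_lt_order m (by rw [he]; exact_mod_cast hm)
  have hlead : constantCoeff h' ≠ 0 := by
    have h1 : coeff e h ≠ 0 := ((order_eq_nat).1 he).1
    rw [hh'] at h1
    have := coeff_X_pow_mul h' e 0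
    rw [zero_add] at this
    rw [this] at h1
    simpa using h1
  have hai : IsAlmostIntegral A (constantCoeff v') := by
    refine ⟨constantCoeff h', mem_nonZeroDivisors_of_ne_zero hlead, fun n => ?_⟩
    obtain ⟨y, hy⟩ := hn n
    refine ⟨coeff (e + i * n) y, ?_⟩
    rw [← htc, hy, hv', hh', Algebra.smul_def, map_mul (algebraMap A⟦X⟧ K⟦X⟧), map_pow (algebraMap A⟦X⟧ K⟦X⟧)]
    have hXX : algebraMap A⟦X⟧ K⟦X⟧ X = X := by
      ext k; rw [htc, coeff_X, coeff_X]; split_ifs <;> simp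
    rw [hXX, show X ^ e * algebraMap A⟦X⟧ K⟦X⟧ h' * (X ^ i * v') ^ n =
      X ^ (e + i * n) * (algebraMap A⟦X⟧ K⟦X⟧ h' * v' ^ n) by ring]
    have := coeff_X_pow_mul (algebraMap A⟦X⟧ K⟦X⟧ h' * v' ^ n) (e + i * n) 0
    rw [zero_add] at this
    rw [this, coeff_zero_eq_constantCoeff_apply, map_mul, map_pow, ← coeff_zero_eq_constantCoeff_apply,
      htc, Algebra.smul_def]
    simp
  have := IsIntegrallyClosed.algebraMap_eq_of_integral hai.isIntegral
  exact this

theorem ps_normal [IsDomain A] [IsNoetherianRing A] [IsIntegrallyClosed A] :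
    IsIntegrallyClosed A⟦X⟧ := by
  let K := FractionRing A
  let L := FractionRing K⟦X⟧
  let F := FractionRing A⟦X⟧
  have hinj : Function.Injective (algebraMap A⟦X⟧ K⟦X⟧) := by
    intro f g h
    ext k
    have := congrArg (coeff k) h
    exact IsFractionRing.injective A K this
  have hinj2 : Function.Injective ((algebraMap K⟦X⟧ L).comp (algebraMap A⟦X⟧ K⟦X⟧)) :=
    (IsFractionRing.injective K⟦X⟧ L).comp hinj
  let j : F →+* L := IsFractionRing.lift hinj2
  have hj : ∀ f, j (algebraMap A⟦X⟧ F f) = algebraMap K⟦X⟧ L (algebraMap A⟦X⟧ K⟦X⟧ f) :=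
    fun f => IsFractionRing.lift_algebraMap hinj2 f
  rw [isIntegrallyClosed_iff F]
  intro x hx
  have hjx : IsIntegral K⟦X⟧ (j x) := by
    have : IsIntegral A⟦X⟧ x := hx
    obtain ⟨p, hp, hpx⟩ := this
    refine ⟨p.map (algebraMap A⟦X⟧ K⟦X⟧), hp.map _, ?_⟩
    rw [Polynomial.eval₂_map]
    have h2 := congrArg j hpx
    rw [Polynomial.hom_eval₂, map_zero] at h2
    rw [← h2]
    congr 1
    ext f : 1
    exact (hj f).symm
  obtain ⟨w, hw⟩ := IsIntegrallyClosed.algebraMap_eq_of_integral hjx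
  have hwa : IsAlmostIntegral A⟦X⟧ w := by
    obtain ⟨h, hh, hn⟩ := hx.isAlmostIntegral
    refine ⟨h, hh, fun n => ?_⟩
    obtain ⟨y, hy⟩ := hn n
    refine ⟨y, IsFractionRing.injective K⟦X⟧ L ?_⟩
    rw [← hj, hy, Algebra.smul_def, map_mul, map_pow, hj, ← hw, Algebra.smul_def, map_mul, map_pow]
  choose a ha using ps_normal_aux (K := K) w hwa
  refine ⟨PowerSeries.mk a, j.injective ?_⟩
  rw [hj, ← hw]
  congr 1
  ext k
  change algebraMap A K (coeff k (PowerSeries.mk a)) = _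
  rw [coeff_mk, ha]

end PS2

section WR
open RingTheory.Sequence Pointwise
variable {B B' : Type*} [CommRing B] [CommRing B']

theorem wr_congr (e : B ≃+* B') (rs : List B) :
    IsWeaklyRegular B rs ↔ IsWeaklyRegular B' (rs.map e) :=
  AddEquiv.isWeaklyRegular_congr (e := e.toAddEquiv) <| List.forall₂_map_right_iff.mpr <|
    List.forall₂_same.mpr fun r _ x => by simp

theorem wr_cons (r : B) (rs : List B) : IsWeaklyRegular B (r :: rs) ↔
    IsSMulRegular B r ∧ IsWeaklyRegular (B ⧸ Ideal.span {r}) (rs.map (Ideal.Quotient.mk (Ideal.span {r}))) := by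
  rw [isWeaklyRegular_cons_iff]
  refine and_congr_right' ?_
  have h : (r • (⊤ : Submodule B B)) = Ideal.span {r} := by
    rw [← Submodule.ideal_span_singleton_smul, smul_eq_mul, Ideal.mul_top]
  exact AddEquiv.isWeaklyRegular_congr (e := (Submodule.quotEquivOfEq _ _ h).toAddEquiv) <|
    List.forall₂_map_right_iff.mpr <| List.forall₂_same.mpr fun s _ x => by
      obtain ⟨x, rfl⟩ := Submodule.Quotient.mk_surjective _ x
      rfl

theorem isSMulRegular_iff_nzd (r : B) : IsSMulRegular B r ↔ r ∈ B⁰ := by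
  constructor
  · intro h
    rw [mem_nonZeroDivisors_iff_right]
    intro x hx
    exact h (by simpa [mul_comm] using hx)
  · intro h x y hxy
    rw [← sub_eq_zero]
    exact (mem_nonZeroDivisors_iff_right.1 h) _ (by
      have : r * x = r * y := hxy
      rw [sub_mul, mul_comm x, mul_comm y, this, sub_self])

theorem ps_regular {A : Type*} [CommRing A] (rs : List A) (h : IsWeaklyRegular A rs) :
    IsWeaklyRegular A⟦X⟧ (X :: rs.map (C (R := A))) := by
  rw [wr_cons]
  refine ⟨fun f g hfg => X_mul_cancel hfg, ?_⟩
  have hk : RingHom.ker (constantCoeff (R := A)) = Ideal.span {X} := by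
    ext f
    rw [RingHom.mem_ker, Ideal.mem_span_singleton, X_dvd_iff]
  let e : (A⟦X⟧ ⧸ Ideal.span {(X : A⟦X⟧)}) ≃+* A :=
    (Ideal.quotEquivOfEq hk.symm).trans
      (RingHom.quotientKerEquivOfSurjective (f := constantCoeff (R := A)) constantCoeff_surj)
  rw [wr_congr e]
  convert h
  rw [List.map_map, List.map_map]
  convert List.map_id _ using 2
  ext a
  simp [e]

end WR
end X11

namespace X11
universe v w
open IsLocalRing

theorem sec_lemma {E k : Type*} [CommRing E] [Field k] (p : ℕ) [hp : Fact p.Prime] (hE : (p : E) = 0)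
    (π : E →+* k) (hπ : Function.Surjective π) (hN : ∀ a b, π a = 0 → π b = 0 → a * b = 0) :
    ∃ σ : k →+* E, ∀ a, π (σ a) = a := by
  have hEn : Nontrivial E := π.domain_nontrivial
  have hEp : CharP E p := by
    exact (CharP.charP_iff_prime_eq_zero hp.out).2 hE
  have hkp : CharP k p := (CharP.charP_iff_prime_eq_zero hp.out).2 (by rw [← map_natCast π, hE, map_zero])
  have hunit : ∀ a, π a ≠ 0 → IsUnit a := by
    intro a ha
    obtain ⟨b, hb⟩ := hπ (π a)⁻¹
    have h1 : π (a * b - 1) = 0 := by rw [map_sub, map_mul, hb, map_one, mul_inv_cancel₀ ha, sub_self]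
    have h2 := hN _ _ h1 h1
    refine IsUnit.of_mul_eq_one (b * (2 - a * b)) ?_
    linear_combination -h2
  let s : Set (Subring E) := {T | (∀ a : E, a ^ p ∈ T) ∧ ∀ a ∈ T, π a = 0 → a = 0}
  have h0 : (frobenius E p).range ∈ s := by
    refine ⟨fun a => ⟨a, rfl⟩, ?_⟩
    rintro _ ⟨a, rfl⟩ h
    rw [frobenius_def, map_pow] at h
    have h := pow_eq_zero_iff (hp.out.ne_zero) |>.1 h
    rw [frobenius_def, show p = (p - 2) + 2 by have := hp.out.two_le; omega, pow_add, pow_two, hN a a h h, mul_zero]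
  obtain ⟨T, -, hT⟩ := zorn_le_nonempty₀ s (by
    intro c hc hch y hy
    have hd := hch.directedOn
    refine ⟨sSup c, ⟨fun a => ?_, fun a ha h => ?_⟩, fun z hz => le_sSup hz⟩
    · exact (Subring.mem_sSup_of_directedOn ⟨y, hy⟩ hd).2 ⟨y, hy, (hc hy).1 a⟩
    · obtain ⟨z, hz, haz⟩ := (Subring.mem_sSup_of_directedOn ⟨y, hy⟩ hd).1 ha
      exact (hc hz).2 a haz h) _ h0
  have hTp := hT.prop.1
  have hTi := hT.prop.2
  have hfield : IsField T := by
    refine ⟨⟨0, 1, zero_ne_one⟩, mul_comm, fun {t} ht => ?_⟩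
    have h1 : π t ≠ 0 := fun h => ht (Subtype.ext (hTi t t.2 h))
    obtain ⟨w, hw⟩ := (hunit _ h1).exists_right_inv
    refine ⟨⟨(t : E) ^ (p - 1) * w ^ p, T.mul_mem (T.pow_mem t.2 _) (hTp w)⟩, Subtype.ext ?_⟩
    change (t : E) * (t ^ (p - 1) * w ^ p) = 1
    rw [← mul_assoc, mul_pow_sub_one hp.out.ne_zero, ← mul_pow, hw, one_pow]
  let _ := hfield.toField
  have hsurj : ∀ α : k, ∃ t ∈ T, π t = α := by
    intro α
    by_contra! hα
    obtain ⟨a, rfl⟩ := hπ α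
    let q : T := ⟨a ^ p, hTp a⟩
    have hirr : Irreducible (Polynomial.X ^ p - Polynomial.C q) := by
      apply X_pow_sub_C_irreducible_of_prime hp.out
      intro b hb
      apply hα b b.2
      apply frobenius_inj k p
      have := congrArg (fun z : T => π z) hb
      simpa [q, frobenius_def] using this
    let ev : Polynomial T →+* E := Polynomial.eval₂RingHom T.subtype a
    have hev0 : ev (Polynomial.X ^ p - Polynomial.C q) = 0 := by
      simp [ev, q]
    have hle : ev.range ∈ s := by
      refine ⟨fun b => ⟨Polynomial.C ⟨b ^ p, hTp b⟩, by simp [ev]⟩, ?_⟩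
      rintro _ ⟨f, rfl⟩ hf
      rcases hirr.isCoprime_or_dvd f with h | h
      · exfalso
        obtain ⟨u, v, huv⟩ := h
        have := congrArg (fun z => π (ev z)) huv
        simp only [map_add, map_mul, hev0, hf, map_one] at this
        simp at this
      · obtain ⟨g, rfl⟩ := h
        rw [map_mul, hev0, zero_mul]
    have h2 : T ≤ ev.range := fun t ht => ⟨Polynomial.C ⟨t, ht⟩, by simp [ev]⟩
    have h3 := hT.le_of_ge hle h2
    exact hα a (h3 ⟨Polynomial.X, by simp [ev]⟩) rfl
  let e : T ≃+* k := RingEquiv.ofBijective (π.comp T.subtype)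
    ⟨by
      rw [injective_iff_map_eq_zero]
      exact fun t ht => Subtype.ext (hTi t t.2 ht), fun α => by
      obtain ⟨t, ht, h⟩ := hsurj α
      exact ⟨⟨t, ht⟩, h⟩⟩
  refine ⟨T.subtype.comp e.symm, fun a => ?_⟩
  exact e.apply_symm_apply a


/-- lifting step, mixed characteristic -/
theorem lift_step {Λ E E' k : Type*} [CommRing Λ] [CommRing E] [CommRing E'] [Field k]
    (p : ℕ) [hp : Fact p.Prime] (π : Λ →+* k) (hπ : Function.Surjective π)
    (hker : ∀ a, π a = 0 ↔ ∃ b, a = p * b) (hreg : ∀ a : Λ, (p : Λ) * a = 0 → a = 0)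
    (g : E' →+* E) (hg : Function.Surjective g) (hN : ∀ a b, g a = 0 → g b = 0 → a * b = 0)
    (hpN : ∀ a, g a = 0 → (p : E') * a = 0) (φ : Λ →+* E) :
    ∃ φ' : Λ →+* E', g.comp φ' = φ := by
  let Λ₁ : Subring (Λ × E') := (φ.comp (RingHom.fst Λ E')).eqLocus (g.comp (RingHom.snd Λ E'))
  let q : Λ₁ →+* Λ := (RingHom.fst Λ E').comp Λ₁.subtype
  have hq : Function.Surjective q := fun a => by
    obtain ⟨e, he⟩ := hg (φ a)
    exact ⟨⟨(a, e), he.symm⟩, rfl⟩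
  have hq0 : ∀ z : Λ₁, q z = 0 → g (z : Λ × E').2 = 0 := by
    intro z hz
    have h1 : φ (z : Λ × E').1 = g (z : Λ × E').2 := z.2
    have h2 : (z : Λ × E').1 = 0 := hz
    rw [← h1, h2, map_zero]
  let T := Λ₁ ⧸ Ideal.span {(p : Λ₁)}
  let π' : T →+* k := Ideal.Quotient.lift _ (π.comp q) (by
    intro a ha
    obtain ⟨b, rfl⟩ := Ideal.mem_span_singleton.1 ha
    rw [RingHom.comp_apply, map_mul, map_natCast]
    exact (hker _).2 ⟨_, rfl⟩)
  have hπ'mk : ∀ z : Λ₁, π' (Ideal.Quotient.mk _ z) = π (q z) := fun z => rfl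
  -- elements of the kernel come from kernel of `q`
  have hrep : ∀ z : Λ₁, π (q z) = 0 → ∃ y : Λ₁, q y = 0 ∧
      Ideal.Quotient.mk (Ideal.span {(p : Λ₁)}) z = Ideal.Quotient.mk _ y := by
    intro z hz
    obtain ⟨b, hb⟩ := (hker _).1 hz
    obtain ⟨w, rfl⟩ := hq b
    refine ⟨z - p * w, by rw [map_sub, hb, map_mul, map_natCast, sub_self], ?_⟩
    rw [Ideal.Quotient.eq, Ideal.mem_span_singleton]
    exact ⟨w, by ring⟩
  obtain ⟨σ, hσ⟩ := sec_lemma (E := T) p (by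
      rw [← map_natCast (Ideal.Quotient.mk (Ideal.span {(p : Λ₁)}))]
      exact Ideal.Quotient.eq_zero_iff_mem.2 (Ideal.mem_span_singleton_self _)) π' (by
      intro a
      obtain ⟨l, rfl⟩ := hπ a
      obtain ⟨z, rfl⟩ := hq l
      exact ⟨Ideal.Quotient.mk _ z, rfl⟩) (by
      intro a b ha hb
      obtain ⟨a, rfl⟩ := Ideal.Quotient.mk_surjective a
      obtain ⟨b, rfl⟩ := Ideal.Quotient.mk_surjective b
      obtain ⟨a', ha', h1⟩ := hrep a ha
      obtain ⟨b', hb', h2⟩ := hrep b hb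
      rw [h1, h2, ← map_mul]
      have : a' * b' = 0 := by
        apply Subtype.ext
        apply Prod.ext
        · have h3 : (a' : Λ × E').1 = 0 := ha'
          change (a' : Λ × E').1 * _ = 0
          rw [h3, zero_mul]
        · exact hN _ _ (hq0 _ ha') (hq0 _ hb')
      rw [this, map_zero])
  let Λ₂ : Subring Λ₁ := (Ideal.Quotient.mk (Ideal.span {(p : Λ₁)})).eqLocus (σ.comp (π.comp q))
  have hbij : Function.Bijective (q.comp Λ₂.subtype) := by
    constructor
    · rw [injective_iff_map_eq_zero]
      rintro ⟨y, hy⟩ h0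
      have h0 : q y = 0 := h0
      have hy : Ideal.Quotient.mk (Ideal.span {(p : Λ₁)}) y = σ (π (q y)) := hy
      rw [h0, map_zero, map_zero, Ideal.Quotient.eq_zero_iff_mem, Ideal.mem_span_singleton] at hy
      obtain ⟨z, rfl⟩ := hy
      rw [map_mul, map_natCast] at h0
      have hz := hreg _ h0
      apply Subtype.ext
      apply Subtype.ext
      apply Prod.ext
      · have h0' : (p : Λ) * (z : Λ × E').1 = 0 := h0
        simpa using h0'
      · simpa using hpN _ (hq0 _ hz)
    · intro l
      obtain ⟨y, hy⟩ := Ideal.Quotient.mk_surjective (σ (π l))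
      have h1 : π (q y - l) = 0 := by
        rw [map_sub, ← hπ'mk, hy, hσ, sub_self]
      obtain ⟨m, hm⟩ := (hker _).1 h1
      obtain ⟨z, rfl⟩ := hq m
      have h3 : q (y - p * z) = l := by
        rw [map_sub, map_mul, map_natCast, ← hm]; ring
      refine ⟨⟨y - p * z, ?_⟩, h3⟩
      change Ideal.Quotient.mk (Ideal.span {(p : Λ₁)}) (y - p * z) = σ (π (q _))
      rw [h3, ← hy, Ideal.Quotient.eq, Ideal.mem_span_singleton]
      exact ⟨-z, by ring⟩
  let e := RingEquiv.ofBijective _ hbij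
  refine ⟨((RingHom.snd Λ E').comp Λ₁.subtype).comp (Λ₂.subtype.comp (e.symm : Λ →+* Λ₂)), ?_⟩
  ext l
  have h1 : q (e.symm l : Λ₂) = l := e.apply_symm_apply l
  have h2 : φ (q (e.symm l : Λ₂)) = g ((e.symm l : Λ₂) : Λ₁).1.2 := ((e.symm l : Λ₂) : Λ₁).2
  rw [h1] at h2
  exact h2.symm

/-- lifting step, equal characteristic p -/
theorem lift_step_eq {E E' k : Type*} [CommRing E] [CommRing E'] [Field k]
    (p : ℕ) [hp : Fact p.Prime] [CharP k p] (hE' : (p : E') = 0)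
    (g : E' →+* E) (hg : Function.Surjective g) (hN : ∀ a b, g a = 0 → g b = 0 → a * b = 0)
    (φ : k →+* E) : ∃ φ' : k →+* E', g.comp φ' = φ := by
  let Λ₁ : Subring (k × E') := (φ.comp (RingHom.fst k E')).eqLocus (g.comp (RingHom.snd k E'))
  let q : Λ₁ →+* k := (RingHom.fst k E').comp Λ₁.subtype
  have hq : Function.Surjective q := fun a => by
    obtain ⟨e, he⟩ := hg (φ a)
    exact ⟨⟨(a, e), he.symm⟩, rfl⟩
  have hq0 : ∀ z : Λ₁, q z = 0 → g (z : k × E').2 = 0 := by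
    intro z hz
    have h1 : φ (z : k × E').1 = g (z : k × E').2 := z.2
    have h2 : (z : k × E').1 = 0 := hz
    rw [← h1, h2, map_zero]
  obtain ⟨σ, hσ⟩ := sec_lemma p (by
      apply Subtype.ext
      apply Prod.ext
      · simp
      · simpa using hE') q hq (by
      intro a b ha hb
      apply Subtype.ext
      apply Prod.ext
      · have h3 : (a : k × E').1 = 0 := ha
        change (a : k × E').1 * _ = 0
        rw [h3, zero_mul]
      · exact hN _ _ (hq0 _ ha) (hq0 _ hb))
  refine ⟨((RingHom.snd k E').comp Λ₁.subtype).comp σ, ?_⟩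
  ext l
  have h2 : φ (q (σ l)) = g (σ l).1.2 := (σ l).2
  rw [hσ] at h2
  exact h2.symm

/-- passing to the limit -/
theorem lift_limit {Λ D : Type*} [CommRing Λ] [CommRing D] (I : Ideal D) [IsAdicComplete I D]
    (φ₁ : Λ →+* D ⧸ I)
    (hstep : ∀ n, 1 ≤ n → ∀ φ : Λ →+* D ⧸ I ^ n, ∃ φ' : Λ →+* D ⧸ I ^ (n + 1),
      (Ideal.Quotient.factorPow I (show n ≤ n + 1 by omega)).comp φ' = φ) :
    ∃ ψ : Λ →+* D, (Ideal.Quotient.mk I).comp ψ = φ₁ := by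
  have hstep' : ∀ n : ℕ, ∀ φ : Λ →+* D ⧸ I ^ (n + 1), ∃ φ' : Λ →+* D ⧸ I ^ (n + 2),
      (Ideal.Quotient.factorPow I (show n + 1 ≤ n + 2 by omega)).comp φ' = φ := fun n => hstep (n + 1) (by omega)
  choose nx hnx using hstep'
  have hI : I = I ^ (0 + 1) := by rw [zero_add, pow_one]
  let φ₀ : Λ →+* D ⧸ I ^ (0 + 1) := (Ideal.quotEquivOfEq hI).toRingHom.comp φ₁
  let f : (n : ℕ) → Λ →+* D ⧸ I ^ (n + 1) := fun n =>
    Nat.rec (motive := fun n => Λ →+* D ⧸ I ^ (n + 1)) φ₀ (fun n φ => nx n φ) n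
  have hf : ∀ n, (Ideal.Quotient.factorPow I (show n + 1 ≤ n + 2 by omega)).comp (f (n + 1)) = f n := fun n => hnx n (f n)
  have hmono : StrictMono (fun n : ℕ => n + 1) := fun a b h => by simpa using h
  refine ⟨IsAdicComplete.StrictMono.liftRingHom I hmono f (fun {n} => hf n), ?_⟩
  have h0 := IsAdicComplete.StrictMono.mk_comp_liftRingHom I hmono f (fun {n} => hf n) (n := 0)
  ext l
  have h1 := RingHom.congr_fun h0 l
  have h2 : f 0 l = Ideal.quotEquivOfEq hI (φ₁ l) := rfl
  rw [h2, RingHom.comp_apply] at h1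
  rw [← (Ideal.quotEquivOfEq hI).injective.eq_iff, ← h1]
  rfl

end X11

namespace X11
universe v w
open IsLocalRing

theorem cohen_zorn {V κ k : Type*} [CommRing V] [IsDomain V] [CharZero V] [Field κ] [Field k] (p : ℕ)
    [hp : Fact p.Prime] [CharP k p] (ρ : V →+* κ) (hρ : Function.Surjective ρ)
    (hu : ∀ v, ρ v ≠ 0 → IsUnit v) (ι : k →+* κ)
    (hsplit : ∀ f : Polynomial V, f.Monic → ∃ s : Multiset V, f = (s.map (fun a => Polynomial.X - Polynomial.C a)).prod) :
    ∃ (C : Subring V) (π : C →+* k), Function.Surjective π ∧ ∀ a, π a = 0 ↔ ∃ b, a = p * b := by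
  classical
  have hκ : CharP κ p := (RingHom.charP_iff ι ι.injective p).1 inferInstance
  let s : Set (Subring V) := {C | (∀ c ∈ C, ρ c = 0 → ∃ b ∈ C, c = p * b) ∧ ∀ c ∈ C, ρ c ∈ ι.range}
  have h0 : (Int.castRingHom V).range ∈ s := by
    constructor
    · rintro _ ⟨n, rfl⟩ h
      simp only [eq_intCast, map_intCast] at h
      obtain ⟨m, rfl⟩ := (CharP.intCast_eq_zero_iff κ p n).1 h
      exact ⟨_, ⟨m, rfl⟩, by simp⟩
    · rintro _ ⟨n, rfl⟩
      exact ⟨n, by simp⟩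
  obtain ⟨C, -, hC⟩ := zorn_le_nonempty₀ s (by
    intro c hc hch y hy
    have hd := hch.directedOn
    refine ⟨sSup c, ⟨fun a ha h => ?_, fun a ha => ?_⟩, fun z hz => le_sSup hz⟩
    · obtain ⟨z, hz, haz⟩ := (Subring.mem_sSup_of_directedOn ⟨y, hy⟩ hd).1 ha
      obtain ⟨b, hb, h⟩ := (hc hz).1 a haz h
      exact ⟨b, (Subring.mem_sSup_of_directedOn ⟨y, hy⟩ hd).2 ⟨z, hz, hb⟩, h⟩
    · obtain ⟨z, hz, haz⟩ := (Subring.mem_sSup_of_directedOn ⟨y, hy⟩ hd).1 ha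
      exact (hc hz).2 a haz) _ h0
  have hC1 := hC.prop.1
  have hC2 := hC.prop.2
  -- inverses
  have hinv : ∀ c ∈ C, ρ c ≠ 0 → ∃ b ∈ C, c * b = 1 := by
    let C' : Subring V :=
      { carrier := {v | ∃ t ∈ C, ∃ c ∈ C, ρ t ≠ 0 ∧ t * v = c}
        zero_mem' := ⟨1, C.one_mem, 0, C.zero_mem, by simp, by simp⟩
        one_mem' := ⟨1, C.one_mem, 1, C.one_mem, by simp, by simp⟩
        add_mem' := by
          rintro v w ⟨t, ht, c, hc, h1, h2⟩ ⟨t', ht', c', hc', h1', h2'⟩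
          exact ⟨t * t', C.mul_mem ht ht', c * t' + c' * t, C.add_mem (C.mul_mem hc ht') (C.mul_mem hc' ht),
            by simp [h1, h1'], by rw [← h2, ← h2']; ring⟩
        mul_mem' := by
          rintro v w ⟨t, ht, c, hc, h1, h2⟩ ⟨t', ht', c', hc', h1', h2'⟩
          exact ⟨t * t', C.mul_mem ht ht', c * c', C.mul_mem hc hc',
            by simp [h1, h1'], by rw [← h2, ← h2']; ring⟩
        neg_mem' := by
          rintro v ⟨t, ht, c, hc, h1, h2⟩
          exact ⟨t, ht, -c, C.neg_mem hc, h1, by rw [← h2]; ring⟩ }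
    have hC's : C' ∈ s := by
      constructor
      · rintro v ⟨t, ht, c, hc, h1, h2⟩ hv
        obtain ⟨b, hb, rfl⟩ := hC1 c hc (by rw [← h2, map_mul, hv, mul_zero])
        obtain ⟨u, hu'⟩ := (hu t h1).exists_left_inv
        refine ⟨u * b, ⟨t, ht, b, hb, h1, by linear_combination b * hu'⟩, ?_⟩
        linear_combination u * h2 - v * hu'
      · rintro v ⟨t, ht, c, hc, h1, h2⟩
        obtain ⟨a, ha⟩ := hC2 c hc
        obtain ⟨b, hb⟩ := hC2 t ht
        refine ⟨a / b, ?_⟩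
        rw [map_div₀, ha, hb, ← h2, map_mul, mul_div_cancel_left₀ _ h1]
    have hle : C ≤ C' := fun c hc => ⟨1, C.one_mem, c, hc, by simp, by simp⟩
    have hle' := hC.le_of_ge hC's hle
    intro c hc h
    obtain ⟨b, hb⟩ := (hu c h).exists_right_inv
    exact ⟨b, hle' ⟨c, hc, 1, C.one_mem, h, hb⟩, hb⟩
  let K0 : Subfield κ :=
    { (C.map ρ) with
      inv_mem' := by
        rintro _ ⟨c, hc, rfl⟩
        by_cases h : ρ c = 0
        · rw [h, inv_zero]; exact ⟨0, C.zero_mem, map_zero _⟩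
        · obtain ⟨b, hb, hcb⟩ := hinv c hc h
          refine ⟨b, hb, ?_⟩
          exact eq_inv_of_mul_eq_one_right (by rw [← map_mul, hcb, map_one]) }
  have hK0 : ∀ c : C, ρ c ∈ K0 := fun c => ⟨c, c.2, rfl⟩
  let ρ0 : C →+* K0 := (ρ.comp C.subtype).codRestrict K0 hK0
  have hρ0 : Function.Surjective ρ0 := by
    rintro ⟨_, c, hc, rfl⟩
    exact ⟨⟨c, hc⟩, rfl⟩
  -- polynomials vanishing mod p
  have hdiv : ∀ f : Polynomial C, f.map ρ0 = 0 → ∃ g : Polynomial C, f = Polynomial.C (p : C) * g := by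
    intro f hf
    rw [← dvd_def, Polynomial.C_dvd_iff_dvd_coeff]
    intro i
    have h1 := congrArg (fun g => g.coeff i) hf
    simp only [Polynomial.coeff_map, Polynomial.coeff_zero] at h1
    obtain ⟨b, hb, h2⟩ := hC1 (f.coeff i) (f.coeff i).2 (congrArg Subtype.val h1)
    exact ⟨⟨b, hb⟩, Subtype.ext (by simpa using h2)⟩
  have hmain : ∀ a : V, ρ a ∈ ι.range → (∀ g : Polynomial C, ρ (g.eval₂ C.subtype a) = 0 →
      ∃ g' : Polynomial C, g.eval₂ C.subtype a = p * g'.eval₂ C.subtype a) → a ∈ C := by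
    intro a ha h
    have hle : (Polynomial.eval₂RingHom C.subtype a).range ∈ s := by
      constructor
      · rintro _ ⟨g, rfl⟩ h3
        obtain ⟨g', hg'⟩ := h g h3
        exact ⟨_, ⟨g', rfl⟩, hg'⟩
      · rintro _ ⟨g, rfl⟩
        rw [Polynomial.coe_eval₂RingHom, Polynomial.hom_eval₂]
        rw [Polynomial.eval₂_eq_sum]
        exact Subring.sum_mem _ fun i _ => Subring.mul_mem _ (hC2 _ (g.coeff i).2) (Subring.pow_mem _ ha _)
    have h2 : C ≤ (Polynomial.eval₂RingHom C.subtype a).range := fun t ht => ⟨Polynomial.C ⟨t, ht⟩, by simp⟩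
    exact hC.le_of_ge hle h2 ⟨Polynomial.X, by simp⟩
  have hevρ : ∀ (a : V) (g : Polynomial C), ρ (g.eval₂ C.subtype a) = Polynomial.aeval (ρ a) (g.map ρ0) := by
    intro a g
    rw [Polynomial.hom_eval₂, Polynomial.aeval_def, Polynomial.eval₂_map]
    rfl
  have hsurj : ∀ α : k, ∃ c ∈ C, ρ c = ι α := by
    intro α
    by_cases hIntg : IsIntegral K0 (ι α)
    · obtain ⟨f, hf, hfd, hfm⟩ := Polynomial.lifts_and_natDegree_eq_and_monic
        (f := ρ0) (p := minpoly K0 (ι α)) (by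
          rw [Polynomial.lifts_iff_coeff_lifts]
          exact fun n => hρ0 _) (minpoly.monic hIntg)
      obtain ⟨t, ht⟩ := hsplit (f.map C.subtype) (hfm.map _)
      have h1 : Polynomial.aeval (ι α) (f.map ρ0) = 0 := by rw [hf]; exact minpoly.aeval _ _
      have h2 : ((f.map C.subtype).map ρ).eval (ι α) = 0 := by
        rw [← h1, Polynomial.aeval_def, Polynomial.eval₂_map, Polynomial.map_map, Polynomial.eval_map]
        rfl
      rw [ht, Polynomial.map_multiset_prod, Multiset.map_map, Polynomial.eval_multiset_prod, Multiset.map_map,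
        Multiset.prod_eq_zero_iff, Multiset.mem_map] at h2
      obtain ⟨a, hat, ha⟩ := h2
      simp only [Function.comp_apply, Polynomial.map_sub, Polynomial.map_X, Polynomial.map_C,
        Polynomial.eval_sub, Polynomial.eval_X, Polynomial.eval_C, sub_eq_zero] at ha
      have hfa : f.eval₂ C.subtype a = 0 := by
        rw [← Polynomial.eval_map, ht, Polynomial.eval_multiset_prod, Multiset.map_map, Multiset.prod_eq_zero_iff,
          Multiset.mem_map]
        exact ⟨a, hat, by simp⟩
      refine ⟨a, hmain a ⟨α, ha⟩ ?_, ha.symm⟩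
      intro g hg
      have h3 : g.eval₂ C.subtype a = (g %ₘ f).eval₂ C.subtype a := by
        conv_lhs => rw [← Polynomial.modByMonic_add_div g f]
        rw [Polynomial.eval₂_add, Polynomial.eval₂_mul, hfa, zero_mul, add_zero]
      rw [h3, hevρ, ← ha] at hg
      have h4 : (g %ₘ f).map ρ0 = 0 := by
        by_contra hne
        have h5 := minpoly.degree_le_of_ne_zero K0 (ι α) hne hg
        have h6 : (minpoly K0 (ι α)).degree = f.degree := by
          rw [← hf, hfm.degree_map]
        rw [h6] at h5
        have h7 := Polynomial.degree_modByMonic_lt g hfm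
        have h8 := Polynomial.degree_map_le (f := ρ0) (p := g %ₘ f)
        exact absurd (h5.trans h8) (not_le.2 h7)
      obtain ⟨g', hg'⟩ := hdiv _ h4
      refine ⟨g', ?_⟩
      rw [h3, hg', Polynomial.eval₂_mul]
      simp
    · obtain ⟨a, ha⟩ := hρ (ι α)
      refine ⟨a, hmain a ⟨α, ha.symm⟩ ?_, ha⟩
      intro g hg
      rw [hevρ, ha] at hg
      have h4 : g.map ρ0 = 0 := by
        by_contra hne
        exact hIntg (isAlgebraic_iff_isIntegral.1 ⟨_, hne, hg⟩)
      obtain ⟨g', hg'⟩ := hdiv _ h4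
      refine ⟨g', ?_⟩
      rw [hg', Polynomial.eval₂_mul]
      simp
  choose π0 hπ0 using fun c : C => hC2 c c.2
  let π : C →+* k :=
    { toFun := π0
      map_one' := ι.injective (by rw [hπ0]; simp)
      map_zero' := ι.injective (by rw [hπ0]; simp)
      map_add' := fun a b => ι.injective (by rw [hπ0, map_add, hπ0, hπ0]; simp)
      map_mul' := fun a b => ι.injective (by rw [hπ0, map_mul, hπ0, hπ0]; simp) }
  have hπ : ∀ c : C, ι (π c) = ρ c := hπ0
  refine ⟨C, π, fun α => ?_, fun a => ⟨fun h => ?_, ?_⟩⟩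
  · obtain ⟨c, hc, h⟩ := hsurj α
    exact ⟨⟨c, hc⟩, ι.injective (by rw [hπ, h])⟩
  · obtain ⟨b, hb, h2⟩ := hC1 a a.2 (by rw [← hπ, h, map_zero])
    exact ⟨⟨b, hb⟩, Subtype.ext (by simpa using h2)⟩
  · rintro ⟨b, rfl⟩
    rw [map_mul, map_natCast, CharP.cast_eq_zero, zero_mul]


section AC
variable {A : Type*} [CommRing A] {I : Ideal A}

theorem ac_mem (hI : I.FG) (n : ℕ) (z : AdicCompletion I A) :
    z ∈ (I.map (algebraMap A (AdicCompletion I A))) ^ n ↔ AdicCompletion.evalₐ I n z = 0 := by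
  rw [← Ideal.map_pow]
  have h1 : z ∈ (I ^ n).map (algebraMap A (AdicCompletion I A)) ↔
      z ∈ ((I ^ n) • ⊤ : Submodule A (AdicCompletion I A)) := by
    rw [Ideal.smul_top_eq_map]; rfl
  rw [h1, AdicCompletion.pow_smul_top_eq_ker_eval hI, LinearMap.mem_ker]
  have h : I ^ n ≤ I ^ n • (⊤ : Ideal A) := by rw [smul_eq_mul, Ideal.mul_top]
  have h' : I ^ n • (⊤ : Ideal A) ≤ I ^ n := by rw [smul_eq_mul, Ideal.mul_top]
  constructor
  · intro h2
    have h3 := AdicCompletion.factor_eval_eq_evalₐ I z h'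
    rw [← h3, h2, map_zero]
  · intro h2
    have h3 := AdicCompletion.factor_evalₐ_eq_eval I z h
    rw [← h3, h2, map_zero]

theorem ac_algebraMap_mem (hI : I.FG) (n : ℕ) (r : A) :
    algebraMap A (AdicCompletion I A) r ∈ (I.map (algebraMap A (AdicCompletion I A))) ^ n ↔ r ∈ I ^ n := by
  rw [ac_mem hI, AlgHom.commutes, Ideal.Quotient.algebraMap_eq, Ideal.Quotient.eq_zero_iff_mem]

theorem ac_approx (hI : I.FG) (n : ℕ) (z : AdicCompletion I A) :
    ∃ r, z - algebraMap A (AdicCompletion I A) r ∈ (I.map (algebraMap A (AdicCompletion I A))) ^ n := by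
  obtain ⟨r, hr⟩ := Ideal.Quotient.mk_surjective (AdicCompletion.evalₐ I n z)
  refine ⟨r, ?_⟩
  rw [ac_mem hI, map_sub, AlgHom.commutes, Ideal.Quotient.algebraMap_eq, hr, sub_self]

theorem ac_complete (hI : I.FG) :
    IsAdicComplete (I.map (algebraMap A (AdicCompletion I A))) (AdicCompletion I A) := by
  have := AdicCompletion.isAdicComplete (I := I) (M := A) hI
  exact (IsAdicComplete.map_algebraMap_iff (I := I) (M := AdicCompletion I A)).2 this

end AC

/-- Existence of Cohen rings. -/
theorem exists_cohen (k : Type u) [Field k] (p : ℕ) [hp : Fact p.Prime] [CharP k p] :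
    ∃ (Λ : Type u) (_ : CommRing Λ) (π : Λ →+* k), Function.Surjective π ∧
      (∀ a, π a = 0 ↔ ∃ b, a = p * b) ∧ (∀ a : Λ, (p : Λ) * a = 0 → a = 0) ∧
      IsAdicComplete (Ideal.span {(p : Λ)}) Λ := by
  let M := MvPolynomial k ℤ
  let θ : M →+* k := MvPolynomial.eval₂Hom (Int.castRingHom k) id
  have hP : (RingHom.ker θ).IsPrime := RingHom.ker_isPrime θ
  let Ω := AlgebraicClosure (FractionRing M)
  let B := Localization.AtPrime (RingHom.ker θ)
  let jM : M →+* Ω := (algebraMap (FractionRing M) Ω).comp (algebraMap M (FractionRing M))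
  have hjM : Function.Injective jM := (algebraMap (FractionRing M) Ω).injective.comp (IsFractionRing.injective M _)
  let j : B →+* Ω := IsLocalization.lift (M := (RingHom.ker θ).primeCompl) (g := jM) (fun y => by
    rw [isUnit_iff_ne_zero]
    intro h
    have := hjM (h.trans (map_zero _).symm)
    exact y.2 (this ▸ Ideal.zero_mem _))
  obtain ⟨V, hV, hloc⟩ := IsLocalRing.exists_factor_valuationRing j
  let jV : B →+* V := j.codRestrict V.toSubring hV
  have hloc : IsLocalHom jV := hloc
  have : CharZero Ω := (RingHom.charZero_iff hjM).1 inferInstance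
  have : CharZero V := (RingHom.charZero_iff (ϕ := algebraMap V Ω) Subtype.val_injective).2 inferInstance
  -- the embedding of k
  let ι0 : M →+* ResidueField V := (residue V).comp (jV.comp (algebraMap M B))
  have hθs : Function.Surjective θ := fun a => ⟨MvPolynomial.X a, MvPolynomial.eval₂_X _ _ _⟩
  have hθ : ∀ f : M, θ f = 0 → ι0 f = 0 := by
    intro f hf
    change residue V (jV (algebraMap M B f)) = 0
    rw [residue_eq_zero_iff]
    have : algebraMap M B f ∈ maximalIdeal B := by
      rw [← IsLocalization.AtPrime.map_eq_maximalIdeal (RingHom.ker θ) B]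
      exact Ideal.mem_map_of_mem _ hf
    exact fun h => this ((isUnit_map_iff jV _).1 h)
  let ι : k →+* ResidueField V := RingHom.liftOfSurjective θ hθs ⟨ι0, fun f hf => hθ f hf⟩
  obtain ⟨C, π, hπs, hπ⟩ := cohen_zorn (V := V) p (residue V) residue_surjective (by
      intro v hv
      by_contra h
      exact hv ((residue_eq_zero_iff v).2 h)) ι (by
      intro f hf
      have h1 := (IsAlgClosed.splits (f.map (algebraMap V Ω))).eq_prod_roots_of_monic (hf.map _)
      have h2 : ∀ r ∈ (f.map (algebraMap V Ω)).roots, ∃ v : V, algebraMap V Ω v = r := by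
        intro r hr
        have : IsIntegral V r := by
          refine ⟨f, hf, ?_⟩
          rw [← Polynomial.eval_map]
          exact Polynomial.isRoot_of_mem_roots hr
        exact IsIntegrallyClosed.algebraMap_eq_of_integral this
      have h3 : ∃ t : Multiset V, t.map (algebraMap V Ω) = (f.map (algebraMap V Ω)).roots := by
        choose! g hg using h2
        refine ⟨(f.map (algebraMap V Ω)).roots.map g, ?_⟩
        rw [Multiset.map_map]
        conv_rhs => rw [← Multiset.map_id (f.map (algebraMap V Ω)).roots]
        exact Multiset.map_congr rfl fun r hr => hg r hr
      obtain ⟨t, ht⟩ := h3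
      refine ⟨t, Polynomial.map_injective (algebraMap V Ω) Subtype.val_injective ?_⟩
      rw [h1, ← ht, Polynomial.map_multiset_prod, Multiset.map_map, Multiset.map_map]
      congr 1
      refine Multiset.map_congr rfl fun r hr => ?_
      simp)
  let J : Ideal C := Ideal.span {(p : C)}
  have hJ : J.FG := ⟨{(p : C)}, by simp [J]⟩
  let Λ := AdicCompletion J C
  have hmap : J.map (algebraMap C Λ) = Ideal.span {(p : Λ)} := by
    rw [Ideal.map_span, Set.image_singleton, map_natCast]
  have hcomp : IsAdicComplete (Ideal.span {(p : Λ)}) Λ := hmap ▸ ac_complete hJ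
  have happ := fun n z => ac_approx hJ n z
  have hmem := fun n r => ac_algebraMap_mem hJ n r
  rw [hmap] at happ hmem
  have hJ1 : ∀ c ∈ J, π c = 0 := fun c hc => (hπ c).2 (by
    obtain ⟨b, rfl⟩ := Ideal.mem_span_singleton.1 hc
    exact ⟨b, rfl⟩)
  let πq : C ⧸ J →+* k := Ideal.Quotient.lift J π hJ1
  let πΛ : Λ →+* k := πq.comp (AdicCompletion.evalOneₐ J).toRingHom
  have hπΛ : ∀ c, πΛ (algebraMap C Λ c) = π c := by
    intro c
    change πq (AdicCompletion.evalOneₐ J (algebraMap C Λ c)) = π c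
    rw [AlgHom.commutes]
    rfl
  refine ⟨Λ, inferInstance, πΛ, fun a => ?_, fun a => ⟨fun h => ?_, ?_⟩, fun a ha => ?_, hcomp⟩
  · obtain ⟨c, rfl⟩ := hπs a
    exact ⟨algebraMap C Λ c, hπΛ c⟩
  · obtain ⟨c, hc⟩ := happ 1 a
    rw [pow_one, Ideal.mem_span_singleton] at hc
    obtain ⟨b, hb⟩ := hc
    rw [sub_eq_iff_eq_add] at hb
    rw [hb, map_add, map_mul, map_natCast, CharP.cast_eq_zero, zero_mul, zero_add, hπΛ, hπ] at h
    obtain ⟨c', rfl⟩ := h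
    exact ⟨b + algebraMap C Λ c', by rw [hb, map_mul, map_natCast]; ring⟩
  · rintro ⟨b, rfl⟩
    rw [map_mul, map_natCast, CharP.cast_eq_zero, zero_mul]
  · have := hcomp.toIsHausdorff
    refine haus_iff.1 this a fun n => ?_
    obtain ⟨c, hc⟩ := happ (n + 1) a
    have h1 : algebraMap C Λ (p * c) ∈ Ideal.span {(p : Λ)} ^ (n + 1) := by
      have := Ideal.mul_mem_left _ (-(p : Λ)) hc
      rw [mul_sub, neg_mul, ha] at this
      convert this using 1
      rw [map_mul, map_natCast]; ring
    rw [hmem, Ideal.span_singleton_pow, Ideal.mem_span_singleton] at h1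
    obtain ⟨b, hb⟩ := h1
    have hp0 : (p : C) ≠ 0 := by
      intro h
      have : (p : V) = 0 := by simpa using congrArg Subtype.val h
      exact hp.out.ne_zero (by exact_mod_cast this)
    have hc' : c ∈ J ^ n := by
      rw [Ideal.span_singleton_pow, Ideal.mem_span_singleton]
      exact ⟨b, mul_left_cancel₀ hp0 (by rw [hb, pow_succ]; ring)⟩
    have := (hmem n c).2 hc'
    have h3 := add_mem (Ideal.pow_le_pow_right (Nat.le_succ n) hc) this
    simpa using h3

end X11

namespace X11
universe v w
open IsLocalRing

/-- The N-2 property. -/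
def N2 (A : Type u) [CommRing A] [IsDomain A] : Prop :=
  ∀ (L : Type u) [Field L] [Algebra A L] [Algebra (FractionRing A) L]
    [IsScalarTower A (FractionRing A) L] [FiniteDimensional (FractionRing A) L],
    Module.Finite A (integralClosure A L)

theorem N2_of_charZero (A : Type u) [CommRing A] [IsDomain A] [IsNoetherianRing A]
    [IsIntegrallyClosed A] [CharZero A] : N2 A := by
  intro L _ _ _ _ _
  have : CharZero (FractionRing A) := (RingHom.charZero_iff
    (IsFractionRing.injective A (FractionRing A))).1 inferInstance
  exact IsIntegralClosure.finite A (FractionRing A) L (integralClosure A L)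

theorem N2_of_field (A : Type u) [Field A] : N2 A := by
  intro L _ _ _ _ _
  have : Module.Finite A (FractionRing A) :=
    Module.Finite.of_surjective (Algebra.linearMap A (FractionRing A)) (by
      have h := IsFractionRing.surjective_iff_isField (R := A) (K := FractionRing A)
      exact h.2 (Field.toIsField A))
  have : Module.Finite A L := Module.Finite.trans (FractionRing A) L
  infer_instance

theorem tate_T1 (A0 E : Type u) [CommRing A0] [IsDomain A0] [IsNoetherianRing A0] (hN : N2 A0)
    [CommRing E] [IsDomain E] [Algebra A0 E] (hinj : Function.Injective (algebraMap A0 E))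
    [Algebra.IsIntegral A0 E] (n : ℕ)
    (hn : ∀ (k : ℕ) (f : Fin k → E), LinearIndependent A0 f → k ≤ n) :
    Module.Finite A0 E := by
  classical
  have : FaithfulSMul A0 E := (faithfulSMul_iff_algebraMap_injective A0 E).2 hinj
  have : FaithfulSMul A0 (FractionRing E) := (faithfulSMul_iff_algebraMap_injective A0 _).2 (by
    rw [IsScalarTower.algebraMap_eq A0 E (FractionRing E)]
    exact (IsFractionRing.injective E (FractionRing E)).comp hinj)
  let _ : Algebra (FractionRing A0) (FractionRing E) := FractionRing.liftAlgebra A0 (FractionRing E)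
  have := FractionRing.isScalarTower_liftAlgebra A0 (FractionRing E)
  have hden : ∀ z : FractionRing E, ∃ s : A0, s ≠ 0 ∧ ∃ e : E, algebraMap E _ e = s • z := by
    intro z
    obtain ⟨a, b, hb, rfl⟩ := IsFractionRing.div_surjective (A := E) z
    have hb0 : b ≠ 0 := nonZeroDivisors.ne_zero hb
    obtain ⟨s, hs, t, ht⟩ := (Algebra.IsIntegral.isIntegral (R := A0) b).isAlgebraic.exists_nonzero_dvd hb
    refine ⟨s, hs, a * t, ?_⟩
    have hb' : algebraMap E (FractionRing E) b ≠ 0 := by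
      simpa using hb0
    rw [Algebra.smul_def, IsScalarTower.algebraMap_apply A0 E (FractionRing E), ht, map_mul, map_mul]
    field_simp
  have hfin : FiniteDimensional (FractionRing A0) (FractionRing E) := by
    have hr : Module.rank (FractionRing A0) (FractionRing E) ≤ n := by
      apply rank_le
      intro s hs
      choose d hd e he using hden
      let v : Fin s.card → FractionRing E := fun i => (s.equivFin.symm i : FractionRing E)
      have hv : LinearIndependent (FractionRing A0) v := hs.comp _ s.equivFin.symm.injective
      have hv2 : LinearIndependent (FractionRing A0) (fun i => algebraMap E (FractionRing E) (e (v i))) := by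
        have := hv.units_smul (fun i => Units.mk0 (algebraMap A0 (FractionRing A0) (d (v i))) (by simpa using hd (v i)))
        convert this using 1
        funext i
        simp only [he, Pi.smul_apply', Units.smul_mk0, algebraMap_smul]
      have hv3 : LinearIndependent A0 (fun i => algebraMap E (FractionRing E) (e (v i))) :=
        (LinearIndependent.iff_fractionRing A0 (FractionRing A0)).2 hv2
      exact hn _ (fun i => e (v i)) (LinearIndependent.of_comp ((Algebra.linearMap E (FractionRing E)).restrictScalars A0) hv3)
    exact Module.rank_lt_aleph0_iff.1 (hr.trans_lt (Cardinal.natCast_lt_aleph0))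
  have := hN (FractionRing E)
  let f : E →ₗ[A0] integralClosure A0 (FractionRing E) :=
    { toFun := fun e => ⟨algebraMap E _ e, (Algebra.IsIntegral.isIntegral (R := A0) e).algebraMap⟩
      map_add' := fun a b => Subtype.ext (by simp)
      map_smul' := fun a b => Subtype.ext (by simp [Algebra.smul_def, IsScalarTower.algebraMap_apply A0 E (FractionRing E)]) }
  exact Module.Finite.of_injective f (fun a b h => IsFractionRing.injective E (FractionRing E) (congrArg Subtype.val h))

theorem tate_core (A A0 : Type u) [CommRing A] [IsDomain A] [IsNoetherianRing A] [IsIntegrallyClosed A]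
    [CommRing A0] [IsDomain A0] (hN : N2 A0) (π : A →+* A0) (hπ : Function.Surjective π) (x : A)
    (hx0 : x ≠ 0) (hker : ∀ a, π a = 0 ↔ x ∣ a) [hc : IsAdicComplete (Ideal.span {x}) A]
    (K' : Type u) [Field K'] [Algebra A K'] [Algebra (FractionRing A) K']
    [IsScalarTower A (FractionRing A) K'] [FiniteDimensional (FractionRing A) K']
    (q : ℕ) (hq0 : 0 < q) (hq : ∀ b : K', ∃ c : FractionRing A, b ^ q = algebraMap _ K' c)
    (y : K') (hy : y ^ q = algebraMap A K' x) :
    Module.Finite A (integralClosure A K') := by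
  classical
  have : IsNoetherianRing A0 := isNoetherianRing_of_surjective A A0 π hπ
  have hinjK : Function.Injective (algebraMap A K') := by
    rw [IsScalarTower.algebraMap_eq A (FractionRing A) K']
    exact (algebraMap (FractionRing A) K').injective.comp (IsFractionRing.injective A _)
  have hIntg : ∀ b : K', IsIntegral A b ↔ ∃ a : A, b ^ q = algebraMap A K' a := by
    intro b
    constructor
    · intro h
      obtain ⟨c, hc⟩ := hq b
      have h1 := h.pow q
      rw [hc] at h1
      have h2 : IsIntegral A c := (isIntegral_algebraMap_iff (algebraMap (FractionRing A) K').injective).1 h1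
      obtain ⟨a, rfl⟩ := IsIntegrallyClosed.isIntegral_iff.1 h2
      exact ⟨a, by rw [hc, IsScalarTower.algebraMap_apply A (FractionRing A) K']⟩
    · rintro ⟨a, ha⟩
      refine IsIntegral.of_pow hq0 ?_
      rw [ha]; exact isIntegral_algebraMap
  let B := integralClosure A K'
  let y' : B := ⟨y, (hIntg y).2 ⟨x, hy⟩⟩
  have hAB : ∀ a, (algebraMap A B a : K') = algebraMap A K' a := fun a => rfl
  have hinjB : Function.Injective (algebraMap A B) := fun a b h => hinjK (congrArg Subtype.val h)
  have hy' : y' ^ q = algebraMap A B x := Subtype.ext hy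
  have hy0 : y ≠ 0 := by
    rintro rfl
    rw [zero_pow hq0.ne'] at hy
    exact hx0 (hinjK (by rw [← hy, map_zero]))
  have hBq : ∀ b : B, ∃ a, b ^ q = algebraMap A B a := fun b => by
    obtain ⟨a, ha⟩ := (hIntg b).1 b.2
    exact ⟨a, Subtype.ext ha⟩
  let P : Ideal B := Ideal.span {y'}
  have hP : ∀ (b : B) (a : A), b ^ q = algebraMap A B a → (b ∈ P ↔ x ∣ a) := by
    intro b a hba
    rw [Ideal.mem_span_singleton]
    constructor
    · rintro ⟨c, rfl⟩
      obtain ⟨a', ha'⟩ := hBq c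
      refine ⟨a', hinjB ?_⟩
      rw [← hba, mul_pow, hy', ha', map_mul]
    · rintro ⟨a', rfl⟩
      have h1 : IsIntegral A ((b : K') / y) := by
        rw [hIntg]
        refine ⟨a', ?_⟩
        have : (b : K') ^ q = algebraMap A K' (x * a') := congrArg Subtype.val hba
        rw [div_pow, this, hy, map_mul, mul_div_cancel_left₀]
        rw [← hy]; exact pow_ne_zero _ hy0
      refine ⟨⟨_, h1⟩, Subtype.ext ?_⟩
      change (b : K') = y * (b / y)
      field_simp
  have hxpr : Prime x := by
    refine ⟨hx0, fun h => ?_, fun a b hab => ?_⟩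
    · have := (hker 1).2 (h.dvd)
      rw [map_one] at this; exact one_ne_zero this
    · rw [← hker, map_mul, mul_eq_zero, hker, hker] at hab; exact hab
  have hPp : P.IsPrime := by
    refine Ideal.isPrime_iff.2 ⟨?_, ?_⟩
    · rw [Ideal.ne_top_iff_one, hP 1 1 (by simp)]
      exact fun h => hxpr.not_isUnit (isUnit_of_dvd_one h)
    · intro b c hbc
      obtain ⟨a, ha⟩ := hBq b
      obtain ⟨a', ha'⟩ := hBq c
      rw [hP _ (a * a') (by rw [mul_pow, ha, ha', map_mul])] at hbc
      rw [hP _ _ ha, hP _ _ ha']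
      exact hxpr.dvd_or_dvd hbc
  have hAP : ∀ a : A, algebraMap A B a ∈ P ↔ x ∣ a := fun a => by
    rw [hP _ (a ^ q) (by rw [map_pow])]
    exact ⟨hxpr.dvd_of_dvd_pow, fun h => dvd_pow h hq0.ne'⟩
  let φ : A →+* B ⧸ P := (Ideal.Quotient.mk P).comp (algebraMap A B)
  have hφ : ∀ a, φ a = 0 ↔ π a = 0 := fun a => by
    change Ideal.Quotient.mk P _ = 0 ↔ _
    rw [Ideal.Quotient.eq_zero_iff_mem, hAP, hker]
  let φ0 : A0 →+* B ⧸ P := RingHom.liftOfSurjective π hπ ⟨φ, fun a ha => (hφ a).2 ha⟩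
  have hφ0 : ∀ a, φ0 (π a) = φ a := fun a => RingHom.liftOfRightInverse_comp_apply _ _ _ _ _
  let _ : Algebra A0 (B ⧸ P) := φ0.toAlgebra
  have halg : ∀ a, algebraMap A0 (B ⧸ P) (π a) = φ a := hφ0
  have hinj0 : Function.Injective (algebraMap A0 (B ⧸ P)) := by
    rw [injective_iff_map_eq_zero]
    intro a ha
    obtain ⟨a, rfl⟩ := hπ a
    rw [halg] at ha
    exact (hφ a).1 ha
  have : Algebra.IsIntegral A0 (B ⧸ P) := ⟨fun b => by
    obtain ⟨b, rfl⟩ := Ideal.Quotient.mk_surjective b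
    obtain ⟨a, ha⟩ := hBq b
    refine IsIntegral.of_pow hq0 ?_
    rw [← map_pow, ha]
    change IsIntegral A0 (φ a)
    rw [← halg]
    exact isIntegral_algebraMap⟩
  have hH := haus_iff.1 hc.toIsHausdorff
  have hfin0 : Module.Finite A0 (B ⧸ P) := by
    refine tate_T1 A0 (B ⧸ P) hN hinj0 (Module.finrank (FractionRing A) K') ?_
    intro k f hf
    choose b hb using fun i => Ideal.Quotient.mk_surjective (f i)
    have hli : LinearIndependent A (fun i => (b i : K')) := by
      rw [Fintype.linearIndependent_iff]
      have key : ∀ n (c : Fin k → A), ∑ i, c i • (b i : K') = 0 → ∀ i, c i ∈ Ideal.span {x} ^ n := by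
        intro n
        induction n with
        | zero => intro c hc i; simp
        | succ n ih =>
          intro c hc
          have h1 : ∑ i, π (c i) • f i = 0 := by
            have h2 : ∑ i, algebraMap A B (c i) * b i = 0 := by
              apply Subtype.ext
              simpa [Algebra.smul_def] using hc
            have h3 := congrArg (Ideal.Quotient.mk P) h2
            rw [map_sum, map_zero] at h3
            rw [← h3]
            refine Finset.sum_congr rfl fun i _ => ?_
            rw [Algebra.smul_def, halg, map_mul, hb]
            rfl
          have h4 := Fintype.linearIndependent_iff.1 hf _ h1
          choose c' hc' using fun i => (hker _).1 (h4 i)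
          have h5 : ∑ i, c' i • (b i : K') = 0 := by
            have h6 : algebraMap A K' x * ∑ i, c' i • (b i : K') = 0 := by
              rw [← hc, Finset.mul_sum]
              refine Finset.sum_congr rfl fun i _ => ?_
              rw [hc' i, Algebra.smul_def, Algebra.smul_def, map_mul, mul_assoc]
            refine (mul_eq_zero.1 h6).resolve_left ?_
            rw [← hy]; exact pow_ne_zero _ hy0
          intro i
          rw [hc' i, pow_succ']
          exact Ideal.mul_mem_mul (Ideal.mem_span_singleton_self x) (ih _ h5 i)
      intro c hc i
      exact hH _ fun n => key n c hc i
    have hli2 : LinearIndependent (FractionRing A) (fun i => (b i : K')) :=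
      (LinearIndependent.iff_fractionRing A (FractionRing A)).1 hli
    simpa using hli2.fintype_card_le_finrank
  -- B/P finite over A
  have hfinP : ∃ s : Finset B, ∀ b : B, ∃ c ∈ Submodule.span A (s : Set B), b - c ∈ P := by
    obtain ⟨s, hs⟩ := hfin0.1
    choose l hl using fun z : B ⧸ P => Ideal.Quotient.mk_surjective z
    refine ⟨s.image l, fun b => ?_⟩
    have hz : ∀ z : B ⧸ P, ∃ c ∈ Submodule.span A ((s.image l : Finset B) : Set B), Ideal.Quotient.mk P c = z := by
      intro z
      have : z ∈ Submodule.span A0 (s : Set (B ⧸ P)) := hs ▸ Submodule.mem_top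
      induction this using Submodule.span_induction with
      | mem z hz => exact ⟨l z, Submodule.subset_span (by simpa using ⟨z, hz, rfl⟩), hl z⟩
      | zero => exact ⟨0, zero_mem _, map_zero _⟩
      | add z w _ _ h1 h2 =>
        obtain ⟨c, hc, h1⟩ := h1
        obtain ⟨c', hc', h2⟩ := h2
        exact ⟨c + c', add_mem hc hc', by rw [map_add, h1, h2]⟩
      | smul a z _ h1 =>
        obtain ⟨c, hc, h1⟩ := h1
        obtain ⟨a, rfl⟩ := hπ a
        refine ⟨a • c, Submodule.smul_mem _ _ hc, ?_⟩
        rw [Algebra.smul_def, Algebra.smul_def, map_mul, h1, halg]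
        rfl
    obtain ⟨c, hc, h⟩ := hz (Ideal.Quotient.mk P b)
    exact ⟨c, hc, by rw [← Ideal.Quotient.eq_zero_iff_mem, map_sub, h, sub_self]⟩
  have hfinPn : ∀ n : ℕ, ∃ s : Finset B, ∀ b : B, ∃ c ∈ Submodule.span A (s : Set B), y' ^ n ∣ b - c := by
    obtain ⟨s, hs⟩ := hfinP
    intro n
    induction n with
    | zero => exact ⟨∅, fun b => ⟨0, zero_mem _, by simp⟩⟩
    | succ n ih =>
      obtain ⟨t, ht⟩ := ih
      refine ⟨t ∪ s.image (fun z => y' ^ n * z), fun b => ?_⟩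
      obtain ⟨c, hc, c1, hc1⟩ := ht b
      obtain ⟨c2, hc2, hc3⟩ := hs c1
      obtain ⟨c3, hc3⟩ := Ideal.mem_span_singleton.1 hc3
      refine ⟨c + y' ^ n * c2, add_mem (Submodule.span_mono (by simp) hc) ?_, c3, ?_⟩
      · have h1 : y' ^ n * c2 ∈ Submodule.map (LinearMap.mulLeft A (y' ^ n)) (Submodule.span A (s : Set B)) :=
          ⟨c2, hc2, rfl⟩
        rw [Submodule.map_span] at h1
        refine Submodule.span_mono ?_ h1
        rintro _ ⟨z, hz, rfl⟩
        simp only [Finset.coe_union, Finset.coe_image]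
        exact Or.inr ⟨z, hz, rfl⟩
      · rw [← sub_sub, hc1, pow_succ, mul_assoc, ← hc3]; ring
  have hsm : ∀ (n : ℕ) (b : B), b ∈ ((Ideal.span {x} ^ n) • ⊤ : Submodule A B) ↔ ∃ c, b = algebraMap A B (x ^ n) * c := by
    intro n b
    rw [Ideal.span_singleton_pow, Submodule.ideal_span_singleton_smul]
    constructor
    · rintro ⟨c, -, rfl⟩; exact ⟨c, by simp [Algebra.smul_def]⟩
    · rintro ⟨c, rfl⟩; exact ⟨c, trivial, by simp [Algebra.smul_def]⟩
  have hHB : IsHausdorff (Ideal.span {x}) B := ⟨fun b hb => by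
    obtain ⟨a, ha⟩ := hBq b
    have : a = 0 := hH a fun n => by
      have h1 := hb n
      rw [SModEq.zero, hsm] at h1
      obtain ⟨c, rfl⟩ := h1
      obtain ⟨a', ha'⟩ := hBq c
      have : a = (x ^ n) ^ q * a' := hinjB (by rw [← ha, mul_pow, ha']; simp only [map_mul, map_pow])
      rw [this, Ideal.span_singleton_pow, Ideal.mem_span_singleton]
      exact Dvd.dvd.mul_right (dvd_pow_self _ hq0.ne') _
    rw [this, map_zero] at ha
    exact eq_zero_of_pow_eq_zero ha⟩
  have : Module.Finite A (B ⧸ (Ideal.span {x} • ⊤ : Submodule A B)) := by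
    obtain ⟨s, hs⟩ := hfinPn q
    refine ⟨⟨s.image (Submodule.mkQ _), ?_⟩⟩
    rw [eq_top_iff]
    rintro z -
    obtain ⟨b, rfl⟩ := Submodule.mkQ_surjective _ z
    obtain ⟨c, hc, c1, h⟩ := hs b
    have : Submodule.mkQ (Ideal.span {x} • ⊤ : Submodule A B) b = Submodule.mkQ _ c := by
      rw [← sub_eq_zero, ← map_sub]
      simp only [Submodule.mkQ_apply, Submodule.Quotient.mk_eq_zero]
      have := (hsm 1 (b - c)).2 ⟨c1, by rw [h, hy', pow_one]⟩
      rwa [pow_one] at this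
    rw [this, Finset.coe_image, ← Submodule.map_span]
    exact Submodule.mem_map_of_mem hc
  exact finite_of_complete (Ideal.span {x})

theorem N2_descend (A K L K' E : Type u) [CommRing A] [IsDomain A] [IsNoetherianRing A] [IsIntegrallyClosed A]
    [Field K] [Field L] [Field K'] [Field E] [Algebra A K] [IsFractionRing A K] [Algebra A L] [Algebra A K']
    [Algebra K K'] [IsScalarTower A K K'] [FiniteDimensional K K'] [Algebra K' E] [FiniteDimensional K' E]
    [Algebra.IsSeparable K' E] [Algebra A E] [IsScalarTower A K' E]
    (hB : Module.Finite A (integralClosure A K')) (g : L →ₐ[A] E) :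
    Module.Finite A (integralClosure A L) := by
  let B := integralClosure A K'
  have hBn : IsNoetherianRing B := isNoetherian_of_isNoetherianRing_of_finite A B |> fun h =>
    isNoetherian_of_tower A h
  have hBf : IsFractionRing B K' := integralClosure.isFractionRing_of_finite_extension K K'
  have hBi : IsIntegrallyClosed B := integralClosure.isIntegrallyClosedOfFiniteExtension K
  have hC : Module.Finite B (integralClosure B E) := IsIntegralClosure.finite B K' E (integralClosure B E)
  have hCA : Module.Finite A (integralClosure B E) := Module.Finite.trans B _
  let f : integralClosure A L →ₗ[A] integralClosure B E :=
    { toFun := fun l => ⟨g l, (l.2.map g).tower_top⟩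
      map_add' := fun a b => Subtype.ext (by simp)
      map_smul' := fun a b => Subtype.ext (by simp) }
  exact Module.Finite.of_injective f (fun a b h => Subtype.ext (g.toRingHom.injective (congrArg Subtype.val h)))

theorem tate_N2 (A A0 : Type u) [CommRing A] [IsDomain A] [IsNoetherianRing A] [IsIntegrallyClosed A]
    [CommRing A0] [IsDomain A0] (hN : N2 A0) (π : A →+* A0) (hπ : Function.Surjective π) (x : A)
    (hx0 : x ≠ 0) (hker : ∀ a, π a = 0 ↔ x ∣ a) [hc : IsAdicComplete (Ideal.span {x}) A]
    (p : ℕ) [Fact p.Prime] [CharP A p] : N2 A := by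
  classical
  intro L _ _ _ _ _
  let K := FractionRing A
  let Ω := AlgebraicClosure L
  have : CharP K p := charP_of_injective_algebraMap (IsFractionRing.injective A K) p
  have : ExpChar K p := ExpChar.prime Fact.out
  let Pc := perfectClosure K Ω
  have : CharP Ω p := charP_of_injective_algebraMap (algebraMap K Ω).injective p
  have : ExpChar Ω p := ExpChar.prime Fact.out
  have : Algebra.IsAlgebraic K Ω := Algebra.IsAlgebraic.trans K L Ω
  have hsep : Algebra.IsSeparable Pc Ω := inferInstance
  -- generators of L
  let s : Finset L := Finset.univ.image (Module.finBasis K L)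
  let S : Finset Ω := s.image (algebraMap L Ω)
  let cs : Finset Ω := S.biUnion fun a => ((minpoly Pc a).coeffs.image (fun z : Pc => (z : Ω)))
  have hcs : ∀ z ∈ cs, z ∈ Pc := by
    intro z hz
    simp only [cs, Finset.mem_biUnion, Finset.mem_image] at hz
    obtain ⟨a, _, w, _, rfl⟩ := hz
    exact w.2
  obtain ⟨e, he⟩ : ∃ e : ℕ, ∀ z ∈ cs, z ^ p ^ e ∈ (algebraMap K Ω).range := by
    choose! f hf using fun z hz => (mem_perfectClosure_iff_pow_mem (F := K) (E := Ω) p).1 (hcs z hz)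
    refine ⟨cs.sup f, fun z hz => ?_⟩
    obtain ⟨g, hg⟩ := Nat.exists_eq_add_of_le (Finset.le_sup (f := f) hz)
    rw [hg, pow_add, pow_mul]
    exact Subring.pow_mem _ (hf z hz) _
  obtain ⟨y, hy⟩ : ∃ y : Ω, y ^ p ^ e = algebraMap A Ω x :=
    IsAlgClosed.exists_pow_nat_eq _ (pow_pos (Fact.out (p := p.Prime)).pos e)
  have hyr : y ^ p ^ e ∈ (algebraMap K Ω).range := ⟨algebraMap A K x, by
    rw [hy, ← IsScalarTower.algebraMap_apply]⟩
  let K' : IntermediateField K Ω := IntermediateField.adjoin K (insert y cs : Set Ω)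
  have hfinK' : FiniteDimensional K K' :=
    IntermediateField.finiteDimensional_adjoin (S := (insert y cs : Set Ω)) (fun z _ => Algebra.IsIntegral.isIntegral z)
  have hq : ∀ b : K', ∃ c : K, b ^ (p ^ e) = algebraMap K K' c := by
    have h1 : ∀ b ∈ K', b ^ (p ^ e) ∈ (algebraMap K Ω).range := by
      intro b hb
      induction hb using IntermediateField.adjoin_induction with
      | mem z hz => rcases hz with rfl | hz
                    · exact hyr
                    · exact he _ hz
      | algebraMap z => exact ⟨z ^ p ^ e, map_pow _ _ _⟩
      | add a b _ _ h1 h2 => rw [add_pow_char_pow]; exact add_mem h1 h2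
      | inv a _ h1 => obtain ⟨c, hc⟩ := h1; exact ⟨c⁻¹, by rw [map_inv₀, hc, inv_pow]⟩
      | mul a b _ _ h1 h2 => rw [mul_pow]; exact mul_mem h1 h2
    intro b
    obtain ⟨c, hc⟩ := h1 b b.2
    exact ⟨c, Subtype.ext hc.symm⟩
  have hB := tate_core A A0 hN π hπ x hx0 hker K' (p ^ e) (pow_pos (Fact.out (p := p.Prime)).pos e) hq
    ⟨y, IntermediateField.subset_adjoin _ _ (Set.mem_insert _ _)⟩ (Subtype.ext hy)
  -- the compositum
  let E : IntermediateField K' Ω := IntermediateField.adjoin K' (S : Set Ω)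
  have hEf : FiniteDimensional K' E :=
    IntermediateField.finiteDimensional_adjoin (fun z _ => Algebra.IsIntegral.isIntegral z)
  have hEs : Algebra.IsSeparable K' E := by
    rw [IntermediateField.isSeparable_adjoin_iff_isSeparable]
    intro a ha
    have h1 : (minpoly Pc a).Separable := Algebra.IsSeparable.isSeparable Pc a
    have h2 : ((minpoly Pc a).map (algebraMap Pc Ω)) ∈ Polynomial.lifts (algebraMap K' Ω) := by
      rw [Polynomial.lifts_iff_coeff_lifts]
      intro n
      rw [Polynomial.coeff_map]
      by_cases h0 : (minpoly Pc a).coeff n = 0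
      · exact ⟨0, by rw [h0, map_zero, map_zero]⟩
      · refine ⟨⟨_, IntermediateField.subset_adjoin _ _ (Set.mem_insert_of_mem _ ?_)⟩, rfl⟩
        simp only [cs, Finset.coe_biUnion, Set.mem_iUnion]
        refine ⟨a, ha, ?_⟩
        rw [Finset.mem_coe, Finset.mem_image]
        exact ⟨_, Polynomial.coeff_mem_coeffs h0, rfl⟩
    obtain ⟨f, hf⟩ := h2
    replace hf : f.map (algebraMap K' Ω) = (minpoly Pc a).map (algebraMap Pc Ω) := hf
    have h3 : f.Separable := by
      rw [← Polynomial.separable_map (algebraMap K' Ω), hf, Polynomial.separable_map]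
      exact h1
    refine h3.of_dvd (minpoly.dvd _ _ ?_)
    rw [Polynomial.aeval_def, ← Polynomial.eval_map, hf, Polynomial.eval_map, ← Polynomial.aeval_def, minpoly.aeval]
  have hLE : ∀ l : L, algebraMap L Ω l ∈ E := by
    intro l
    have : l ∈ Submodule.span K (Set.range (Module.finBasis K L)) := (Module.finBasis K L).mem_span l
    induction this using Submodule.span_induction with
    | mem z hz =>
      obtain ⟨i, rfl⟩ := hz
      refine IntermediateField.subset_adjoin _ _ ?_
      simp only [S, s, Finset.coe_image]
      exact ⟨_, ⟨i, by simp, rfl⟩, rfl⟩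
    | zero => rw [map_zero]; exact zero_mem _
    | add a b _ _ h1 h2 => rw [map_add]; exact add_mem h1 h2
    | smul c z _ h1 =>
      rw [Algebra.smul_def, map_mul, ← IsScalarTower.algebraMap_apply K L Ω]
      refine mul_mem ?_ h1
      rw [IsScalarTower.algebraMap_apply K K' Ω]
      exact E.algebraMap_mem _
  let _ : Algebra A E := ((algebraMap K' E).comp (algebraMap A K')).toAlgebra
  have : IsScalarTower A K' E := IsScalarTower.of_algebraMap_eq fun _ => rfl
  let g : L →ₐ[A] E :=
    { toFun := fun l => ⟨algebraMap L Ω l, hLE l⟩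
      map_one' := Subtype.ext (map_one _)
      map_zero' := Subtype.ext (map_zero _)
      map_add' := fun a b => Subtype.ext (map_add _ _ _)
      map_mul' := fun a b => Subtype.ext (map_mul _ _ _)
      commutes' := fun a => Subtype.ext rfl }
  exact N2_descend A K L K' E hB g

end X11

namespace X11
universe v w
open IsLocalRing RingTheory.Sequence

theorem dim_le_of_integral (A B : Type*) [CommRing A] [CommRing B] [Algebra A B] [Algebra.IsIntegral A B] :
    ringKrullDim B ≤ ringKrullDim A := by
  refine Order.krullDim_le_of_strictMono (PrimeSpectrum.comap (algebraMap A B)) ?_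
  intro p q h
  exact Ideal.IsIntegral.comap_lt_comap (I := p.asIdeal) (J := q.asIdeal) h

theorem dim_eq_of_integral (A B : Type*) [CommRing A] [CommRing B] [Algebra A B] [Algebra.IsIntegral A B]
    (hinj : Function.Injective (algebraMap A B)) : ringKrullDim B = ringKrullDim A := by
  refine le_antisymm (dim_le_of_integral A B) ?_
  unfold ringKrullDim Order.krullDim
  refine iSup_le fun l => ?_
  obtain ⟨Q, hQ, hQ2⟩ : ∃ Q : Ideal B, Q.IsPrime ∧ Q.comap (algebraMap A B) = l.head.asIdeal := by
    obtain ⟨Q, -, hQ1, hQ2⟩ := Ideal.exists_ideal_over_prime_of_isIntegral l.head.asIdeal (⊥ : Ideal B) (by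
      rw [← RingHom.ker_eq_comap_bot, (RingHom.injective_iff_ker_eq_bot _).1 hinj]; exact bot_le)
    exact ⟨Q, hQ1, hQ2⟩
  have : Q.LiesOver l.head.asIdeal := ⟨hQ2.symm⟩
  obtain ⟨L, hL, _⟩ := Ideal.exists_ltSeries_of_hasGoingUp l Q
  exact le_iSup_of_le L (by rw [hL])

/-- complete local regular-type rings used for Noether normalization -/
structure Good (A : Type u) [CommRing A] [IsLocalRing A] [IsNoetherianRing A] [IsDomain A] (n : ℕ) : Prop where
  normal : IsIntegrallyClosed A
  complete : IsAdicComplete (maximalIdeal A) A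
  reg : ∃ rs : List A, rs.length = n ∧ IsWeaklyRegular A rs ∧ Ideal.ofList rs = maximalIdeal A
  n2 : N2 A

open PowerSeries in
theorem Good.ps {A : Type u} [CommRing A] [IsLocalRing A] [IsNoetherianRing A] [IsDomain A] {n : ℕ}
    (h : Good A n) : Good A⟦X⟧ (n + 1) := by
  have := h.normal
  have := h.complete
  have hn : IsIntegrallyClosed A⟦X⟧ := ps_normal
  refine ⟨hn, ?_, ?_, ?_⟩
  · rw [ps_maximalIdeal]; exact psComplete _
  · obtain ⟨rs, h1, h2, h3⟩ := h.reg
    refine ⟨_, ?_, ps_regular rs h2, ?_⟩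
    · simp [h1]
    · rw [ps_maximalIdeal, psIdeal, ← h3, Ideal.ofList_cons, sup_comm, Ideal.map_ofList]
  · obtain ⟨p, hp⟩ := CharP.exists A
    rcases CharP.char_is_prime_or_zero A p with hpp | rfl
    · have : Fact p.Prime := ⟨hpp⟩
      have : CharP A⟦X⟧ p := charP_of_injective_algebraMap (R := A) (A := A⟦X⟧) (by
        intro a b hab
        simpa using congrArg (constantCoeff) hab) p
      have : IsAdicComplete (Ideal.span {(X : A⟦X⟧)}) A⟦X⟧ := by
        have := IsAdicComplete.bot (R := A) (M := A)
        have := psComplete (A := A) ⊥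
        rwa [psIdeal, Ideal.map_bot, bot_sup_eq] at this
      exact tate_N2 A⟦X⟧ A h.n2 (constantCoeff) (fun a => ⟨C a, by simp⟩) X X_ne_zero
        (fun a => X_dvd_iff.symm) p
    · have : CharZero A := CharP.charP_to_charZero A
      have : CharZero A⟦X⟧ := charZero_of_injective_algebraMap (R := A) (A := A⟦X⟧) (by
        intro a b hab
        simpa using congrArg (constantCoeff) hab)
      exact N2_of_charZero _

theorem Good.field (k : Type u) [Field k] : Good k 0 := by
  refine ⟨inferInstance, ?_, ⟨[], rfl, ?_, ?_⟩, N2_of_field k⟩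
  · have h : maximalIdeal k = ⊥ := IsLocalRing.maximalIdeal_eq_bot
    rw [h]; exact IsAdicComplete.bot k
  · exact (isWeaklyRegular_iff_Fin k []).2 (fun i => i.elim0)
  · have h : maximalIdeal k = ⊥ := IsLocalRing.maximalIdeal_eq_bot
    rw [h, Ideal.ofList_nil]

theorem Good.dim {A : Type u} [CommRing A] [IsLocalRing A] [IsNoetherianRing A] [IsDomain A] {n : ℕ}
    (h : Good A n) : ringKrullDim A = n := by
  obtain ⟨rs, h1, h2, h3⟩ := h.reg
  have hr : IsRegular A rs := IsRegular.of_isWeaklyRegular_of_mem_maximalIdeal A (by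
    intro r hr; rw [← h3]; exact Ideal.subset_span hr) h2
  have := ringKrullDim_add_length_eq_ringKrullDim_of_isRegular rs hr
  rw [← this, h1, h3]
  have hf : IsField (A ⧸ maximalIdeal A) := Field.toIsField (ResidueField A)
  rw [ringKrullDim_eq_zero_of_isField hf, zero_add]

theorem Good.cohen (k : Type u) [Field k] (p : ℕ) [hp : Fact p.Prime] [CharP k p] (Λ : Type u) [CommRing Λ]
    (π : Λ →+* k) (hπ : Function.Surjective π) (hker : ∀ a, π a = 0 ↔ ∃ b, a = p * b)
    (hreg : ∀ a : Λ, (p : Λ) * a = 0 → a = 0) [hc : IsAdicComplete (Ideal.span {(p : Λ)}) Λ] :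
    ∃ (_ : IsLocalRing Λ) (_ : IsNoetherianRing Λ) (_ : IsDomain Λ), Good Λ 1 ∧
      maximalIdeal Λ = Ideal.span {(p : Λ)} := by
  have hnt : Nontrivial Λ := π.domain_nontrivial
  have hker' : ∀ a, π a = 0 ↔ a ∈ Ideal.span {(p : Λ)} := fun a => by
    rw [hker, Ideal.mem_span_singleton]; rfl
  have hjac := IsAdicComplete.le_jacobson_bot (Ideal.span {(p : Λ)})
  have hunit : ∀ a, IsUnit a ↔ π a ≠ 0 := by
    intro a
    constructor
    · intro h; exact (h.map π).ne_zero
    · intro h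
      obtain ⟨b, hb⟩ := hπ (π a)⁻¹
      have h1 : a * b - 1 ∈ Ideal.span {(p : Λ)} := by
        rw [← hker', map_sub, map_mul, hb, mul_inv_cancel₀ h, map_one, sub_self]
      have h2 := Ideal.mem_jacobson_bot.1 (hjac h1) 1
      rw [mul_one, sub_add_cancel] at h2
      exact isUnit_of_mul_isUnit_left h2
  have hloc : IsLocalRing Λ := IsLocalRing.of_nonunits_add (by
    intro a b ha hb
    rw [mem_nonunits_iff, hunit, not_not] at *
    rw [map_add, ha, hb, add_zero])
  have hmax : maximalIdeal Λ = Ideal.span {(p : Λ)} := by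
    ext a
    rw [mem_maximalIdeal, mem_nonunits_iff, hunit, not_not, hker']
  have hpow : ∀ n (a : Λ), (p : Λ) ^ n * a = 0 → a = 0 := by
    intro n
    induction n with
    | zero => intro a h; simpa using h
    | succ n ih => intro a h; exact ih a (hreg _ (by rw [← h]; ring))
  have hfac : ∀ a : Λ, a ≠ 0 → ∃ (n : ℕ) (v : Λ), IsUnit v ∧ a = p ^ n * v := by
    intro a ha
    have h1 : ∃ n, a ∉ Ideal.span {(p : Λ)} ^ n := by
      by_contra h
      push Not at h
      exact ha (haus_iff.1 hc.toIsHausdorff a h)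
    classical
    have h2 := Nat.find_spec h1
    have h3 : Nat.find h1 ≠ 0 := by
      intro h; rw [h] at h2; simp at h2
    obtain ⟨n, hn⟩ := Nat.exists_eq_succ_of_ne_zero h3
    have h4 := Nat.find_min h1 (show n < _ by omega)
    rw [not_not, Ideal.span_singleton_pow, Ideal.mem_span_singleton] at h4
    obtain ⟨v, rfl⟩ := h4
    refine ⟨n, v, ?_, rfl⟩
    rw [hunit, Ne, hker]
    rintro ⟨b, rfl⟩
    apply h2
    rw [hn, Ideal.span_singleton_pow, Ideal.mem_span_singleton]
    exact ⟨b, by rw [Nat.succ_eq_add_one]; ring⟩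
  have hdom : IsDomain Λ := by
    have : NoZeroDivisors Λ := ⟨by
      intro a b hab
      by_contra! h
      obtain ⟨n, v, hv, rfl⟩ := hfac a h.1
      obtain ⟨m, w, hw, rfl⟩ := hfac b h.2
      have := hpow (n + m) (v * w) (by rw [← hab]; ring)
      exact not_isUnit_zero (this ▸ hv.mul hw)⟩
    exact NoZeroDivisors.to_isDomain _
  have hp0 : (p : Λ) ≠ 0 := fun h => one_ne_zero (hreg 1 (by rw [h, zero_mul]))
  have hpnu : ¬ IsUnit (p : Λ) := by rw [hunit, not_not, map_natCast, CharP.cast_eq_zero]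
  have hpirr : Irreducible (p : Λ) := by
    have : Prime (p : Λ) := by
      rw [← Ideal.span_singleton_prime hp0, ← hmax]; infer_instance
    exact this.irreducible
  have hdvr : IsDiscreteValuationRing Λ :=
    IsDiscreteValuationRing.ofHasUnitMulPowIrreducibleFactorization ⟨p, hpirr, fun {a} ha => by
      obtain ⟨n, v, hv, rfl⟩ := hfac a ha
      exact ⟨n, ⟨hv.unit, rfl⟩⟩⟩
  have hcz : CharZero Λ := by
    obtain ⟨q, hq⟩ := CharP.exists Λ
    rcases CharP.char_is_prime_or_zero Λ q with hqp | rfl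
    · exfalso
      have h1 : (q : k) = 0 := by rw [← map_natCast π, CharP.cast_eq_zero, map_zero]
      rw [CharP.cast_eq_zero_iff k p, Nat.prime_dvd_prime_iff_eq hp.out hqp] at h1
      subst h1
      exact hp0 (CharP.cast_eq_zero _ _)
    · exact CharP.charP_to_charZero Λ
  refine ⟨hloc, inferInstance, hdom, ⟨inferInstance, hmax ▸ hc, ⟨[(p : Λ)], rfl, ?_, ?_⟩, N2_of_charZero _⟩, hmax⟩
  · rw [wr_cons]
    refine ⟨(isSMulRegular_iff_nzd _).2 (mem_nonZeroDivisors_of_ne_zero hp0), ?_⟩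
    exact (isWeaklyRegular_iff_Fin _ []).2 (fun i => i.elim0)
  · rw [Ideal.ofList_singleton, hmax]

/-- Adjoining power series variables over a base. -/
theorem goodExtend (D : Type u) [CommRing D] [IsLocalRing D] [hD : IsAdicComplete (maximalIdeal D) D]
    (zs : List D) (hzs : ∀ z ∈ zs, z ∈ maximalIdeal D) (A : Type u) [CommRing A] [IsLocalRing A]
    [IsNoetherianRing A] [IsDomain A] (n : ℕ) (hA : Good A n) (φ : A →+* D)
    (hres : ∀ d, ∃ a, d - φ a ∈ maximalIdeal D) :
    ∃ (A' : Type u) (_ : CommRing A') (_ : IsLocalRing A') (_ : IsNoetherianRing A') (_ : IsDomain A')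
      (φ' : A' →+* D), Good A' (n + zs.length) ∧ (∀ d, ∃ a, d - φ' a ∈ maximalIdeal D) ∧
      (maximalIdeal A').map φ' = (maximalIdeal A).map φ ⊔ Ideal.ofList zs := by
  induction zs with
  | nil => exact ⟨A, _, inferInstance, inferInstance, inferInstance, φ, hA, hres, by simp⟩
  | cons z zs ih =>
    obtain ⟨A', _, _, _, _, φ', h1, h2, h3⟩ := ih (fun w hw => hzs w (List.mem_cons_of_mem _ hw))
    obtain ⟨ψ, hψ1, hψ2⟩ := exists_evalHom φ' (maximalIdeal D) z (hzs z (by simp))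
    refine ⟨PowerSeries A', inferInstance, inferInstance, inferInstance, inferInstance, ψ, h1.ps, ?_, ?_⟩
    · intro d
      obtain ⟨a, ha⟩ := h2 d
      exact ⟨PowerSeries.C a, by rwa [hψ1]⟩
    · have : ψ.comp PowerSeries.C = φ' := by ext a; exact hψ1 a
      rw [ps_maximalIdeal, psIdeal, Ideal.map_sup, Ideal.map_map, this, h3, Ideal.map_span,
        Set.image_singleton, hψ2, Ideal.ofList_cons, sup_assoc, sup_comm (Ideal.ofList zs)]

/-- finiteness from completeness -/
theorem finite_of_primary {A D : Type*} [CommRing A] [IsLocalRing A] [CommRing D] [IsLocalRing D]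
    [IsNoetherianRing D] [IsAdicComplete (maximalIdeal A) A] (φ : A →+* D)
    (hres : ∀ d, ∃ a, d - φ a ∈ maximalIdeal D) (hle : (maximalIdeal A).map φ ≤ maximalIdeal D)
    (N : ℕ) (hN : maximalIdeal D ^ N ≤ (maximalIdeal A).map φ) : φ.Finite := by
  classical
  let _ := φ.toAlgebra
  have halg : ∀ a, algebraMap A D a = φ a := fun _ => rfl
  have key : ∀ n : ℕ, ∃ s : Finset D, ∀ d : D, ∃ c ∈ Submodule.span A (s : Set D), d - c ∈ maximalIdeal D ^ n := by
    intro n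
    induction n with
    | zero => exact ⟨∅, fun d => ⟨0, zero_mem _, by simp⟩⟩
    | succ n ih =>
      obtain ⟨s, hs⟩ := ih
      obtain ⟨t, ht⟩ := IsNoetherian.noetherian (maximalIdeal D ^ n)
      refine ⟨s ∪ t, fun d => ?_⟩
      obtain ⟨c, hc, h1⟩ := hs d
      have h2 : ∀ w ∈ maximalIdeal D ^ n, ∃ c ∈ Submodule.span A (t : Set D), w - c ∈ maximalIdeal D ^ (n + 1) := by
        intro w hw
        rw [← ht] at hw
        induction hw using Submodule.span_induction with
        | mem z hz => exact ⟨z, Submodule.subset_span hz, by simp⟩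
        | zero => exact ⟨0, zero_mem _, by simp⟩
        | add a b _ _ ha hb =>
          obtain ⟨c, hc, h1⟩ := ha
          obtain ⟨c', hc', h1'⟩ := hb
          exact ⟨c + c', add_mem hc hc', by rw [add_sub_add_comm]; exact add_mem h1 h1'⟩
        | smul r z hz hz' =>
          obtain ⟨c, hc, h1⟩ := hz'
          obtain ⟨a, ha⟩ := hres r
          refine ⟨a • c, Submodule.smul_mem _ _ hc, ?_⟩
          have hz2 : z ∈ maximalIdeal D ^ n := by rw [← ht]; exact hz
          have : r • z - a • c = (r - φ a) * z + φ a * (z - c) := by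
            rw [smul_eq_mul, Algebra.smul_def, halg]; ring
          rw [this]
          refine add_mem ?_ (Ideal.mul_mem_left _ _ h1)
          rw [pow_succ']
          exact Ideal.mul_mem_mul ha hz2
      obtain ⟨c', hc', h3⟩ := h2 _ h1
      exact ⟨c + c', add_mem (Submodule.span_mono (by simp) hc) (Submodule.span_mono (by simp) hc'), by
        rw [← sub_sub]; exact h3⟩
  have hsm : ∀ n : ℕ, ((maximalIdeal A ^ n) • ⊤ : Submodule A D) = ((maximalIdeal A).map φ ^ n).restrictScalars A := by
    intro n
    rw [Ideal.smul_top_eq_map, Ideal.map_pow]; rfl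
  have : IsHausdorff (maximalIdeal A) D := ⟨fun d hd => by
    refine haus_iff.1 (inferInstance : IsHausdorff (maximalIdeal D) D) d fun n => ?_
    have := hd n
    rw [SModEq.zero, hsm] at this
    exact Ideal.pow_right_mono hle n this⟩
  have : Module.Finite A (D ⧸ (maximalIdeal A • ⊤ : Submodule A D)) := by
    obtain ⟨s, hs⟩ := key N
    refine ⟨⟨s.image (Submodule.mkQ _), ?_⟩⟩
    rw [eq_top_iff]
    rintro z -
    obtain ⟨b, rfl⟩ := Submodule.mkQ_surjective _ z
    obtain ⟨c, hc, h⟩ := hs b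
    have : Submodule.mkQ (maximalIdeal A • ⊤ : Submodule A D) b = Submodule.mkQ _ c := by
      rw [← sub_eq_zero, ← map_sub]
      simp only [Submodule.mkQ_apply, Submodule.Quotient.mk_eq_zero]
      have h2 := hsm 1
      rw [pow_one, pow_one] at h2
      rw [h2]
      exact hN h
    rw [this, Finset.coe_image, ← Submodule.map_span]
    exact Submodule.mem_map_of_mem hc
  exact finite_of_complete (A := A) (M := D) (maximalIdeal A)

end X11

namespace X11
universe v w
open IsLocalRing RingTheory.Sequence

theorem exists_sop_list (D : Type u) [CommRing D] [IsLocalRing D] [IsNoetherianRing D]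
    (r : ℕ) (hr : ringKrullDim D = r) :
    ∃ zs : List D, zs.length = r ∧ (∀ z ∈ zs, z ∈ maximalIdeal D) ∧
      ∀ P : Ideal D, P.IsPrime → Ideal.ofList zs ≤ P → P = maximalIdeal D := by
  obtain ⟨s, hs, hc⟩ := Ideal.exists_finset_card_eq_height_of_isNoetherianRing (maximalIdeal D)
  refine ⟨s.toList, ?_, ?_, ?_⟩
  · rw [Finset.length_toList]
    have := IsLocalRing.maximalIdeal_height_eq_ringKrullDim (R := D)
    rw [← hc, hr] at this
    exact_mod_cast this
  · intro z hz
    exact hs.1.2 (Ideal.subset_span (by simpa using hz))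
  · intro P hP hle
    refine le_antisymm (IsLocalRing.le_maximalIdeal hP.ne_top) (hs.2 ⟨hP, ?_⟩ (IsLocalRing.le_maximalIdeal hP.ne_top))
    refine le_trans ?_ hle
    rw [Ideal.ofList]
    exact Ideal.span_mono (fun z hz => by simpa using hz)

theorem norm_of_base (D : Type u) [CommRing D] [IsLocalRing D] [IsNoetherianRing D] [IsDomain D]
    [IsAdicComplete (maximalIdeal D) D] (A0 : Type u) [CommRing A0] [IsLocalRing A0]
    [IsNoetherianRing A0] [IsDomain A0] (n0 : ℕ) (hA : Good A0 n0) (φ0 : A0 →+* D)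
    (hres : ∀ d, ∃ a, d - φ0 a ∈ maximalIdeal D) (hle : (maximalIdeal A0).map φ0 ≤ maximalIdeal D)
    (r : ℕ) (hr : ringKrullDim (D ⧸ (maximalIdeal A0).map φ0) = r) (hD : ringKrullDim D = (n0 + r : ℕ)) :
    ∃ (A : Type u) (_ : CommRing A) (_ : IsLocalRing A) (_ : IsNoetherianRing A) (_ : IsDomain A)
      (n : ℕ) (φ : A →+* D), Good A n ∧ φ.Finite ∧ Function.Injective φ ∧ IsLocalHom φ ∧
      ∀ d, ∃ a, d - φ a ∈ maximalIdeal D := by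
  set 𝔞 := (maximalIdeal A0).map φ0 with h𝔞
  have hne : 𝔞 ≠ ⊤ := fun h => (maximalIdeal.isMaximal D).ne_top (top_le_iff.1 (h ▸ hle))
  have : Nontrivial (D ⧸ 𝔞) := Ideal.Quotient.nontrivial_iff.2 hne
  have : IsLocalRing (D ⧸ 𝔞) := IsLocalRing.of_surjective' (Ideal.Quotient.mk 𝔞) Ideal.Quotient.mk_surjective
  obtain ⟨zs', h1, h2, h3⟩ := exists_sop_list (D ⧸ 𝔞) r hr
  let f : D ⧸ 𝔞 → D := Function.surjInv (Ideal.Quotient.mk_surjective (I := 𝔞))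
  have hf : ∀ z, Ideal.Quotient.mk 𝔞 (f z) = z := Function.surjInv_eq _
  have hlocmk : IsLocalHom (Ideal.Quotient.mk 𝔞) := IsLocalHom.of_surjective (Ideal.Quotient.mk 𝔞) Ideal.Quotient.mk_surjective
  have hmem : ∀ z ∈ zs'.map f, z ∈ maximalIdeal D := by
    intro z hz
    obtain ⟨w, hw, rfl⟩ := List.mem_map.1 hz
    have := h2 w hw
    rw [← hf w] at this
    rw [IsLocalRing.mem_maximalIdeal, mem_nonunits_iff] at this ⊢
    exact fun h => this (h.map _)
  obtain ⟨A, _, _, _, _, φ, hg, hres', hmap⟩ := goodExtend D (zs'.map f) hmem A0 n0 hA φ0 hres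
  have hprim : ∀ P : Ideal D, P.IsPrime → (maximalIdeal A).map φ ≤ P → P = maximalIdeal D := by
    intro P hP hPle
    rw [hmap] at hPle
    have haP : 𝔞 ≤ P := le_trans le_sup_left hPle
    have hker : RingHom.ker (Ideal.Quotient.mk 𝔞) ≤ P := by rwa [Ideal.mk_ker]
    have hP' : (P.map (Ideal.Quotient.mk 𝔞)).IsPrime := Ideal.map_isPrime_of_surjective Ideal.Quotient.mk_surjective hker
    have := h3 _ hP' (by
      rw [Ideal.ofList, Ideal.span_le]
      intro z hz
      rw [← hf z]
      exact Ideal.mem_map_of_mem _ (hPle (Ideal.mem_sup_right (Ideal.subset_span (List.mem_map_of_mem (f := f) hz)))))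
    refine le_antisymm (IsLocalRing.le_maximalIdeal hP.ne_top) ?_
    intro z hz
    have hz' : Ideal.Quotient.mk 𝔞 z ∈ P.map (Ideal.Quotient.mk 𝔞) := by
      rw [this, IsLocalRing.mem_maximalIdeal, mem_nonunits_iff]
      intro hu
      exact hz (hlocmk.map_nonunit z hu)
    have h5 := Ideal.mem_comap.2 hz'
    rw [Ideal.comap_map_of_surjective _ Ideal.Quotient.mk_surjective, ← RingHom.ker_eq_comap_bot, Ideal.mk_ker,
      sup_eq_left.2 haP] at h5
    exact h5
  have hle' : (maximalIdeal A).map φ ≤ maximalIdeal D := by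
    rw [hmap]
    refine sup_le hle ?_
    rw [Ideal.ofList, Ideal.span_le]
    exact hmem
  have hrad : ((maximalIdeal A).map φ).radical = maximalIdeal D := by
    refine le_antisymm ((maximalIdeal.isMaximal D).isPrime.radical_le_iff.2 hle') ?_
    rw [Ideal.radical_eq_sInf]
    refine le_sInf ?_
    rintro P ⟨hP1, hP2⟩
    exact (hprim P hP2 hP1).ge
  obtain ⟨N, hN⟩ := Ideal.exists_radical_pow_le_of_fg ((maximalIdeal A).map φ) (by
    exact IsNoetherian.noetherian _)
  rw [hrad] at hN
  have hcA := hg.complete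
  have hfin := finite_of_primary φ hres' hle' N hN
  have hlocal : IsLocalHom φ := ⟨fun a ha => by
    by_contra hu
    exact (maximalIdeal.isMaximal D).ne_top (Ideal.eq_top_of_isUnit_mem _ (hle' (Ideal.mem_map_of_mem φ
      ((IsLocalRing.mem_maximalIdeal a).2 hu))) ha)⟩
  refine ⟨A, _, inferInstance, inferInstance, inferInstance, _, φ, hg, hfin, ?_, hlocal, hres'⟩
  rw [injective_iff_map_eq_zero]
  intro a ha
  by_contra ha0
  have hdimA := hg.dim
  rw [List.length_map, h1] at hdimA
  have e1 := ringKrullDim_quotient_succ_le_of_nonZeroDivisor (mem_nonZeroDivisors_of_ne_zero ha0)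
  let ψ : A ⧸ Ideal.span {a} →+* D := Ideal.Quotient.lift _ φ (by
    intro b hb
    obtain ⟨c, rfl⟩ := Ideal.mem_span_singleton.1 hb
    rw [map_mul, ha, zero_mul])
  have hψ : ψ.Finite := by
    refine RingHom.Finite.of_comp_finite (f := Ideal.Quotient.mk (Ideal.span {a})) ?_
    exact hfin
  let _ := ψ.toAlgebra
  have : Module.Finite (A ⧸ Ideal.span {a}) D := hψ
  have e2 := dim_le_of_integral (A ⧸ Ideal.span {a}) D
  have e3 : ((n0 + r : ℕ) : WithBot ℕ∞) + 1 ≤ ((n0 + r : ℕ) : WithBot ℕ∞) := by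
    have := (add_le_add_left e2 1).trans e1
    rwa [hD, hdimA] at this
  have e4 : (n0 + r : ℕ) + 1 ≤ (n0 + r : ℕ) := by exact_mod_cast e3
  omega

theorem exists_dim (D : Type*) [CommRing D] [IsLocalRing D] [IsNoetherianRing D] :
    ∃ r : ℕ, ringKrullDim D = r := by
  have h1 := ringKrullDim_ne_top (R := D)
  have h2 := ringKrullDim_ne_bot (R := D)
  generalize ringKrullDim D = t at h1 h2
  induction t with
  | bot => exact absurd rfl h2
  | coe t =>
    induction t using ENat.recTopCoe with
    | top => exact absurd rfl h1
    | coe t => exact ⟨t, rfl⟩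

noncomputable def ratHom (D : Type*) [CommRing D] (hunit : ∀ n : ℕ, n ≠ 0 → IsUnit (n : D)) : ℚ →+* D :=
  IsLocalization.lift (M := nonZeroDivisors ℤ) (g := Int.castRingHom D) (by
      intro z
      have hz0 : (z : ℤ) ≠ 0 := nonZeroDivisors.ne_zero z.2
      generalize (z : ℤ) = w at hz0 ⊢
      have := hunit w.natAbs (by simpa using hz0)
      rcases Int.natAbs_eq w with h | h
      · rw [h]; simpa using this
      · rw [h]; simpa using this)

theorem lift_char0 {D : Type*} [CommRing D] [Algebra ℚ D] {k : Type*} [Field k] [CharZero k] (I : Ideal D)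
    [IsAdicComplete I D] (φ : k →+* D ⧸ I) : ∃ ψ : k →+* D, (Ideal.Quotient.mk I).comp ψ = φ := by
  have : Algebra.FormallySmooth ℚ k := by
    obtain ⟨ι, v, hv⟩ := exists_isTranscendenceBasis' ℚ k
    have hi : AlgebraicIndependent ℚ v := hv.1
    have : Algebra.IsAlgebraic (IntermediateField.adjoin ℚ (Set.range v)) k :=
      hv.isAlgebraic_field
    exact Algebra.FormallySmooth.of_algebraicIndependent_of_isSeparable hi
  obtain ⟨g, hg⟩ := Algebra.FormallySmooth.exists_mkₐ_comp_eq_of_isAdicComplete (I := I) φ.toRatAlgHom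
  refine ⟨g.toRingHom, ?_⟩
  ext d
  exact AlgHom.congr_fun hg d

theorem exists_norm (D : Type u) [CommRing D] [IsLocalRing D] [IsNoetherianRing D] [IsDomain D]
    [IsAdicComplete (maximalIdeal D) D] :
    ∃ (A : Type u) (_ : CommRing A) (_ : IsLocalRing A) (_ : IsNoetherianRing A) (_ : IsDomain A)
      (n : ℕ) (φ : A →+* D), Good A n ∧ φ.Finite ∧ Function.Injective φ ∧ IsLocalHom φ ∧
      ∀ d, ∃ a, d - φ a ∈ maximalIdeal D := by
  obtain ⟨r, hr⟩ := exists_dim D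
  -- the field case helper
  have field_case : (∃ ψ : ResidueField D →+* D, (Ideal.Quotient.mk (maximalIdeal D)).comp ψ = RingHom.id (ResidueField D)) →
      ∃ (A : Type u) (_ : CommRing A) (_ : IsLocalRing A) (_ : IsNoetherianRing A) (_ : IsDomain A)
      (n : ℕ) (φ : A →+* D), Good A n ∧ φ.Finite ∧ Function.Injective φ ∧ IsLocalHom φ ∧
      ∀ d, ∃ a, d - φ a ∈ maximalIdeal D := by
    rintro ⟨ψ, hψ⟩
    have hbot : maximalIdeal (ResidueField D) = ⊥ := IsLocalRing.maximalIdeal_eq_bot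
    refine norm_of_base D (ResidueField D) 0 (Good.field _) ψ ?_ ?_ r ?_ ?_
    · intro d
      refine ⟨Ideal.Quotient.mk (maximalIdeal D) d, ?_⟩
      rw [← Ideal.Quotient.eq_zero_iff_mem, map_sub, sub_eq_zero]
      exact (RingHom.congr_fun hψ _).symm
    · rw [hbot, Ideal.map_bot]; exact bot_le
    · rw [hbot, Ideal.map_bot, ← hr]
      exact ringKrullDim_eq_of_ringEquiv (RingEquiv.quotientBot D)
    · rw [hr, zero_add]
  obtain ⟨p, hp⟩ := CharP.exists (ResidueField D)
  rcases CharP.char_is_prime_or_zero (ResidueField D) p with hpp | rfl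
  · have : Fact p.Prime := ⟨hpp⟩
    have hpm : (p : D) ∈ maximalIdeal D := by
      rw [← Ideal.Quotient.eq_zero_iff_mem, map_natCast]
      exact CharP.cast_eq_zero (ResidueField D) p
    have sqz : ∀ n, 1 ≤ n → ∀ a b : D ⧸ maximalIdeal D ^ (n+1),
        (Ideal.Quotient.factorPow (maximalIdeal D) (show n ≤ n+1 by omega)) a = 0 →
        (Ideal.Quotient.factorPow (maximalIdeal D) (show n ≤ n+1 by omega)) b = 0 → a * b = 0 := by
      intro n hn a b ha hb
      obtain ⟨a, rfl⟩ := Ideal.Quotient.mk_surjective a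
      obtain ⟨b, rfl⟩ := Ideal.Quotient.mk_surjective b
      have ha' : a ∈ maximalIdeal D ^ n := Ideal.Quotient.eq_zero_iff_mem.1 ha
      have hb' : b ∈ maximalIdeal D ^ n := Ideal.Quotient.eq_zero_iff_mem.1 hb
      rw [← map_mul, Ideal.Quotient.eq_zero_iff_mem]
      refine Ideal.pow_le_pow_right (show n + 1 ≤ n + n by omega) ?_
      rw [pow_add]; exact Ideal.mul_mem_mul ha' hb'
    by_cases hp0 : (p : D) = 0
    · apply field_case
      refine lift_limit (maximalIdeal D) (RingHom.id (ResidueField D)) ?_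
      intro n hn φ
      refine lift_step_eq p ?_ _ (Ideal.Quotient.factor_surjective _) (sqz n hn) φ
      rw [← map_natCast (Ideal.Quotient.mk _), hp0, map_zero]
    · obtain ⟨Λ, _, π, hπ, hker, hreg, hc⟩ := exists_cohen (ResidueField D) p
      obtain ⟨_, _, _, hg, hmax⟩ := Good.cohen (ResidueField D) p Λ π hπ hker hreg
      obtain ⟨ψ, hψ⟩ := lift_limit (maximalIdeal D) (Λ := Λ) π (by
        intro n hn φ
        refine lift_step p π hπ hker hreg _ (Ideal.Quotient.factor_surjective _) (sqz n hn) ?_ φ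
        intro a ha
        obtain ⟨a, rfl⟩ := Ideal.Quotient.mk_surjective a
        have ha' : a ∈ maximalIdeal D ^ n := Ideal.Quotient.eq_zero_iff_mem.1 ha
        rw [← map_natCast (Ideal.Quotient.mk _), ← map_mul, Ideal.Quotient.eq_zero_iff_mem, pow_succ']
        exact Ideal.mul_mem_mul hpm ha')
      have hmapp : (maximalIdeal Λ).map ψ = Ideal.span {(p : D)} := by
        rw [hmax, Ideal.map_span, Set.image_singleton, map_natCast]
      have hdim := ringKrullDim_quotient_span_singleton_succ_eq_ringKrullDim_of_mem_nonZeroDivisors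
        (mem_nonZeroDivisors_of_ne_zero hp0) hpm
      have hrpos : ∃ s : ℕ, ringKrullDim (D ⧸ Ideal.span {(p:D)}) = s ∧ r = 1 + s := by
        rw [hr] at hdim
        generalize ringKrullDim (D ⧸ Ideal.span {(p:D)}) = t at hdim
        induction t with
        | bot => simp at hdim
        | coe t =>
          induction t using ENat.recTopCoe with
          | top => exfalso; revert hdim; simp; exact fun h => by
                    exact absurd h (by exact (WithBot.coe_injective.ne (ENat.natCast_ne_top r)).symm)
          | coe t => exact ⟨t, rfl, by
              have : ((t + 1 : ℕ) : WithBot ℕ∞) = (r : ℕ) := by exact_mod_cast hdim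
              have : t + 1 = r := by exact_mod_cast this
              omega⟩
      obtain ⟨s, hs1, hs2⟩ := hrpos
      refine norm_of_base D Λ 1 hg ψ ?_ ?_ s ?_ ?_
      · intro d
        obtain ⟨a, ha⟩ := hπ (Ideal.Quotient.mk (maximalIdeal D) d)
        refine ⟨a, ?_⟩
        rw [← Ideal.Quotient.eq_zero_iff_mem, map_sub, sub_eq_zero, ← ha]
        exact (RingHom.congr_fun hψ _).symm
      · rw [hmapp, Ideal.span_singleton_le_iff_mem]; exact hpm
      · rw [hmapp, hs1]
      · rw [hr, hs2]
  · apply field_case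
    have : CharZero (ResidueField D) := CharP.charP_to_charZero _
    have hunit : ∀ n : ℕ, n ≠ 0 → IsUnit (n : D) := by
      intro n hn
      by_contra h
      have : (n : D) ∈ maximalIdeal D := h
      rw [← Ideal.Quotient.eq_zero_iff_mem] at this
      have h2 : ((n : ℕ) : ResidueField D) = 0 := by
        rw [← map_natCast (IsLocalRing.residue D)]; exact this
      exact hn (Nat.cast_eq_zero.1 h2)
    let _ : Algebra ℚ D := (ratHom D hunit).toAlgebra
    exact lift_char0 (k := ResidueField D) (maximalIdeal D) (RingHom.id (ResidueField D))

end X11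

namespace X11
universe v w
open IsLocalRing RingTheory.Sequence

theorem precomplete_of_finite {A M : Type*} [CommRing A] (I : Ideal A) [IsPrecomplete I A]
    [AddCommGroup M] [Module A M] [Module.Finite A M] : IsPrecomplete I M := by
  obtain ⟨n, f, hf⟩ := Module.Finite.exists_fin' A M
  have hp := precomplete_pi I n (A := A)
  have hmap : ∀ k : ℕ, Submodule.map f (I ^ k • ⊤) = I ^ k • ⊤ := by
    intro k
    rw [Submodule.map_smul'', Submodule.map_top, LinearMap.range_eq_top.2 hf]
  refine ⟨fun g hg => ?_⟩
  have hstep : ∀ k (v : Fin n → A), f v = g k → ∃ w, f w = g (k+1) ∧ w - v ∈ (I ^ k • ⊤ : Submodule A (Fin n → A)) := by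
    intro k v hv
    have h1 : g (k+1) - g k ∈ (I ^ k • ⊤ : Submodule A M) :=
      SModEq.sub_mem.1 (hg (Nat.le_succ k)).symm
    rw [← hmap] at h1
    obtain ⟨w, hw, hw2⟩ := h1
    exact ⟨v + w, by rw [map_add, hw2, hv]; abel, by simpa using hw⟩
  choose! nx h1 h2 using hstep
  obtain ⟨v0, hv0⟩ := hf (g 0)
  let h : ℕ → Fin n → A := fun k => Nat.rec v0 (fun k v => nx k v) k
  have hh : ∀ k, f (h k) = g k := by
    intro k
    induction k with
    | zero => exact hv0
    | succ k ih => exact h1 k _ ih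
  have hh2 : ∀ k, h (k+1) - h k ∈ (I ^ k • ⊤ : Submodule A (Fin n → A)) := fun k => h2 k _ (hh k)
  obtain ⟨L, hL⟩ := hp.prec (f := h) (by
    intro a b hab
    induction b, hab using Nat.le_induction with
    | base => exact SModEq.rfl
    | succ b hab ih =>
      refine ih.trans (SModEq.symm ?_)
      rw [SModEq.sub_mem]
      exact Submodule.smul_mono (Ideal.pow_le_pow_right hab) le_rfl (hh2 b))
  refine ⟨f L, fun k => ?_⟩
  rw [← hh, SModEq.sub_mem, ← map_sub, ← hmap]
  exact Submodule.mem_map_of_mem (SModEq.sub_mem.1 (hL k))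

theorem complete_of_finite {A B : Type*} [CommRing A] [CommRing B] [IsLocalRing A] [IsLocalRing B]
    [IsNoetherianRing B] [hA : IsAdicComplete (maximalIdeal A) A] (φ : A →+* B) (hφ : φ.Finite)
    (hmap : (maximalIdeal A).map φ = maximalIdeal B) : IsAdicComplete (maximalIdeal B) B := by
  let _ := φ.toAlgebra
  have : Module.Finite A B := hφ
  have h1 : IsPrecomplete (maximalIdeal A) B := precomplete_of_finite _
  have h2 : IsPrecomplete (maximalIdeal B) B := by
    rw [← hmap]
    exact IsPrecomplete.map_algebraMap_iff.2 h1
  exact {}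

theorem complete_quot {R : Type*} [CommRing R] [IsLocalRing R] [IsNoetherianRing R]
    [IsAdicComplete (maximalIdeal R) R] (p : Ideal R) [IsLocalRing (R ⧸ p)] :
    IsAdicComplete (maximalIdeal (R ⧸ p)) (R ⧸ p) := by
  refine complete_of_finite (Ideal.Quotient.mk p) (RingHom.Finite.of_surjective _ Ideal.Quotient.mk_surjective) ?_
  exact IsLocalRing.map_maximalIdeal_of_surjective _ Ideal.Quotient.mk_surjective

theorem quot_local {R : Type*} [CommRing R] [IsLocalRing R] (p : Ideal R) (hp : p ≠ ⊤) : IsLocalRing (R ⧸ p) := by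
  have : Nontrivial (R ⧸ p) := Ideal.Quotient.nontrivial_iff.2 hp
  exact IsLocalRing.of_surjective' (Ideal.Quotient.mk p) Ideal.Quotient.mk_surjective

theorem finite_frac (A Y : Type u) [CommRing A] [IsDomain A] [CommRing Y] [IsDomain Y] [Algebra A Y]
    (hinj : Function.Injective (algebraMap A Y)) [Module.Finite A Y]
    [Algebra (FractionRing A) (FractionRing Y)] [IsScalarTower A (FractionRing A) (FractionRing Y)] :
    FiniteDimensional (FractionRing A) (FractionRing Y) := by
  have : FaithfulSMul A Y := (faithfulSMul_iff_algebraMap_injective A Y).2 hinj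
  have hden : ∀ z : FractionRing Y, ∃ s : A, s ≠ 0 ∧ ∃ e : Y, algebraMap Y _ e = s • z := by
    intro z
    obtain ⟨a, b, hb, rfl⟩ := IsFractionRing.div_surjective (A := Y) z
    have hb0 : b ≠ 0 := nonZeroDivisors.ne_zero hb
    obtain ⟨s, hs, t, ht⟩ := (Algebra.IsIntegral.isIntegral (R := A) b).isAlgebraic.exists_nonzero_dvd hb
    refine ⟨s, hs, a * t, ?_⟩
    have hb' : algebraMap Y (FractionRing Y) b ≠ 0 := by
      simpa using hb0
    rw [Algebra.smul_def, IsScalarTower.algebraMap_apply A Y (FractionRing Y), ht, map_mul, map_mul]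
    field_simp
  obtain ⟨n, f, hf⟩ := Module.Finite.exists_fin' A Y
  obtain ⟨s, hs⟩ := (Module.Finite.fg_top : (⊤ : Submodule A Y).FG)
  classical
  refine ⟨⟨s.image (algebraMap Y (FractionRing Y)), ?_⟩⟩
  rw [eq_top_iff]
  rintro z -
  obtain ⟨a, ha, e, he⟩ := hden z
  have hz : z = (algebraMap A (FractionRing A) a)⁻¹ • algebraMap Y (FractionRing Y) e := by
    rw [he, ← algebraMap_smul (FractionRing A) a z, smul_smul, inv_mul_cancel₀ (by simpa using ha), one_smul]
  rw [hz]
  refine Submodule.smul_mem _ _ ?_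
  have he' : e ∈ Submodule.span A (s : Set Y) := by rw [hs]; trivial
  clear hz he
  induction he' using Submodule.span_induction with
  | mem x hx => exact Submodule.subset_span (by rw [Finset.coe_image]; exact ⟨x, hx, rfl⟩)
  | zero => simp
  | add x y _ _ hx hy => rw [map_add]; exact add_mem hx hy
  | smul r x _ hx =>
    rw [show algebraMap Y (FractionRing Y) (r • x) = r • algebraMap Y (FractionRing Y) x from
      (Algebra.linearMap Y (FractionRing Y)).map_smul_of_tower r x, ← algebraMap_smul (FractionRing A) r]
    exact Submodule.smul_mem _ _ hx

theorem N1_conductor (Y : Type u) [CommRing Y] [IsDomain Y] [IsLocalRing Y] [IsNoetherianRing Y]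
    [IsAdicComplete (maximalIdeal Y) Y] :
    ∃ y : Y, y ≠ 0 ∧ ∀ z : FractionRing Y, IsIntegral Y z → ∃ w : Y, algebraMap Y _ w = y • z := by
  obtain ⟨A, _, _, _, _, n, φ, hg, hfin, hinj, -, -⟩ := exists_norm Y
  let _ := φ.toAlgebra
  have : Module.Finite A Y := hfin
  have : FaithfulSMul A Y := (faithfulSMul_iff_algebraMap_injective A Y).2 hinj
  have : FaithfulSMul A (FractionRing Y) := (faithfulSMul_iff_algebraMap_injective A _).2 (by
    rw [IsScalarTower.algebraMap_eq A Y (FractionRing Y)]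
    exact (IsFractionRing.injective Y (FractionRing Y)).comp hinj)
  let _ : Algebra (FractionRing A) (FractionRing Y) := FractionRing.liftAlgebra A (FractionRing Y)
  have := FractionRing.isScalarTower_liftAlgebra A (FractionRing Y)
  have := finite_frac A Y hinj
  have hN := hg.n2 (FractionRing Y)
  obtain ⟨s, hs⟩ := (Module.Finite.fg_top : (⊤ : Submodule A (integralClosure A (FractionRing Y))).FG)
  classical
  obtain ⟨b, hb⟩ := IsLocalization.exist_integer_multiples_of_finset (nonZeroDivisors Y) (s.image Subtype.val)
  refine ⟨b, nonZeroDivisors.ne_zero b.2, fun z hz => ?_⟩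
  have hz' : IsIntegral A z := isIntegral_trans z hz
  have : ∀ c : integralClosure A (FractionRing Y), ∃ w : Y, algebraMap Y (FractionRing Y) w = (b : Y) • (c : FractionRing Y) := by
    intro c
    have hc : c ∈ Submodule.span A (s : Set (integralClosure A (FractionRing Y))) := by rw [hs]; trivial
    induction hc using Submodule.span_induction with
    | mem x hx => exact hb _ (Finset.mem_image_of_mem _ hx)
    | zero => exact ⟨0, by simp⟩
    | add x y _ _ hx hy =>
      obtain ⟨w, hw⟩ := hx
      obtain ⟨w', hw'⟩ := hy
      exact ⟨w + w', by rw [map_add, hw, hw', ← smul_add]; rfl⟩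
    | smul r x _ hx =>
      obtain ⟨w, hw⟩ := hx
      exact ⟨r • w, by
        rw [show algebraMap Y (FractionRing Y) (r • w) = r • algebraMap Y (FractionRing Y) w from
          (Algebra.linearMap Y (FractionRing Y)).map_smul_of_tower r w, hw, smul_comm]; rfl⟩
  exact this ⟨z, hz'⟩

end X11

namespace X11
universe v w
open IsLocalRing RingTheory.Sequence

theorem isIntegral_of_eq {A B : Type*} [CommRing A] [CommRing B] [Algebra A B] (z : B) (k : ℕ)
    (a : ℕ → A) (h : z ^ k + ∑ j ∈ Finset.Icc 1 k, algebraMap A B (a j) * z ^ (k - j) = 0) : IsIntegral A z := by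
  refine ⟨Polynomial.X ^ k + ∑ j ∈ Finset.Icc 1 k, Polynomial.C (a j) * Polynomial.X ^ (k - j), ?_, ?_⟩
  · apply Polynomial.monic_X_pow_add
    refine lt_of_le_of_lt (Polynomial.degree_sum_le _ _) ?_
    rw [Finset.sup_lt_iff (by exact_mod_cast WithBot.bot_lt_coe k)]
    intro j hj
    rw [Finset.mem_Icc] at hj
    refine lt_of_le_of_lt (Polynomial.degree_C_mul_X_pow_le _ _) ?_
    exact_mod_cast (by omega : k - j < k)
  · rw [Polynomial.eval₂_add, Polynomial.eval₂_finsetSum]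
    simpa using h

theorem mem_span_mul_iff {D : Type*} [CommRing D] {r : ℕ} (z : Fin r → D) (J : Ideal D) (a : D) :
    a ∈ Ideal.span (Set.range z) * J ↔ ∃ b : Fin r → D, (∀ i, b i ∈ J) ∧ a = ∑ i, z i * b i := by
  rw [mul_comm, ← smul_eq_mul]
  constructor
  · intro h
    obtain ⟨b, hb, rfl⟩ := (Submodule.mem_ideal_smul_span_iff_exists_sum J z a).1 h
    exact ⟨b, hb, by rw [Finsupp.sum_fintype _ _ (by simp)]; simp [mul_comm]⟩
  · rintro ⟨b, hb, rfl⟩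
    refine sum_mem fun i _ => ?_
    rw [mul_comm]
    exact Ideal.mul_mem_mul (hb i) (Ideal.subset_span ⟨i, rfl⟩)

open PowerSeries

section Y
variable {D : Type u} [CommRing D]

def reesPS (q : Ideal D) : Subring D⟦X⟧ where
  carrier := {f | ∀ n, coeff n f ∈ q ^ n}
  mul_mem' := by
    intro f g hf hg n
    rw [coeff_mul]
    refine sum_mem fun p hp => ?_
    rw [← Finset.HasAntidiagonal.mem_antidiagonal.1 hp, pow_add]
    exact Ideal.mul_mem_mul (hf _) (hg _)
  one_mem' := by
    intro n
    rw [coeff_one]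
    split_ifs with h
    · subst h; simp
    · exact zero_mem _
  add_mem' := by
    intro f g hf hg n
    rw [map_add]; exact add_mem (hf n) (hg n)
  zero_mem' := fun n => by simp
  neg_mem' := by
    intro f hf n
    rw [map_neg]; exact neg_mem (hf n)

theorem mem_reesPS (q : Ideal D) (f : D⟦X⟧) : f ∈ reesPS q ↔ ∀ n, coeff n f ∈ q ^ n := Iff.rfl

noncomputable def rc (q : Ideal D) : D →+* reesPS q :=
  (PowerSeries.C (R := D)).codRestrict (reesPS q) (by
    intro a n
    rw [coeff_C]
    split_ifs with h
    · subst h; simp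
    · exact zero_mem _)

theorem rc_coe (q : Ideal D) (a : D) : ((rc q a : reesPS q) : D⟦X⟧) = C a := rfl

noncomputable def rm (q : Ideal D) (n : ℕ) (b : D) (hb : b ∈ q ^ n) : reesPS q :=
  ⟨monomial n b, by
    intro m
    rw [coeff_monomial]
    split_ifs with h
    · subst h; exact hb
    · exact zero_mem _⟩

theorem rm_coe (q : Ideal D) (n : ℕ) (b : D) (hb : b ∈ q ^ n) : ((rm q n b hb : reesPS q) : D⟦X⟧) = monomial n b := rfl

noncomputable def r0 (q : Ideal D) : reesPS q →+* D := (constantCoeff (R := D)).comp (reesPS q).subtype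

noncomputable def rI (q : Ideal D) : Ideal (reesPS q) := RingHom.ker (r0 q)

theorem rI_mem (q : Ideal D) (f : reesPS q) : f ∈ rI q ↔ coeff 0 (f : D⟦X⟧) = 0 := by
  rw [coeff_zero_eq_constantCoeff]; exact Iff.rfl

variable {r : ℕ} (z : Fin r → D)

theorem rI_decomp (q : Ideal D) (hq : q = Ideal.span (Set.range z)) (k : ℕ) (f : reesPS q)
    (hf : ∀ j < k + 1, coeff j (f : D⟦X⟧) = 0) :
    ∃ g : Fin r → reesPS q, (∀ i, ∀ j < k, coeff j (g i : D⟦X⟧) = 0) ∧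
      f = ∑ i, rm q 1 (z i) (by rw [pow_one, hq]; exact Ideal.subset_span ⟨i, rfl⟩) * g i := by
  have h1 : ∀ n, ∃ b : Fin r → D, (∀ i, b i ∈ q ^ n) ∧ (n < k → ∀ i, b i = 0) ∧ coeff (n+1) (f : D⟦X⟧) = ∑ i, z i * b i := by
    intro n
    by_cases hn : n < k
    · exact ⟨0, by simp, by simp, by rw [hf (n+1) (by omega)]; simp⟩
    · have := f.2 (n+1)
      rw [pow_succ'] at this
      nth_rewrite 1 [hq] at this
      obtain ⟨b, hb, h⟩ := (mem_span_mul_iff z (q^n) _).1 this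
      exact ⟨b, hb, fun h => absurd h hn, h⟩
  choose b hb1 hb2 hb3 using h1
  refine ⟨fun i => ⟨PowerSeries.mk fun n => b n i, fun n => by rw [coeff_mk]; exact hb1 n i⟩, ?_, ?_⟩
  · intro i j hj
    simp only [coeff_mk]
    exact hb2 j hj i
  · apply Subtype.ext
    rw [AddSubmonoidClass.coe_finsetSum]
    ext n
    rw [map_sum]
    cases n with
    | zero =>
      rw [hf 0 (by omega)]
      refine (Finset.sum_eq_zero fun i _ => ?_).symm
      simp [rm_coe, monomial_eq_mk, coeff_zero_eq_constantCoeff]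
    | succ n =>
      rw [hb3]
      refine Finset.sum_congr rfl fun i _ => ?_
      show _ = coeff (n+1) (monomial 1 (z i) * PowerSeries.mk fun n => b n i)
      rw [monomial_eq_C_mul_X_pow, pow_one, mul_assoc, coeff_C_mul, coeff_succ_X_mul, coeff_mk]

end Y

section Y2
variable {D : Type u} [CommRing D] {r : ℕ} (z : Fin r → D) (q : Ideal D)

theorem rI_pow_mem (hq : q = Ideal.span (Set.range z)) (k : ℕ) (f : reesPS q) : f ∈ rI q ^ k ↔ ∀ j < k, coeff j (f : D⟦X⟧) = 0 := by
  constructor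
  · intro hf
    have h1 : (rI q).map (reesPS q).subtype ≤ Ideal.span {(X : D⟦X⟧)} := by
      rw [Ideal.map_le_iff_le_comap]
      intro g hg
      rw [rI_mem] at hg
      rw [Ideal.mem_comap, Ideal.mem_span_singleton, X_dvd_iff]
      simpa using hg
    have h2 : (f : D⟦X⟧) ∈ Ideal.span {(X : D⟦X⟧)} ^ k := by
      refine Ideal.pow_right_mono h1 k ?_
      rw [← Ideal.map_pow]
      exact Ideal.mem_map_of_mem (reesPS q).subtype hf
    rw [Ideal.span_singleton_pow, Ideal.mem_span_singleton, X_pow_dvd_iff] at h2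
    exact h2
  · intro hf
    induction k generalizing f with
    | zero => simp
    | succ k ih =>
      obtain ⟨g, hg, h⟩ := rI_decomp z q hq k f hf
      rw [h, pow_succ']
      refine sum_mem fun i _ => Ideal.mul_mem_mul ?_ (ih _ (hg i))
      rw [rI_mem, rm_coe, coeff_monomial]; simp

theorem rI_eq (hq : q = Ideal.span (Set.range z)) : rI q = Ideal.span (Set.range fun i : Fin r => rm q 1 (z i) (by rw [pow_one, hq]; exact Ideal.subset_span ⟨i, rfl⟩)) := by
  refine le_antisymm ?_ ?_
  · intro f hf
    obtain ⟨g, hg, h⟩ := rI_decomp z q hq 0 f (by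
      intro j hj
      obtain rfl : j = 0 := by omega
      exact (rI_mem q f).1 hf)
    rw [h]
    refine sum_mem fun i _ => Ideal.mul_mem_right _ _ (Ideal.subset_span ⟨i, rfl⟩)
  · rw [Ideal.span_le]
    rintro _ ⟨i, rfl⟩
    show _ ∈ rI q
    rw [rI_mem, rm_coe, coeff_monomial]; simp

theorem rI_complete (hq : q = Ideal.span (Set.range z)) : IsAdicComplete (rI q) (reesPS q) := by
  have h1 : IsHausdorff (rI q) (reesPS q) := by
    rw [haus_iff]
    intro f hf
    apply Subtype.ext
    ext n
    exact (rI_pow_mem z q hq (n+1) f).1 (hf (n+1)) n (by omega)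
  have h2 : IsPrecomplete (rI q) (reesPS q) := by
    rw [precomplete_iff]
    intro f hf
    refine ⟨⟨PowerSeries.mk fun j => coeff j (f (j+1) : D⟦X⟧), fun j => by rw [coeff_mk]; exact (f (j+1)).2 j⟩, ?_⟩
    intro n
    rw [rI_pow_mem z q hq]
    intro j hj
    rw [AddSubgroupClass.coe_sub, map_sub, coeff_mk, sub_eq_zero]
    have : ∀ m, j + 1 ≤ m → coeff j (f m : D⟦X⟧) = coeff j (f (j+1) : D⟦X⟧) := by
      intro m hm
      induction m, hm using Nat.le_induction with
      | base => rfl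
      | succ m hm ih =>
        rw [← ih, ← sub_eq_zero, ← map_sub, ← AddSubgroupClass.coe_sub]
        exact (rI_pow_mem z q hq m _).1 (hf m) j hm
    exact this n hj
  exact {}

theorem rc_sub (hq : q = Ideal.span (Set.range z)) (b : reesPS q) : b - rc q (r0 q b) ∈ rI q := by
  rw [rI_mem, AddSubgroupClass.coe_sub, rc_coe, map_sub, coeff_zero_C, sub_eq_zero, coeff_zero_eq_constantCoeff]; rfl

theorem reesPS_noeth (hq : q = Ideal.span (Set.range z)) [IsNoetherianRing D] : IsNoetherianRing (reesPS q) := by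
  have := rI_complete z q hq
  exact isNoetherianRing_of_complete (rI q) (by rw [rI_eq z q hq]; exact Submodule.fg_span (Set.finite_range _)) D (rc q)
    (fun b => ⟨_, rc_sub z q hq b⟩)

theorem reesPS_local (hq : q = Ideal.span (Set.range z)) [IsLocalRing D] : ∃ _ : IsLocalRing (reesPS q), ∀ f, f ∈ maximalIdeal (reesPS q) ↔ r0 q f ∈ maximalIdeal D := by
  have := rI_complete z q hq
  have hjac := IsAdicComplete.le_jacobson_bot (rI q)
  have hloc : IsLocalHom (r0 q) := ⟨fun f hf => by
    obtain ⟨u, hu⟩ := hf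
    have h1 : f * rc q (↑u⁻¹ : D) - 1 ∈ rI q := by
      have : r0 q (rc q (↑u⁻¹ : D)) = ↑u⁻¹ := constantCoeff_C _
      rw [rI, RingHom.mem_ker, map_sub, map_mul, this, ← hu]; simp
    have h2 := Ideal.mem_jacobson_bot.1 (hjac h1) 1
    rw [mul_one, sub_add_cancel] at h2
    exact isUnit_of_mul_isUnit_left h2⟩
  have hl : IsLocalRing (reesPS q) := (r0 q).domain_isLocalRing
  refine ⟨hl, fun f => ?_⟩
  rw [IsLocalRing.mem_maximalIdeal, IsLocalRing.mem_maximalIdeal, mem_nonunits_iff, mem_nonunits_iff]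
  exact not_congr (isUnit_map_iff (r0 q) f).symm
end Y2

/-- Adjoining power series variables. -/
theorem exists_ps_hom (B : Type u) [CommRing B] (I : Ideal B) [IsAdicComplete I B]
    (zs : List B) (hzs : ∀ z ∈ zs, z ∈ I) (A : Type u) [CommRing A] [IsLocalRing A]
    [IsNoetherianRing A] [hA : IsAdicComplete (maximalIdeal A) A] (φ : A →+* B) :
    ∃ (A' : Type u) (_ : CommRing A') (_ : IsLocalRing A') (_ : IsNoetherianRing A')
      (_ : IsAdicComplete (maximalIdeal A') A')
      (φ' : A' →+* B), (∀ a, ∃ a', φ' a' = φ a) ∧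
      (maximalIdeal A').map φ' = (maximalIdeal A).map φ ⊔ Ideal.ofList zs := by
  induction zs with
  | nil => exact ⟨A, _, inferInstance, inferInstance, hA, φ, fun a => ⟨a, rfl⟩, by simp⟩
  | cons z zs ih =>
    obtain ⟨A', _, _, _, _, φ', h2, h3⟩ := ih (fun w hw => hzs w (List.mem_cons_of_mem _ hw))
    obtain ⟨ψ, hψ1, hψ2⟩ := exists_evalHom φ' I z (hzs z (by simp))
    refine ⟨PowerSeries A', inferInstance, inferInstance, inferInstance, ?_, ψ, ?_, ?_⟩
    · rw [ps_maximalIdeal]; exact psComplete _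
    · intro d
      obtain ⟨a, ha⟩ := h2 d
      exact ⟨PowerSeries.C a, by rw [hψ1, ha]⟩
    · have : ψ.comp PowerSeries.C = φ' := by ext a; exact hψ1 a
      rw [ps_maximalIdeal, psIdeal, Ideal.map_sup, Ideal.map_map, this, h3, Ideal.map_span,
        Set.image_singleton, hψ2, Ideal.ofList_cons, sup_assoc, sup_comm (Ideal.ofList zs)]

theorem reesPS_complete {D : Type u} [CommRing D] [IsLocalRing D] [IsNoetherianRing D]
    [IsAdicComplete (maximalIdeal D) D] (q : Ideal D) :
    ∃ (_ : IsLocalRing (reesPS q)) (_ : IsNoetherianRing (reesPS q)),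
      IsAdicComplete (maximalIdeal (reesPS q)) (reesPS q) := by
  obtain ⟨r, z, hz⟩ := Submodule.fg_iff_exists_fin_generating_family.1 (IsNoetherian.noetherian q)
  have hq : q = Ideal.span (Set.range z) := hz.symm
  obtain ⟨hl, hmax⟩ := reesPS_local z q hq
  have hn := reesPS_noeth z q hq
  have := rI_complete z q hq
  refine ⟨hl, hn, ?_⟩
  let y : Fin r → reesPS q := fun i => rm q 1 (z i) (by rw [pow_one, hq]; exact Ideal.subset_span ⟨i, rfl⟩)
  have hI : rI q = Ideal.ofList (List.ofFn y) := by
    rw [rI_eq z q hq, Ideal.ofList]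
    congr 1
    ext w
    simp [List.mem_ofFn, y]
  obtain ⟨A', _, _, _, _, φ', h2, h3⟩ := exists_ps_hom (reesPS q) (rI q) (List.ofFn y) (by
    intro w hw
    rw [hI]; exact Ideal.subset_span hw) D (rc q)
  have hmm : (maximalIdeal D).map (rc q) ⊔ rI q = maximalIdeal (reesPS q) := by
    apply le_antisymm
    · refine sup_le ?_ ?_
      · rw [Ideal.map_le_iff_le_comap]
        intro a ha
        rw [Ideal.mem_comap, hmax]
        have : r0 q (rc q a) = a := constantCoeff_C _
        rwa [this]
      · intro f hf
        rw [hmax, show r0 q f = 0 from hf]; exact zero_mem _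
    · intro f hf
      rw [hmax] at hf
      rw [← sub_add_cancel f (rc q (r0 q f))]
      exact add_mem (Ideal.mem_sup_right (rc_sub z q hq f)) (Ideal.mem_sup_left (Ideal.mem_map_of_mem _ hf))
  rw [← hI, hmm] at h3
  have hfin : φ'.Finite := by
    refine finite_of_primary φ' ?_ h3.le 1 (by rw [pow_one, h3])
    intro f
    obtain ⟨a', ha'⟩ := h2 (r0 q f)
    refine ⟨a', ?_⟩
    rw [ha', ← hmm]
    exact Ideal.mem_sup_right (rc_sub z q hq f)
  exact complete_of_finite φ' hfin h3

end X11

namespace X11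
universe v w
open IsLocalRing RingTheory.Sequence
open PowerSeries

theorem rees_aux {K : Type*} [Field K] (c a m : K) (hc : c ≠ 0) (i j : ℕ) :
    c ^ (j + i) * (a * (m / c) ^ i) = a * c ^ j * m ^ i := by
  rw [div_pow, pow_add]; field_simp

theorem rees_domain (D : Type u) [CommRing D] [IsLocalRing D] [IsNoetherianRing D] [IsDomain D]
    [IsAdicComplete (maximalIdeal D) D] (q : Ideal D) :
    ∃ c : D, c ≠ 0 ∧ ∀ n b, b ∈ intClSet D (q ^ n) → c * b ∈ q ^ n := by
  by_cases hq0 : q = ⊥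
  · refine ⟨1, one_ne_zero, fun n b hb => ?_⟩
    rw [one_mul]
    cases n with
    | zero => simp
    | succ n =>
      obtain ⟨k, hk, a, ha, h⟩ := hb
      have : ∑ j ∈ Finset.Icc 1 k, a j * b ^ (k - j) = 0 := by
        refine Finset.sum_eq_zero fun j hj => ?_
        have := ha j hj
        rw [hq0, ← pow_mul, Ideal.bot_pow (by have := (Finset.mem_Icc.1 hj).1; positivity)] at this
        rw [(Submodule.mem_bot D).1 this, zero_mul]
      rw [this, add_zero] at h
      rw [eq_zero_of_pow_eq_zero h]
      exact zero_mem _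
  obtain ⟨z, hz, hz0⟩ := Submodule.exists_mem_ne_zero_of_ne_bot hq0
  obtain ⟨_, _, _⟩ := reesPS_complete q
  obtain ⟨y, hy0, hy⟩ := N1_conductor (reesPS q)
  have hy1 : (y : D⟦X⟧) ≠ 0 := fun h => hy0 (Subtype.ext h)
  obtain ⟨j0, hj0⟩ : ∃ j, coeff j (y : D⟦X⟧) ≠ 0 := by
    by_contra! h
    exact hy1 (by ext n; simpa using h n)
  refine ⟨_, hj0, fun n b hb => ?_⟩
  obtain ⟨k, hk, a, ha, h⟩ := hb
  have hzn : z ^ n * b ∈ q ^ n := Ideal.mul_mem_right _ _ (Ideal.pow_mem_pow hz n)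
  set K := FractionRing (reesPS q)
  set α := algebraMap (reesPS q) K
  have hden : rc q (z ^ n) ≠ 0 := by
    intro h0
    have : C (z ^ n) = (0 : D⟦X⟧) := congrArg Subtype.val h0
    exact pow_ne_zero n hz0 (by simpa using congrArg (constantCoeff) this)
  have hden' : α (rc q (z ^ n)) ≠ 0 := by
    simpa [α] using hden
  have ha' : ∀ j ∈ Finset.Icc 1 k, a j ∈ q ^ (n * j) := fun j hj => by rw [pow_mul]; exact ha j hj
  classical
  let a' : ℕ → reesPS q := fun j => if hj : j ∈ Finset.Icc 1 k then rm q (n * j) (a j) (ha' j hj) else 0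
  have heq : (rm q n _ hzn) ^ k + ∑ j ∈ Finset.Icc 1 k, a' j * (rc q (z ^ n)) ^ j * (rm q n _ hzn) ^ (k - j) = 0 := by
    apply Subtype.ext
    rw [Subring.coe_add, AddSubmonoidClass.coe_finsetSum, Subring.coe_pow, rm_coe, Subring.coe_zero]
    have e1 : ∀ j ∈ Finset.Icc 1 k, ((a' j * (rc q (z ^ n)) ^ j * (rm q n _ hzn) ^ (k - j) : reesPS q) : D⟦X⟧) =
        monomial (n * k) ((z^n)^k * (a j * b ^ (k - j))) := by
      intro j hj
      have hj' := (Finset.mem_Icc.1 hj).2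
      simp only [a', dif_pos hj, Subring.coe_mul, Subring.coe_pow, rm_coe, rc_coe]
      rw [← monomial_zero_eq_C_apply, monomial_pow, monomial_pow, monomial_mul_monomial, monomial_mul_monomial]
      obtain ⟨i, rfl⟩ := Nat.exists_eq_add_of_le hj'
      have : j + i - j = i := by omega
      rw [this]
      congr 1
      · congr 1; ring
      · rw [mul_pow, pow_add]; ring
    rw [Finset.sum_congr rfl e1, monomial_pow, ← map_sum, ← Finset.mul_sum, mul_comm k n, ← map_add, mul_pow, ← mul_add, h]
    simp
  set ζ : K := α (rm q n _ hzn) / α (rc q (z ^ n)) with hζ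
  have hIntg : IsIntegral (reesPS q) ζ := by
    refine isIntegral_of_eq ζ k a' ?_
    have h2 := congrArg α heq
    rw [map_add, map_sum, map_zero, map_pow] at h2
    have hmul : (α (rc q (z ^ n))) ^ k * (ζ ^ k + ∑ j ∈ Finset.Icc 1 k, α (a' j) * ζ ^ (k - j)) = 0 := by
      rw [← h2, mul_add, Finset.mul_sum]
      congr 1
      · rw [← mul_pow, hζ, mul_div_cancel₀ _ hden']
      · refine Finset.sum_congr rfl fun j hj => ?_
        have hj' := (Finset.mem_Icc.1 hj).2
        obtain ⟨i, rfl⟩ := Nat.exists_eq_add_of_le hj'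
        have : j + i - j = i := by omega
        rw [this, map_mul, map_mul, hζ]
        have e1 : α (rc q (z ^ n) ^ j) = α (rc q (z ^ n)) ^ j := map_pow _ _ _
        have e2 : α (rm q n _ hzn ^ i) = α (rm q n _ hzn) ^ i := map_pow _ _ _
        rw [e1, e2]
        exact rees_aux _ _ _ hden' i j
    exact (mul_eq_zero.1 hmul).resolve_left (pow_ne_zero _ hden')
  obtain ⟨w, hw⟩ := hy ζ hIntg
  have h3 : w * rc q (z ^ n) = y * rm q n _ hzn := by
    apply IsFractionRing.injective (reesPS q) K
    rw [map_mul, hw, Algebra.smul_def, map_mul, hζ]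
    show α y * (α (rm q n _ hzn) / α (rc q (z ^ n))) * α (rc q (z ^ n)) = α y * α (rm q n _ hzn)
    rw [mul_assoc, div_mul_cancel₀ _ hden']
  have h4 : (w : D⟦X⟧) * C (z ^ n) = (y : D⟦X⟧) * monomial n (z ^ n * b) := congrArg Subtype.val h3
  have h5 := congrArg (coeff (j0 + n)) h4
  rw [mul_comm, coeff_C_mul, monomial_eq_C_mul_X_pow, ← mul_assoc, coeff_mul_X_pow, mul_comm (y : D⟦X⟧), coeff_C_mul, mul_assoc] at h5
  have h6 := mul_left_cancel₀ (pow_ne_zero n hz0) h5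
  rw [mul_comm, ← h6]
  exact Ideal.pow_le_pow_right (by omega) (w.2 (j0 + n))

theorem intCl_map {R S : Type*} [CommRing R] [CommRing S] (f : R →+* S) (I : Ideal R) (b : R)
    (hb : b ∈ intClSet R I) : f b ∈ intClSet S (I.map f) := by
  obtain ⟨k, hk, a, ha, h⟩ := hb
  refine ⟨k, hk, fun j => f (a j), ?_, ?_⟩
  · intro j hj
    rw [← Ideal.map_pow]; exact Ideal.mem_map_of_mem f (ha j hj)
  · have := congrArg f h
    simpa using this

theorem rees_domain' (D : Type u) [CommRing D] [IsLocalRing D] [IsNoetherianRing D] [IsDomain D]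
    [IsAdicComplete (maximalIdeal D) D] (q : Ideal D) :
    ∃ c : ℕ, ∀ n b, b ∈ intClSet D (q ^ n) → b ∈ q ^ (n - c) := by
  obtain ⟨c, hc0, hc⟩ := rees_domain D q
  obtain ⟨k, hk⟩ := Ideal.exists_pow_inf_eq_pow_smul q (Ideal.span {c})
  refine ⟨k, fun n b hb => ?_⟩
  by_cases hn : n < k
  · rw [Nat.sub_eq_zero_of_le hn.le]; simp
  · have h1 : c * b ∈ q ^ n • ⊤ ⊓ Ideal.span {c} := by
      refine ⟨by simpa using hc n b hb, Ideal.mul_mem_right _ _ (Ideal.mem_span_singleton_self c)⟩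
    rw [hk n (by omega)] at h1
    have h2 : c * b ∈ q ^ (n - k) * Ideal.span {c} := Submodule.smul_mono le_rfl inf_le_right h1
    rw [Ideal.mem_mul_span_singleton] at h2
    obtain ⟨w, hw, hw2⟩ := h2
    rw [mul_comm] at hw2
    rw [← mul_left_cancel₀ hc0 hw2]
    exact hw

theorem rees (R : Type u) [CommRing R] [IsLocalRing R] [IsNoetherianRing R] [IsReduced R]
    [IsAdicComplete (maximalIdeal R) R] (Q : Ideal R) :
    ∃ c : ℕ, ∀ n b, b ∈ intClSet R (Q ^ n) → b ∈ Q ^ (n - c) := by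
  have hfin : (minimalPrimes R).Finite := minimalPrimes.finite_of_isNoetherianRing R
  have key : ∀ p : minimalPrimes R, ∃ c : ℕ, ∀ n b, b ∈ intClSet R (Q ^ n) →
      Ideal.Quotient.mk p.1 b ∈ (Q.map (Ideal.Quotient.mk p.1)) ^ (n - c) := by
    rintro ⟨p, hp⟩
    have hpp : p.IsPrime := hp.1.1
    have := quot_local p hpp.ne_top
    have := complete_quot p
    obtain ⟨c, hc⟩ := rees_domain' (R ⧸ p) (Q.map (Ideal.Quotient.mk p))
    refine ⟨c, fun n b hb => hc n _ ?_⟩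
    have := intCl_map (Ideal.Quotient.mk p) _ b hb
    rwa [Ideal.map_pow] at this
  choose c hc using key
  have : Finite (minimalPrimes R) := hfin
  have := Fintype.ofFinite (minimalPrimes R)
  let C := ∑ p, c p
  have hcC : ∀ p, c p ≤ C := fun p => Finset.single_le_sum (f := c) (fun _ _ => Nat.zero_le _) (Finset.mem_univ p)
  let f : R →ₗ[R] ((p : minimalPrimes R) → R ⧸ p.1) := LinearMap.pi fun p => (Submodule.mkQ p.1)
  have hf : Function.Injective f := by
    rw [injective_iff_map_eq_zero]
    intro b hb
    have : b ∈ nilradical R := by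
      rw [nilradical, ← Ideal.sInf_minimalPrimes, Submodule.mem_sInf]
      intro p hp
      have := congrFun hb ⟨p, hp⟩
      exact (Submodule.Quotient.mk_eq_zero p).1 this
    exact (mem_nilradical.1 this).eq_zero
  obtain ⟨k, hk⟩ := Ideal.exists_pow_inf_eq_pow_smul Q (LinearMap.range f)
  refine ⟨C + k, fun n b hb => ?_⟩
  by_cases hn : n < C + k
  · rw [Nat.sub_eq_zero_of_le hn.le]; simp
  have h1 : f b ∈ (Q ^ (n - C) • ⊤ : Submodule R ((p : minimalPrimes R) → R ⧸ p.1)) := by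
    classical
    have : f b = ∑ p, LinearMap.single R (fun p : minimalPrimes R => R ⧸ p.1) p (Ideal.Quotient.mk p.1 b) := by
      funext p
      simp [f, LinearMap.single_apply]
    rw [this]
    refine sum_mem fun p _ => ?_
    have h2 : Ideal.Quotient.mk p.1 b ∈ (Q ^ (n - C) • ⊤ : Submodule R (R ⧸ p.1)) := by
      have := Ideal.pow_le_pow_right (show n - C ≤ n - c p by have := hcC p; omega) (hc p n b hb)
      rw [Ideal.smul_top_eq_map, Ideal.map_pow]
      exact this
    have h3 := Submodule.mem_map_of_mem (f := LinearMap.single R (fun p : minimalPrimes R => R ⧸ p.1) p) h2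
    rw [Submodule.map_smul''] at h3
    exact Submodule.smul_mono le_rfl le_top h3
  have h2 : f b ∈ Q ^ (n - C) • ⊤ ⊓ LinearMap.range f := ⟨h1, ⟨b, rfl⟩⟩
  rw [hk _ (by omega)] at h2
  have h3 : f b ∈ Q ^ (n - C - k) • Submodule.map f ⊤ := by
    rw [Submodule.map_top]
    exact Submodule.smul_mono le_rfl inf_le_right h2
  rw [← Submodule.map_smul''] at h3
  obtain ⟨b', hb', h4⟩ := h3
  rw [hf h4] at hb'
  rw [← Nat.sub_sub]
  simpa using hb'

end X11

namespace X11
universe v w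
open IsLocalRing RingTheory.Sequence

theorem intCl_mono {R : Type*} [CommRing R] {I J : Ideal R} (h : I ≤ J) : intClSet R I ⊆ intClSet R J := by
  rintro b ⟨k, hk, a, ha, h'⟩
  exact ⟨k, hk, a, fun j hj => Ideal.pow_right_mono h j (ha j hj), h'⟩

theorem le_intCl {R : Type*} [CommRing R] {I : Ideal R} : (I : Set R) ⊆ intClSet R I := by
  intro b hb
  refine ⟨1, one_pos, fun _ => -b, ?_, by simp⟩
  intro k hk
  simp at hk
  subst hk
  simpa using hb

theorem intCl_mul {R : Type*} [CommRing R] {I J : Ideal R} {q b : R} (hq : q ∈ I) (hb : b ∈ intClSet R J) :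
    q * b ∈ intClSet R (I * J) := by
  obtain ⟨k, hk, a, ha, h⟩ := hb
  refine ⟨k, hk, fun j => q ^ j * a j, ?_, ?_⟩
  · intro j hj
    rw [mul_pow]
    exact Ideal.mul_mem_mul (Ideal.pow_mem_pow hq j) (ha j hj)
  · have : ∀ j ∈ Finset.Icc 1 k, q ^ j * a j * (q * b) ^ (k - j) = q ^ k * (a j * b ^ (k - j)) := by
      intro j hj
      obtain ⟨i, rfl⟩ := Nat.exists_eq_add_of_le (Finset.mem_Icc.1 hj).2
      rw [Nat.add_sub_cancel_left]
      ring
    rw [Finset.sum_congr rfl this, ← Finset.mul_sum, mul_pow, ← mul_add, h, mul_zero]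

/-- A filtration of ideals compatible with `Q`. -/
structure QFil {R : Type*} [CommRing R] (Q : Ideal R) (F : ℕ → Ideal R) : Prop where
  mono : ∀ n, F (n + 1) ≤ F n
  mul : ∀ n, Q * F n ≤ F (n + 1)

theorem QFil.anti {R : Type*} [CommRing R] {Q : Ideal R} {F : ℕ → Ideal R} (h : QFil Q F) : Antitone F :=
  antitone_nat_of_succ_le h.mono

theorem QFil.pow_mul {R : Type*} [CommRing R] {Q : Ideal R} {F : ℕ → Ideal R} (h : QFil Q F) (k n : ℕ) :
    Q ^ k * F n ≤ F (n + k) := by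
  induction k with
  | zero => simp
  | succ k ih =>
    rw [pow_succ', mul_assoc]
    exact (Ideal.mul_mono_right ih).trans (h.mul _)

theorem QFil.map {R S : Type*} [CommRing R] [CommRing S] (f : R →+* S) {Q : Ideal R} {F : ℕ → Ideal R} (h : QFil Q F) :
    QFil (Q.map f) (fun n => (F n).map f) :=
  ⟨fun n => Ideal.map_mono (h.mono n), fun n => by rw [← Ideal.map_mul]; exact Ideal.map_mono (h.mul n)⟩

theorem QFil.stable {R : Type*} [CommRing R] [IsNoetherianRing R] {Q : Ideal R} {F : ℕ → Ideal R} (h : QFil Q F)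
    (c : ℕ) (hc : ∀ n, F n ≤ Q ^ (n - c)) : ∃ n0, ∀ n ≥ n0, F (n + 1) = Q * F n := by
  let F1 : Q.Filtration R := ⟨F, h.mono, h.mul⟩
  let F2 : Q.Filtration R := ⟨fun n => Q ^ (n - c), fun n => Ideal.pow_le_pow_right (by omega),
    fun n => by
      show Q * Q ^ (n - c) ≤ Q ^ (n + 1 - c)
      rw [← pow_succ']
      exact Ideal.pow_le_pow_right (by omega)⟩
  have h2 : F2.Stable := by
    refine ⟨c, fun n hn => ?_⟩
    show Q * Q ^ (n - c) = Q ^ (n + 1 - c)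
    rw [← pow_succ']
    congr 1; omega
  have h1 : F1.Stable := h2.of_le (fun n => hc n)
  obtain ⟨n0, hn0⟩ := h1
  exact ⟨n0, fun n hn => (hn0 n hn).symm⟩

theorem QFil_intCl {R : Type*} [CommRing R] {Q : Ideal R} {F : ℕ → Ideal R}
    (hF : ∀ n, (F n : Set R) = intClSet R (Q ^ n)) : QFil Q F := by
  have hF' : ∀ n b, b ∈ F n ↔ b ∈ intClSet R (Q ^ n) := fun n b => by rw [← hF]; rfl
  refine ⟨fun n b hb => ?_, fun n => Ideal.mul_le.2 fun q hq b hb => ?_⟩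
  · rw [hF'] at hb ⊢
    exact intCl_mono (Ideal.pow_le_pow_right (by omega)) hb
  · rw [hF'] at hb ⊢
    rw [pow_succ']
    exact intCl_mul hq hb

/-- colon lemma -/
theorem QFil.colon {R : Type*} [CommRing R] [IsNoetherianRing R] {d : ℕ} {x : Fin d → R} {Q : Ideal R}
    (hQ : Q = Ideal.span (Set.range x)) {F : ℕ → Ideal R} (h : QFil Q F)
    (c : ℕ) (hc : ∀ n, F n ≤ Q ^ (n - c)) (h0 : ∀ z, (∀ q ∈ Q, q * z = 0) → z = 0) :
    ∃ n1, ∀ n ≥ n1, ∀ z, (∀ q ∈ Q, q * z ∈ F (n + 1)) → z ∈ F n := by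
  let H : ℕ → Ideal R := fun n =>
    { carrier := {z | ∀ q ∈ Q, q * z ∈ F (n + 1)}
      add_mem' := fun ha hb q hq => by rw [mul_add]; exact add_mem (ha q hq) (hb q hq)
      zero_mem' := fun q _ => by simp
      smul_mem' := fun r z hz q hq => by
        rw [smul_eq_mul, mul_left_comm]; exact Ideal.mul_mem_left _ _ (hz q hq) }
  have hH : ∀ n z, z ∈ H n ↔ ∀ q ∈ Q, q * z ∈ F (n + 1) := fun n z => Iff.rfl
  have hFH : ∀ n, F n ≤ H n := fun n z hz q hq => h.mul n (Ideal.mul_mem_mul hq hz)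
  have hQF : ∀ n, Q * H n ≤ F (n + 1) := fun n => Ideal.mul_le.2 fun q hq z hz => hz q hq
  have hfil : QFil Q H := ⟨fun n z hz q hq => h.mono _ (hz q hq), fun n => (hQF n).trans (hFH _)⟩
  let f : R →ₗ[R] (Fin d → R) := LinearMap.pi fun i => LinearMap.mulLeft R (x i)
  have hfapp : ∀ z i, f z i = x i * z := fun z i => rfl
  have hf : Function.Injective f := by
    rw [injective_iff_map_eq_zero]
    intro z hz
    apply h0
    intro q hq
    rw [hQ] at hq
    induction hq using Submodule.span_induction with
    | mem y hy => obtain ⟨i, rfl⟩ := hy; rw [← hfapp, hz]; rfl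
    | zero => simp
    | add a b _ _ ha hb => rw [add_mul, ha, hb, add_zero]
    | smul a b _ hb => rw [smul_eq_mul, mul_assoc, hb, mul_zero]
  obtain ⟨k, hk⟩ := Ideal.exists_pow_inf_eq_pow_smul Q (LinearMap.range f)
  have hHc : ∀ n, H n ≤ Q ^ (n - (c + k)) := by
    intro n z hz
    by_cases hn : n < c + k
    · rw [Nat.sub_eq_zero_of_le hn.le]; simp
    have h1 : f z ∈ (Q ^ (n - c) • ⊤ : Submodule R (Fin d → R)) := by
      classical
      have : f z = ∑ i, LinearMap.single R (fun _ : Fin d => R) i (x i * z) := by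
        funext i; simp [f, LinearMap.single_apply]
      rw [this]
      refine sum_mem fun i _ => ?_
      have h2 : x i * z ∈ (Q ^ (n - c) • ⊤ : Submodule R R) := by
        simp only [smul_eq_mul, Ideal.mul_top]
        refine Ideal.pow_le_pow_right (show n - c ≤ n + 1 - c by omega) (hc _ (hz (x i) ?_))
        rw [hQ]; exact Ideal.subset_span ⟨i, rfl⟩
      have h3 := Submodule.mem_map_of_mem (f := LinearMap.single R (fun _ : Fin d => R) i) h2
      rw [Submodule.map_smul''] at h3
      exact Submodule.smul_mono le_rfl le_top h3
    have h2 : f z ∈ Q ^ (n - c) • ⊤ ⊓ LinearMap.range f := ⟨h1, ⟨z, rfl⟩⟩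
    rw [hk _ (by omega)] at h2
    have h3 : f z ∈ Q ^ (n - c - k) • Submodule.map f ⊤ := by
      rw [Submodule.map_top]
      exact Submodule.smul_mono le_rfl inf_le_right h2
    rw [← Submodule.map_smul''] at h3
    obtain ⟨b', hb', h4⟩ := h3
    rw [hf h4] at hb'
    rw [← Nat.sub_sub]
    simpa using hb'
  obtain ⟨n1, hn1⟩ := hfil.stable _ hHc
  refine ⟨n1 + 1, fun n hn z hz => ?_⟩
  obtain ⟨m, rfl⟩ : ∃ m, n = m + 1 := ⟨n - 1, by omega⟩
  have : z ∈ H (m + 1) := hz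
  rw [hn1 m (by omega)] at this
  exact hQF m this

theorem colon_iter {R : Type*} [CommRing R] {Q : Ideal R} {F : ℕ → Ideal R} {n1 : ℕ}
    (h : ∀ n ≥ n1, ∀ z, (∀ q ∈ Q, q * z ∈ F (n + 1)) → z ∈ F n)
    (k : ℕ) : ∀ n ≥ n1, ∀ z, (∀ q ∈ Q ^ k, q * z ∈ F (n + k)) → z ∈ F n := by
  induction k with
  | zero => intro n hn z hz; simpa using hz 1 (by simp)
  | succ k ih =>
    intro n hn z hz
    apply ih n hn z
    intro q hq
    apply h (n + k) (by omega)
    intro q' hq'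
    rw [← mul_assoc]
    apply hz
    rw [pow_succ']
    exact Ideal.mul_mem_mul hq' hq

/-- powers of generators suffice -/
theorem pow_gens {R : Type*} [CommRing R] {d : ℕ} {x : Fin d → R} {Q : Ideal R}
    (hQ : Q = Ideal.span (Set.range x)) {F : ℕ → Ideal R} (h : QFil Q F) (n k : ℕ) (z : R)
    (hz : ∀ i, ∀ m ≥ k, x i ^ m * z ∈ F (n + m)) : ∃ K, ∀ q ∈ Q ^ K, q * z ∈ F (n + K) := by
  have key : ∀ s : Finset (Fin d), ∃ K, ∀ m ≥ K, ∀ q ∈ (Ideal.span (x '' s)) ^ m, q * z ∈ F (n + m) := by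
    classical
    intro s
    induction s using Finset.induction_on with
    | empty =>
      refine ⟨1, fun m hm q hq => ?_⟩
      simp only [Finset.coe_empty, Set.image_empty, Ideal.span_empty] at hq
      rw [Ideal.bot_pow (by omega)] at hq
      rw [(Submodule.mem_bot R).1 hq]; simp
    | insert i s _ ih =>
      obtain ⟨K, hK⟩ := ih
      refine ⟨K + k, fun m hm q hq => ?_⟩
      rw [Finset.coe_insert, Set.image_insert_eq, Ideal.span_insert, ← Ideal.add_eq_sup] at hq
      have hle : (Ideal.span {x i} + Ideal.span (x '' s)) ^ m ≤
          Ideal.span {x i ^ k} * Q ^ (m - k) + Q ^ (m - K) * (Ideal.span (x '' s)) ^ K := by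
        rw [add_pow]
        have hi : Ideal.span {x i} ≤ Q := by
          rw [hQ]; exact Ideal.span_mono (by rintro _ rfl; exact ⟨i, rfl⟩)
        have hs : Ideal.span (x '' s) ≤ Q := by
          rw [hQ]; exact Ideal.span_mono (by rintro _ ⟨j, _, rfl⟩; exact ⟨j, rfl⟩)
        refine (Finset.sum_induction _ (fun J : Ideal R => J ≤ _) (fun a b ha hb => sup_le ha hb) bot_le ?_)
        intro a ha
        have ha' : a ≤ m := by simpa [Nat.lt_succ_iff] using ha
        refine Ideal.mul_le_left.trans ?_
        by_cases hak : k ≤ a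
        · refine le_trans ?_ le_sup_left
          obtain ⟨a', rfl⟩ := Nat.exists_eq_add_of_le hak
          rw [pow_add, mul_assoc, Ideal.span_singleton_pow]
          refine Ideal.mul_mono_right ((Ideal.mul_mono (Ideal.pow_right_mono hi _) (Ideal.pow_right_mono hs _)).trans ?_)
          rw [← pow_add]
          exact Ideal.pow_le_pow_right (by omega)
        · refine le_trans ?_ le_sup_right
          obtain ⟨b', hb'⟩ := Nat.exists_eq_add_of_le (show K ≤ m - a by omega)
          rw [hb', pow_add, mul_comm ((Ideal.span (x '' s)) ^ K), ← mul_assoc]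
          refine Ideal.mul_mono_left ((Ideal.mul_mono (Ideal.pow_right_mono hi _) (Ideal.pow_right_mono hs _)).trans ?_)
          rw [← pow_add]
          exact Ideal.pow_le_pow_right (by omega)
      obtain ⟨a, ha, b, hb, rfl⟩ := Submodule.mem_sup.1 (hle hq)
      rw [add_mul]
      refine add_mem ?_ ?_
      · obtain ⟨w, hw, rfl⟩ := Ideal.mem_span_singleton_mul.1 ha
        have := h.pow_mul (m - k) (n + k) (Ideal.mul_mem_mul hw (hz i k le_rfl))
        rw [show n + k + (m - k) = n + m by omega] at this
        convert this using 1; ring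
      · refine Submodule.mul_induction_on hb (fun r hr w hw => ?_) (fun a b ha hb => by rw [add_mul]; exact add_mem ha hb)
        have := h.pow_mul (m - K) (n + K) (Ideal.mul_mem_mul hr (hK K le_rfl w hw))
        rw [show n + K + (m - K) = n + m by omega] at this
        rwa [mul_assoc]
  obtain ⟨K, hK⟩ := key Finset.univ
  refine ⟨K, fun q hq => hK K le_rfl q ?_⟩
  rw [Finset.coe_univ, Set.image_univ, ← hQ]
  exact hq

end X11

namespace X11
universe v w
open IsLocalRing RingTheory.Sequence

theorem exists_eq_of_isIntegral {A B : Type*} [CommRing A] [CommRing B] [Algebra A B] {z : B}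
    (h : IsIntegral A z) : ∃ k : ℕ, 0 < k ∧ ∃ a : ℕ → A,
      z ^ k + ∑ j ∈ Finset.Icc 1 k, algebraMap A B (a j) * z ^ (k - j) = 0 := by
  obtain ⟨p, hp, hz⟩ := h
  have hm : (p * Polynomial.X).Monic := hp.mul Polynomial.monic_X
  have hz' : Polynomial.eval₂ (algebraMap A B) z (p * Polynomial.X) = 0 := by
    rw [Polynomial.eval₂_mul, hz, zero_mul]
  rcases subsingleton_or_nontrivial A with hA | hA
  · have : Subsingleton B := Module.subsingleton A B
    exact ⟨1, one_pos, 0, Subsingleton.elim _ _⟩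
  set q := p * Polynomial.X
  have hdeg : 0 < q.natDegree := by
    rw [hp.natDegree_mul Polynomial.monic_X, Polynomial.natDegree_X]; omega
  refine ⟨q.natDegree, hdeg, fun j => q.coeff (q.natDegree - j), ?_⟩
  rw [Polynomial.eval₂_eq_sum_range, Finset.sum_range_succ, Polynomial.coeff_natDegree, hm.leadingCoeff, map_one, one_mul,
    add_comm] at hz'
  rw [← hz']
  congr 1
  refine Finset.sum_bij' (fun j _ => q.natDegree - j) (fun j _ => q.natDegree - j) ?_ ?_ ?_ ?_ ?_
  · intro j hj; simp at hj ⊢; omega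
  · intro j hj; simp at hj ⊢; omega
  · intro j hj; simp at hj ⊢; omega
  · intro j hj; simp at hj ⊢; omega
  · intro j hj; rfl

section subst
variable {R L : Type*} [CommRing R] [CommRing L] [Algebra R L] (y : R) [IsLocalization.Away y L]

/-- the ring `R[Q/y]` in `R_y`. -/
def blowRing (Q : Ideal R) (hy : y ∈ Q) : Subring L where
  carrier := {z | ∃ m, ∃ q ∈ Q ^ m, algebraMap R L y ^ m * z = algebraMap R L q}
  mul_mem' := by
    rintro a b ⟨m, q, hq, h⟩ ⟨m', q', hq', h'⟩
    refine ⟨m + m', q * q', by rw [pow_add]; exact Ideal.mul_mem_mul hq hq', ?_⟩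
    rw [map_mul, ← h, ← h', pow_add]; ring
  one_mem' := ⟨0, 1, by simp, by simp⟩
  add_mem' := by
    rintro a b ⟨m, q, hq, h⟩ ⟨m', q', hq', h'⟩
    refine ⟨m + m', y ^ m' * q + y ^ m * q', add_mem ?_ ?_, ?_⟩
    · rw [pow_add, mul_comm (Q ^ m)]; exact Ideal.mul_mem_mul (Ideal.pow_mem_pow hy _) hq
    · rw [pow_add]; exact Ideal.mul_mem_mul (Ideal.pow_mem_pow hy _) hq'
    · rw [map_add, map_mul, map_mul, ← h, ← h', pow_add, map_pow, map_pow]; ring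
  zero_mem' := ⟨0, 0, by simp, by simp⟩
  neg_mem' := by
    rintro a ⟨m, q, hq, h⟩
    exact ⟨m, -q, neg_mem hq, by rw [map_neg, ← h]; ring⟩

theorem blow_integral {Q : Ideal R} (hy : y ∈ Q) {F : ℕ → Ideal R}
    (hF : ∀ n, (F n : Set R) = intClSet R (Q ^ n)) (c : L) (hc : IsIntegral (blowRing (L := L) y Q hy) c) :
    ∃ K, ∀ m ≥ K, ∃ r ∈ F m, algebraMap R L r = algebraMap R L y ^ m * c := by
  have hF' : ∀ n b, b ∈ F n ↔ b ∈ intClSet R (Q ^ n) := fun n b => by rw [← hF]; rfl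
  obtain ⟨k, hk, b, hb⟩ := exists_eq_of_isIntegral hc
  have hb2 : ∀ j, ∃ m, ∃ q ∈ Q ^ m, algebraMap R L y ^ m * (b j : L) = algebraMap R L q := fun j => (b j).2
  choose μ q hq hbq using hb2
  obtain ⟨s, r0, hr0⟩ : ∃ (s : ℕ) (r0 : R), algebraMap R L y ^ s * c = algebraMap R L r0 := by
    obtain ⟨⟨r, ⟨_, s, rfl⟩⟩, h⟩ := IsLocalization.surj (Submonoid.powers y) c
    exact ⟨s, r, by rw [← h, mul_comm, map_pow]⟩
  let M := (∑ j ∈ Finset.Icc 1 k, μ j) + s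
  have hM : ∀ j ∈ Finset.Icc 1 k, μ j ≤ M := fun j hj =>
    (Finset.single_le_sum (f := μ) (fun _ _ => Nat.zero_le _) hj).trans (by simp only [M]; omega)
  set Y := algebraMap R L y with hY
  have hr : algebraMap R L (y ^ (M - s) * r0) = Y ^ M * c := by
    rw [map_mul, ← hr0, map_pow, ← mul_assoc, ← pow_add]
    congr 2; simp only [M]; omega
  set r := y ^ (M - s) * r0
  let a : ℕ → R := fun j => y ^ (M * j - μ j) * q j
  have haQ : ∀ j ∈ Finset.Icc 1 k, a j ∈ Q ^ (M * j) := by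
    intro j hj
    have h1 : μ j ≤ M * j := (hM j hj).trans (Nat.le_mul_of_pos_right _ (Finset.mem_Icc.1 hj).1)
    have := Ideal.mul_mem_mul (Ideal.pow_mem_pow hy (M * j - μ j)) (hq j)
    rwa [← pow_add, Nat.sub_add_cancel h1] at this
  have haL : ∀ j ∈ Finset.Icc 1 k, algebraMap R L (a j) = Y ^ (M * j) * (b j : L) := by
    intro j hj
    have h1 : μ j ≤ M * j := (hM j hj).trans (Nat.le_mul_of_pos_right _ (Finset.mem_Icc.1 hj).1)
    simp only [a]
    rw [map_mul, ← hbq, map_pow, ← mul_assoc, ← pow_add, Nat.sub_add_cancel h1]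
  have hE : algebraMap R L (r ^ k + ∑ j ∈ Finset.Icc 1 k, a j * r ^ (k - j)) = algebraMap R L 0 := by
    rw [map_add, map_sum, map_pow, hr, map_zero]
    have : ∀ j ∈ Finset.Icc 1 k, algebraMap R L (a j * r ^ (k - j)) = Y ^ (M * k) * ((b j : L) * c ^ (k - j)) := by
      intro j hj
      rw [map_mul, map_pow, hr, haL j hj]
      obtain ⟨i, rfl⟩ := Nat.exists_eq_add_of_le (Finset.mem_Icc.1 hj).2
      rw [Nat.add_sub_cancel_left]; ring
    rw [Finset.sum_congr rfl this, ← Finset.mul_sum, mul_pow, ← pow_mul, ← mul_add]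
    have hb' : c ^ k + ∑ j ∈ Finset.Icc 1 k, (b j : L) * c ^ (k - j) = 0 := hb
    rw [hb', mul_zero]
  obtain ⟨⟨_, l, rfl⟩, hl⟩ := (IsLocalization.eq_iff_exists (Submonoid.powers y) L).1 hE
  simp only [mul_zero] at hl
  have hmem : y ^ l * r ∈ F (M + l) := by
    rw [hF']
    refine ⟨k, hk, fun j => y ^ (l * j) * a j, ?_, ?_⟩
    · intro j hj
      have := Ideal.mul_mem_mul (Ideal.pow_mem_pow hy (l * j)) (haQ j hj)
      rw [← pow_add] at this
      rw [← pow_mul]; convert this using 2; ring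
    · have : ∀ j ∈ Finset.Icc 1 k, y ^ (l * j) * a j * (y ^ l * r) ^ (k - j) = y ^ (l * k) * (a j * r ^ (k - j)) := by
        intro j hj
        obtain ⟨i, rfl⟩ := Nat.exists_eq_add_of_le (Finset.mem_Icc.1 hj).2
        rw [Nat.add_sub_cancel_left]; ring
      rw [Finset.sum_congr rfl this, ← Finset.mul_sum, mul_pow, ← pow_mul, ← mul_add]
      obtain ⟨k', rfl⟩ : ∃ k', k = k' + 1 := ⟨k - 1, by omega⟩
      rw [show l * (k' + 1) = l * k' + l by ring, pow_add, mul_assoc, hl, mul_zero]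
  refine ⟨M + l, fun m hm => ⟨y ^ (m - (M + l)) * (y ^ l * r), ?_, ?_⟩⟩
  · have := (QFil_intCl hF).pow_mul (m - (M + l)) (M + l) (Ideal.mul_mem_mul (Ideal.pow_mem_pow hy _) hmem)
    rwa [show M + l + (m - (M + l)) = m by omega] at this
  · rw [map_mul, map_mul, hr, map_pow, map_pow, ← hY, ← mul_assoc, ← mul_assoc, ← pow_add, ← pow_add]
    congr 2; omega
end subst

section M5b
open MvPolynomial
attribute [local instance] MvPolynomial.algebraMvPolynomial

theorem mem_map_C_iff' {R : Type*} [CommRing R] {σ : Type*} (I : Ideal R) (p : MvPolynomial σ R) :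
    p ∈ I.map (C : R →+* MvPolynomial σ R) ↔ ∀ m, p.coeff m ∈ I := MvPolynomial.mem_map_C_iff

section
variable {R L : Type*} [CommRing R] [CommRing L] [Algebra R L] {d : ℕ} (x : Fin d → R) (i : Fin d)

/-- the substitution `t_i ↦ -∑_{l ≠ i} t_l x_l / x_i`. -/
noncomputable def sub (v : L) : MvPolynomial (Fin d) R →+* MvPolynomial (Fin d) L :=
  eval₂Hom (C.comp (algebraMap R L)) (fun j => if j = i then
    - ∑ l ∈ Finset.univ.erase i, X l * C (algebraMap R L (x l) * v) else X j)

theorem sub_C (v : L) (r : R) : sub x i v (C r) = C (algebraMap R L r) := by simp [sub]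

theorem sub_X_self (v : L) : sub x i v (X i) = - ∑ l ∈ Finset.univ.erase i, X l * C (algebraMap R L (x l) * v) := by
  simp [sub]

theorem sub_X_ne (v : L) (j : Fin d) (h : j ≠ i) : sub x i v (X j) = X j := by
  simp [sub, h]

theorem sub_gen (v : L) (hv : algebraMap R L (x i) * v = 1) : sub x i v (genElt R d x) = 0 := by
  rw [genElt, map_sum, ← Finset.add_sum_erase _ _ (Finset.mem_univ i), map_mul, sub_X_self, sub_C, neg_mul, Finset.sum_mul,
    ← Finset.sum_neg_distrib, ← Finset.sum_add_distrib]
  refine Finset.sum_eq_zero fun l hl => ?_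
  have e1 : C v * C (algebraMap R L (x i)) = (1 : MvPolynomial (Fin d) L) := by
    rw [← map_mul, mul_comm, hv, map_one]
  rw [map_mul (sub x i v), sub_X_ne _ _ _ _ (Finset.ne_of_mem_erase hl), sub_C, map_mul]
  linear_combination (- X l * C (algebraMap R L (x l))) * e1

theorem sub_eq_map (v : L) (hv : algebraMap R L (x i) * v = 1) (g : MvPolynomial (Fin d) R) :
    ∃ h, sub x i v g = map (algebraMap R L) g + h * map (algebraMap R L) (genElt R d x) := by
  have key : (Ideal.Quotient.mk (Ideal.span {map (algebraMap R L) (genElt R d x)})).comp (sub x i v) =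
      (Ideal.Quotient.mk (Ideal.span {map (algebraMap R L) (genElt R d x)})).comp (map (algebraMap R L)) := by
    apply MvPolynomial.ringHom_ext
    · intro r; simp [sub_C]
    · intro j
      by_cases hj : j = i
      · subst hj
        rw [RingHom.comp_apply, RingHom.comp_apply, Ideal.Quotient.eq, Ideal.mem_span_singleton']
        refine ⟨- C v, ?_⟩
        rw [sub_X_self, genElt, map_sum, ← Finset.add_sum_erase _ _ (Finset.mem_univ j)]
        have e1 : C v * C (algebraMap R L (x j)) = (1 : MvPolynomial (Fin d) L) := by
          rw [← map_mul, mul_comm, hv, map_one]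
        have e2 : ∀ l, map (algebraMap R L) (X l * C (x l)) = X l * C (algebraMap R L (x l)) := by intro l; simp
        simp only [e2, map_X, map_mul]
        have e3 : ∀ l, X l * (C (algebraMap R L (x l)) * C v) = C v * (X l * C (algebraMap R L (x l)) : MvPolynomial (Fin d) L) := by
          intro l; ring
        simp only [e3, ← Finset.mul_sum]
        linear_combination (- X j) * e1
      · rw [RingHom.comp_apply, sub_X_ne _ _ _ _ hj, RingHom.comp_apply, map_X]
  have := congrArg (fun f => f g) key
  simp only [RingHom.comp_apply] at this
  rw [Ideal.Quotient.eq, Ideal.mem_span_singleton'] at this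
  obtain ⟨h, hh⟩ := this
  exact ⟨h, by rw [hh]; ring⟩

variable {Q : Ideal R} (hQ : Q = Ideal.span (Set.range x)) (hy : x i ∈ Q)

theorem sub_mem (hQ : Q = Ideal.span (Set.range x)) (v : L) (hv : algebraMap R L (x i) * v = 1) (g : MvPolynomial (Fin d) R) :
    sub x i v g ∈ (map (σ := Fin d) (blowRing (L := L) (x i) Q hy).subtype).range := by
  have hC : ∀ z ∈ blowRing (L := L) (x i) Q hy, C z ∈ (map (σ := Fin d) (blowRing (L := L) (x i) Q hy).subtype).range :=
    fun z hz => ⟨C ⟨z, hz⟩, by simp⟩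
  have hX : ∀ j, (X j : MvPolynomial (Fin d) L) ∈ (map (σ := Fin d) (blowRing (L := L) (x i) Q hy).subtype).range :=
    fun j => ⟨X j, by simp⟩
  induction g using MvPolynomial.induction_on with
  | C a =>
    rw [sub_C]
    exact hC _ ⟨0, a, by simp, by simp⟩
  | add p q hp hq => rw [map_add]; exact add_mem hp hq
  | mul_X p j hp =>
    rw [map_mul]
    refine mul_mem hp ?_
    by_cases hj : j = i
    · subst hj
      rw [sub_X_self]
      refine neg_mem (sum_mem fun l hl => mul_mem (hX l) (hC _ ⟨1, x l, ?_, ?_⟩))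
      · rw [pow_one, hQ]; exact Ideal.subset_span ⟨l, rfl⟩
      · rw [pow_one, mul_left_comm, hv, mul_one]
    · rw [sub_X_ne _ _ _ _ hj]; exact hX j

theorem sub_mem_pow (hQ : Q = Ideal.span (Set.range x)) (v : L) (hv : algebraMap R L (x i) * v = 1) (n : ℕ) (g : MvPolynomial (Fin d) R)
    (hg : g ∈ (Q ^ n).map (C : R →+* MvPolynomial (Fin d) R)) :
    sub x i v g * C v ^ n ∈ (map (σ := Fin d) (blowRing (L := L) (x i) Q hy).subtype).range := by
  have hC : ∀ z ∈ blowRing (L := L) (x i) Q hy, C z ∈ (map (σ := Fin d) (blowRing (L := L) (x i) Q hy).subtype).range :=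
    fun z hz => ⟨C ⟨z, hz⟩, by simp⟩
  refine Submodule.span_induction (fun y hy' => ?_) ?_ (fun a b _ _ ha hb => ?_) (fun a b _ hb => ?_) hg
  · obtain ⟨r, hr, rfl⟩ := hy'
    rw [sub_C, ← map_pow, ← map_mul]
    refine hC _ ⟨n, r, hr, ?_⟩
    rw [mul_left_comm, ← mul_pow, hv, one_pow, mul_one]
  · rw [map_zero, zero_mul]; exact zero_mem _
  · rw [map_add, add_mul]; exact add_mem ha hb
  · rw [smul_eq_mul, map_mul, mul_assoc]; exact mul_mem (sub_mem x i hy hQ v hv a) hb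

theorem subst_main {F : ℕ → Ideal R} (hQ : Q = Ideal.span (Set.range x))
    (hF : ∀ n, (F n : Set R) = intClSet R (Q ^ n)) (n k : ℕ) (g : MvPolynomial (Fin d) R) (a : ℕ → MvPolynomial (Fin d) R)
    (ha : ∀ j ∈ Finset.Icc 1 k, a j ∈ (Q ^ (n * j)).map (C : R →+* MvPolynomial (Fin d) R))
    (h : g ^ k + ∑ j ∈ Finset.Icc 1 k, a j * g ^ (k - j) ∈ Ideal.span {genElt R d x}) :
    ∃ K, ∀ m ≥ K, C (x i) ^ m * g ∈ (F (n + m)).map (C : R →+* MvPolynomial (Fin d) R) ⊔ Ideal.span {genElt R d x} := by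
  have hy : x i ∈ Q := by rw [hQ]; exact Ideal.subset_span ⟨i, rfl⟩
  have hfil := QFil_intCl hF
  let L := Localization.Away (x i)
  let ι := algebraMap R L
  let v : L := IsLocalization.Away.invSelf (x i)
  have hv : algebraMap R L (x i) * v = 1 := IsLocalization.Away.mul_invSelf (x i)
  set T := blowRing (L := L) (x i) Q hy
  have ha2 : ∀ j ∈ Finset.Icc 1 k, ∃ b : MvPolynomial (Fin d) T, map T.subtype b = sub x i v (a j) * C v ^ (n * j) :=
    fun j hj => sub_mem_pow x i hy hQ v hv (n * j) (a j) (ha j hj)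
  classical
  choose! b hb using ha2
  let ζ := sub x i v g * C v ^ n
  have hIntg : IsIntegral (MvPolynomial (Fin d) T) ζ := by
    refine isIntegral_of_eq ζ k b ?_
    have e1 : ∀ j ∈ Finset.Icc 1 k, algebraMap (MvPolynomial (Fin d) T) (MvPolynomial (Fin d) L) (b j) * ζ ^ (k - j) =
        C v ^ (n * k) * sub x i v (a j * g ^ (k - j)) := by
      intro j hj
      have : algebraMap (MvPolynomial (Fin d) T) (MvPolynomial (Fin d) L) (b j) = map T.subtype (b j) := rfl
      rw [this, hb j hj]
      obtain ⟨l, rfl⟩ := Nat.exists_eq_add_of_le (Finset.mem_Icc.1 hj).2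
      rw [Nat.add_sub_cancel_left, map_mul, map_pow]
      simp only [ζ]
      ring
    rw [Finset.sum_congr rfl e1, ← Finset.mul_sum]
    have e2 : ζ ^ k = C v ^ (n * k) * sub x i v (g ^ k) := by
      simp only [ζ]; rw [map_pow]; ring
    rw [e2, ← mul_add, ← map_sum, ← map_add]
    obtain ⟨w, hw⟩ := Ideal.mem_span_singleton'.1 h
    rw [← hw, map_mul, sub_gen x i v hv, mul_zero, mul_zero]
  have hcoef := MvPolynomial.isIntegral_iff_isIntegral_coeff.1 hIntg
  have h3 : ∀ α, ∃ K, ∀ m ≥ K, ∃ r ∈ F m, algebraMap R L r = algebraMap R L (x i) ^ m * ζ.coeff α :=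
    fun α => blow_integral (x i) hy hF _ (hcoef α)
  choose K hK using h3
  let M := ∑ α ∈ ζ.support, K α
  have hM : ∀ α ∈ ζ.support, K α ≤ n + M := fun α hα =>
    (Finset.single_le_sum (f := K) (fun _ _ => Nat.zero_le _) hα).trans (by simp only [M]; omega)
  have h4 : ∀ α ∈ ζ.support, ∃ r ∈ F (n + M), algebraMap R L r = algebraMap R L (x i) ^ (n + M) * ζ.coeff α :=
    fun α hα => hK α _ (hM α hα)
  choose! r hr1 hr2 using h4
  let G : MvPolynomial (Fin d) R := ∑ α ∈ ζ.support, monomial α (r α)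
  have hG : G ∈ (F (n + M)).map (C : R →+* MvPolynomial (Fin d) R) := by
    refine sum_mem fun α hα => ?_
    have : monomial α (r α) = C (r α) * monomial α 1 := by rw [C_mul_monomial, mul_one]
    rw [this]
    exact Ideal.mul_mem_right _ _ (Ideal.mem_map_of_mem _ (hr1 α hα))
  have hG2 : map ι G = C (ι (x i)) ^ (n + M) * ζ := by
    rw [map_sum]
    conv_rhs => rw [ζ.as_sum, Finset.mul_sum]
    refine Finset.sum_congr rfl fun α hα => ?_
    rw [map_monomial, hr2 α hα, ← map_pow C, C_mul_monomial]
  have hG3 : map ι G = C (ι (x i)) ^ M * sub x i v g := by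
    rw [hG2]
    have : C (ι (x i)) * C v = (1 : MvPolynomial (Fin d) L) := by rw [← map_mul, hv, map_one]
    calc _ = C (ι (x i)) ^ M * sub x i v g * (C (ι (x i)) * C v) ^ n := by simp only [ζ]; ring
      _ = _ := by rw [this, one_pow, mul_one]
  obtain ⟨e, he⟩ := sub_eq_map x i v hv g
  have hloc : IsLocalization ((Submonoid.powers (x i)).map (C (σ := Fin d))) (MvPolynomial (Fin d) L) := inferInstance
  have halg : algebraMap (MvPolynomial (Fin d) R) (MvPolynomial (Fin d) L) = map ι := rfl
  obtain ⟨⟨e', ⟨_, ⟨_, ⟨s, rfl⟩, rfl⟩⟩⟩, he'⟩ := IsLocalization.surj ((Submonoid.powers (x i)).map (C (σ := Fin d))) e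
  simp only [halg] at he'
  have he'' : e * C (ι (x i)) ^ s = map ι e' := by rw [← he']; simp [ι]
  have hE : algebraMap (MvPolynomial (Fin d) R) (MvPolynomial (Fin d) L) (C (x i) ^ s * (G - C (x i) ^ M * g)) =
      algebraMap (MvPolynomial (Fin d) R) (MvPolynomial (Fin d) L) (C (x i) ^ M * e' * genElt R d x) := by
    simp only [halg]
    rw [map_mul, map_sub, map_mul, map_mul, map_mul, hG3, he, map_pow, map_pow, map_C, ← he'']
    ring
  obtain ⟨⟨_, ⟨_, ⟨l, rfl⟩, rfl⟩⟩, hl⟩ := (IsLocalization.eq_iff_exists ((Submonoid.powers (x i)).map (C (σ := Fin d))) _).1 hE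
  simp only at hl
  refine ⟨M + s + l, fun m hm => ?_⟩
  obtain ⟨m', rfl⟩ := Nat.exists_eq_add_of_le hm
  have hfin : C (x i) ^ (M + s + l + m') * g = C (x i) ^ (s + l + m') * G - (C (x i) ^ (M + l + m') * e') * genElt R d x := by
    rw [map_pow] at hl
    linear_combination (- C (x i) ^ m') * hl
  rw [hfin]
  refine Submodule.sub_mem _ (Ideal.mem_sup_left ?_) (Ideal.mem_sup_right (Ideal.mul_mem_left _ _ (Ideal.mem_span_singleton_self _)))
  have h5 := hfil.pow_mul (s + l + m') (n + M)
  rw [show n + M + (s + l + m') = n + (M + s + l + m') by ring] at h5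
  have h6 := Ideal.map_mono (f := (C : R →+* MvPolynomial (Fin d) R)) h5
  rw [Ideal.map_mul] at h6
  refine h6 (Ideal.mul_mem_mul ?_ hG)
  rw [← map_pow]
  exact Ideal.mem_map_of_mem _ (Ideal.pow_mem_pow hy _)
end
end M5b

section M5c
open MvPolynomial

theorem mccoy {R : Type*} [CommRing R] {d : ℕ} {x : Fin d → R} {Q : Ideal R}
    (hQ : Q = Ideal.span (Set.range x)) {H : ℕ → Ideal R} (h : QFil Q H) (n : ℕ) (g : MvPolynomial (Fin d) R)
    (hg : genElt R d x * g ∈ (H (n + 1)).map (C : R →+* MvPolynomial (Fin d) R)) (i : Fin d) (α : Fin d →₀ ℕ) :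
    ∃ K, ∀ m ≥ K, x i ^ m * g.coeff α ∈ H (n + m) := by
  rw [MvPolynomial.mem_map_C_iff] at hg
  have hxQ : ∀ j, x j ∈ Q := fun j => by rw [hQ]; exact Ideal.subset_span ⟨j, rfl⟩
  have hcoef : ∀ β : Fin d →₀ ℕ, coeff β (genElt R d x * g) =
      ∑ j, if j ∈ β.support then x j * coeff (β - Finsupp.single j 1) g else 0 := by
    intro β
    rw [genElt, Finset.sum_mul, coeff_sum]
    refine Finset.sum_congr rfl fun j _ => ?_
    rw [mul_assoc, coeff_X_mul']
    split_ifs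
    · rw [coeff_C_mul]
    · rfl
  have key : ∀ N : ℕ, ∀ α : Fin d →₀ ℕ, g.totalDegree < α i + N → ∃ K, ∀ m ≥ K, x i ^ m * g.coeff α ∈ H (n + m) := by
    intro N
    induction N with
    | zero =>
      intro α hα
      refine ⟨0, fun m _ => ?_⟩
      have : coeff α g = 0 := by
        by_contra hne
        have := le_totalDegree (mem_support_iff.2 hne)
        have h2 : α i ≤ α.sum fun _ e => e := by
          by_cases hi : α i = 0
          · omega
          · exact Finset.single_le_sum (f := fun j => α j) (fun _ _ => Nat.zero_le _) (Finsupp.mem_support_iff.2 hi)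
        omega
      rw [this, mul_zero]; exact zero_mem _
    | succ N ih =>
      intro α hα
      let β := α + Finsupp.single i 1
      have hβ : ∀ j : Fin d, j ≠ i → ∃ K, ∀ m ≥ K, x i ^ m * g.coeff (β - Finsupp.single j 1) ∈ H (n + m) := by
        intro j hj
        apply ih
        have : (β - Finsupp.single j 1 : Fin d →₀ ℕ) i = α i + 1 := by
          simp [β, Finsupp.single_apply, hj]
        omega
      choose! K hK using hβ
      refine ⟨(∑ j, K j) + 1, fun m hm => ?_⟩
      obtain ⟨m', rfl⟩ : ∃ m', m = m' + 1 := ⟨m - 1, by omega⟩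
      have e1 := hcoef β
      rw [← Finset.add_sum_erase _ _ (Finset.mem_univ i)] at e1
      have hi : i ∈ β.support := by simp [β]
      have hi2 : β - Finsupp.single i 1 = α := by simp [β]
      rw [if_pos hi, hi2] at e1
      have e2 : x i ^ (m' + 1) * coeff α g = x i ^ m' * coeff β (genElt R d x * g) -
        x i ^ m' * ∑ j ∈ Finset.univ.erase i, (if j ∈ β.support then x j * coeff (β - Finsupp.single j 1) g else 0) := by
        rw [e1]; ring
      rw [e2]
      refine Submodule.sub_mem _ ?_ ?_
      · have := h.pow_mul m' (n + 1) (Ideal.mul_mem_mul (Ideal.pow_mem_pow (hxQ i) m') (hg β))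
        convert this using 2; ring
      · rw [Finset.mul_sum]
        refine sum_mem fun j hj => ?_
        split_ifs
        · have hK' := hK j (Finset.ne_of_mem_erase hj) m' (by
            have := Finset.single_le_sum (f := K) (fun _ _ => Nat.zero_le _) (Finset.mem_univ j)
            omega)
          have := h.mul _ (Ideal.mul_mem_mul (hxQ j) hK')
          rw [mul_left_comm, ← add_assoc]
          exact this
        · simp
  exact key (g.totalDegree + 1) α (by omega)

theorem mccoy' {R : Type*} [CommRing R] {d : ℕ} {x : Fin d → R} {Q : Ideal R}
    (hQ : Q = Ideal.span (Set.range x)) {H : ℕ → Ideal R} (h : QFil Q H) {n1 : ℕ}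
    (hcol : ∀ n ≥ n1, ∀ z, (∀ q ∈ Q, q * z ∈ H (n + 1)) → z ∈ H n)
    (n : ℕ) (hn : n1 ≤ n) (g : MvPolynomial (Fin d) R)
    (hg : genElt R d x * g ∈ (H (n + 1)).map (C : R →+* MvPolynomial (Fin d) R)) :
    g ∈ (H n).map (C : R →+* MvPolynomial (Fin d) R) := by
  rw [MvPolynomial.mem_map_C_iff]
  intro α
  choose K hK using fun i => mccoy hQ h n g hg i α
  obtain ⟨N, hN⟩ := pow_gens hQ h n (∑ i, K i) (g.coeff α) (fun i m hm => hK i m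
    ((Finset.single_le_sum (f := K) (fun _ _ => Nat.zero_le _) (Finset.mem_univ i)).trans hm))
  exact colon_iter hcol N n hn _ hN

theorem gen_nzd {R : Type*} [CommRing R] {d : ℕ} {x : Fin d → R} {Q : Ideal R}
    (hQ : Q = Ideal.span (Set.range x)) (h0 : ∀ z, (∀ q ∈ Q, q * z = 0) → z = 0)
    (g : MvPolynomial (Fin d) R) (hg : genElt R d x * g = 0) : g = 0 := by
  have := mccoy' hQ (H := fun _ => ⊥) ⟨fun _ => le_rfl, fun _ => by simp⟩ (n1 := 0)
    (fun n _ z hz => by simpa using h0 z (by simpa using hz)) 0 le_rfl g (by rw [hg]; exact zero_mem _)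
  simpa [Ideal.map_bot] using this
end M5c

end X11

namespace X11
universe v w
open IsLocalRing RingTheory.Sequence

set_option linter.unusedSectionVars false
section Gen
open MvPolynomial
variable (R : Type u) [CommRing R] [IsLocalRing R] [IsNoetherianRing R] (d : ℕ) (hP : (genPrime R d).IsPrime)

theorem gl_flatA : Module.Flat (GenPoly R d) (GenLocHat R d hP) := by
  have : Module.Flat (GenLoc R d hP) (GenLocHat R d hP) := AdicCompletion.flat_of_isNoetherian _
  have : Module.Flat (GenPoly R d) (GenLoc R d hP) := IsLocalization.flat _ (genPrime R d).primeCompl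
  exact Module.Flat.trans (GenPoly R d) (GenLoc R d hP) _

theorem gl_flat : Module.Flat R (GenLocHat R d hP) := by
  have := gl_flatA R d hP
  exact Module.Flat.trans R (GenPoly R d) _

theorem gl_max : maximalIdeal (GenLoc R d hP) = (genPrime R d).map (algebraMap (GenPoly R d) (GenLoc R d hP)) :=
  (IsLocalization.AtPrime.map_eq_maximalIdeal (genPrime R d) (GenLoc R d hP)).symm

theorem glh_max' : maximalIdeal (GenLocHat R d hP) =
    (maximalIdeal (GenLoc R d hP)).map (algebraMap (GenLoc R d hP) (GenLocHat R d hP)) :=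
  AdicCompletion.maximalIdeal_eq_map

theorem glh_maxA : maximalIdeal (GenLocHat R d hP) =
    (genPrime R d).map (algebraMap (GenPoly R d) (GenLocHat R d hP)) := by
  rw [glh_max', IsScalarTower.algebraMap_eq (GenPoly R d) (GenLoc R d hP) (GenLocHat R d hP), ← Ideal.map_map]
  exact congrArg _ (gl_max R d hP)

theorem glh_max : maximalIdeal (GenLocHat R d hP) = (maximalIdeal R).map (algebraMap R (GenLocHat R d hP)) := by
  rw [glh_maxA, IsScalarTower.algebraMap_eq R (GenPoly R d) (GenLocHat R d hP), ← Ideal.map_map]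
  rfl

theorem glh_noeth : IsNoetherianRing (GenLocHat R d hP) := by
  have hFG : (maximalIdeal (GenLoc R d hP)).FG := IsNoetherian.noetherian _
  have := ac_complete hFG
  refine isNoetherianRing_of_complete ((maximalIdeal (GenLoc R d hP)).map (algebraMap (GenLoc R d hP) (GenLocHat R d hP))) (hFG.map _) (GenLoc R d hP) (algebraMap _ _) fun b => ?_
  obtain ⟨r, hr⟩ := ac_approx hFG 1 b
  exact ⟨r, by simpa using hr⟩

theorem glh_complete : IsAdicComplete (maximalIdeal (GenLocHat R d hP)) (GenLocHat R d hP) := by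
  rw [glh_max']
  exact ac_complete (IsNoetherian.noetherian _)

theorem glh_approx0 (N : ℕ) (z : GenLocHat R d hP) : ∃ u ∈ (genPrime R d).primeCompl, ∃ g : GenPoly R d,
    algebraMap _ _ u * z - algebraMap _ _ g ∈ maximalIdeal (GenLocHat R d hP) ^ N := by
  have hFG : (maximalIdeal (GenLoc R d hP)).FG := IsNoetherian.noetherian _
  obtain ⟨r, hr⟩ := ac_approx hFG N z
  rw [← glh_max'] at hr
  obtain ⟨⟨g, u⟩, hg⟩ := IsLocalization.surj (genPrime R d).primeCompl r
  refine ⟨u, u.2, g, ?_⟩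
  simp only at hg
  have : algebraMap (GenPoly R d) (GenLocHat R d hP) u * z - algebraMap _ _ g = algebraMap (GenPoly R d) (GenLocHat R d hP) u *
      (z - algebraMap (GenLoc R d hP) (GenLocHat R d hP) r) := by
    rw [mul_sub, IsScalarTower.algebraMap_apply (GenPoly R d) (GenLoc R d hP) (GenLocHat R d hP) u,
     IsScalarTower.algebraMap_apply (GenPoly R d) (GenLoc R d hP) (GenLocHat R d hP) g, ← hg, map_mul]; ring
  rw [this]
  exact Ideal.mul_mem_left _ _ hr

theorem glh_approx (N : ℕ) (J : Ideal (GenPoly R d)) (z : GenLocHat R d hP) (hz : z ∈ J.map (algebraMap _ (GenLocHat R d hP))) :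
    ∃ u ∈ (genPrime R d).primeCompl, ∃ g ∈ J,
    algebraMap _ _ u * z - algebraMap _ _ g ∈ maximalIdeal (GenLocHat R d hP) ^ N := by
  refine Submodule.span_induction (fun y hy' => ?_) ?_ (fun a b _ _ ha hb => ?_) (fun a b _ hb => ?_) hz
  · obtain ⟨r, hr, rfl⟩ := hy'
    exact ⟨1, one_mem _, r, hr, by simp⟩
  · exact ⟨1, one_mem _, 0, zero_mem _, by simp⟩
  · obtain ⟨u, hu, g, hg, h1⟩ := ha
    obtain ⟨u', hu', g', hg', h1'⟩ := hb
    refine ⟨u * u', mul_mem hu hu', u' * g + u * g', add_mem (Ideal.mul_mem_left _ _ hg) (Ideal.mul_mem_left _ _ hg'), ?_⟩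
    have := add_mem (Ideal.mul_mem_left _ (algebraMap _ (GenLocHat R d hP) u') h1) (Ideal.mul_mem_left _ (algebraMap _ (GenLocHat R d hP) u) h1')
    convert this using 1
    simp only [map_mul, map_add]; ring
  · obtain ⟨u, hu, g, hg, h1⟩ := hb
    obtain ⟨u', hu', g', h1'⟩ := glh_approx0 R d hP N a
    refine ⟨u * u', mul_mem hu hu', g' * g, (Ideal.mul_mem_left _ _ hg), ?_⟩
    have := add_mem (Ideal.mul_mem_left _ (algebraMap _ (GenLocHat R d hP) u' * a) h1) (Ideal.mul_mem_left _ (algebraMap _ (GenLocHat R d hP) g) h1')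
    convert this using 1
    simp only [map_mul, smul_eq_mul]; ring

theorem glh_contract (N : ℕ) (J : Ideal (GenPoly R d)) (hJ : (genPrime R d) ^ N ≤ J) (g : GenPoly R d)
    (hg : algebraMap _ (GenLocHat R d hP) g ∈ J.map (algebraMap _ (GenLocHat R d hP))) :
    ∃ u ∈ (genPrime R d).primeCompl, u * g ∈ J := by
  have hFG : (maximalIdeal (GenLoc R d hP)).FG := IsNoetherian.noetherian _
  obtain ⟨u, hu, j, hj, h1⟩ := glh_approx R d hP N J _ hg
  rw [← map_mul, ← map_sub, IsScalarTower.algebraMap_apply (GenPoly R d) (GenLoc R d hP) (GenLocHat R d hP), glh_max',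
    ac_algebraMap_mem hFG, gl_max, ← Ideal.map_pow, IsLocalization.mem_map_algebraMap_iff (genPrime R d).primeCompl] at h1
  obtain ⟨⟨j', u'⟩, h2⟩ := h1
  rw [← map_mul, IsLocalization.eq_iff_exists (genPrime R d).primeCompl] at h2
  obtain ⟨u'', h3⟩ := h2
  simp only at h3
  refine ⟨u'' * (u' * u), mul_mem u''.2 (mul_mem u'.2 hu), ?_⟩
  have : (u'' : GenPoly R d) * (u' * u) * g = u'' * ((u * g - j) * u') + u'' * u' * j := by ring
  rw [this, h3]
  exact add_mem (Ideal.mul_mem_left _ _ (hJ j'.2)) (Ideal.mul_mem_left _ _ hj)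

theorem glh_unit (u : GenPoly R d) (hu : u ∈ (genPrime R d).primeCompl) : IsUnit (algebraMap _ (GenLocHat R d hP) u) := by
  rw [IsScalarTower.algebraMap_apply (GenPoly R d) (GenLoc R d hP) (GenLocHat R d hP)]
  exact (IsLocalization.map_units (GenLoc R d hP) ⟨u, hu⟩).map _

theorem genMap_eq (x : Fin d → R) : genMap R d hP x = (Ideal.Quotient.mk _).comp (algebraMap R (GenLocHat R d hP)) := by
  rw [genMap, IsScalarTower.algebraMap_eq R (GenLoc R d hP) (GenLocHat R d hP)]

/-- `R[t] → R''` -/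
noncomputable def phi (x : Fin d → R) : GenPoly R d →+* GenQuot R d hP x :=
  (Ideal.Quotient.mk _).comp (algebraMap (GenPoly R d) (GenLocHat R d hP))

theorem genMap_eq' (x : Fin d → R) : genMap R d hP x = (phi R d hP x).comp C := by
  rw [genMap_eq, phi, IsScalarTower.algebraMap_eq R (GenPoly R d) (GenLocHat R d hP), RingHom.comp_assoc]; rfl

theorem genEltHat_eq (x : Fin d → R) : genEltHat R d hP x = algebraMap _ _ (genElt R d x) := by
  rw [genEltHat, genEltLoc, ← IsScalarTower.algebraMap_apply]

theorem phi_gen (x : Fin d → R) : phi R d hP x (genElt R d x) = 0 := by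
  rw [phi, RingHom.comp_apply, ← genEltHat_eq, Ideal.Quotient.eq_zero_iff_mem]
  exact Ideal.mem_span_singleton_self _

theorem phi_approx (x : Fin d → R) (N : ℕ) (J : Ideal (GenPoly R d)) (z : GenQuot R d hP x) (hz : z ∈ J.map (phi R d hP x)) :
    ∃ u ∈ (genPrime R d).primeCompl, ∃ g ∈ J,
    phi R d hP x u * z - phi R d hP x g ∈ (genPrime R d ^ N).map (phi R d hP x) := by
  rw [phi, ← Ideal.map_map] at hz
  obtain ⟨z, hz', rfl⟩ := (Ideal.mem_map_iff_of_surjective _ Ideal.Quotient.mk_surjective).1 hz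
  obtain ⟨u, hu, g, hg, h⟩ := glh_approx R d hP N J z hz'
  refine ⟨u, hu, g, hg, ?_⟩
  rw [phi, ← Ideal.map_map, Ideal.map_pow _ (genPrime R d), ← glh_maxA]
  have := Ideal.mem_map_of_mem (Ideal.Quotient.mk (Ideal.span {genEltHat R d hP x})) h
  simpa using this

theorem phi_contract (x : Fin d → R) (N : ℕ) (J : Ideal (GenPoly R d)) (hJ : (genPrime R d) ^ N ≤ J) (g : GenPoly R d)
    (hg : phi R d hP x g ∈ J.map (phi R d hP x)) :
    ∃ u ∈ (genPrime R d).primeCompl, u * g ∈ J ⊔ Ideal.span {genElt R d x} := by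
  refine glh_contract R d hP N _ (hJ.trans le_sup_left) g ?_
  rw [phi, ← Ideal.map_map] at hg
  rw [Ideal.map_sup, Ideal.map_span, Set.image_singleton, ← genEltHat_eq]
  have := Ideal.mem_comap.2 (show Ideal.Quotient.mk (Ideal.span {genEltHat R d hP x}) (algebraMap (GenPoly R d) (GenLocHat R d hP) g) ∈ _ from hg)
  rwa [Ideal.comap_map_of_surjective _ Ideal.Quotient.mk_surjective, ← RingHom.ker_eq_comap_bot, Ideal.mk_ker] at this

theorem phi_unit (x : Fin d → R) (u : GenPoly R d) (hu : u ∈ (genPrime R d).primeCompl) : IsUnit (phi R d hP x u) := by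
  rw [phi, RingHom.comp_apply]
  exact (glh_unit R d hP u hu).map _

theorem gq_noeth (x : Fin d → R) : IsNoetherianRing (GenQuot R d hP x) := by
  have := glh_noeth R d hP
  infer_instance
end Gen

section Gen2
open MvPolynomial
variable (R : Type u) [CommRing R] [IsLocalRing R] [IsNoetherianRing R] (d : ℕ) (hP : (genPrime R d).IsPrime)

theorem phi_approx_fin (x : Fin d → R) (N : ℕ) (J : ℕ → Ideal (GenPoly R d)) (z : ℕ → GenQuot R d hP x) (s : Finset ℕ)
    (hz : ∀ j ∈ s, z j ∈ (J j).map (phi R d hP x)) :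
    ∃ u ∈ (genPrime R d).primeCompl, ∃ g : ℕ → GenPoly R d, ∀ j ∈ s, g j ∈ J j ∧
    phi R d hP x u * z j - phi R d hP x (g j) ∈ (genPrime R d ^ N).map (phi R d hP x) := by
  classical
  induction s using Finset.induction_on with
  | empty => exact ⟨1, one_mem _, 0, by simp⟩
  | insert i s hi ih =>
    obtain ⟨u, hu, g, h⟩ := ih (fun j hj => hz j (Finset.mem_insert_of_mem hj))
    obtain ⟨u', hu', g', hg', h'⟩ := phi_approx R d hP x N (J i) (z i) (hz i (Finset.mem_insert_self _ _))
    refine ⟨u * u', mul_mem hu hu', fun j => if j = i then u * g' else u' * g j, fun j hj => ?_⟩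
    by_cases hji : j = i
    · subst hji
      simp only [if_true]
      refine ⟨Ideal.mul_mem_left _ _ hg', ?_⟩
      have := Ideal.mul_mem_left _ (phi R d hP x u) h'
      convert this using 1
      simp only [map_mul]; ring
    · have hjs := Finset.mem_of_mem_insert_of_ne hj hji
      simp only [if_neg hji]
      refine ⟨Ideal.mul_mem_left _ _ (h j hjs).1, ?_⟩
      have := Ideal.mul_mem_left _ (phi R d hP x u') (h j hjs).2
      convert this using 1
      simp only [map_mul]; ring

theorem eq_transfer {A : Type v} {B : Type w} [CommRing A] [CommRing B] (φ : A →+* B) (I : Ideal B) (k : ℕ)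
    (u : A) (g : ℕ → A) (z : B) (a : ℕ → B) (h0 : φ u * z - φ (g 0) ∈ I)
    (h1 : ∀ j ∈ Finset.Icc 1 k, φ u * a j - φ (g j) ∈ I)
    (h : z ^ k + ∑ j ∈ Finset.Icc 1 k, a j * z ^ (k - j) = 0) :
    φ (g 0 ^ k + ∑ j ∈ Finset.Icc 1 k, (u ^ (j - 1) * g j) * g 0 ^ (k - j)) ∈ I := by
  let π := Ideal.Quotient.mk I
  have e0 : π (φ (g 0)) = π (φ u) * π z := by
    rw [← map_mul, eq_comm, Ideal.Quotient.eq]; exact h0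
  have e1 : ∀ j ∈ Finset.Icc 1 k, π (φ (g j)) = π (φ u) * π (a j) := fun j hj => by
    rw [← map_mul, eq_comm, Ideal.Quotient.eq]; exact h1 j hj
  rw [← Ideal.Quotient.eq_zero_iff_mem]
  show π _ = 0
  have : ∀ j ∈ Finset.Icc 1 k, π (φ ((u ^ (j - 1) * g j) * g 0 ^ (k - j))) = π (φ u) ^ k * π (a j * z ^ (k - j)) := by
    intro j hj
    simp only [map_mul, map_pow, e0, e1 j hj]
    obtain ⟨l, rfl⟩ := Nat.exists_eq_add_of_le (Finset.mem_Icc.1 hj).2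
    obtain ⟨j', rfl⟩ : ∃ j', j = j' + 1 := ⟨j - 1, by have := (Finset.mem_Icc.1 hj).1; omega⟩
    rw [Nat.add_sub_cancel_left, Nat.add_sub_cancel]; ring
  rw [map_add, map_add, map_sum, map_sum, Finset.sum_congr rfl this, ← Finset.mul_sum, map_pow, map_pow, e0, mul_pow, ← map_pow π z,
      ← mul_add, ← map_sum, ← map_add, h, map_zero, mul_zero]

theorem m5 (x : Fin d → R) (Q : Ideal R) (hQ : Q = Ideal.span (Set.range x)) (hrad : maximalIdeal R ≤ Q.radical)
    (F : ℕ → Ideal R) (hF : ∀ n, (F n : Set R) = intClSet R (Q ^ n)) (c : ℕ) (hc : ∀ n, F n ≤ Q ^ (n - c))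
    (h0 : ∀ z : GenQuot R d hP x, (∀ q ∈ Q.map (genMap R d hP x), q * z = 0) → z = 0) :
    ∃ n1, ∀ n ≥ n1, ∀ z ∈ intClSet (GenQuot R d hP x) ((Q.map (genMap R d hP x)) ^ n), z ∈ (F n).map (genMap R d hP x) := by
  have := gq_noeth R d hP x
  set ψ := genMap R d hP x with hψ
  set φ := phi R d hP x with hφ
  have hφC : ∀ I : Ideal R, I.map ψ = (I.map C).map φ := fun I => by rw [hψ, genMap_eq', Ideal.map_map]
  have hfil := QFil_intCl hF
  have hfil'' := hfil.map ψ
  have hQ'' : Q.map ψ = Ideal.span (Set.range (fun i => ψ (x i))) := by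
    rw [hQ, Ideal.map_span, ← Set.range_comp]; rfl
  obtain ⟨n1, hn1⟩ := hfil''.colon hQ'' c (fun n => by rw [← Ideal.map_pow]; exact Ideal.map_mono (hc n)) h0
  refine ⟨n1, fun n hn z hz => ?_⟩
  obtain ⟨k, hk, a, ha, h⟩ := hz
  obtain ⟨N, hN⟩ := (Ideal.exists_pow_le_of_le_radical_of_fg hrad (IsNoetherian.noetherian _) : ∃ N, (maximalIdeal R) ^ N ≤ Q)
  set M := N * (n * k)
  have hM : (maximalIdeal R) ^ M ≤ Q ^ (n * k) := by rw [pow_mul]; exact Ideal.pow_right_mono hN _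
  have hM' : (genPrime R d) ^ M ≤ (Q ^ (n * k)).map C := by rw [← Ideal.map_pow]; exact Ideal.map_mono hM
  let b : ℕ → GenQuot R d hP x := fun j => if j = 0 then z else a j
  obtain ⟨u, hu, g, hg⟩ := phi_approx_fin R d hP x M (fun j => (Q ^ (n * j)).map C) b (Finset.range (k + 1)) (by
    intro j hj
    by_cases hj0 : j = 0
    · subst hj0
      simp [Ideal.map_top]
    · simp only [b, if_neg hj0]
      have := ha j (by simp at hj ⊢; omega)
      rw [← pow_mul, ← Ideal.map_pow, hφC] at this
      exact this)
  have hgk : ∀ j ∈ Finset.range (k + 1), φ u * b j - φ (g j) ∈ (Q ^ (n * k)).map ψ := fun j hj => by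
    rw [hφC]; exact Ideal.map_mono hM' (hg j hj).2
  -- equation
  let α : ℕ → GenPoly R d := fun j => u ^ (j - 1) * g j
  have hα : ∀ j ∈ Finset.Icc 1 k, α j ∈ (Q ^ (n * j)).map C := fun j hj =>
    Ideal.mul_mem_left _ _ (hg j (by simp at hj ⊢; omega)).1
  have hE : φ (g 0 ^ k + ∑ j ∈ Finset.Icc 1 k, α j * g 0 ^ (k - j)) ∈ ((Q ^ (n * k)).map C).map φ := by
    rw [← hφC]
    refine eq_transfer φ _ k u g z a ?_ ?_ h
    · have := hgk 0 (by simp)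
      simp only [b, if_true] at this; exact this
    · intro j hj
      have := hgk j (by simp at hj ⊢; omega)
      have hj0 : j ≠ 0 := by have := (Finset.mem_Icc.1 hj).1; omega
      simp only [b, if_neg hj0] at this; exact this
  obtain ⟨u', hu', hE'⟩ := phi_contract R d hP x M _ hM' _ hE
  obtain ⟨q, hq, w, hw, hqw⟩ := Submodule.mem_sup.1 hE'
  let g' := u' * g 0
  let α' : ℕ → GenPoly R d := fun j => u' ^ j * α j - if j = k then u' ^ (k - 1) * q else 0
  have hα' : ∀ j ∈ Finset.Icc 1 k, α' j ∈ (Q ^ (n * j)).map C := by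
    intro j hj
    refine Submodule.sub_mem _ (Ideal.mul_mem_left _ _ (hα j hj)) ?_
    split_ifs with hjk
    · subst hjk; exact Ideal.mul_mem_left _ _ hq
    · exact zero_mem _
  have hEq : g' ^ k + ∑ j ∈ Finset.Icc 1 k, α' j * g' ^ (k - j) ∈ Ideal.span {genElt R d x} := by
    have h1 : ∀ j ∈ Finset.Icc 1 k, α' j * g' ^ (k - j) = u' ^ k * (α j * g 0 ^ (k - j)) -
        (if j = k then u' ^ (k - 1) * q else 0) := by
      intro j hj
      obtain ⟨l, rfl⟩ := Nat.exists_eq_add_of_le (Finset.mem_Icc.1 hj).2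
      simp only [α', g', Nat.add_sub_cancel_left]
      by_cases hl : l = 0
      · subst hl; simp
      · rw [if_neg (by omega)]; ring
    rw [Finset.sum_congr rfl h1, Finset.sum_sub_distrib, ← Finset.mul_sum, Finset.sum_ite_eq' , if_pos (by simp; omega)]
    obtain ⟨k', rfl⟩ : ∃ k', k = k' + 1 := ⟨k - 1, by omega⟩
    have : g' ^ (k' + 1) + (u' ^ (k' + 1) * ∑ j ∈ Finset.Icc 1 (k' + 1), α j * g 0 ^ (k' + 1 - j) - u' ^ (k' + 1 - 1) * q) =
        u' ^ k' * w := by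
      rw [Nat.add_sub_cancel]
      simp only [g']
      linear_combination (- u' ^ k') * hqw
    rw [this]
    exact Ideal.mul_mem_left _ _ hw
  have hsub := fun i => subst_main x i hQ hF n k g' α' hα' hEq
  choose K hK using hsub
  have hpow : ∀ i, ∀ m ≥ ∑ i, K i, ψ (x i) ^ m * φ g' ∈ (F (n + m)).map ψ := by
    intro i m hm
    have h1 := Ideal.mem_map_of_mem φ (hK i m ((Finset.single_le_sum (f := K) (fun _ _ => Nat.zero_le _) (Finset.mem_univ i)).trans hm))
    rw [Ideal.map_sup, ← hφC, Ideal.map_span, Set.image_singleton, phi_gen, map_mul, map_pow] at h1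
    have h2 : φ (C (x i)) = ψ (x i) := by rw [hψ, genMap_eq']; rfl
    rw [h2] at h1
    simpa using h1
  obtain ⟨K', hK'⟩ := pow_gens hQ'' hfil'' n (∑ i, K i) (φ g') hpow
  have h3 : φ g' ∈ (F n).map ψ := colon_iter (F := fun n => (F n).map ψ) hn1 K' n hn _ hK'
  have h4 : φ (u' * u) * z ∈ (F n).map ψ := by
    have h5 : φ u * z - φ (g 0) ∈ (F n).map ψ := by
      have := hgk 0 (by simp)
      simp only [b, if_true] at this
      refine Ideal.map_mono ?_ this
      refine (Ideal.pow_le_pow_right (show n ≤ n * k from Nat.le_mul_of_pos_right _ hk)).trans ?_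
      intro y hy
      have : y ∈ (F n : Set R) := by rw [hF]; exact le_intCl hy
      exact this
    have h6 := add_mem (Ideal.mul_mem_left _ (φ u') h5) h3
    convert h6 using 1
    simp only [g', map_mul]; ring
  exact (Ideal.unit_mul_mem_iff_mem _ (phi_unit R d hP x _ (mul_mem hu' hu))).1 h4
end Gen2

end X11

namespace X11
universe v w
open IsLocalRing RingTheory.Sequence


/-- depth at least `n` for local rings -/
def HD (B : Type u) [CommRing B] [IsLocalRing B] (n : ℕ) : Prop :=
  ∃ rs : List B, rs.length = n ∧ (∀ r ∈ rs, r ∈ maximalIdeal B) ∧ IsWeaklyRegular B rs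

theorem HD_iff (B : Type u) [CommRing B] [IsLocalRing B] (n : ℕ) : HasDepthGE B n ↔ HD B n := by
  constructor
  · rintro ⟨rs, h1, h2, h3⟩
    exact ⟨rs, h1, fun r hr => by rw [← jacobson_eq_maximalIdeal ⊥ bot_ne_top]; exact h2 r hr, h3.1⟩
  · rintro ⟨rs, h1, h2, h3⟩
    exact ⟨rs, h1, fun r hr => by rw [jacobson_eq_maximalIdeal ⊥ bot_ne_top]; exact h2 r hr,
      IsRegular.of_isWeaklyRegular_of_mem_maximalIdeal B h2 h3⟩

theorem HD_congr {B : Type u} {B' : Type v} [CommRing B] [IsLocalRing B] [CommRing B'] [IsLocalRing B'] (e : B ≃+* B') {n : ℕ}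
    (h : HD B n) : HD B' n := by
  obtain ⟨rs, h1, h2, h3⟩ := h
  refine ⟨rs.map e, by simpa, ?_, (wr_congr e rs).1 h3⟩
  intro r hr
  obtain ⟨a, ha, rfl⟩ := List.mem_map.1 hr
  have := h2 a ha
  rw [mem_maximalIdeal, mem_nonunits_iff] at this ⊢
  simpa using this

theorem HD_mono {B : Type u} [CommRing B] [IsLocalRing B] {n m : ℕ} (hmn : m ≤ n) (h : HD B n) : HD B m := by
  obtain ⟨rs, h1, h2, h3⟩ := h
  refine ⟨rs.take m, by simp; omega, fun r hr => h2 r (List.mem_of_mem_take hr), ?_⟩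
  have : rs = rs.take m ++ rs.drop m := (List.take_append_drop m rs).symm
  rw [this, isWeaklyRegular_append_iff] at h3
  exact h3.1

open CategoryTheory CategoryTheory.Abelian in
theorem HD_quot {B : Type u} [CommRing B] [IsLocalRing B] [IsNoetherianRing B] {n : ℕ} (h : HD B (n + 1)) (x : B)
    (hx : x ∈ maximalIdeal B) (hr : IsSMulRegular B x) [IsLocalRing (B ⧸ Ideal.span {x})] : HD (B ⧸ Ideal.span {x}) n := by
  obtain ⟨rs, h1, h2, h3⟩ := h
  have hreg := IsRegular.of_isWeaklyRegular_of_mem_maximalIdeal B h2 h3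
  have hlt : ∀ (M : Type u) [AddCommGroup M] [Module B M] [Module.Finite B M] [Nontrivial M],
      maximalIdeal B • (⊤ : Submodule B M) < ⊤ := fun M _ _ _ _ => by
    refine lt_top_iff_ne_top.2 fun h => ?_
    have := Submodule.eq_bot_of_le_smul_of_le_jacobson_bot (maximalIdeal B) (⊤ : Submodule B M) Module.Finite.fg_top h.ge
      (by rw [jacobson_eq_maximalIdeal ⊥ bot_ne_top])
    exact top_ne_bot this
  have e1 := ((ModuleCat.exists_isRegular_tfae (maximalIdeal B) (n+1) (ModuleCat.of B B) (hlt B)).out 3 1 :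
    (∃ rs : List B, rs.length = n+1 ∧ (∀ r ∈ rs, r ∈ maximalIdeal B) ∧ RingTheory.Sequence.IsRegular B rs) ↔ _).1 ⟨rs, h1, h2, hreg⟩
  have : Nontrivial (QuotSMulTop x B) := nontrivial_quotSMulTop_of_mem_maximalIdeal B hx
  have e2 := ((ModuleCat.exists_isRegular_tfae (maximalIdeal B) n (ModuleCat.of B (QuotSMulTop x B)) (hlt _)).out 1 3).1 (by
    intro i hi
    have zero1 := AddCommGrpCat.isZero_of_iff_subsingleton.mpr (e1 i (by omega))
    have zero2 := AddCommGrpCat.isZero_of_iff_subsingleton.mpr (e1 (i + 1) (by omega))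
    exact AddCommGrpCat.subsingleton_of_isZero <| ShortComplex.Exact.isZero_of_both_zeros
        ((Ext.covariant_sequence_exact₃' _ (IsSMulRegular.smulShortComplex_shortExact (M := ModuleCat.of B B) hr)) i (i + 1) rfl)
        (zero1.eq_zero_of_src _) (zero2.eq_zero_of_tgt _))
  obtain ⟨ss, g1, g2, g3⟩ := e2
  refine ⟨ss.map (Ideal.Quotient.mk _), by simpa, ?_, ?_⟩
  · intro r hr'
    obtain ⟨a, ha, rfl⟩ := List.mem_map.1 hr'
    have := g2 a ha
    rw [mem_maximalIdeal, mem_nonunits_iff] at this ⊢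
    intro hu
    apply this
    have : IsLocalHom (Ideal.Quotient.mk (Ideal.span {x})) := IsLocalHom.of_surjective _ Ideal.Quotient.mk_surjective
    exact isUnit_of_map_unit _ _ hu
  · have := (wr_cons x ss).1 (by rw [isWeaklyRegular_cons_iff]; exact ⟨hr, g3.1⟩)
    exact this.2

/-- regular pairs, elementwise -/
def Pair {B : Type u} [CommRing B] (a b : B) : Prop := (∀ r, a * r = 0 → r = 0) ∧ ∀ r s, b * r = a * s → ∃ t, r = a * t

theorem pair_iff {B : Type u} [CommRing B] (a b : B) : Pair a b ↔ IsWeaklyRegular B [a, b] := by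
  rw [wr_cons, List.map_cons, List.map_nil, isWeaklyRegular_singleton_iff, Pair]
  refine and_congr ?_ ?_
  · exact (isSMulRegular_iff_right_eq_zero_of_smul (R := B) (M := B)).symm
  · rw [isSMulRegular_iff_right_eq_zero_of_smul]
    constructor
    · intro h z hz
      obtain ⟨r, rfl⟩ := Ideal.Quotient.mk_surjective z
      rw [smul_eq_mul, ← map_mul, Ideal.Quotient.eq_zero_iff_mem, Ideal.mem_span_singleton'] at hz
      obtain ⟨s, hs⟩ := hz
      obtain ⟨t, ht⟩ := h r s (by rw [← hs, mul_comm])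
      rw [Ideal.Quotient.eq_zero_iff_mem, Ideal.mem_span_singleton]
      exact ⟨t, ht⟩
    · intro h r s hrs
      have := h (Ideal.Quotient.mk _ r) (by
        rw [smul_eq_mul, ← map_mul, Ideal.Quotient.eq_zero_iff_mem, Ideal.mem_span_singleton]
        exact ⟨s, hrs⟩)
      rw [Ideal.Quotient.eq_zero_iff_mem, Ideal.mem_span_singleton] at this
      exact this

theorem Pair.pow_right {B : Type u} [CommRing B] {a b : B} (h : Pair a b) (k : ℕ) : Pair a (b ^ k) := by
  refine ⟨h.1, ?_⟩
  induction k with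
  | zero => intro r s hrs; exact ⟨s, by simpa using hrs⟩
  | succ k ih =>
    intro r s hrs
    obtain ⟨t, ht⟩ := h.2 (b ^ k * r) s (by rw [← hrs]; ring)
    exact ih r t ht

theorem Pair.pow_left {B : Type u} [CommRing B] {a b : B} (h : Pair a b) (k : ℕ) : Pair (a ^ k) b := by
  induction k with
  | zero => exact ⟨fun r => by simp, fun r s _ => ⟨r, by simp⟩⟩
  | succ k ih =>
    refine ⟨fun r hr => ih.1 _ (h.1 _ (by rw [← hr]; ring)), fun r s hrs => ?_⟩
    obtain ⟨r1, rfl⟩ := h.2 r (a ^ k * s) (by rw [hrs]; ring)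
    obtain ⟨t, rfl⟩ := ih.2 r1 s (by
      have := h.1 (b * r1 - a ^ k * s) (by linear_combination hrs)
      linear_combination this)
    exact ⟨t, by ring⟩

theorem Pair.flat {B : Type u} {S : Type v} [CommRing B] [CommRing S] [Algebra B S] [Module.Flat B S] {a b : B} (h : Pair a b) :
    Pair (algebraMap B S a) (algebraMap B S b) := by
  rw [pair_iff] at h ⊢
  exact h.of_flat

theorem nzd_flat {B : Type u} {S : Type v} [CommRing B] [CommRing S] [Algebra B S] [Module.Flat B S] {a : B} (h : ∀ r, a * r = 0 → r = 0) :
    ∀ r, algebraMap B S a * r = 0 → r = 0 := by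
  have : IsWeaklyRegular B [a] := (isWeaklyRegular_singleton_iff _ _).2 (isSMulRegular_iff_right_eq_zero_of_smul.2 h)
  have := this.of_flat (S := S)
  rw [List.map_cons, List.map_nil, isWeaklyRegular_singleton_iff] at this
  exact isSMulRegular_iff_right_eq_zero_of_smul.1 this



section Gen3
open MvPolynomial
variable (R : Type u) [CommRing R] [IsLocalRing R] [IsNoetherianRing R] (d : ℕ) (hP : (genPrime R d).IsPrime)

theorem exists_pair {B : Type u} [CommRing B] [IsLocalRing B] (h : HD B 2) : ∃ a b : B, a ∈ maximalIdeal B ∧ b ∈ maximalIdeal B ∧ Pair a b := by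
  obtain ⟨rs, h1, h2, h3⟩ := h
  match rs, h1, h2, h3 with
  | [a, b], _, h2, h3 => exact ⟨a, b, h2 a (by simp), h2 b (by simp), (pair_iff a b).2 h3⟩

theorem exists_pair_Q (h : HD R 2) (Q : Ideal R) (hrad : maximalIdeal R ≤ Q.radical) : ∃ a ∈ Q, ∃ b ∈ Q, Pair a b := by
  obtain ⟨a, b, ha, hb, hab⟩ := exists_pair h
  obtain ⟨k, hk⟩ := hrad ha
  obtain ⟨l, hl⟩ := hrad hb
  exact ⟨a ^ k, hk, b ^ l, hl, (hab.pow_left k).pow_right l⟩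

theorem gen_nzdS (h : HD R 2) (x : Fin d → R) (Q : Ideal R) (hQ : Q = Ideal.span (Set.range x)) (hrad : maximalIdeal R ≤ Q.radical) :
    ∀ s : GenLocHat R d hP, genEltHat R d hP x * s = 0 → s = 0 := by
  obtain ⟨a, ha, b, hb, hab⟩ := exists_pair_Q R h Q hrad
  have h1 : ∀ g : GenPoly R d, genElt R d x * g = 0 → g = 0 := fun g hg =>
    gen_nzd hQ (fun z hz => hab.1 z (hz a ha)) g hg
  have := gl_flatA R d hP
  rw [genEltHat_eq]
  exact nzd_flat h1

theorem pair_quot {B : Type u} [CommRing B] {a b x : B} (hab : Pair a b) (hx : ∀ s, x * s = 0 → s = 0) (z : B ⧸ Ideal.span {x})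
    (h1 : Ideal.Quotient.mk _ a * z = 0) (h2 : Ideal.Quotient.mk _ b * z = 0) : z = 0 := by
  obtain ⟨s, rfl⟩ := Ideal.Quotient.mk_surjective z
  rw [← map_mul, Ideal.Quotient.eq_zero_iff_mem, Ideal.mem_span_singleton] at h1 h2
  obtain ⟨s1, h1⟩ := h1
  obtain ⟨s2, h2⟩ := h2
  have h3 : b * s1 = a * s2 := by
    have := hx (b * s1 - a * s2) (by linear_combination a * h2 - b * h1)
    linear_combination this
  obtain ⟨t, rfl⟩ := hab.2 _ _ h3
  rw [Ideal.Quotient.eq_zero_iff_mem, Ideal.mem_span_singleton]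
  refine ⟨t, ?_⟩
  have := hab.1 (s - x * t) (by linear_combination h1)
  linear_combination this

theorem m5d (h : HD R 2) (x : Fin d → R) (Q : Ideal R) (hQ : Q = Ideal.span (Set.range x)) (hrad : maximalIdeal R ≤ Q.radical) :
    ∀ z : GenQuot R d hP x, (∀ q ∈ Q.map (genMap R d hP x), q * z = 0) → z = 0 := by
  intro z hz
  obtain ⟨a, ha, b, hb, hab⟩ := exists_pair_Q R h Q hrad
  have := gl_flat R d hP
  have h1 := hz _ (Ideal.mem_map_of_mem _ ha)
  have h2 := hz _ (Ideal.mem_map_of_mem _ hb)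
  rw [genMap_eq] at h1 h2
  exact pair_quot (hab.flat (S := GenLocHat R d hP)) (gen_nzdS R d hP h x Q hQ hrad) z h1 h2

theorem genElt_mem (x : Fin d → R) (hx : ∀ i, x i ∈ maximalIdeal R) : genElt R d x ∈ genPrime R d :=
  Ideal.sum_mem _ fun i _ => Ideal.mul_mem_left _ _ (Ideal.mem_map_of_mem _ (hx i))

theorem genEltHat_mem (x : Fin d → R) (hx : ∀ i, x i ∈ maximalIdeal R) : genEltHat R d hP x ∈ maximalIdeal (GenLocHat R d hP) := by
  rw [genEltHat_eq, glh_maxA]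
  exact Ideal.mem_map_of_mem _ (genElt_mem R d x hx)

theorem gq_local (x : Fin d → R) (hx : ∀ i, x i ∈ maximalIdeal R) : IsLocalRing (GenQuot R d hP x) := by
  refine quot_local _ fun h => ?_
  have h1 : Ideal.span {genEltHat R d hP x} ≤ maximalIdeal (GenLocHat R d hP) := by
    rw [Ideal.span_singleton_le_iff_mem]; exact genEltHat_mem R d hP x hx
  rw [h] at h1
  exact (maximalIdeal.isMaximal (GenLocHat R d hP)).ne_top (top_le_iff.1 h1)

theorem gq_reduced (x : Fin d → R) (hx : ∀ i, x i ∈ maximalIdeal R) (Q : Ideal R) (hQ : Q = Ideal.span (Set.range x)) (hrad : maximalIdeal R ≤ Q.radical)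
    (F : ℕ → Ideal R) (hF : ∀ n, (F n : Set R) = intClSet R (Q ^ n)) (c : ℕ) (hc : ∀ n, F n ≤ Q ^ (n - c)) (hd : HD R 2) :
    IsReduced (GenQuot R d hP x) := by
  have := gq_noeth R d hP x
  have := gq_local R d hP x hx
  obtain ⟨n1, hn1⟩ := m5 R d hP x Q hQ hrad F hF c hc (m5d R d hP hd x Q hQ hrad)
  have hψ : (maximalIdeal R).map (genMap R d hP x) ≤ maximalIdeal (GenQuot R d hP x) := by
    refine le_maximalIdeal fun h => ?_
    rw [genMap_eq, ← Ideal.map_map, ← glh_max] at h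
    have : maximalIdeal (GenLocHat R d hP) ⊔ Ideal.span {genEltHat R d hP x} = ⊤ := by
      have h2 := congrArg (Ideal.comap (Ideal.Quotient.mk (Ideal.span {genEltHat R d hP x}))) h
      rwa [Ideal.comap_map_of_surjective _ Ideal.Quotient.mk_surjective, Ideal.comap_top, ← RingHom.ker_eq_comap_bot, Ideal.mk_ker] at h2
    rw [sup_eq_left.2 ((Ideal.span_singleton_le_iff_mem _).2 (genEltHat_mem R d hP x hx))] at this
    exact (maximalIdeal.isMaximal (GenLocHat R d hP)).ne_top this
  have hQm : Q ≤ maximalIdeal R := by rw [hQ, Ideal.span_le]; rintro _ ⟨i, rfl⟩; exact hx i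
  refine ⟨fun z hz => ?_⟩
  obtain ⟨k, hk⟩ := hz
  have hmem : ∀ n, z ∈ intClSet (GenQuot R d hP x) ((Q.map (genMap R d hP x)) ^ n) := fun n => by
    refine ⟨k + 1, by omega, 0, fun _ _ => zero_mem _, ?_⟩
    rw [pow_succ, hk]; simp
  have hall : ∀ n, z ∈ maximalIdeal (GenQuot R d hP x) ^ n := by
    intro n
    have h1 := hn1 (n1 + n + c) (by omega) z (hmem _)
    have h2 := Ideal.map_mono (f := genMap R d hP x) (hc (n1 + n + c)) h1
    rw [Ideal.map_pow] at h2
    exact Ideal.pow_le_pow_right (by omega) (Ideal.pow_right_mono ((Ideal.map_mono hQm).trans hψ) _ h2)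
  have h3 := Ideal.iInf_pow_eq_bot_of_isLocalRing (maximalIdeal (GenQuot R d hP x)) (maximalIdeal.isMaximal _).ne_top
  have : z ∈ (⨅ n, maximalIdeal (GenQuot R d hP x) ^ n) := by rw [Ideal.mem_iInf]; exact hall
  rwa [h3] at this

end Gen3


section Len
theorem length_quot {S : Type u} [CommRing S] (I1 I2 : Ideal S) (x : S) (h1 : ∀ s, x * s ∈ I2 ↔ s ∈ I1) :
    Module.length S (S ⧸ I2) = Module.length S (S ⧸ I1) + Module.length S (S ⧸ (I2 ⊔ Ideal.span {x})) := by
  let f : (S ⧸ I1) →ₗ[S] (S ⧸ I2) := Submodule.mapQ I1 I2 (LinearMap.mulLeft S x) (fun s hs => (h1 s).2 hs)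
  let g : (S ⧸ I2) →ₗ[S] (S ⧸ (I2 ⊔ Ideal.span {x})) := Submodule.factor le_sup_left
  refine Module.length_eq_add_of_exact f g ?_ (Submodule.factor_surjective _) ?_
  · rw [injective_iff_map_eq_zero]
    intro z hz
    obtain ⟨s, rfl⟩ := Ideal.Quotient.mk_surjective z
    have : Ideal.Quotient.mk I2 (x * s) = 0 := hz
    rw [Ideal.Quotient.eq_zero_iff_mem] at this ⊢
    exact (h1 s).1 this
  · intro z
    obtain ⟨s, rfl⟩ := Ideal.Quotient.mk_surjective z
    constructor
    · intro hz
      have : Ideal.Quotient.mk (I2 ⊔ Ideal.span {x}) s = 0 := hz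
      rw [Ideal.Quotient.eq_zero_iff_mem] at this
      obtain ⟨a, ha, b, hb, rfl⟩ := Submodule.mem_sup.1 this
      obtain ⟨t, rfl⟩ := Ideal.mem_span_singleton.1 hb
      refine ⟨Ideal.Quotient.mk I1 t, ?_⟩
      show Ideal.Quotient.mk I2 (x * t) = _
      rw [Ideal.Quotient.eq]
      convert neg_mem ha using 1; ring
    · rintro ⟨y, hy⟩
      obtain ⟨t, rfl⟩ := Ideal.Quotient.mk_surjective y
      have h2 : Ideal.Quotient.mk I2 (x * t) = Ideal.Quotient.mk I2 s := hy
      rw [Ideal.Quotient.eq] at h2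
      show Ideal.Quotient.mk (I2 ⊔ Ideal.span {x}) s = 0
      rw [Ideal.Quotient.eq_zero_iff_mem, Submodule.mem_sup]
      exact ⟨-(x * t - s), neg_mem h2, x * t, Ideal.mem_span_singleton.2 ⟨t, rfl⟩, by ring⟩

theorem length_self_congr {T : Type u} {T' : Type v} [CommRing T] [CommRing T'] (e : T ≃+* T') : Module.length T T = Module.length T' T' := by
  apply WithBot.coe_injective
  rw [Module.coe_length, Module.coe_length]
  exact Order.krullDim_eq_of_orderIso e.symm.idealComapOrderIso

theorem length_double {S : Type u} [CommRing S] (I J : Ideal S) :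
    Module.length (S ⧸ I) ((S ⧸ I) ⧸ J.map (Ideal.Quotient.mk I)) = Module.length S (S ⧸ (J ⊔ I)) := by
  rw [Module.length_eq_of_surjective (R := (S ⧸ I) ⧸ J.map (Ideal.Quotient.mk I)) (S := S ⧸ I) Ideal.Quotient.mk_surjective,
    Module.length_eq_of_surjective (R := S ⧸ (J ⊔ I)) (S := S) Ideal.Quotient.mk_surjective]
  exact length_self_congr ((DoubleQuot.quotQuotEquivQuotSup I J).trans (Ideal.quotEquivOfEq (sup_comm _ _)))

theorem length_ext {R : Type u} {S : Type v} [CommRing R] [CommRing S] [IsLocalRing R] [IsLocalRing S] [Algebra R S] [Module.Flat R S]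
    (hmax : maximalIdeal S = (maximalIdeal R).map (algebraMap R S)) (J : Ideal R) :
    Module.length S (S ⧸ J.map (algebraMap R S)) = Module.length R (R ⧸ J) := by
  have : IsLocalHom (algebraMap R S) := ((local_hom_TFAE (algebraMap R S)).out 0 2).2 hmax.ge
  rw [(Algebra.TensorProduct.quotIdealMapEquivTensorQuot S J).toLinearEquiv.length_eq, IsLocalRing.length_baseChange, ← hmax]
  have : IsSimpleModule S (S ⧸ maximalIdeal S) := (isSimpleModule_iff_isCoatom).2 (maximalIdeal.isMaximal S).out
  rw [Module.length_eq_one (R := S) (M := S ⧸ maximalIdeal S), mul_one]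

/-- binomial sums -/
def BP (D : ℕ) (c : ℕ → ℤ) (n : ℕ) : ℤ := ∑ j ∈ Finset.range (D + 1), c j * ((n + j).choose j : ℤ)

theorem BP_diff (D : ℕ) (c : ℕ → ℤ) (n : ℕ) : BP (D + 1) c (n + 1) - BP (D + 1) c n = BP D (fun j => c (j + 1)) (n + 1) := by
  unfold BP
  rw [Finset.sum_range_succ', Finset.sum_range_succ' _ (D + 1)]
  simp only [add_zero, Nat.choose_zero_right]
  rw [add_sub_add_right_eq_sub, ← Finset.sum_sub_distrib]
  refine Finset.sum_congr rfl fun j _ => ?_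
  have : (n + 1 + (j + 1)).choose (j + 1) = (n + 1 + j).choose j + (n + (j + 1)).choose (j + 1) := by
    rw [show n + 1 + (j + 1) = (n + 1 + j) + 1 by ring, Nat.choose_succ_succ, show n + (j + 1) = n + 1 + j by ring]
  rw [this]; push_cast; ring

theorem BP_uniq (D : ℕ) : ∀ (c : ℕ → ℤ) (N : ℕ), (∀ n ≥ N, BP D c n = 0) → ∀ j ≤ D, c j = 0 := by
  induction D with
  | zero =>
    intro c N h j hj
    have := h N le_rfl
    obtain rfl : j = 0 := by omega
    simpa [BP] using this
  | succ D ih =>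
    intro c N h
    have h1 : ∀ j ≤ D, c (j + 1) = 0 := ih (fun j => c (j + 1)) (N + 1) (by
      intro n hn
      obtain ⟨m, rfl⟩ : ∃ m, n = m + 1 := ⟨n - 1, by omega⟩
      rw [← BP_diff, h _ (by omega), h _ (by omega), sub_zero])
    have h0 : c 0 = 0 := by
      have := h N le_rfl
      unfold BP at this
      rw [Finset.sum_range_succ', Finset.sum_eq_zero (fun j hj => by rw [h1 j (by simp at hj; omega), zero_mul])] at this
      simpa using this
    intro j hj
    cases j with
    | zero => exact h0
    | succ j => exact h1 j (by omega)

theorem hilb_BP (d : ℕ) (e : ℕ → ℤ) (n : ℕ) : ∑ i ∈ Finset.range (d + 1), (-1) ^ i * e i * ((n + d - i).choose (d - i) : ℤ) =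
    BP d (fun j => (-1) ^ (d - j) * e (d - j)) n := by
  unfold BP
  rw [← Finset.sum_range_reflect]
  refine Finset.sum_congr rfl fun j hj => ?_
  have hj : j ≤ d := by simp at hj; omega
  simp only [show d + 1 - 1 - j = d - j by omega, show n + d - (d - j) = n + j by omega, show d - (d - j) = j by omega]
end Len

section Gen4
open MvPolynomial
variable (R : Type u) [CommRing R] [IsLocalRing R] [IsNoetherianRing R] (d : ℕ) (hP : (genPrime R d).IsPrime)

theorem colonS (x : Fin d → R) (Q : Ideal R) (hQ : Q = Ideal.span (Set.range x)) (hrad : maximalIdeal R ≤ Q.radical)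
    (F : ℕ → Ideal R) (hF : ∀ n, (F n : Set R) = intClSet R (Q ^ n)) (c : ℕ) (hc : ∀ n, F n ≤ Q ^ (n - c)) (hd : HD R 2) :
    ∃ n1, ∀ n ≥ n1, ∀ s : GenLocHat R d hP, genEltHat R d hP x * s ∈ (F (n + 1)).map (algebraMap R (GenLocHat R d hP)) ↔
      s ∈ (F n).map (algebraMap R (GenLocHat R d hP)) := by
  obtain ⟨a, ha, b, hb, hab⟩ := exists_pair_Q R hd Q hrad
  have hfil := QFil_intCl hF
  obtain ⟨n1, hn1⟩ := hfil.colon hQ c hc (fun z hz => hab.1 z (hz a ha))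
  have hmap : ∀ I : Ideal R, I.map (algebraMap R (GenLocHat R d hP)) = (I.map C).map (algebraMap (GenPoly R d) (GenLocHat R d hP)) := fun I => by
    rw [IsScalarTower.algebraMap_eq R (GenPoly R d) (GenLocHat R d hP), ← Ideal.map_map]; rfl
  have hxQ : genElt R d x ∈ Q.map C := Ideal.sum_mem _ fun i _ => Ideal.mul_mem_left _ _ (Ideal.mem_map_of_mem _ (by
    rw [hQ]; exact Ideal.subset_span ⟨i, rfl⟩))
  refine ⟨n1, fun n hn s => ⟨fun hs => ?_, fun hs => ?_⟩⟩
  · obtain ⟨N0, hN0⟩ := (Ideal.exists_pow_le_of_le_radical_of_fg hrad (IsNoetherian.noetherian _) : ∃ N, (maximalIdeal R) ^ N ≤ Q)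
    set N := N0 * (n + 1)
    have hN : (maximalIdeal R) ^ N ≤ F (n + 1) := by
      intro y hy
      have : y ∈ (F (n + 1) : Set R) := by
        rw [hF]; refine le_intCl ?_
        rw [pow_mul] at hy; exact Ideal.pow_right_mono hN0 _ hy
      exact this
    have hN1 : (genPrime R d) ^ N ≤ (F (n + 1)).map C := by rw [← Ideal.map_pow]; exact Ideal.map_mono hN
    have hN2 : maximalIdeal (GenLocHat R d hP) ^ N ≤ (F (n + 1)).map (algebraMap R (GenLocHat R d hP)) := by
      rw [glh_max, ← Ideal.map_pow]; exact Ideal.map_mono hN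
    obtain ⟨u, hu, g, hg⟩ := glh_approx0 R d hP N s
    have h1 : algebraMap _ (GenLocHat R d hP) (genElt R d x * g) ∈ (F (n + 1)).map (algebraMap R (GenLocHat R d hP)) := by
      have h2 := Ideal.mul_mem_left _ (genEltHat R d hP x) (hN2 hg)
      have h3 := Ideal.mul_mem_left _ (algebraMap _ (GenLocHat R d hP) u) hs
      have := Submodule.sub_mem _ h3 h2
      rw [map_mul, ← genEltHat_eq]
      convert this using 1; ring
    rw [hmap] at h1
    obtain ⟨u', hu', h4⟩ := glh_contract R d hP N _ hN1 _ h1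
    have h5 : u' * g ∈ (F n).map C := mccoy' hQ hfil hn1 n hn _ (by rw [mul_left_comm]; exact h4)
    have h6 := Ideal.mem_map_of_mem (algebraMap _ (GenLocHat R d hP)) h5
    rw [← hmap, map_mul, Ideal.unit_mul_mem_iff_mem _ (glh_unit R d hP u' hu')] at h6
    have h7 := add_mem (Ideal.map_mono (hfil.anti (Nat.le_succ n)) (hN2 hg)) h6
    rw [sub_add_cancel, Ideal.unit_mul_mem_iff_mem _ (glh_unit R d hP u hu)] at h7
    exact h7
  · have h1 : genEltHat R d hP x ∈ Q.map (algebraMap R (GenLocHat R d hP)) := by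
      rw [genEltHat_eq, hmap]; exact Ideal.mem_map_of_mem _ hxQ
    have h2 := Ideal.mul_mem_mul h1 hs
    rw [← Ideal.map_mul] at h2
    refine Ideal.map_mono ?_ h2
    have := hfil.pow_mul 1 n
    rwa [pow_one] at this

theorem m6 (x : Fin d → R) (hx : ∀ i, x i ∈ maximalIdeal R) (Q : Ideal R) (hQ : Q = Ideal.span (Set.range x)) (hrad : maximalIdeal R ≤ Q.radical)
    (F : ℕ → Ideal R) (hF : ∀ n, (F n : Set R) = intClSet R (Q ^ n)) (c : ℕ) (hc : ∀ n, F n ≤ Q ^ (n - c)) (hd : HD R 2)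
    (hd2 : 2 ≤ d) (e : ℕ → ℤ) (he : HasHilbertSeries R d F e) (h1 : e 1 = 0)
    (J'' : ℕ → Ideal (GenQuot R d hP x)) (e'' : ℕ → ℤ)
    (hJ : ∀ n, (J'' n : Set (GenQuot R d hP x)) = intClSet (GenQuot R d hP x) (Q.map (genMap R d hP x) ^ n))
    (he'' : HasHilbertSeries (GenQuot R d hP x) (d - 1) J'' e'') : e'' 1 = 0 := by
  have := gl_flat R d hP
  obtain ⟨n1, hn1⟩ := m5 R d hP x Q hQ hrad F hF c hc (m5d R d hP hd x Q hQ hrad)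
  obtain ⟨n2, hn2⟩ := colonS R d hP x Q hQ hrad F hF c hc hd
  have hJF : ∀ n ≥ n1, J'' n = (F n).map (genMap R d hP x) := by
    intro n hn
    refine le_antisymm (fun z hz => hn1 n hn z ?_) ?_
    · rw [← hJ]; exact hz
    · rw [Ideal.map_le_iff_le_comap]
      intro b hb
      have hb' : b ∈ (F n : Set R) := hb
      rw [hF] at hb'
      have h2 := intCl_map (genMap R d hP x) _ b hb'
      rw [Ideal.map_pow, ← hJ] at h2
      exact h2
  have hlen : ∀ n ≥ n1 + n2, Module.length R (R ⧸ F (n + 1)) = Module.length R (R ⧸ F n) +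
      Module.length (GenQuot R d hP x) (GenQuot R d hP x ⧸ J'' (n + 1)) := by
    intro n hn
    rw [hJF _ (by omega), genMap_eq, ← Ideal.map_map, length_double, ← length_ext (glh_max R d hP), ← length_ext (glh_max R d hP)]
    exact length_quot _ _ _ (hn2 n (by omega))
  obtain ⟨N, hN⟩ := he
  obtain ⟨N', hN'⟩ := he''
  let C1 : ℕ → ℤ := fun j => (-1) ^ (d - j) * e (d - j)
  let C2 : ℕ → ℤ := fun j => (-1) ^ (d - 1 - j) * e'' (d - 1 - j)
  obtain ⟨D, rfl⟩ : ∃ D, d = D + 2 := ⟨d - 2, by omega⟩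
  have key : ∀ n ≥ N + N' + n1 + n2 + 1, BP (D + 1) (fun j => C1 (j + 1) - C2 j) n = 0 := by
    intro n hn
    obtain ⟨k, rfl⟩ : ∃ k, n = k + 1 := ⟨n - 1, by omega⟩
    obtain ⟨a, ha, ha'⟩ := hN k (by omega)
    obtain ⟨b, hb, hb'⟩ := hN (k + 1) (by omega)
    obtain ⟨l, hl, hl'⟩ := hN' (k + 1) (by omega)
    rw [moduleLength, ← Module.coe_length] at ha hb hl
    have ha2 : Module.length R (R ⧸ F (k + 1)) = a := by exact_mod_cast ha
    have hb2 : Module.length R (R ⧸ F (k + 1 + 1)) = b := by exact_mod_cast hb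
    have hl2 : Module.length (GenQuot R (D + 2) hP x) (GenQuot R (D + 2) hP x ⧸ J'' (k + 1 + 1)) = l := by exact_mod_cast hl
    have h3 := hlen (k + 1) (by omega)
    rw [ha2, hb2, hl2] at h3
    have h4 : (b : ℤ) = a + l := by exact_mod_cast h3
    rw [hilb_BP] at ha' hb' hl'
    have h5 : BP (D + 1) (fun j => C1 (j + 1) - C2 j) (k + 1) = BP (D + 1) (fun j => C1 (j + 1)) (k + 1) - BP (D + 1) C2 (k + 1) := by
      unfold BP
      rw [← Finset.sum_sub_distrib]
      exact Finset.sum_congr rfl fun j _ => by ring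
    rw [h5, ← BP_diff]
    have e1 : BP (D + 1 + 1) C1 (k + 1) = b := hb'.symm
    have e2 : BP (D + 1 + 1) C1 k = a := ha'.symm
    have e3 : BP (D + 1) C2 (k + 1) = l := hl'.symm
    rw [e1, e2, e3]; linarith
  have := BP_uniq _ _ _ key D (by omega)
  simp only [C1, C2, show D + 2 - (D + 1) = 1 by omega, show D + 2 - 1 - D = 1 by omega, h1] at this
  simpa using this
end Gen4

end X11

namespace X11
universe v w
open IsLocalRing RingTheory.Sequence

theorem surj_of_base (D : Type u) [CommRing D] [IsLocalRing D] [IsNoetherianRing D]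
    [IsAdicComplete (maximalIdeal D) D] (A0 : Type u) [CommRing A0] [IsLocalRing A0]
    [IsNoetherianRing A0] [IsDomain A0] (n0 : ℕ) (hA : Good A0 n0) (φ0 : A0 →+* D)
    (hres : ∀ d, ∃ a, d - φ0 a ∈ maximalIdeal D) (hle : (maximalIdeal A0).map φ0 ≤ maximalIdeal D) :
    ∃ (A : Type u) (_ : CommRing A) (_ : IsLocalRing A) (_ : IsNoetherianRing A) (_ : IsDomain A)
      (n : ℕ) (φ : A →+* D), Good A n ∧ Function.Surjective φ := by
  obtain ⟨s, hs⟩ := IsNoetherian.noetherian (maximalIdeal D)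
  obtain ⟨A, _, _, _, _, φ, hg, hres', hmap⟩ := goodExtend D s.toList (by
    intro z hz
    rw [← hs]; exact Submodule.subset_span (by simpa using hz)) A0 n0 hA φ0 hres
  have h1 : Ideal.ofList s.toList = maximalIdeal D := by
    rw [← hs, Ideal.ofList]; congr 1; ext; simp
  rw [h1, sup_eq_right.2 hle] at hmap
  have hc := hg.complete
  have hfin := finite_of_primary φ hres' hmap.le 1 (by rw [pow_one, hmap])
  refine ⟨A, _, inferInstance, inferInstance, inferInstance, _, φ, hg, ?_⟩
  let _ := φ.toAlgebra
  have : Module.Finite A D := hfin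
  have h2 : (⊤ : Submodule A D) ≤ LinearMap.range (Algebra.linearMap A D) := by
    refine Submodule.le_of_le_smul_of_le_jacobson_bot (I := maximalIdeal A) Module.Finite.fg_top (IsLocalRing.maximalIdeal_le_jacobson _) ?_
    intro d _
    obtain ⟨a, ha⟩ := hres' d
    rw [Submodule.mem_sup]
    refine ⟨φ a, ⟨a, rfl⟩, d - φ a, ?_, by ring⟩
    rw [Ideal.smul_top_eq_map]
    show d - φ a ∈ (maximalIdeal A).map φ
    rwa [hmap]
  intro d
  obtain ⟨a, ha⟩ := h2 (Submodule.mem_top (x := d))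
  exact ⟨a, ha⟩

theorem exists_surj (D : Type u) [CommRing D] [IsLocalRing D] [IsNoetherianRing D]
    [IsAdicComplete (maximalIdeal D) D] :
    ∃ (A : Type u) (_ : CommRing A) (_ : IsLocalRing A) (_ : IsNoetherianRing A) (_ : IsDomain A)
      (n : ℕ) (φ : A →+* D), Good A n ∧ Function.Surjective φ := by
  obtain ⟨p, hp⟩ := CharP.exists (ResidueField D)
  rcases CharP.char_is_prime_or_zero (ResidueField D) p with hpp | rfl
  · have : Fact p.Prime := ⟨hpp⟩
    have hpm : (p : D) ∈ maximalIdeal D := by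
      rw [← Ideal.Quotient.eq_zero_iff_mem, map_natCast]
      exact CharP.cast_eq_zero (ResidueField D) p
    have sqz : ∀ n, 1 ≤ n → ∀ a b : D ⧸ maximalIdeal D ^ (n+1),
        (Ideal.Quotient.factorPow (maximalIdeal D) (show n ≤ n+1 by omega)) a = 0 →
        (Ideal.Quotient.factorPow (maximalIdeal D) (show n ≤ n+1 by omega)) b = 0 → a * b = 0 := by
      intro n hn a b ha hb
      obtain ⟨a, rfl⟩ := Ideal.Quotient.mk_surjective a
      obtain ⟨b, rfl⟩ := Ideal.Quotient.mk_surjective b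
      have ha' : a ∈ maximalIdeal D ^ n := Ideal.Quotient.eq_zero_iff_mem.1 ha
      have hb' : b ∈ maximalIdeal D ^ n := Ideal.Quotient.eq_zero_iff_mem.1 hb
      rw [← map_mul, Ideal.Quotient.eq_zero_iff_mem]
      refine Ideal.pow_le_pow_right (show n + 1 ≤ n + n by omega) ?_
      rw [pow_add]; exact Ideal.mul_mem_mul ha' hb'
    obtain ⟨Λ, _, π, hπ, hker, hreg, hc⟩ := exists_cohen (ResidueField D) p
    obtain ⟨_, _, _, hg, hmax⟩ := Good.cohen (ResidueField D) p Λ π hπ hker hreg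
    obtain ⟨ψ, hψ⟩ := lift_limit (maximalIdeal D) (Λ := Λ) π (by
      intro n hn φ
      refine lift_step p π hπ hker hreg _ (Ideal.Quotient.factor_surjective _) (sqz n hn) ?_ φ
      intro a ha
      obtain ⟨a, rfl⟩ := Ideal.Quotient.mk_surjective a
      have ha' : a ∈ maximalIdeal D ^ n := Ideal.Quotient.eq_zero_iff_mem.1 ha
      rw [← map_natCast (Ideal.Quotient.mk _), ← map_mul, Ideal.Quotient.eq_zero_iff_mem, pow_succ']
      exact Ideal.mul_mem_mul hpm ha')
    have hmapp : (maximalIdeal Λ).map ψ = Ideal.span {(p : D)} := by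
      rw [hmax, Ideal.map_span, Set.image_singleton, map_natCast]
    refine surj_of_base D Λ 1 hg ψ ?_ ?_
    · intro d
      obtain ⟨a, ha⟩ := hπ (Ideal.Quotient.mk (maximalIdeal D) d)
      refine ⟨a, ?_⟩
      rw [← Ideal.Quotient.eq_zero_iff_mem, map_sub, sub_eq_zero, ← ha]
      exact (RingHom.congr_fun hψ _).symm
    · rw [hmapp, Ideal.span_singleton_le_iff_mem]; exact hpm
  · have : CharZero (ResidueField D) := CharP.charP_to_charZero _
    have hunit : ∀ n : ℕ, n ≠ 0 → IsUnit (n : D) := by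
      intro n hn
      by_contra h
      have : (n : D) ∈ maximalIdeal D := h
      rw [← Ideal.Quotient.eq_zero_iff_mem] at this
      have h2 : ((n : ℕ) : ResidueField D) = 0 := by
        rw [← map_natCast (IsLocalRing.residue D)]; exact this
      exact hn (Nat.cast_eq_zero.1 h2)
    let _ : Algebra ℚ D := (ratHom D hunit).toAlgebra
    obtain ⟨ψ, hψ⟩ := lift_char0 (k := ResidueField D) (maximalIdeal D) (RingHom.id (ResidueField D))
    have hbot : maximalIdeal (ResidueField D) = ⊥ := IsLocalRing.maximalIdeal_eq_bot
    refine surj_of_base D (ResidueField D) 0 (Good.field _) ψ ?_ ?_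
    · intro d
      refine ⟨Ideal.Quotient.mk (maximalIdeal D) d, ?_⟩
      rw [← Ideal.Quotient.eq_zero_iff_mem, map_sub, sub_eq_zero]
      exact (RingHom.congr_fun hψ _).symm
    · rw [hbot, Ideal.map_bot]; exact bot_le


theorem loc_quot {B : Type*} [CommRing B] [IsLocalRing B] (I : Ideal B) (h : I ≤ maximalIdeal B) : IsLocalRing (B ⧸ I) :=
  quot_local I fun h' => (maximalIdeal.isMaximal B).ne_top (top_le_iff.1 (h' ▸ h))

theorem loc_quot1 {B : Type*} [CommRing B] [IsLocalRing B] {x : B} (h : x ∈ maximalIdeal B) : IsLocalRing (B ⧸ Ideal.span {x}) :=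
  loc_quot _ ((Ideal.span_singleton_le_iff_mem _).2 h)

theorem smulreg_iff {B : Type*} [CommRing B] (x : B) : IsSMulRegular B x ↔ ∀ s, x * s = 0 → s = 0 := by
  rw [isSMulRegular_iff_nzd, mem_nonZeroDivisors_iff_right]
  simp only [mul_comm]

theorem mk_mem_max {B : Type*} [CommRing B] [IsLocalRing B] {B' : Type*} [CommRing B'] [IsLocalRing B'] (f : B →+* B') (hf : Function.Surjective f) (x : B) :
    f x ∈ maximalIdeal B' ↔ x ∈ maximalIdeal B := by
  have := IsLocalHom.of_surjective f hf
  rw [mem_maximalIdeal, mem_maximalIdeal, mem_nonunits_iff, mem_nonunits_iff, isUnit_map_iff]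

theorem HD_cons {B : Type u} [CommRing B] [IsLocalRing B] {n : ℕ} (x : B) (hx : x ∈ maximalIdeal B)
    (hr : ∀ s, x * s = 0 → s = 0) [IsLocalRing (B ⧸ Ideal.span {x})] (h : HD (B ⧸ Ideal.span {x}) n) : HD B (n + 1) := by
  obtain ⟨rs, h1, h2, h3⟩ := h
  let f : B ⧸ Ideal.span {x} → B := Function.surjInv Ideal.Quotient.mk_surjective
  have hf : ∀ z, Ideal.Quotient.mk (Ideal.span {x}) (f z) = z := Function.surjInv_eq _
  refine ⟨x :: rs.map f, by simp [h1], ?_, ?_⟩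
  · intro r hr
    rcases List.mem_cons.1 hr with rfl | hr
    · exact hx
    · obtain ⟨z, hz, rfl⟩ := List.mem_map.1 hr
      rw [← mk_mem_max (Ideal.Quotient.mk (Ideal.span {x})) Ideal.Quotient.mk_surjective, hf]
      exact h2 z hz
  · rw [wr_cons, smulreg_iff, List.map_map]
    refine ⟨hr, ?_⟩
    have h4 : rs.map ((Ideal.Quotient.mk (Ideal.span {x})) ∘ f) = rs :=
      (List.map_congr_left fun z _ => hf z).trans (List.map_id rs)
    rw [h4]; exact h3

theorem HD_uncons {B : Type u} [CommRing B] [IsLocalRing B] {n : ℕ} (h : HD B (n + 1)) :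
    ∃ x ∈ maximalIdeal B, (∀ s, x * s = 0 → s = 0) ∧ ∀ [IsLocalRing (B ⧸ Ideal.span {x})], HD (B ⧸ Ideal.span {x}) n := by
  obtain ⟨rs, h1, h2, h3⟩ := h
  cases rs with
  | nil => simp at h1
  | cons x rs =>
    rw [wr_cons, smulreg_iff] at h3
    refine ⟨x, h2 x (by simp), h3.1, ?_⟩
    intro _
    refine ⟨rs.map (Ideal.Quotient.mk _), by simpa using h1, ?_, h3.2⟩
    intro r hr
    obtain ⟨z, hz, rfl⟩ := List.mem_map.1 hr
    rw [mk_mem_max _ Ideal.Quotient.mk_surjective]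
    exact h2 z (by simp [hz])

theorem HD_quot' {B : Type u} [CommRing B] [IsLocalRing B] [IsNoetherianRing B] {n : ℕ} (h : HD B (n + 1)) (x : B)
    (hx : x ∈ maximalIdeal B) (hr : ∀ s, x * s = 0 → s = 0) [IsLocalRing (B ⧸ Ideal.span {x})] : HD (B ⧸ Ideal.span {x}) n :=
  HD_quot h x hx ((smulreg_iff x).2 hr)

theorem HD_zero (B : Type u) [CommRing B] [IsLocalRing B] : HD B 0 :=
  ⟨[], rfl, by simp, (isWeaklyRegular_iff_Fin _ []).2 (fun i => i.elim0)⟩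

/-- Krull: ideals are closed -/
theorem krull_closed {T : Type u} [CommRing T] [IsLocalRing T] [IsNoetherianRing T] (K : Ideal T) (s : T)
    (h : ∀ n, s ∈ K ⊔ maximalIdeal T ^ n) : s ∈ K := by
  by_cases hK : K = ⊤
  · rw [hK]; trivial
  have := quot_local K hK
  have h1 := Ideal.iInf_pow_eq_bot_of_isLocalRing (maximalIdeal (T ⧸ K)) (maximalIdeal.isMaximal _).ne_top
  rw [← Ideal.Quotient.eq_zero_iff_mem]
  have h2 : Ideal.Quotient.mk K s ∈ ⨅ i : ℕ, maximalIdeal (T ⧸ K) ^ i := by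
    rw [Ideal.mem_iInf]
    intro n
    obtain ⟨a, ha, b, hb, rfl⟩ := Submodule.mem_sup.1 (h n)
    rw [map_add, Ideal.Quotient.eq_zero_iff_mem.2 ha, zero_add]
    have h3 : (maximalIdeal T).map (Ideal.Quotient.mk K) ≤ maximalIdeal (T ⧸ K) := by
      rw [Ideal.map_le_iff_le_comap]
      intro z hz
      exact (mk_mem_max _ Ideal.Quotient.mk_surjective z).2 hz
    refine Ideal.pow_right_mono h3 n ?_
    rw [← Ideal.map_pow]
    exact Ideal.mem_map_of_mem _ hb
  rw [h1] at h2
  exact h2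

/-- elementwise flatness -/
def FL {E : Type u} {T : Type v} [CommRing E] [CommRing T] (φ : E →+* T) : Prop :=
  ∀ (J : Ideal E) (a : E) (t : T), φ a * t ∈ J.map φ → ∃ K : Ideal E, (∀ k ∈ K, a * k ∈ J) ∧ t ∈ K.map φ

theorem FL_flat {E : Type u} {T : Type v} [CommRing E] [CommRing T] [Algebra E T] [Module.Flat E T] : FL (algebraMap E T) := by
  intro J a t h
  rw [Ideal.map, Ideal.span, Submodule.mem_span_image_iff_exists_fun] at h
  obtain ⟨s, hs, c, hc⟩ := h
  let f : Option s → E := fun o => o.elim (-a) (fun i => i)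
  let x : Option s → T := fun o => o.elim t c
  have h0 : ∑ o, f o • x o = 0 := by
    rw [Fintype.sum_option]
    simp only [f, x, Option.elim]
    rw [neg_smul, Algebra.smul_def, ← hc, neg_add_eq_zero]
    exact Finset.sum_congr rfl fun i _ => by rw [Algebra.smul_def (i : E), smul_eq_mul, mul_comm]
  obtain ⟨k, A, y, h1, h2⟩ := Module.Flat.isTrivialRelation_of_sum_smul_eq_zero (R := E) (M := T) (f := f) (x := x) h0
  refine ⟨Submodule.comap (LinearMap.mulLeft E a) J, fun k hk => hk, ?_⟩
  have h3 := h1 none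
  simp only [x, Option.elim] at h3
  rw [h3]
  refine Submodule.sum_mem _ fun j _ => ?_
  rw [Algebra.smul_def]
  refine Ideal.mul_mem_right _ _ (Ideal.mem_map_of_mem _ ?_)
  show a * A none j ∈ J
  have h4 := h2 j
  rw [Fintype.sum_option] at h4
  simp only [f, Option.elim] at h4
  rw [neg_mul, neg_add_eq_zero] at h4
  rw [h4]
  exact Submodule.sum_mem _ fun i _ => Ideal.mul_mem_right _ _ (hs i.2)

theorem FL.base {E E' : Type u} {T T' : Type v} [CommRing E] [CommRing T] [CommRing E'] [CommRing T'] {φ : E →+* T}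
    (h : FL φ) (φ' : E' →+* T') (π : E →+* E') (ρ : T →+* T') (hπ : Function.Surjective π) (hρ : Function.Surjective ρ)
    (hc : φ'.comp π = ρ.comp φ) (hk : RingHom.ker ρ ≤ (RingHom.ker π).map φ) : FL φ' := by
  intro J a t hat
  obtain ⟨a, rfl⟩ := hπ a
  obtain ⟨t, rfl⟩ := hρ t
  have hc' : ∀ e, φ' (π e) = ρ (φ e) := fun e => RingHom.congr_fun hc e
  have h1 : J.map φ' = ((J.comap π).map φ).map ρ := by
    rw [Ideal.map_map, ← hc, ← Ideal.map_map, Ideal.map_comap_of_surjective _ hπ]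
  rw [h1, hc', ← map_mul] at hat
  obtain ⟨z, hz, hz'⟩ := (Ideal.mem_map_iff_of_surjective _ hρ).1 hat
  have h2 : φ a * t ∈ (J.comap π).map φ := by
    have h3 : φ a * t - z ∈ (J.comap π).map φ := by
      refine Ideal.map_mono ?_ (hk (show ρ (φ a * t - z) = 0 by rw [map_sub, hz', sub_self]))
      intro e he
      rw [Ideal.mem_comap, show π e = 0 from he]
      exact zero_mem _
    have := add_mem h3 hz
    simpa using this
  obtain ⟨K, hK, ht⟩ := h _ _ _ h2
  refine ⟨K.map π, ?_, ?_⟩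
  · intro k hk
    obtain ⟨k', hk', rfl⟩ := (Ideal.mem_map_iff_of_surjective _ hπ).1 hk
    rw [← map_mul]; exact hK k' hk'
  · rw [Ideal.map_map, hc, ← Ideal.map_map]
    exact Ideal.mem_map_of_mem _ ht

theorem FL.nzd_lift {E : Type u} {T : Type v} [CommRing E] [CommRing T] [IsLocalRing E] [IsNoetherianRing E] [IsLocalRing T] [IsNoetherianRing T]
    {φ : E →+* T} (h : FL φ) (hφ : (maximalIdeal E).map φ ≤ maximalIdeal T) (y : T)
    (hy : ∀ s, y * s ∈ (maximalIdeal E).map φ → s ∈ (maximalIdeal E).map φ) (J : Ideal E) (s : T) (hs : y * s ∈ J.map φ) : s ∈ J.map φ := by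
  have step : ∀ J : Ideal E, (∃ n, maximalIdeal E ^ n ≤ J) → ∀ s, y * s ∈ J.map φ → s ∈ J.map φ := by
    intro J
    refine IsNoetherian.induction (R := E) (M := E) (P := fun J : Ideal E => (∃ n, maximalIdeal E ^ n ≤ J) → ∀ s, y * s ∈ Ideal.map φ J → s ∈ Ideal.map φ J) ?_ J
    intro (J : Ideal E) ih hn s hs
    by_cases hJ : (J : Ideal E) = ⊤
    · rw [hJ, Ideal.map_top]; trivial
    classical
    have h1 := Nat.find_spec hn
    have h0 : Nat.find hn ≠ 0 := fun h0 => hJ (by rw [h0] at h1; simpa using h1)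
    obtain ⟨m, hm⟩ := Nat.exists_eq_succ_of_ne_zero h0
    have h2 := Nat.find_min hn (show m < Nat.find hn by omega)
    obtain ⟨e, he1, he2⟩ := Set.not_subset.1 h2
    rw [hm, Nat.succ_eq_add_one, pow_succ] at h1
    have h3 : s ∈ (J ⊔ Ideal.span {e}).map φ := by
      refine ih _ ?_ ?_ s (Ideal.map_mono le_sup_left hs)
      · refine lt_of_le_of_ne le_sup_left fun h => he2 ?_
        have : e ∈ J ⊔ Ideal.span {e} := Ideal.mem_sup_right (Ideal.mem_span_singleton_self e)
        rwa [← h] at this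
      · obtain ⟨n, hn⟩ := hn; exact ⟨n, hn.trans le_sup_left⟩
    rw [Ideal.map_sup, Ideal.map_span, Set.image_singleton] at h3
    obtain ⟨j, hj, b, hb, rfl⟩ := Submodule.mem_sup.1 h3
    obtain ⟨s', rfl⟩ := Ideal.mem_span_singleton.1 hb
    have h4 : φ e * (y * s') ∈ J.map φ := by
      have := Submodule.sub_mem _ hs (Ideal.mul_mem_left _ y hj)
      convert this using 1; ring
    obtain ⟨K, hK, hK2⟩ := h _ _ _ h4
    have hKm : K ≤ maximalIdeal E := by
      refine le_maximalIdeal fun hK' => he2 ?_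
      have := hK 1 (by rw [hK']; trivial)
      simpa using this
    have h5 := hy _ (Ideal.map_mono hKm hK2)
    refine add_mem hj ?_
    have h6 := Ideal.mul_mem_mul (Ideal.mem_map_of_mem φ (Ideal.mem_span_singleton_self e)) h5
    rw [← Ideal.map_mul] at h6
    refine Ideal.map_mono ?_ h6
    rw [Ideal.mul_le]
    intro r hr z hz
    obtain ⟨c, rfl⟩ := Ideal.mem_span_singleton.1 hr
    have := Ideal.mul_mem_left _ c (h1 (Ideal.mul_mem_mul he1 hz))
    convert this using 1; ring
  refine krull_closed _ s fun n => ?_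
  have h1 := step (J ⊔ maximalIdeal E ^ n) ⟨n, le_sup_right⟩ s (Ideal.map_mono le_sup_left hs)
  rw [Ideal.map_sup, Ideal.map_pow] at h1
  exact sup_le_sup_left (Ideal.pow_right_mono hφ n) _ h1

theorem FL.top {E : Type u} {T : Type v} [CommRing E] [CommRing T] {φ : E →+* T} (h : FL φ) (y : T)
    (hy : ∀ (J : Ideal E) (s : T), y * s ∈ J.map φ → s ∈ J.map φ) : FL ((Ideal.Quotient.mk (Ideal.span {y})).comp φ) := by
  intro J a t hat
  obtain ⟨t, rfl⟩ := Ideal.Quotient.mk_surjective t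
  rw [← Ideal.map_map, RingHom.comp_apply, ← map_mul] at hat
  obtain ⟨z, hz, hz'⟩ := (Ideal.mem_map_iff_of_surjective _ Ideal.Quotient.mk_surjective).1 hat
  rw [eq_comm, Ideal.Quotient.eq, Ideal.mem_span_singleton] at hz'
  obtain ⟨s, hs⟩ := hz'
  have h1 : s ∈ (J ⊔ Ideal.span {a}).map φ := by
    refine hy _ _ ?_
    rw [← hs, Ideal.map_sup]
    refine Submodule.sub_mem _ (Ideal.mem_sup_right (Ideal.mul_mem_right _ _ (Ideal.mem_map_of_mem _ (Ideal.mem_span_singleton_self _)))) (Ideal.mem_sup_left hz)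
  rw [Ideal.map_sup, Ideal.map_span, Set.image_singleton] at h1
  obtain ⟨j, hj, b, hb, rfl⟩ := Submodule.mem_sup.1 h1
  obtain ⟨s', rfl⟩ := Ideal.mem_span_singleton.1 hb
  have h2 : φ a * (t - y * s') ∈ J.map φ := by
    have : φ a * (t - y * s') = z + y * j := by linear_combination hs
    rw [this]; exact add_mem hz (Ideal.mul_mem_left _ _ hj)
  obtain ⟨K, hK, hK2⟩ := h _ _ _ h2
  refine ⟨K, hK, ?_⟩
  rw [← Ideal.map_map]
  have := Ideal.mem_map_of_mem (Ideal.Quotient.mk (Ideal.span {y})) hK2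
  convert this using 1
  rw [Ideal.Quotient.eq, Ideal.mem_span_singleton]
  exact ⟨s', by ring⟩



theorem quot_iso {T : Type u} {T' : Type v} [CommRing T] [CommRing T'] (ρ : T →+* T') (hρ : Function.Surjective ρ) (I : Ideal T)
    (hk : RingHom.ker ρ ≤ I) : Nonempty ((T ⧸ I) ≃+* (T' ⧸ I.map ρ)) := by
  have hs : Function.Surjective ((Ideal.Quotient.mk (I.map ρ)).comp ρ) := Ideal.Quotient.mk_surjective.comp hρ
  have h1 : I = RingHom.ker ((Ideal.Quotient.mk (I.map ρ)).comp ρ) := by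
    rw [RingHom.ker_eq_comap_bot, ← Ideal.comap_comap, ← RingHom.ker_eq_comap_bot, Ideal.mk_ker, Ideal.comap_map_of_surjective _ hρ,
      ← RingHom.ker_eq_comap_bot, sup_eq_left.2 hk]
  exact ⟨(Ideal.quotEquivOfEq h1).trans (RingHom.quotientKerEquivOfSurjective hs)⟩

theorem max_map_quot {E : Type u} {E' : Type v} [CommRing E] [IsLocalRing E] [CommRing E'] [IsLocalRing E'] (π : E →+* E') (hπ : Function.Surjective π) :
    (maximalIdeal E).map π = maximalIdeal E' := by
  ext z
  obtain ⟨z, rfl⟩ := hπ z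
  rw [mk_mem_max π hπ]
  constructor
  · intro h
    obtain ⟨w, hw, h2⟩ := (Ideal.mem_map_iff_of_surjective _ hπ).1 h
    rw [← mk_mem_max π hπ] at hw
    rw [h2] at hw
    exact (mk_mem_max π hπ z).1 hw
  · exact fun h => Ideal.mem_map_of_mem _ h

/-- base quotient -/
theorem FL.mod {E : Type u} {T : Type v} [CommRing E] [CommRing T] {φ : E →+* T} (h : FL φ) (a : E) :
    ∃ φ' : E ⧸ Ideal.span {a} →+* T ⧸ Ideal.span {φ a}, FL φ' ∧ φ'.comp (Ideal.Quotient.mk _) = (Ideal.Quotient.mk _).comp φ := by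
  have h0 : Ideal.span {a} ≤ (Ideal.span {φ a}).comap φ := by
    rw [Ideal.span_singleton_le_iff_mem]
    exact Ideal.mem_span_singleton_self _
  refine ⟨Ideal.quotientMap _ φ h0, ?_, Ideal.quotientMap_comp_mk h0⟩
  refine h.base _ (Ideal.Quotient.mk _) (Ideal.Quotient.mk _) Ideal.Quotient.mk_surjective Ideal.Quotient.mk_surjective (Ideal.quotientMap_comp_mk h0) ?_
  rw [Ideal.mk_ker, Ideal.mk_ker, Ideal.map_span, Set.image_singleton]

theorem FL.nzd {E : Type u} {T : Type v} [CommRing E] [CommRing T] {φ : E →+* T} (h : FL φ) (a : E) (ha : ∀ s, a * s = 0 → s = 0)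
    (t : T) (ht : φ a * t = 0) : t = 0 := by
  obtain ⟨K, hK, hK2⟩ := h ⊥ a t (by rw [ht]; exact zero_mem _)
  have : K = ⊥ := by
    rw [eq_bot_iff]
    intro k hk
    exact ha k (hK k hk)
  rw [this, Ideal.map_bot] at hK2
  exact hK2

theorem FL.HD_up (k : ℕ) : ∀ {E : Type u} {T : Type v} [CommRing E] [CommRing T] [IsLocalRing E] [IsLocalRing T]
    {φ : E →+* T} (_ : FL φ) (_ : (maximalIdeal E).map φ ≤ maximalIdeal T) (_ : HD E k), HD T k := by
  induction k with
  | zero => intros; exact HD_zero _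
  | succ k ih =>
    intro E T _ _ _ _ φ h hφ hE
    obtain ⟨a, ha, hr, hq⟩ := HD_uncons hE
    have h1 : φ a ∈ maximalIdeal T := hφ (Ideal.mem_map_of_mem _ ha)
    have := loc_quot1 ha
    have := loc_quot1 h1
    obtain ⟨φ', h2, h3⟩ := h.mod a
    refine HD_cons (φ a) h1 (h.nzd a hr) (ih h2 ?_ hq)
    rw [← max_map_quot (Ideal.Quotient.mk (Ideal.span {a})) Ideal.Quotient.mk_surjective, Ideal.map_map, h3, ← Ideal.map_map,
      ← max_map_quot (Ideal.Quotient.mk (Ideal.span {φ a})) Ideal.Quotient.mk_surjective]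
    exact Ideal.map_mono hφ

theorem FL.HD_lift {E : Type u} [CommRing E] [IsLocalRing E] [IsNoetherianRing E] (k f : ℕ) (hE : HD E k) : ∀ {T : Type v} [CommRing T] [IsLocalRing T]
    [IsNoetherianRing T] {φ : E →+* T} (_ : FL φ) (_ : (maximalIdeal E).map φ ≤ maximalIdeal T) [IsLocalRing (T ⧸ (maximalIdeal E).map φ)]
    (_ : HD (T ⧸ (maximalIdeal E).map φ) f), HD T (k + f) := by
  induction f with
  | zero => intro T _ _ _ φ h hφ _ _; exact h.HD_up k hφ hE
  | succ f ih =>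
    intro T _ _ _ φ h hφ _ hT
    obtain ⟨y, hy, hr, hq⟩ := HD_uncons hT
    have := loc_quot1 hy
    obtain ⟨y, rfl⟩ := Ideal.Quotient.mk_surjective y
    rw [mk_mem_max _ Ideal.Quotient.mk_surjective] at hy
    have h1 := h.nzd_lift hφ y (fun s hs => by
      rw [← Ideal.Quotient.eq_zero_iff_mem] at hs ⊢
      exact hr _ (by rw [← map_mul]; exact hs))
    have := loc_quot1 hy
    refine HD_cons (n := k + f) y hy (fun s hs => ?_) ?_
    · have := h1 ⊥ s (by rw [hs]; exact zero_mem _)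
      rwa [Ideal.map_bot] at this
    · have h3 : (maximalIdeal E).map ((Ideal.Quotient.mk (Ideal.span {y})).comp φ) ≤ maximalIdeal (T ⧸ Ideal.span {y}) := by
        rw [← Ideal.map_map, ← max_map_quot (Ideal.Quotient.mk (Ideal.span {y})) Ideal.Quotient.mk_surjective]
        exact Ideal.map_mono hφ
      have := loc_quot _ h3
      refine ih (h.top y h1) h3 ?_
      refine HD_congr (((Ideal.quotEquivOfEq ?_).trans (DoubleQuot.quotQuotEquivComm ((maximalIdeal E).map φ) (Ideal.span {y}))).trans (Ideal.quotEquivOfEq ?_)) hq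
      · rw [Ideal.map_span, Set.image_singleton]
      · rw [Ideal.map_map]

theorem exists_nzd_or {B : Type u} [CommRing B] [IsLocalRing B] [IsNoetherianRing B] : HD B 1 ∨ ∃ z : B, z ≠ 0 ∧ ∀ y ∈ maximalIdeal B, y * z = 0 := by
  by_cases h : ∃ y ∈ maximalIdeal B, ∀ s, y * s = 0 → s = 0
  · obtain ⟨y, hy, hr⟩ := h
    have := loc_quot1 hy
    exact Or.inl (HD_cons y hy hr (HD_zero _))
  · push Not at h
    right
    have h1 : (maximalIdeal B : Set B) ⊆ ⋃ p ∈ associatedPrimes B B, p := by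
      rw [biUnion_associatedPrimes_eq_compl_regular]
      intro y hy
      obtain ⟨s, hs, hs2⟩ := h y hy
      rw [Set.mem_compl_iff]
      intro hh
      have hh2 : IsSMulRegular B y := hh
      rw [smulreg_iff] at hh2
      exact hs2 (hh2 s hs)
    obtain ⟨p, hp, hle⟩ := (Ideal.subset_union_prime_finite (associatedPrimes.finite B B) ⊥ ⊥ (fun p hp _ _ => hp.isPrime)).1 h1
    obtain ⟨hpp, z, hz⟩ := (isAssociatedPrime_iff).1 hp
    refine ⟨z, ?_, ?_⟩
    · rintro rfl
      apply hpp.ne_top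
      rw [hz]; ext; simp
    · intro y hy
      have := hle hy
      rw [hz] at this
      simpa using this

theorem FL.HD_fibre0 {E : Type u} [CommRing E] [IsLocalRing E] [IsNoetherianRing E] (f : ℕ) (hE : ¬ HD E 1) : ∀ {T : Type v} [CommRing T] [IsLocalRing T]
    [IsNoetherianRing T] {φ : E →+* T} (_ : FL φ) (_ : (maximalIdeal E).map φ ≤ maximalIdeal T) [IsLocalRing (T ⧸ (maximalIdeal E).map φ)]
    (_ : HD T f), HD (T ⧸ (maximalIdeal E).map φ) f := by
  induction f with
  | zero => intros; exact HD_zero _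
  | succ f ih =>
    intro T _ _ _ φ h hφ _ hT
    have key : HD (T ⧸ (maximalIdeal E).map φ) 1 := by
      rcases exists_nzd_or (B := T ⧸ (maximalIdeal E).map φ) with h1 | ⟨z, hz, hz2⟩
      · exact h1
      exfalso
      obtain ⟨z, rfl⟩ := Ideal.Quotient.mk_surjective z
      obtain ⟨e, he, he2⟩ := (exists_nzd_or (B := E)).resolve_left hE
      obtain ⟨y, hy, hr, -⟩ := HD_uncons hT
      have h1 : φ e * z = 0 := by
        refine hr _ ?_
        have h2 : y * z ∈ (maximalIdeal E).map φ := by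
          rw [← Ideal.Quotient.eq_zero_iff_mem, map_mul]
          exact hz2 _ ((mk_mem_max _ Ideal.Quotient.mk_surjective y).2 hy)
        have h3 := Ideal.mul_mem_mul (Ideal.mem_map_of_mem φ (Ideal.mem_span_singleton_self e)) h2
        rw [← Ideal.map_mul] at h3
        have h4 : Ideal.span {e} * maximalIdeal E = ⊥ := by
          rw [eq_bot_iff, Ideal.mul_le]
          intro r hr z hz
          obtain ⟨c, rfl⟩ := Ideal.mem_span_singleton.1 hr
          have := he2 z hz
          show e * c * z = 0
          linear_combination c * this
        rw [h4, Ideal.map_bot] at h3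
        have : φ e * (y * z) = 0 := h3
        linear_combination this
      obtain ⟨K, hK, hK2⟩ := h ⊥ e z (by rw [h1]; exact zero_mem _)
      apply hz
      rw [Ideal.Quotient.eq_zero_iff_mem]
      refine Ideal.map_mono (le_maximalIdeal fun hK' => he ?_) hK2
      simpa using hK 1 (by rw [hK']; trivial)
    obtain ⟨y, hy, hr, -⟩ := HD_uncons key
    have := loc_quot1 hy
    obtain ⟨y, rfl⟩ := Ideal.Quotient.mk_surjective y
    have hyy := hy
    rw [mk_mem_max _ Ideal.Quotient.mk_surjective] at hy
    have h1 := h.nzd_lift hφ y (fun s hs => by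
      rw [← Ideal.Quotient.eq_zero_iff_mem] at hs ⊢
      exact hr _ (by rw [← map_mul]; exact hs))
    have := loc_quot1 hy
    have h3 : (maximalIdeal E).map ((Ideal.Quotient.mk (Ideal.span {y})).comp φ) ≤ maximalIdeal (T ⧸ Ideal.span {y}) := by
      rw [← Ideal.map_map, ← max_map_quot (Ideal.Quotient.mk (Ideal.span {y})) Ideal.Quotient.mk_surjective]
      exact Ideal.map_mono hφ
    have := loc_quot _ h3
    have h4 := ih (h.top y h1) h3 (HD_quot' hT y hy fun s hs => by
      have := h1 ⊥ s (by rw [hs]; exact zero_mem _)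
      rwa [Ideal.map_bot] at this)
    refine HD_cons _ hyy hr (HD_congr (((Ideal.quotEquivOfEq ?_).trans (DoubleQuot.quotQuotEquivComm ((maximalIdeal E).map φ) (Ideal.span {y}))).trans (Ideal.quotEquivOfEq ?_)).symm h4)
    · rw [Ideal.map_span, Set.image_singleton]
    · rw [Ideal.map_map]

theorem FL.HD_fibre (k f : ℕ) : ∀ {E : Type u} [CommRing E] [IsLocalRing E] [IsNoetherianRing E] (_ : HD E k) (_ : ¬ HD E (k + 1)) {T : Type v} [CommRing T] [IsLocalRing T]
    [IsNoetherianRing T] {φ : E →+* T} (_ : FL φ) (_ : (maximalIdeal E).map φ ≤ maximalIdeal T) [IsLocalRing (T ⧸ (maximalIdeal E).map φ)]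
    (_ : HD T (f + k)), HD (T ⧸ (maximalIdeal E).map φ) f := by
  induction k with
  | zero => intro E _ _ _ _ hE T _ _ _ φ h hφ _ hT; exact h.HD_fibre0 f hE hφ hT
  | succ k ih =>
    intro E _ _ _ hE hE2 T _ _ _ φ h hφ _ hT
    obtain ⟨a, ha, hr, hq⟩ := HD_uncons hE
    have h1 : φ a ∈ maximalIdeal T := hφ (Ideal.mem_map_of_mem _ ha)
    have := loc_quot1 ha
    have := loc_quot1 h1
    obtain ⟨φ', h2, h3⟩ := h.mod a
    have h4 : (maximalIdeal (E ⧸ Ideal.span {a})).map φ' = ((maximalIdeal E).map φ).map (Ideal.Quotient.mk (Ideal.span {φ a})) := by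
      rw [← max_map_quot (Ideal.Quotient.mk (Ideal.span {a})) Ideal.Quotient.mk_surjective, Ideal.map_map, h3, ← Ideal.map_map]
    have h5 : (maximalIdeal (E ⧸ Ideal.span {a})).map φ' ≤ maximalIdeal (T ⧸ Ideal.span {φ a}) := by
      rw [h4, ← max_map_quot (Ideal.Quotient.mk (Ideal.span {φ a})) Ideal.Quotient.mk_surjective]
      exact Ideal.map_mono hφ
    have := loc_quot _ h5
    have h6 := ih hq (fun hh => hE2 (HD_cons a ha hr hh)) h2 h5 (HD_quot' (n := f + k) hT (φ a) h1 (h.nzd a hr))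
    obtain ⟨e⟩ := quot_iso (Ideal.Quotient.mk (Ideal.span {φ a})) Ideal.Quotient.mk_surjective ((maximalIdeal E).map φ) (by
      rw [Ideal.mk_ker, Ideal.span_singleton_le_iff_mem]; exact Ideal.mem_map_of_mem _ ha)
    exact HD_congr (e.trans (Ideal.quotEquivOfEq h4.symm)).symm h6


end X11

namespace X11
universe v w
open IsLocalRing RingTheory.Sequence

theorem exists_ass {B : Type u} [CommRing B] [IsNoetherianRing B] (z : B) (hz : z ≠ 0) :
    ∃ 𝔞 : Ideal B, 𝔞.IsPrime ∧ (∃ w : B, ∀ y, y ∈ 𝔞 ↔ y * w = 0) ∧ ∀ y, y * z = 0 → y ∈ 𝔞 := by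
  obtain ⟨P, hP, hle⟩ := exists_le_isAssociatedPrime_of_isNoetherianRing B z hz
  rw [isAssociatedPrime_iff] at hP
  obtain ⟨h1, w, hw⟩ := hP
  refine ⟨P, h1, ⟨w, fun y => ?_⟩, fun y hy => hle ?_⟩
  · rw [hw, Submodule.mem_colon_singleton, Submodule.mem_bot, smul_eq_mul]
  · rwa [Submodule.mem_colon_singleton, Submodule.mem_bot, smul_eq_mul]

/-- depth is at most the dimension of any associated component -/
theorem DL (k : ℕ) : ∀ {B : Type u} [CommRing B] [IsLocalRing B] [IsNoetherianRing B] (_ : HD B k) (𝔞 : Ideal B)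
    [𝔞.IsPrime] (w : B) (_ : ∀ y, y ∈ 𝔞 ↔ y * w = 0), (k : WithBot ℕ∞) ≤ ringKrullDim (B ⧸ 𝔞) := by
  induction k with
  | zero =>
    intro B _ _ _ _ 𝔞 _ w _
    exact_mod_cast ringKrullDim_nonneg_of_nontrivial
  | succ k ih =>
    intro B _ _ _ h 𝔞 _ w hw
    obtain ⟨y, hy, hr, hq⟩ := HD_uncons h
    have := loc_quot1 hy
    have hw0 : w ≠ 0 := by
      rintro rfl
      exact Ideal.IsPrime.ne_top (I := 𝔞) ‹_› ((Ideal.eq_top_iff_one _).2 ((hw 1).2 (by simp)))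
    have hya : y ∉ 𝔞 := fun h => hw0 (hr _ ((hw y).1 h))
    let N : Ideal B :=
      { carrier := {n | ∀ a ∈ 𝔞, a * n = 0}
        add_mem' := fun {a b} ha hb c hc => by rw [mul_add, ha c hc, hb c hc, add_zero]
        zero_mem' := fun c _ => mul_zero c
        smul_mem' := fun c x hx a ha => by
          rw [smul_eq_mul, mul_left_comm, hx a ha, mul_zero] }
    have hN : ∀ n, n ∈ N ↔ ∀ a ∈ 𝔞, a * n = 0 := fun n => Iff.rfl
    have hex : ∃ n ∈ N, n ∉ Ideal.span {y} := by
      by_contra hc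
      push Not at hc
      have h1 : N ≤ Ideal.span {y} • N := by
        intro n hn
        obtain ⟨n', rfl⟩ := Ideal.mem_span_singleton'.1 (hc n hn)
        rw [mul_comm]
        refine Submodule.smul_mem_smul (Ideal.mem_span_singleton_self y) ?_
        rw [hN] at hn ⊢
        intro a ha
        apply hr
        rw [← hn a ha]; ring
      have h2 := Submodule.eq_bot_of_le_smul_of_le_jacobson_bot (Ideal.span {y}) N (IsNoetherian.noetherian N) h1
        (by rw [jacobson_eq_maximalIdeal _ bot_ne_top]; exact (Ideal.span_singleton_le_iff_mem _).2 hy)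
      have h3 : w ∈ N := (hN w).2 fun a ha => (hw a).1 ha
      rw [h2] at h3
      exact hw0 h3
    obtain ⟨n, hn, hny⟩ := hex
    obtain ⟨𝔟, hb, ⟨w', hw'⟩, hb'⟩ := exists_ass (Ideal.Quotient.mk (Ideal.span {y}) n)
      (fun h => hny (Ideal.Quotient.eq_zero_iff_mem.1 h))
    have h1 := ih hq 𝔟 w' hw'
    let g : B →+* ((B ⧸ Ideal.span {y}) ⧸ 𝔟) := (Ideal.Quotient.mk 𝔟).comp (Ideal.Quotient.mk _)
    have hg : Function.Surjective g := Ideal.Quotient.mk_surjective.comp Ideal.Quotient.mk_surjective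
    have hga : ∀ a ∈ 𝔞, g a = 0 := fun a ha => by
      rw [RingHom.comp_apply, Ideal.Quotient.eq_zero_iff_mem]
      apply hb'
      rw [← map_mul, (hN n).1 hn a ha, map_zero]
    let g1 := Ideal.Quotient.lift 𝔞 g hga
    have hg1 : Function.Surjective g1 := Ideal.Quotient.lift_surjective_of_surjective _ _ hg
    let y' := Ideal.Quotient.mk 𝔞 y
    have hg1y : ∀ a ∈ Ideal.span {y'}, g1 a = 0 := by
      intro a ha
      obtain ⟨c, rfl⟩ := Ideal.mem_span_singleton'.1 ha
      rw [map_mul]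
      have : g1 y' = 0 := by
        change g y = 0
        rw [RingHom.comp_apply, Ideal.Quotient.eq_zero_iff_mem.2 (Ideal.mem_span_singleton_self y), map_zero]
      rw [this, mul_zero]
    have h2 := ringKrullDim_le_of_surjective _ (Ideal.Quotient.lift_surjective_of_surjective (Ideal.span {y'}) hg1y hg1)
    have h3 : y' ∈ nonZeroDivisors (B ⧸ 𝔞) := mem_nonZeroDivisors_of_ne_zero
      (fun h => hya (Ideal.Quotient.eq_zero_iff_mem.1 h))
    have h4 := ringKrullDim_quotient_succ_le_of_nonZeroDivisor h3
    push_cast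
    exact (add_le_add_left (h1.trans h2) 1).trans h4

theorem depth_le_dim {k : ℕ} {B : Type u} [CommRing B] [IsLocalRing B] [IsNoetherianRing B] (h : HD B k) :
    (k : WithBot ℕ∞) ≤ ringKrullDim B := by
  obtain ⟨𝔞, h1, ⟨w, hw⟩, -⟩ := exists_ass (1 : B) one_ne_zero
  exact (DL k h 𝔞 w hw).trans (ringKrullDim_quotient_le 𝔞)

/-- a prime without regular elements lies in an associated prime -/
theorem zd_prime {B : Type u} [CommRing B] [IsNoetherianRing B] (𝔮 : Ideal B)
    (h : ∀ y ∈ 𝔮, ∃ s, y * s = 0 ∧ s ≠ 0) : ∃ 𝔞 : Ideal B, 𝔞.IsPrime ∧ (∃ w : B, ∀ y, y ∈ 𝔞 ↔ y * w = 0) ∧ 𝔮 ≤ 𝔞 := by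
  have hf : (associatedPrimes B B).Finite := associatedPrimes.finite B B
  have hsub : (𝔮 : Set B) ⊆ ⋃ i ∈ associatedPrimes B B, ((id i : Ideal B) : Set B) := by
    intro y hy
    obtain ⟨s, hs, hs0⟩ := h y hy
    have := biUnion_associatedPrimes_eq_compl_regular B B
    simp only [id]
    rw [this, Set.mem_compl_iff, Set.mem_ofPred_eq, smulreg_iff]
    intro h'
    exact hs0 (h' s hs)
  obtain ⟨P, hP, hle⟩ := (Ideal.subset_union_prime_finite hf ⊥ ⊥ (fun i hi _ _ => IsAssociatedPrime.isPrime hi)).1 hsub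
  have hP' : IsAssociatedPrime P B := hP
  rw [isAssociatedPrime_iff] at hP'
  obtain ⟨h1, w, hw⟩ := hP'
  refine ⟨P, h1, ⟨w, fun y => ?_⟩, hle⟩
  rw [hw, Submodule.mem_colon_singleton, Submodule.mem_bot, smul_eq_mul]

/-- localization of a surjection -/
theorem loc_surj {B : Type u} {B' : Type v} [CommRing B] [CommRing B'] (f : B →+* B') (hf : Function.Surjective f)
    (𝔮 : Ideal B) [𝔮.IsPrime] (𝔮' : Ideal B') [𝔮'.IsPrime] (h : 𝔮 = 𝔮'.comap f) :
    Function.Surjective (Localization.localRingHom 𝔮 𝔮' f h) ∧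
    RingHom.ker (Localization.localRingHom 𝔮 𝔮' f h) = (RingHom.ker f).map (algebraMap B (Localization.AtPrime 𝔮)) := by
  have hmap : Submonoid.map f 𝔮.primeCompl = 𝔮'.primeCompl := by
    ext z
    constructor
    · rintro ⟨y, hy, rfl⟩
      intro hz
      exact hy (by rw [h]; exact hz)
    · intro hz
      obtain ⟨y, rfl⟩ := hf z
      exact ⟨y, fun hy => hz (by rw [h] at hy; exact hy), rfl⟩
  constructor
  · intro z
    obtain ⟨⟨a, s⟩, rfl⟩ := IsLocalization.mk'_surjective 𝔮'.primeCompl z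
    obtain ⟨a, rfl⟩ := hf a
    obtain ⟨s, hs⟩ := s
    rw [← hmap] at hs
    obtain ⟨t, ht, rfl⟩ := hs
    exact ⟨IsLocalization.mk' _ a (⟨t, ht⟩ : 𝔮.primeCompl), by rw [Localization.localRingHom_mk']⟩
  · exact IsLocalization.ker_map (S := Localization.AtPrime 𝔮) (Localization.AtPrime 𝔮') f hmap

theorem ht_coht {B : Type u} [CommRing B] (𝔮 : Ideal B) [𝔮.IsPrime] :
    (𝔮.height : WithBot ℕ∞) + ringKrullDim (B ⧸ 𝔮) ≤ ringKrullDim B := by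
  let p : PrimeSpectrum B := ⟨𝔮, ‹_›⟩
  have h1 : ringKrullDim (B ⧸ 𝔮) = (Order.coheight p : WithBot ℕ∞) := by
    rw [ringKrullDim_quotient, Order.coheight_eq_krullDim_Ici]
    rfl
  have h2 : 𝔮.height = Order.height p := PrimeSpectrum.height_eq_orderHeight p
  rw [h1, h2, ringKrullDim, @Order.krullDim_eq_iSup_height_add_coheight_of_nonempty _ _ ⟨p⟩, ← WithBot.coe_add, WithBot.coe_le_coe]
  exact le_iSup (fun a : PrimeSpectrum B => Order.height a + Order.coheight a) p

theorem loc_quot_equiv {B : Type u} {B' : Type v} [CommRing B] [CommRing B'] (f : B →+* B') (hf : Function.Surjective f)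
    (𝔮 : Ideal B) [𝔮.IsPrime] (𝔮' : Ideal B') [𝔮'.IsPrime] (h : 𝔮 = 𝔮'.comap f) :
    Nonempty ((Localization.AtPrime 𝔮 ⧸ (RingHom.ker f).map (algebraMap B (Localization.AtPrime 𝔮))) ≃+* Localization.AtPrime 𝔮') := by
  obtain ⟨h1, h2⟩ := loc_surj f hf 𝔮 𝔮' h
  rw [← h2]
  exact ⟨RingHom.quotientKerEquivOfSurjective h1⟩

theorem loc_quot_equiv1 {B : Type u} [CommRing B] (y : B)
    (𝔮 : Ideal B) [𝔮.IsPrime] (𝔮' : Ideal (B ⧸ Ideal.span {y})) [𝔮'.IsPrime] (h : 𝔮 = 𝔮'.comap (Ideal.Quotient.mk _)) :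
    Nonempty ((Localization.AtPrime 𝔮 ⧸ Ideal.span {algebraMap B (Localization.AtPrime 𝔮) y}) ≃+* Localization.AtPrime 𝔮') := by
  have := loc_quot_equiv (Ideal.Quotient.mk (Ideal.span {y})) Ideal.Quotient.mk_surjective 𝔮 𝔮' h
  rwa [Ideal.mk_ker, Ideal.map_span, Set.image_singleton] at this

theorem loc_nzd {B : Type u} [CommRing B] (y : B) (hr : ∀ s, y * s = 0 → s = 0)
    (𝔮 : Ideal B) [𝔮.IsPrime] (s : Localization.AtPrime 𝔮) (h : algebraMap B (Localization.AtPrime 𝔮) y * s = 0) : s = 0 := by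
  obtain ⟨⟨a, t⟩, rfl⟩ := IsLocalization.mk'_surjective 𝔮.primeCompl s
  rw [← IsLocalization.mk'_one (M := 𝔮.primeCompl) (Localization.AtPrime 𝔮) y, ← IsLocalization.mk'_mul, IsLocalization.mk'_eq_zero_iff] at h
  obtain ⟨m, hm⟩ := h
  rw [IsLocalization.mk'_eq_zero_iff]
  refine ⟨m, hr _ ?_⟩
  rw [← hm]; ring

/-- local rings of CM local rings -/
theorem M7 (n : ℕ) : ∀ {B : Type u} [CommRing B] [IsLocalRing B] [IsNoetherianRing B] (_ : HD B n) (_ : ringKrullDim B = n)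
    (𝔮 : Ideal B) [𝔮.IsPrime], ∃ l : ℕ, HD (Localization.AtPrime 𝔮) l ∧ 𝔮.height = l ∧ ringKrullDim (B ⧸ 𝔮) + l = n := by
  induction n with
  | zero =>
    intro B _ _ _ h hd 𝔮 _
    refine ⟨0, HD_zero _, ?_, ?_⟩
    · have := Ideal.height_le_ringKrullDim_of_isPrime (I := 𝔮)
      rw [hd] at this
      have h' : 𝔮.height ≤ ((0 : ℕ) : ℕ∞) := by exact_mod_cast this
      simpa using h'
    · have := ringKrullDim_quotient_le 𝔮
      rw [hd] at this
      have h2 : (0 : WithBot ℕ∞) ≤ ringKrullDim (B ⧸ 𝔮) := ringKrullDim_nonneg_of_nontrivial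
      simpa using le_antisymm this (by exact_mod_cast h2)
  | succ n ih =>
    intro B _ _ _ h hd 𝔮 _
    have hl : IsLocalRing (B ⧸ 𝔮) := quot_local 𝔮 (Ideal.IsPrime.ne_top ‹_›)
    obtain ⟨c, hc⟩ := exists_dim (B ⧸ 𝔮)
    obtain ⟨t, ht⟩ := ENat.ne_top_iff_exists.1 (Ideal.height_ne_top_of_isPrime (I := 𝔮))
    have hsum := ht_coht 𝔮
    rw [hc, ← ht, hd] at hsum
    have hsum' : t + c ≤ n + 1 := by exact_mod_cast hsum
    by_cases hz : ∀ y ∈ 𝔮, ∃ s, y * s = 0 ∧ s ≠ 0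
    · obtain ⟨𝔞, h1, ⟨w, hw⟩, hle⟩ := zd_prime 𝔮 hz
      have h2 := (DL (n+1) h 𝔞 w hw).trans (ringKrullDim_le_of_surjective _ (Ideal.Quotient.factor_surjective hle))
      rw [hc] at h2
      have h2' : n + 1 ≤ c := by exact_mod_cast h2
      refine ⟨0, HD_zero _, ?_, ?_⟩
      · rw [← ht]; norm_cast; omega
      · rw [hc]; norm_cast; omega
    · push Not at hz
      obtain ⟨y, hy, hr⟩ := hz
      have hym : y ∈ maximalIdeal B := le_maximalIdeal (Ideal.IsPrime.ne_top ‹_›) hy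
      have := loc_quot1 hym
      have hq := HD_quot' h y hym hr
      have hyn : y ∈ nonZeroDivisors B := mem_nonZeroDivisors_iff_right.2 (fun s hs => hr s (by rwa [mul_comm]))
      have hd1 := ringKrullDim_quotient_span_singleton_succ_eq_ringKrullDim_of_mem_nonZeroDivisors hyn hym
      obtain ⟨r, hrr⟩ := exists_dim (B ⧸ Ideal.span {y})
      rw [hrr, hd] at hd1
      have hrn : r = n := by
        have : r + 1 = n + 1 := by exact_mod_cast hd1
        omega
      subst hrn
      have hyq : RingHom.ker (Ideal.Quotient.mk (Ideal.span {y})) ≤ 𝔮 := by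
        rw [Ideal.mk_ker]; exact (Ideal.span_singleton_le_iff_mem _).2 hy
      have hp' : (𝔮.map (Ideal.Quotient.mk (Ideal.span {y}))).IsPrime :=
        Ideal.map_isPrime_of_surjective Ideal.Quotient.mk_surjective hyq
      obtain ⟨l, hl1, hl2, hl3⟩ := ih hq hrr (𝔮.map (Ideal.Quotient.mk (Ideal.span {y})))
      have hcom : 𝔮 = (𝔮.map (Ideal.Quotient.mk (Ideal.span {y}))).comap (Ideal.Quotient.mk _) := by
        rw [Ideal.comap_map_of_surjective _ Ideal.Quotient.mk_surjective]
        rw [left_eq_sup]; exact hyq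
      obtain ⟨e⟩ := loc_quot_equiv1 y 𝔮 _ hcom
      have hyl : algebraMap B (Localization.AtPrime 𝔮) y ∈ maximalIdeal (Localization.AtPrime 𝔮) :=
        (IsLocalization.AtPrime.to_map_mem_maximal_iff _ 𝔮 y).2 hy
      have hlo := loc_quot1 hyl
      have h5 := HD_cons _ hyl (loc_nzd y hr 𝔮) (HD_congr e.symm hl1)
      have h6 := depth_le_dim h5
      rw [IsLocalization.AtPrime.ringKrullDim_eq_height 𝔮, ← ht] at h6
      have h6' : l + 1 ≤ t := by exact_mod_cast h6
      obtain ⟨e2⟩ := quot_iso (Ideal.Quotient.mk (Ideal.span {y})) Ideal.Quotient.mk_surjective 𝔮 hyq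
      rw [← ringKrullDim_eq_of_ringEquiv e2, hc] at hl3
      have h7 : c + l = r := by exact_mod_cast hl3
      refine ⟨l + 1, h5, ?_, ?_⟩
      · rw [← ht]; norm_cast; omega
      · rw [hc]; norm_cast; omega


theorem conn {C : Type u} [CommRing C] [IsLocalRing C] (h : HD C 2) (I J : Ideal C) (hIJ : ∀ i ∈ I, ∀ j ∈ J, i * j = 0)
    (hr : maximalIdeal C ≤ (I ⊔ J).radical) : I = ⊥ ∨ J = ⊥ := by
  obtain ⟨a, b, ha, hb, hab⟩ := exists_pair h
  obtain ⟨k, hk⟩ := hr ha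
  obtain ⟨l, hl⟩ := hr hb
  have hp := (hab.pow_left k).pow_right l
  obtain ⟨i, hi, j, hj, hij⟩ := Submodule.mem_sup.1 hk
  obtain ⟨i', hi', j', hj', hij'⟩ := Submodule.mem_sup.1 hl
  obtain ⟨e, he⟩ := hp.2 i i' (by
    rw [← hij, ← hij']
    linear_combination hIJ i hi j' hj' - hIJ i' hi' j hj)
  have h1 : e * j = 0 := hp.1 _ (by linear_combination hIJ i hi j hj - j * he)
  have h2 : e * (1 - e) = 0 := hp.1 _ (by linear_combination (-e) * hij + e * he + h1)
  have hu : IsUnit e ∨ IsUnit (1 - e) := IsLocalRing.isUnit_or_isUnit_of_add_one (by ring)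
  rcases hu with hu | hu
  · right
    have hj0 : j = 0 := hu.mul_right_eq_zero.1 h1
    rw [eq_bot_iff]
    intro y hy
    rw [Ideal.mem_bot]
    apply hp.1
    rw [← hij, hj0, add_zero]
    exact hIJ i hi y hy
  · left
    have he0 : e = 0 := hu.mul_left_eq_zero.1 h2
    have hi0 : i = 0 := by rw [he, he0, mul_zero]
    rw [eq_bot_iff]
    intro y hy
    rw [Ideal.mem_bot]
    apply hp.1
    rw [← hij, hi0, zero_add, mul_comm]
    exact hIJ y hy j hj

theorem loc_rad {R : Type u} [CommRing R] (K P : Ideal R) [P.IsPrime] (hP : P ∈ K.minimalPrimes) :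
    maximalIdeal (Localization.AtPrime P) ≤ (K.map (algebraMap R (Localization.AtPrime P))).radical := by
  rw [Ideal.radical_eq_sInf]
  refine le_sInf ?_
  rintro 𝔯 ⟨h1, h2⟩
  have h3 : K ≤ 𝔯.comap (algebraMap R (Localization.AtPrime P)) := Ideal.map_le_iff_le_comap.1 h1
  have h4 : 𝔯.comap (algebraMap R (Localization.AtPrime P)) ≤ P := by
    intro y hy
    exact (IsLocalization.AtPrime.to_map_mem_maximal_iff (Localization.AtPrime P) P y).1 (le_maximalIdeal h2.ne_top hy)
  have h5 := hP.2 ⟨Ideal.comap_isPrime _ _, h3⟩ h4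
  rw [← Localization.AtPrime.map_eq_maximalIdeal, Ideal.map_le_iff_le_comap]
  exact h5

theorem cat {n : ℕ} {B : Type u} [CommRing B] [IsLocalRing B] [IsNoetherianRing B] (h : HD B n) (hd : ringKrullDim B = n)
    {R : Type v} [CommRing R] (f : B →+* R) (hf : Function.Surjective f) (p P : Ideal R) [p.IsPrime] [P.IsPrime] (hle : p ≤ P) :
    (P.comap f).height ≤ (p.comap f).height + P.height := by
  obtain ⟨t, h1, h2, -⟩ := M7 n h hd (P.comap f)
  have hdis : Disjoint ((P.comap f).primeCompl : Set B) (p.comap f : Ideal B) := by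
    rw [Set.disjoint_left]
    intro a ha ha'
    exact ha (hle ha')
  have hpr := IsLocalization.isPrime_of_isPrime_disjoint (P.comap f).primeCompl (Localization.AtPrime (P.comap f)) (p.comap f) inferInstance hdis
  have h3 := IsLocalization.height_map_of_disjoint (S := Localization.AtPrime (P.comap f)) (P.comap f).primeCompl (p.comap f) hdis
  obtain ⟨s, -, h4, h5⟩ := M7 t h1 (by rw [IsLocalization.AtPrime.ringKrullDim_eq_height (P.comap f), h2]; rfl) ((p.comap f).map (algebraMap B (Localization.AtPrime (P.comap f))))
  obtain ⟨h6, h7⟩ := loc_surj f hf (P.comap f) P rfl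
  obtain ⟨e⟩ := quot_iso _ h6 ((p.comap f).map (algebraMap B (Localization.AtPrime (P.comap f)))) (by
    rw [h7]
    refine Ideal.map_mono ?_
    intro y hy
    rw [Ideal.mem_comap, (RingHom.mem_ker).1 hy]; exact Ideal.zero_mem _)
  have h8 := ringKrullDim_quotient_le (((p.comap f).map (algebraMap B (Localization.AtPrime (P.comap f)))).map (Localization.localRingHom (P.comap f) P f rfl))
  rw [← ringKrullDim_eq_of_ringEquiv e, IsLocalization.AtPrime.ringKrullDim_eq_height P (Localization.AtPrime P)] at h8
  rw [h3] at h4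
  rw [h2, h4]
  have h9 : ((t : ℕ∞) : WithBot ℕ∞) ≤ ((s + P.height : ℕ∞) : WithBot ℕ∞) := by
    have : ((t : ℕ∞) : WithBot ℕ∞) = (t : WithBot ℕ∞) := rfl
    rw [this, ← h5, WithBot.coe_add, add_comm]
    exact add_le_add_right h8 _
  exact_mod_cast h9


open Classical in
theorem equi_R {n : ℕ} {B : Type u} [CommRing B] [IsLocalRing B] [IsNoetherianRing B] (h : HD B n) (hd : ringKrullDim B = n)
    {R : Type v} [CommRing R] [IsLocalRing R] [IsNoetherianRing R] [IsReduced R] (f : B →+* R) (hf : Function.Surjective f)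
    (hS2 : ∀ (P : Ideal R) [P.IsPrime], 2 ≤ P.height → HD (Localization.AtPrime P) 2)
    (p q : Ideal R) (hp : p ∈ minimalPrimes R) (hq : q ∈ minimalPrimes R) : (p.comap f).height = (q.comap f).height := by
  by_contra hne
  have hfin : (minimalPrimes R).Finite := minimalPrimes.finite_of_isNoetherianRing R
  let s := hfin.toFinset
  have hs : ∀ r, r ∈ s ↔ r ∈ minimalPrimes R := fun r => hfin.mem_toFinset
  let sA := s.filter (fun r => (r.comap f).height = (p.comap f).height)
  let sB := s.filter (fun r => ¬ (r.comap f).height = (p.comap f).height)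
  let I : Ideal R := sA.inf id
  let J : Ideal R := sB.inf id
  have hIJ : ∀ i ∈ I, ∀ j ∈ J, i * j = 0 := by
    intro i hi j hj
    have h1 : i * j ∈ sInf (minimalPrimes R) := by
      rw [Ideal.mem_sInf]
      intro r hr
      by_cases hc : (r.comap f).height = (p.comap f).height
      · have : I ≤ r := Finset.inf_le (f := id) (Finset.mem_filter.2 ⟨(hs r).2 hr, hc⟩)
        exact Ideal.mul_mem_right _ _ (this hi)
      · have : J ≤ r := Finset.inf_le (f := id) (Finset.mem_filter.2 ⟨(hs r).2 hr, hc⟩)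
        exact Ideal.mul_mem_left _ _ (this hj)
    have h2 : sInf (minimalPrimes R) = (⊥ : Ideal R).radical := Ideal.sInf_minimalPrimes
    rw [h2, Ideal.mem_radical_iff] at h1
    obtain ⟨k, hk⟩ := h1
    exact IsReduced.eq_zero _ ⟨k, (Ideal.mem_bot).1 hk⟩
  have hpm : ∀ r ∈ minimalPrimes R, r ≤ maximalIdeal R := fun r hr => le_maximalIdeal hr.1.1.ne_top
  have hIp : I ≤ p := Finset.inf_le (f := id) (Finset.mem_filter.2 ⟨(hs p).2 hp, rfl⟩)
  have hJq : J ≤ q := Finset.inf_le (f := id) (Finset.mem_filter.2 ⟨(hs q).2 hq, fun h => hne h.symm⟩)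
  obtain ⟨P, hP, -⟩ := Ideal.exists_minimalPrimes_le (I := I ⊔ J) (J := maximalIdeal R)
    (sup_le (hIp.trans (hpm p hp)) (hJq.trans (hpm q hq)))
  have hPp : P.IsPrime := hP.1.1
  have hsub : ∀ (r : Ideal R), r.IsPrime → I ≤ r → ∃ p' ∈ minimalPrimes R, (p'.comap f).height = (p.comap f).height ∧ p' ≤ r := by
    intro r hr hIr
    obtain ⟨p', h1, h2⟩ := (Ideal.IsPrime.inf_le' hr).1 hIr
    obtain ⟨h3, h4⟩ := Finset.mem_filter.1 h1
    exact ⟨p', (hs p').1 h3, h4, h2⟩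
  have hsubJ : ∀ (r : Ideal R), r.IsPrime → J ≤ r → ∃ p' ∈ minimalPrimes R, (p'.comap f).height ≠ (p.comap f).height ∧ p' ≤ r := by
    intro r hr hIr
    obtain ⟨p', h1, h2⟩ := (Ideal.IsPrime.inf_le' hr).1 hIr
    obtain ⟨h3, h4⟩ := Finset.mem_filter.1 h1
    exact ⟨p', (hs p').1 h3, h4, h2⟩
  have hmin : ∀ p1 ∈ minimalPrimes R, ∀ p2 ∈ minimalPrimes R, p1 ≤ p2 → p1 = p2 := fun p1 h1 p2 h2 h12 =>
    le_antisymm h12 (h2.2 ⟨h1.1.1, bot_le⟩ h12)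
  obtain ⟨p1, hp1, hp1h, hp1P⟩ := hsub P hPp (le_sup_left.trans hP.1.2)
  obtain ⟨q1, hq1, hq1h, hq1P⟩ := hsubJ P hPp (le_sup_right.trans hP.1.2)
  have hp1p : p1.IsPrime := hp1.1.1
  have hq1p : q1.IsPrime := hq1.1.1
  have hpq : p1 ≠ q1 := by rintro rfl; exact hq1h hp1h
  have hlt : ∀ r ∈ minimalPrimes R, ∀ r' ∈ minimalPrimes R, r ≠ r' → r ≤ P → r' ≤ P → r < P := by
    intro r hr r' hr' hrr h1 h2
    refine lt_of_le_of_ne h1 ?_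
    rintro rfl
    exact hrr (hmin r' hr' r hr h2).symm
  have hplt := hlt p1 hp1 q1 hq1 hpq hp1P hq1P
  have hqlt := hlt q1 hq1 p1 hp1 hpq.symm hq1P hp1P
  by_cases h2 : 2 ≤ P.height
  · have h3 := conn (hS2 P h2) (I.map (algebraMap R (Localization.AtPrime P))) (J.map (algebraMap R (Localization.AtPrime P))) ?_ ?_
    · have key : ∀ (K : Ideal R), K.map (algebraMap R (Localization.AtPrime P)) = ⊥ → ∀ r : Ideal R, r.IsPrime → r ≤ P → K ≤ r := by
        intro K hK r hr hrP y hy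
        have h4 : algebraMap R (Localization.AtPrime P) y = 0 := by
          rw [← Ideal.mem_bot, ← hK]; exact Ideal.mem_map_of_mem _ hy
        rw [IsLocalization.map_eq_zero_iff P.primeCompl] at h4
        obtain ⟨m, hm⟩ := h4
        have h5 : (m : R) * y ∈ r := by rw [hm]; exact Ideal.zero_mem _
        exact (hr.mem_or_mem h5).resolve_left (fun h => m.2 (hrP h))
      rcases h3 with h3 | h3
      · obtain ⟨p', h4, h5, h6⟩ := hsub q1 hq1p (key I h3 q1 hq1p hq1P)
        have := hmin p' h4 q1 hq1 h6
        rw [this] at h5; exact hq1h h5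
      · obtain ⟨p', h4, h5, h6⟩ := hsubJ p1 hp1p (key J h3 p1 hp1p hp1P)
        have := hmin p' h4 p1 hp1 h6
        rw [this] at h5; exact h5 hp1h
    · intro i hi j hj
      have : i * j ∈ I.map (algebraMap R (Localization.AtPrime P)) * J.map (algebraMap R (Localization.AtPrime P)) := Ideal.mul_mem_mul hi hj
      rw [← Ideal.map_mul] at this
      have h0 : I * J = ⊥ := by
        rw [eq_bot_iff, Ideal.mul_le]
        intro r hr s hs
        exact (Ideal.mem_bot).2 (hIJ r hr s hs)
      rw [h0, Ideal.map_bot] at this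
      exact this
    · rw [← Ideal.map_sup]
      exact loc_rad _ P hP
  · have h3 : P.height ≤ 1 := by
      rw [not_le] at h2
      exact ENat.lt_add_one_iff (by simp) |>.1 (by simpa [one_add_one_eq_two] using h2)
    have key : ∀ r : Ideal R, r.IsPrime → r < P → (P.comap f).height = (r.comap f).height + 1 := by
      intro r hr hrP
      apply le_antisymm
      · exact (cat h hd f hf r P hrP.le).trans (add_le_add_right h3 _)
      · refine Ideal.height_add_one_le_of_lt_of_isPrime ?_
        refine lt_of_le_of_ne (Ideal.comap_mono hrP.le) ?_
        intro h'
        exact hrP.ne (Ideal.comap_injective_of_surjective f hf h')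
    have h4 := key p1 hp1p hplt
    rw [key q1 hq1p hqlt] at h4
    have h5 : (q1.comap f).height = (p1.comap f).height := ENat.add_left_injective_of_ne_top (n := 1) (by simp) h4
    exact hq1h (h5.trans hp1h)

theorem exists_min_dim (R : Type v) [CommRing R] [IsLocalRing R] [IsNoetherianRing R] :
    ∃ p ∈ minimalPrimes R, ringKrullDim (R ⧸ p) = ringKrullDim R := by
  obtain ⟨d, hd⟩ := exists_dim R
  have h1 : Order.krullDim (PrimeSpectrum R) = d := hd
  obtain ⟨s, hs⟩ := Order.le_krullDim_iff.1 h1.ge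
  obtain ⟨p, hp, hle⟩ := Ideal.exists_minimalPrimes_le (I := ⊥) (J := s.head.asIdeal) bot_le
  have hpp : p.IsPrime := hp.1.1
  refine ⟨p, hp, le_antisymm (ringKrullDim_quotient_le p) ?_⟩
  have h2 : ringKrullDim (R ⧸ p) = (Order.coheight (⟨p, hpp⟩ : PrimeSpectrum R) : WithBot ℕ∞) := by
    rw [ringKrullDim_quotient, Order.coheight_eq_krullDim_Ici]
    rfl
  rw [hd, h2]
  have h3 : (s.length : ℕ∞) ≤ Order.coheight (⟨p, hpp⟩ : PrimeSpectrum R) := Order.length_le_coheight (by exact hle)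
  rw [hs] at h3
  exact_mod_cast h3

/-- all minimal primes of a complete S2 reduced ring have the same dimension, computed in a CM cover -/
theorem equi_R' {n : ℕ} {B : Type u} [CommRing B] [IsLocalRing B] [IsNoetherianRing B] (h : HD B n) (hd : ringKrullDim B = n)
    {R : Type v} [CommRing R] [IsLocalRing R] [IsNoetherianRing R] [IsReduced R] (f : B →+* R) (hf : Function.Surjective f)
    (hS2 : ∀ (P : Ideal R) [P.IsPrime], 2 ≤ P.height → HD (Localization.AtPrime P) 2)
    (p : Ideal R) (hp : p ∈ minimalPrimes R) : ringKrullDim R + ((p.comap f).height : WithBot ℕ∞) = n := by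
  obtain ⟨q, hq, hqd⟩ := exists_min_dim R
  rw [equi_R h hd f hf hS2 p q hp hq, ← hqd]
  have hqp : q.IsPrime := hq.1.1
  obtain ⟨l, -, h2, h3⟩ := M7 n h hd (q.comap f)
  obtain ⟨e⟩ := quot_iso f hf (q.comap f) (by
    intro y hy
    rw [Ideal.mem_comap, (RingHom.mem_ker).1 hy]; exact Ideal.zero_mem _)
  rw [Ideal.map_comap_of_surjective f hf] at e
  rw [← ringKrullDim_eq_of_ringEquiv e, h2]
  exact h3

end X11

namespace X11
universe v w
open IsLocalRing RingTheory.Sequence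

theorem surj_height {T U1 U2 : Type u} [CommRing T] [CommRing U1] [CommRing U2] (g1 : T →+* U1) (g2 : T →+* U2)
    (h1 : Function.Surjective g1) (h2 : Function.Surjective g2) (hk : RingHom.ker g1 = RingHom.ker g2) (Q : Ideal T) :
    (Q.map g1).height = (Q.map g2).height := by
  let e := (RingHom.quotientKerEquivOfSurjective h1).symm.trans ((Ideal.quotEquivOfEq hk).trans (RingHom.quotientKerEquivOfSurjective h2))
  have he : ∀ y, e (g1 y) = g2 y := by
    intro y
    have : (RingHom.quotientKerEquivOfSurjective h1).symm (g1 y) = Ideal.Quotient.mk _ y := by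
      rw [RingEquiv.symm_apply_eq]; rfl
    simp only [e, RingEquiv.trans_apply, this]
    rfl
  have : (Q.map g1).map (e : U1 →+* U2) = Q.map g2 := by
    rw [Ideal.map_map]
    congr 1
    ext y; exact he y
  rw [← this]
  exact (RingEquiv.height_map e _).symm

theorem FL_loc {A : Type u} {T : Type v} [CommRing A] [CommRing T] [Algebra A T] [Module.Flat A T] (p : Ideal A) (P : Ideal T) [p.IsPrime] [P.IsPrime]
    (h : p = P.comap (algebraMap A T)) : FL (Localization.localRingHom p P (algebraMap A T) h) := by
  have h1 : (algebraMap A T).Flat := by rw [RingHom.flat_algebraMap_iff]; infer_instance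
  have h2 := h1.localRingHom P p h
  let _ := (Localization.localRingHom p P (algebraMap A T) h).toAlgebra
  have h3 : Module.Flat (Localization.AtPrime p) (Localization.AtPrime P) := h2
  exact FL_flat

theorem loc_max {A : Type u} {T : Type v} [CommRing A] [CommRing T] (g : A →+* T) (p : Ideal A) (P : Ideal T) [p.IsPrime] [P.IsPrime]
    (h : p = P.comap g) : (maximalIdeal (Localization.AtPrime p)).map (Localization.localRingHom p P g h) = (p.map g).map (algebraMap T (Localization.AtPrime P)) := by
  rw [← Localization.AtPrime.map_eq_maximalIdeal, Ideal.map_map, Ideal.map_map]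
  congr 1
  ext y
  simp [Localization.localRingHom_to_map]

theorem loc_max_le {A : Type u} {T : Type v} [CommRing A] [CommRing T] (g : A →+* T) (p : Ideal A) (P : Ideal T) [p.IsPrime] [P.IsPrime]
    (h : p = P.comap g) : (maximalIdeal (Localization.AtPrime p)).map (Localization.localRingHom p P g h) ≤ maximalIdeal (Localization.AtPrime P) := by
  rw [loc_max, ← Localization.AtPrime.map_eq_maximalIdeal]
  refine Ideal.map_mono ?_
  rw [Ideal.map_le_iff_le_comap, h]

theorem fib {n : ℕ} {A R St S : Type u} [CommRing A] [IsLocalRing A] [IsNoetherianRing A] [CommRing R] [IsNoetherianRing R]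
    [CommRing St] [IsLocalRing St] [IsNoetherianRing St] [CommRing S] [IsNoetherianRing S]
    (hA : HD A n) (hAd : ringKrullDim A = n) (hSt : HD St n) (hStd : ringKrullDim St = n)
    [Algebra A St] [Module.Flat A St] [Algebra R S] [Module.Flat R S]
    (φ : A →+* R) (hφ : Function.Surjective φ) (Θ : St →+* S) (hΘ : Function.Surjective Θ)
    (hcomm : ∀ a, Θ (algebraMap A St a) = algebraMap R S (φ a))
    (hker : ∀ p : Ideal R, p.IsPrime → RingHom.ker Θ ≤ (p.comap φ).map (algebraMap A St))
    (P : Ideal S) [P.IsPrime] (p : Ideal R) [p.IsPrime] (hp : p = P.comap (algebraMap R S)) :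
    ∃ h f : ℕ, (p.comap φ).height = h ∧ (P.comap Θ).height = (h + f : ℕ) ∧ P.height ≤ p.height + f ∧
      (∀ k, HD (Localization.AtPrime p) k → HD (Localization.AtPrime P) (k + f)) ∧
      ringKrullDim (S ⧸ P) + (h + f : ℕ) = n ∧
      (f = 0 → ∀ Q : Ideal St, Q.IsPrime → p.comap φ ≤ Q.comap (algebraMap A St) → Q ≤ P.comap Θ → Q = P.comap Θ) := by
  have hpp : p.comap φ = (P.comap Θ).comap (algebraMap A St) := by
    ext a
    rw [Ideal.mem_comap, hp, Ideal.mem_comap, Ideal.mem_comap, Ideal.mem_comap, hcomm]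
  have hlo : (P.comap Θ).LiesOver (p.comap φ) := ⟨hpp⟩
  have hlo' : P.LiesOver p := ⟨hp⟩
  have hgd := Ideal.height_eq_height_add_of_liesOver_of_hasGoingDown (p.comap φ) (P.comap Θ)
  obtain ⟨h, h1, h2, -⟩ := M7 n hA hAd (p.comap φ)
  obtain ⟨t, t1, t2, t3⟩ := M7 n hSt hStd (P.comap Θ)
  have hf : ∃ f : ℕ, ((P.comap Θ).map (Ideal.Quotient.mk ((p.comap φ).map (algebraMap A St)))).height = f := by
    have h' : ((P.comap Θ).map (Ideal.Quotient.mk ((p.comap φ).map (algebraMap A St)))).height ≠ ⊤ := by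
      intro h'
      rw [h', t2] at hgd
      simp at hgd
    obtain ⟨f, hf⟩ := ENat.ne_top_iff_exists.1 h'
    exact ⟨f, hf.symm⟩
  obtain ⟨f, hf⟩ := hf
  rw [t2, h2, hf] at hgd
  have htf : t = h + f := by exact_mod_cast hgd
  subst htf
  have hmapΘ : ((p.comap φ).map (algebraMap A St)).map Θ = p.map (algebraMap R S) := by
    rw [Ideal.map_map]
    have : Θ.comp (algebraMap A St) = (algebraMap R S).comp φ := RingHom.ext hcomm
    rw [this, ← Ideal.map_map, Ideal.map_comap_of_surjective φ hφ]
  refine ⟨h, f, h2, t2, ?_, ?_, ?_, ?_⟩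
  · have h3 := Ideal.height_le_height_add_of_liesOver p P
    have h4 : (P.map (Ideal.Quotient.mk (p.map (algebraMap R S)))).height = f := by
      rw [← hf]
      have h5 := surj_height (Ideal.Quotient.mk ((p.comap φ).map (algebraMap A St))) ((Ideal.Quotient.mk (p.map (algebraMap R S))).comp Θ)
        Ideal.Quotient.mk_surjective (Ideal.Quotient.mk_surjective.comp hΘ) (by
          rw [Ideal.mk_ker, ← RingHom.comap_ker, Ideal.mk_ker, ← hmapΘ, Ideal.comap_map_of_surjective Θ hΘ, left_eq_sup]
          exact hker p ‹_›) (P.comap Θ)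
      rw [h5, ← Ideal.map_map, Ideal.map_comap_of_surjective Θ hΘ]
    rwa [h4] at h3
  · intro k hk
    have hfl := FL_loc (T := St) (p.comap φ) (P.comap Θ) hpp
    have hle := loc_max_le (algebraMap A St) (p.comap φ) (P.comap Θ) hpp
    have l1 := loc_quot _ hle
    have hn : ¬ HD (Localization.AtPrime (p.comap φ)) (h + 1) := by
      intro h'
      have := depth_le_dim h'
      rw [IsLocalization.AtPrime.ringKrullDim_eq_height (p.comap φ), h2] at this
      have : h + 1 ≤ h := by exact_mod_cast this
      omega
    have h3 := FL.HD_fibre h f h1 hn hfl hle (by rwa [add_comm])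
    have hfl' := FL_loc (T := S) p P hp
    have hle' := loc_max_le (algebraMap R S) p P hp
    have l2 := loc_quot _ hle'
    refine FL.HD_lift k f hk hfl' hle' ?_
    obtain ⟨s1, s2⟩ := loc_surj Θ hΘ (P.comap Θ) P rfl
    have hk1 := loc_max (algebraMap A St) (p.comap φ) (P.comap Θ) hpp
    obtain ⟨e⟩ := quot_iso _ s1 ((maximalIdeal (Localization.AtPrime (p.comap φ))).map (Localization.localRingHom (p.comap φ) (P.comap Θ) (algebraMap A St) hpp)) (by
      rw [s2, hk1]
      exact Ideal.map_mono (hker p ‹_›))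
    have hEq : ((maximalIdeal (Localization.AtPrime (p.comap φ))).map (Localization.localRingHom (p.comap φ) (P.comap Θ) (algebraMap A St) hpp)).map
        (Localization.localRingHom (P.comap Θ) P Θ rfl) = (maximalIdeal (Localization.AtPrime p)).map (Localization.localRingHom p P (algebraMap R S) hp) := by
      rw [hk1, loc_max, ← hmapΘ]
      rw [Ideal.map_map, Ideal.map_map (f := Θ)]
      congr 1
      ext y
      simp [Localization.localRingHom_to_map]
    exact HD_congr (e.trans (Ideal.quotEquivOfEq hEq)) h3
  · obtain ⟨e⟩ := quot_iso Θ hΘ (P.comap Θ) (by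
      intro y hy
      rw [Ideal.mem_comap, (RingHom.mem_ker).1 hy]; exact Ideal.zero_mem _)
    rw [Ideal.map_comap_of_surjective Θ hΘ] at e
    rw [← ringKrullDim_eq_of_ringEquiv e]
    exact t3
  · rintro rfl Q hQ hQ1 hQ2
    by_contra hne
    have hlt : Q < P.comap Θ := lt_of_le_of_ne hQ2 hne
    have h3 := Ideal.height_add_one_le_of_lt_of_isPrime hlt
    have hloQ : Q.LiesOver (p.comap φ) := ⟨le_antisymm hQ1 (by rw [hpp]; exact Ideal.comap_mono hQ2)⟩
    have h4 := Ideal.height_eq_height_add_of_liesOver_of_hasGoingDown (p.comap φ) Q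
    rw [t2, h4, h2] at h3
    have h5 : ((h : ℕ∞)) + 1 ≤ h := by
      refine le_trans ?_ h3
      exact add_le_add_left le_self_add 1
    have : h + 1 ≤ h := by exact_mod_cast h5
    omega

theorem M10core {R S : Type u} [CommRing R] [CommRing S] [IsNoetherianRing S] [Algebra R S] (x : S)
    (hr : ∀ s, x * s = 0 → s = 0)
    (hS2 : ∀ (P : Ideal R) [P.IsPrime] (k : ℕ), k ≤ 2 → (k : ℕ∞) ≤ P.height → HD (Localization.AtPrime P) k)
    (P : Ideal S) [P.IsPrime] (hx : x ∈ P) (f : ℕ) (hf : 1 ≤ f) (hht : P.height ≤ (P.comap (algebraMap R S)).height + f)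
    (hHD : ∀ k, HD (Localization.AtPrime (P.comap (algebraMap R S))) k → HD (Localization.AtPrime P) (k + f))
    (P' : Ideal (S ⧸ Ideal.span {x})) [P'.IsPrime] (hP' : P = P'.comap (Ideal.Quotient.mk _))
    (k : ℕ) (hk : (k : WithBot ℕ∞) ≤ min 2 (ringKrullDim (Localization.AtPrime P'))) :
    HD (Localization.AtPrime P') k := by
  obtain ⟨e⟩ := loc_quot_equiv1 x P P' hP'
  have hxl : algebraMap S (Localization.AtPrime P) x ∈ maximalIdeal (Localization.AtPrime P) :=
    (IsLocalization.AtPrime.to_map_mem_maximal_iff _ P x).2 hx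
  have hlo := loc_quot1 hxl
  refine HD_congr e ?_
  refine HD_quot' ?_ _ hxl (loc_nzd x hr P)
  rw [← ringKrullDim_eq_of_ringEquiv e] at hk
  have hxn : algebraMap S (Localization.AtPrime P) x ∈ nonZeroDivisors (Localization.AtPrime P) :=
    mem_nonZeroDivisors_iff_right.2 (fun s hs => loc_nzd x hr P s (by rwa [mul_comm]))
  have hd1 := ringKrullDim_quotient_succ_le_of_nonZeroDivisor hxn
  rw [IsLocalization.AtPrime.ringKrullDim_eq_height P (Localization.AtPrime P)] at hd1
  have hk2 : k ≤ 2 := by exact_mod_cast hk.trans (min_le_left _ _)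
  have hk3 : ((k + 1 : ℕ) : ℕ∞) ≤ P.height := by
    have h1 := (add_le_add_left (hk.trans (min_le_right _ _)) 1).trans hd1
    exact_mod_cast h1
  have hk4 := hk3.trans hht
  by_cases c2 : (2 : ℕ) ≤ (P.comap (algebraMap R S)).height
  · exact HD_mono (by omega) (hHD 2 (hS2 _ 2 le_rfl c2))
  · have hfin : (P.comap (algebraMap R S)).height ≠ ⊤ := by
      intro h; rw [h] at c2; exact c2 le_top
    obtain ⟨t, ht⟩ := ENat.ne_top_iff_exists.1 hfin
    rw [← ht] at c2 hk4
    have c2' : ¬ 2 ≤ t := fun h => c2 (by exact_mod_cast h)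
    have hk5 : k + 1 ≤ t + f := by exact_mod_cast hk4
    exact HD_mono hk5 (hHD t (hS2 _ t (by omega) ht.le))

theorem M9core {n d : ℕ} {A R S : Type u} [CommRing A] [IsLocalRing A] [IsNoetherianRing A]
    [CommRing R] [IsLocalRing R] [IsNoetherianRing R] [IsReduced R] [CommRing S] [IsLocalRing S] [IsNoetherianRing S] [Algebra R S]
    (hA : HD A n) (hAd : ringKrullDim A = n) (φ : A →+* R) (hφ : Function.Surjective φ) (x : S)
    (hS2 : ∀ (P : Ideal R) [P.IsPrime] (k : ℕ), k ≤ 2 → (k : ℕ∞) ≤ P.height → HD (Localization.AtPrime P) k)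
    (hd2 : 2 ≤ d) (hRd : ringKrullDim R = d) (hSd : ringKrullDim S = d)
    (hfib : ∀ (P : Ideal S) [P.IsPrime], x ∈ P → P ≠ maximalIdeal S → ∃ h f : ℕ, 1 ≤ f ∧
      ((P.comap (algebraMap R S)).comap φ).height = h ∧
      (∀ k, HD (Localization.AtPrime (P.comap (algebraMap R S))) k → HD (Localization.AtPrime P) (k + f)) ∧
      ringKrullDim (S ⧸ P) + (h + f : ℕ) = n)
    (P : Ideal S) (hP : P ∈ (Ideal.span {x}).minimalPrimes) : ringKrullDim (S ⧸ P) + 1 = d := by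
  have hPp : P.IsPrime := hP.1.1
  have hxP : x ∈ P := (Ideal.span_singleton_le_iff_mem _).1 hP.1.2
  have hht : P.height ≤ 1 := Ideal.height_le_one_of_isPrincipal_of_mem_minimalPrimes (Ideal.span {x}) P hP
  have hne : P ≠ maximalIdeal S := by
    rintro rfl
    have h1 := maximalIdeal_height_eq_ringKrullDim (R := S)
    rw [hSd] at h1
    have h2 : (maximalIdeal S).height = (d : ℕ∞) := by exact_mod_cast h1
    rw [h2] at hht
    have : d ≤ 1 := by exact_mod_cast hht
    omega
  obtain ⟨h, f, hf, hh, hHD, hdim⟩ := hfib P hxP hne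
  have hle : ∀ k, HD (Localization.AtPrime P) k → k ≤ 1 := by
    intro k hk
    have h1 := depth_le_dim hk
    rw [IsLocalization.AtPrime.ringKrullDim_eq_height P (Localization.AtPrime P)] at h1
    have h2 : (k : ℕ∞) ≤ P.height := by exact_mod_cast h1
    exact_mod_cast h2.trans hht
  have hp0 : (P.comap (algebraMap R S)).height = 0 := by
    by_contra h0
    have h1 : ((1 : ℕ) : ℕ∞) ≤ (P.comap (algebraMap R S)).height := by
      rw [Nat.cast_one]; exact ENat.one_le_iff_ne_zero.2 h0
    have := hle _ (hHD 1 (hS2 _ 1 (by omega) h1))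
    omega
  have hf1 : f = 1 := by
    have := hle _ (hHD 0 (HD_zero _))
    omega
  subst hf1
  have heq := equi_R' hA hAd φ hφ (fun P _ h2 => hS2 P 2 le_rfl (by exact_mod_cast h2)) (P.comap (algebraMap R S)) (Ideal.height_eq_zero_iff.1 hp0)
  rw [hh, hRd] at heq
  have : IsLocalRing (S ⧸ P) := quot_local P hPp.ne_top
  obtain ⟨c, hc⟩ := exists_dim (S ⧸ P)
  rw [hc] at hdim ⊢
  have e1 : d + h = n := by exact_mod_cast heq
  have e2 : c + (h + 1) = n := by exact_mod_cast hdim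
  have : c + 1 = d := by omega
  exact_mod_cast this

end X11

namespace X11
universe v w
open IsLocalRing RingTheory.Sequence

theorem ac_lift {A : Type u} {T : Type v} [CommRing A] [CommRing T] (I : Ideal A) (hI : I.FG) (L : A →+* T)
    (𝔱 : Ideal T) [IsAdicComplete 𝔱 T] (hL : I.map L ≤ 𝔱) :
    ∃ Θ : AdicCompletion I A →+* T, ∀ a, Θ (algebraMap A _ a) = L a := by
  have h0 : ∀ n, ∀ a ∈ I ^ n, ((Ideal.Quotient.mk (𝔱 ^ n)).comp L) a = 0 := by
    intro n a ha
    rw [RingHom.comp_apply, Ideal.Quotient.eq_zero_iff_mem]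
    refine Ideal.pow_right_mono hL n ?_
    rw [← Ideal.map_pow]
    exact Ideal.mem_map_of_mem _ ha
  let f : (n : ℕ) → AdicCompletion I A →+* T ⧸ 𝔱 ^ n := fun n =>
    (Ideal.Quotient.lift (I ^ n) ((Ideal.Quotient.mk (𝔱 ^ n)).comp L) (h0 n)).comp (AdicCompletion.evalₐ I n : AdicCompletion I A →+* _)
  have fa : ∀ n a, f n (algebraMap A _ a) = Ideal.Quotient.mk _ (L a) := by
    intro n a
    simp only [f, RingHom.comp_apply, RingHom.coe_coe, AlgHom.commutes, Ideal.Quotient.algebraMap_eq, Ideal.Quotient.lift_mk]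
  have fz : ∀ n z, z ∈ (I.map (algebraMap A (AdicCompletion I A))) ^ n → f n z = 0 := by
    intro n z hz
    rw [ac_mem hI] at hz
    simp only [f, RingHom.comp_apply, RingHom.coe_coe, hz, map_zero]
  have hf : ∀ {m n : ℕ} (hle : m ≤ n), (Ideal.Quotient.factorPow 𝔱 hle).comp (f n) = f m := by
    intro m n hle
    ext z
    obtain ⟨r, hr⟩ := ac_approx hI n z
    have h1 := fz n _ hr
    have h2 := fz m _ (Ideal.pow_le_pow_right hle hr)
    rw [map_sub, fa, sub_eq_zero] at h1 h2
    rw [RingHom.comp_apply, h1, h2]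
    rfl
  refine ⟨IsAdicComplete.liftRingHom 𝔱 f hf, fun a => ?_⟩
  have hH := haus_iff.1 (inferInstance : IsHausdorff 𝔱 T)
  rw [← sub_eq_zero]
  apply hH
  intro n
  rw [← Ideal.Quotient.eq_zero_iff_mem, map_sub, IsAdicComplete.mk_liftRingHom, fa, sub_self]

theorem flat_dim {E T : Type u} [CommRing E] [IsLocalRing E] [IsNoetherianRing E] [CommRing T] [IsLocalRing T] [IsNoetherianRing T]
    [Algebra E T] [Module.Flat E T] (h : maximalIdeal T = (maximalIdeal E).map (algebraMap E T)) :
    ringKrullDim T = ringKrullDim E := by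
  have hle : maximalIdeal E ≤ (maximalIdeal T).comap (algebraMap E T) := by
    rw [← Ideal.map_le_iff_le_comap, h]
  have heq := (maximalIdeal.isMaximal E).eq_of_le (Ideal.comap_ne_top _ (maximalIdeal.isMaximal T).ne_top) hle
  have : (maximalIdeal T).LiesOver (maximalIdeal E) := ⟨heq⟩
  have := Ideal.height_eq_height_add_of_liesOver_of_hasGoingDown (maximalIdeal E) (maximalIdeal T)
  have h3 : ((maximalIdeal T).map (Ideal.Quotient.mk <| (maximalIdeal E).map (algebraMap E T))).height = 0 := by
    have hp : ((maximalIdeal E).map (algebraMap E T)).IsPrime := by rw [← h]; infer_instance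
    have : (maximalIdeal T).map (Ideal.Quotient.mk <| (maximalIdeal E).map (algebraMap E T)) = ⊥ := by
      rw [← h, Ideal.map_quotient_self]
    rw [this]
    have : (⊥ : Ideal (T ⧸ (maximalIdeal E).map (algebraMap E T))).IsPrime := Ideal.isPrime_bot
    rw [Ideal.height_bot]
  rw [h3, add_zero] at this
  rw [← maximalIdeal_height_eq_ringKrullDim, ← maximalIdeal_height_eq_ringKrullDim, this]

theorem flat_HD {E T : Type u} [CommRing E] [IsLocalRing E] [CommRing T] [IsLocalRing T]
    [Algebra E T] [Module.Flat E T] (h : (maximalIdeal E).map (algebraMap E T) ≤ maximalIdeal T) {n : ℕ} (hd : HD E n) : HD T n := by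
  obtain ⟨rs, h1, h2, h3⟩ := hd
  refine ⟨rs.map (algebraMap E T), by simpa, ?_, h3.of_flat⟩
  intro r hr
  obtain ⟨a, ha, rfl⟩ := List.mem_map.1 hr
  exact h (Ideal.mem_map_of_mem _ (h2 a ha))

theorem surj_complete {S T : Type u} [CommRing S] [CommRing T] (I : Ideal S) (J : Ideal T) (hIc : IsAdicComplete I S) (hJ : IsHausdorff J T)
    (f : S →+* T) (h : I.map f = J) (hs : ∀ z, ∃ s, z - f s ∈ J) : Function.Surjective f := by
  subst h
  refine surjective_of_mk_map_comp_surjective (I := I) f ?_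
  intro z
  obtain ⟨z, rfl⟩ := Ideal.Quotient.mk_surjective z
  obtain ⟨s, hs⟩ := hs z
  exact ⟨s, by rw [RingHom.comp_apply, eq_comm, Ideal.Quotient.eq]; exact hs⟩

theorem Good.HD {A : Type u} [CommRing A] [IsLocalRing A] [IsNoetherianRing A] [IsDomain A] {n : ℕ} (h : Good A n) : HD A n := by
  obtain ⟨rs, h1, h2, h3⟩ := h.reg
  exact ⟨rs, h1, fun r hr => by rw [← h3]; exact Ideal.subset_span hr, h2⟩


set_option linter.unusedSectionVars false
section Theta
open MvPolynomial

theorem genPrime_prime (R : Type u) [CommRing R] [IsLocalRing R] (d : ℕ) : (genPrime R d).IsPrime := by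
  have : IsDomain (MvPolynomial (Fin d) (R ⧸ maximalIdeal R)) := by infer_instance
  have e := MvPolynomial.quotientEquivQuotientMvPolynomial (σ := Fin d) (maximalIdeal R)
  have : IsDomain (MvPolynomial (Fin d) R ⧸ genPrime R d) := e.symm.toMulEquiv.isDomain _
  exact (Ideal.Quotient.isDomain_iff_prime _).1 this

variable {A R : Type u} [CommRing A] [IsLocalRing A] [IsNoetherianRing A] [CommRing R] [IsLocalRing R] [IsNoetherianRing R] (d : ℕ)
  (hPA : (genPrime A d).IsPrime) (hP : (genPrime R d).IsPrime) (φ : A →+* R) (hφ : Function.Surjective φ)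

theorem map_mem_genPrime (hφ : Function.Surjective φ) (g : GenPoly A d) : MvPolynomial.map φ g ∈ genPrime R d ↔ g ∈ genPrime A d := by
  rw [genPrime, genPrime, MvPolynomial.mem_map_C_iff, MvPolynomial.mem_map_C_iff]
  simp only [MvPolynomial.coeff_map, mk_mem_max φ hφ]

theorem map_max (hφ : Function.Surjective φ) : (maximalIdeal A).map φ = maximalIdeal R := by
  have : maximalIdeal A = (maximalIdeal R).comap φ := by
    ext x; rw [Ideal.mem_comap, mk_mem_max φ hφ]
  rw [this, Ideal.map_comap_of_surjective φ hφ]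

theorem exists_theta (hφ : Function.Surjective φ) : ∃ Θ : GenLocHat A d hPA →+* GenLocHat R d hP,
    Function.Surjective Θ ∧
    (∀ g : GenPoly A d, Θ (algebraMap _ _ g) = algebraMap _ _ (MvPolynomial.map φ g)) ∧
    (∀ a : A, Θ (algebraMap _ _ a) = algebraMap _ _ (φ a)) ∧
    (∀ p : Ideal R, RingHom.ker Θ ≤ (p.comap φ).map (algebraMap A (GenLocHat A d hPA))) := by
  have hu : ∀ y : (genPrime A d).primeCompl, IsUnit (((algebraMap (GenPoly R d) (GenLocHat R d hP)).comp (MvPolynomial.map φ)) y) := by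
    intro y
    rw [RingHom.comp_apply]
    apply glh_unit
    intro h
    exact y.2 ((map_mem_genPrime d φ hφ _).1 h)
  let L : GenLoc A d hPA →+* GenLocHat R d hP := IsLocalization.lift (M := (genPrime A d).primeCompl) hu
  have hL : ∀ g, L (algebraMap _ _ g) = algebraMap _ _ (MvPolynomial.map φ g) := fun g => IsLocalization.lift_eq hu g
  have hLm : (maximalIdeal (GenLoc A d hPA)).map L ≤ maximalIdeal (GenLocHat R d hP) := by
    rw [gl_max A d hPA, Ideal.map_map, Ideal.map_le_iff_le_comap]
    intro g hg
    rw [Ideal.mem_comap, RingHom.comp_apply, hL, glh_maxA]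
    exact Ideal.mem_map_of_mem _ ((map_mem_genPrime d φ hφ _).2 hg)
  have hc := glh_complete R d hP
  have hcA := glh_complete A d hPA
  have hN := glh_noeth A d hPA
  obtain ⟨Θ, hΘ⟩ := ac_lift _ (IsNoetherian.noetherian _) L _ hLm
  have h1 : ∀ g : GenPoly A d, Θ (algebraMap _ _ g) = algebraMap _ _ (MvPolynomial.map φ g) := by
    intro g
    rw [IsScalarTower.algebraMap_apply (GenPoly A d) (GenLoc A d hPA) (GenLocHat A d hPA), hΘ, hL]
  have h2 : ∀ a : A, Θ (algebraMap _ _ a) = algebraMap _ _ (φ a) := by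
    intro a
    rw [IsScalarTower.algebraMap_apply A (GenPoly A d) (GenLocHat A d hPA), h1,
      IsScalarTower.algebraMap_apply R (GenPoly R d) (GenLocHat R d hP)]
    simp [MvPolynomial.algebraMap_eq]
  have h3 : (maximalIdeal (GenLocHat A d hPA)).map Θ = maximalIdeal (GenLocHat R d hP) := by
    rw [glh_max, glh_max, Ideal.map_map, ← map_max φ hφ, Ideal.map_map]
    congr 1
    exact RingHom.ext h2
  refine ⟨Θ, ?_, h1, h2, ?_⟩
  · refine surj_complete _ _ hcA inferInstance Θ h3 fun z => ?_
    obtain ⟨u, hu, g, hg⟩ := glh_approx0 R d hP 1 z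
    obtain ⟨g', rfl⟩ := MvPolynomial.map_surjective φ hφ g
    obtain ⟨u', rfl⟩ := MvPolynomial.map_surjective φ hφ u
    have hu' : u' ∈ (genPrime A d).primeCompl := fun h => hu ((map_mem_genPrime d φ hφ _).2 h)
    obtain ⟨w, hw⟩ := glh_unit A d hPA u' hu'
    rw [pow_one, ← h1, ← h1] at hg
    refine ⟨↑w⁻¹ * algebraMap _ _ g', ?_⟩
    have : z - Θ (↑w⁻¹ * algebraMap _ _ g') = Θ ↑w⁻¹ * (Θ (algebraMap _ _ u') * z - Θ (algebraMap _ _ g')) := by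
      have e : Θ ↑w⁻¹ * Θ (algebraMap _ _ u') = 1 := by rw [← hw, ← map_mul, Units.inv_mul, map_one]
      rw [map_mul, mul_sub, ← mul_assoc, e, one_mul]
    rw [this]
    exact Ideal.mul_mem_left _ _ hg
  · intro p z hz
    rw [RingHom.mem_ker] at hz
    apply krull_closed
    intro n
    obtain ⟨u, hu, g, hg⟩ := glh_approx0 A d hPA n z
    have h4 : algebraMap (GenPoly R d) (GenLocHat R d hP) (MvPolynomial.map φ g) ∈ (genPrime R d ^ n).map (algebraMap _ (GenLocHat R d hP)) := by
      rw [Ideal.map_pow, ← glh_maxA, ← h1, ← h3, ← Ideal.map_pow]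
      have := Ideal.mem_map_of_mem Θ hg
      rw [map_sub, map_mul, hz, mul_zero, zero_sub] at this
      exact neg_mem_iff.1 this
    obtain ⟨v, hv, hvg⟩ := glh_contract R d hP n _ le_rfl _ h4
    obtain ⟨v', rfl⟩ := MvPolynomial.map_surjective φ hφ v
    have hv' : v' ∈ (genPrime A d).primeCompl := fun h => hv ((map_mem_genPrime d φ hφ _).2 h)
    have h5 : genPrime R d ^ n = (genPrime A d ^ n).map (MvPolynomial.map φ) := by
      rw [Ideal.map_pow]
      congr 1
      rw [genPrime, genPrime, ← map_max φ hφ, Ideal.map_map, Ideal.map_map]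
      congr 1
      ext a; simp
    rw [h5, ← map_mul, Ideal.mem_map_iff_of_surjective _ (MvPolynomial.map_surjective φ hφ)] at hvg
    obtain ⟨j, hj, hje⟩ := hvg
    have h6 : v' * g - j ∈ (p.comap φ).map (C : A →+* GenPoly A d) := by
      rw [MvPolynomial.mem_map_C_iff]
      intro m
      rw [Ideal.mem_comap, ← MvPolynomial.coeff_map, map_sub, hje, sub_self, MvPolynomial.coeff_zero]
      exact zero_mem _
    have h7 : algebraMap (GenPoly A d) (GenLocHat A d hPA) (v' * g - j) ∈ (p.comap φ).map (algebraMap A (GenLocHat A d hPA)) := by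
      rw [IsScalarTower.algebraMap_eq A (GenPoly A d) (GenLocHat A d hPA), ← Ideal.map_map]
      exact Ideal.mem_map_of_mem _ h6
    have h8 : algebraMap (GenPoly A d) (GenLocHat A d hPA) j ∈ maximalIdeal (GenLocHat A d hPA) ^ n := by
      rw [glh_maxA, ← Ideal.map_pow]
      exact Ideal.mem_map_of_mem _ hj
    have h9 : algebraMap (GenPoly A d) (GenLocHat A d hPA) (v' * u) * z ∈ (p.comap φ).map (algebraMap A (GenLocHat A d hPA)) ⊔ maximalIdeal (GenLocHat A d hPA) ^ n := by
      have : algebraMap (GenPoly A d) (GenLocHat A d hPA) (v' * u) * z = algebraMap _ _ (v' * g - j) +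
        (algebraMap (GenPoly A d) (GenLocHat A d hPA) v' * (algebraMap _ _ u * z - algebraMap _ _ g) + algebraMap _ _ j) := by
        simp only [map_mul, map_sub]; ring
      rw [this]
      exact Submodule.add_mem_sup h7 (add_mem (Ideal.mul_mem_left _ _ hg) h8)
    exact (Ideal.unit_mul_mem_iff_mem _ (glh_unit A d hPA _ (mul_mem hv' hu))).1 h9

end Theta


section Fib
open MvPolynomial

theorem prime_map_C {A : Type u} [CommRing A] (p : Ideal A) [p.IsPrime] (d : ℕ) :
    (p.map (C : A →+* MvPolynomial (Fin d) A)).IsPrime := by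
  have : IsDomain (MvPolynomial (Fin d) (A ⧸ p)) := by infer_instance
  have e := MvPolynomial.quotientEquivQuotientMvPolynomial (σ := Fin d) p
  have : IsDomain (MvPolynomial (Fin d) A ⧸ p.map (C : A →+* MvPolynomial (Fin d) A)) := e.symm.toMulEquiv.isDomain _
  exact (Ideal.Quotient.isDomain_iff_prime _).1 this

theorem genElt_mem_C {A : Type u} [CommRing A] [IsLocalRing A] (p : Ideal A) (d : ℕ) (x : Fin d → A)
    (h : genElt A d x ∈ p.map (C : A →+* MvPolynomial (Fin d) A)) (i : Fin d) : x i ∈ p := by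
  classical
  rw [MvPolynomial.mem_map_C_iff] at h
  have := h (Finsupp.single i 1)
  rw [genElt, MvPolynomial.coeff_sum] at this
  have e : ∀ j, MvPolynomial.coeff (Finsupp.single i 1) (X j * C (x j)) = if j = i then x j else 0 := by
    intro j
    rw [mul_comm, MvPolynomial.coeff_C_mul, MvPolynomial.coeff_X]
    by_cases h : j = i
    · subst h; simp
    · rw [if_neg, if_neg h, mul_zero]
      intro h'
      exact h (Finsupp.single_left_injective one_ne_zero h')
  simpa [e] using this

theorem gen_fib {A R : Type u} [CommRing A] [IsLocalRing A] [IsNoetherianRing A] [CommRing R] [IsLocalRing R] [IsNoetherianRing R]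
    (d : ℕ) (hP : (genPrime R d).IsPrime) (x : Fin d → R) (Q : Ideal R) (hQ : Q = Ideal.span (Set.range x))
    (hrad : maximalIdeal R ≤ Q.radical) {n : ℕ} (hA : HD A n) (hAd : ringKrullDim A = n) (φ : A →+* R) (hφ : Function.Surjective φ)
    (P : Ideal (GenLocHat R d hP)) [P.IsPrime] (hx : genEltHat R d hP x ∈ P) (hne : P ≠ maximalIdeal (GenLocHat R d hP)) :
    ∃ h f : ℕ, 1 ≤ f ∧ ((P.comap (algebraMap R _)).comap φ).height = h ∧ P.height ≤ (P.comap (algebraMap R _)).height + f ∧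
      (∀ k, HD (Localization.AtPrime (P.comap (algebraMap R _))) k → HD (Localization.AtPrime P) (k + f)) ∧
      ringKrullDim (GenLocHat R d hP ⧸ P) + (h + f : ℕ) = n := by
  have hPA := genPrime_prime A d
  have := glh_noeth A d hPA
  have := glh_noeth R d hP
  have := gl_flat A d hPA
  have := gl_flat R d hP
  have hfA := gl_flatA A d hPA
  obtain ⟨Θ, hΘ, h1, h2, h3⟩ := exists_theta d hPA hP φ hφ
  have hSt : HD (GenLocHat A d hPA) n := flat_HD (glh_max A d hPA).ge hA
  have hStd : ringKrullDim (GenLocHat A d hPA) = n := (flat_dim (glh_max A d hPA)).trans hAd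
  obtain ⟨h, f, g1, g2, g3, g4, g5, g6⟩ := fib hA hAd hSt hStd φ hφ Θ hΘ h2 (fun p _ => h3 p) P (P.comap (algebraMap R _)) rfl
  refine ⟨h, f, ?_, g1, g3, g4, g5⟩
  by_contra hf
  have g6 := g6 (by omega)
  have hp : ((P.comap (algebraMap R (GenLocHat R d hP))).comap φ).IsPrime := inferInstance
  have hq := prime_map_C ((P.comap (algebraMap R (GenLocHat R d hP))).comap φ) d
  have hle : ((P.comap (algebraMap R (GenLocHat R d hP))).comap φ).map (C : A →+* GenPoly A d) ≤
      (P.comap Θ).comap (algebraMap (GenPoly A d) (GenLocHat A d hPA)) := by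
    rw [Ideal.map_le_iff_le_comap]
    intro a ha
    rw [Ideal.mem_comap, Ideal.mem_comap] at ha
    rw [Ideal.mem_comap, Ideal.mem_comap, Ideal.mem_comap, h1, map_C,
      ← MvPolynomial.algebraMap_eq, ← IsScalarTower.algebraMap_apply]
    exact ha
  have : (P.comap Θ).LiesOver ((P.comap Θ).comap (algebraMap (GenPoly A d) (GenLocHat A d hPA))) := ⟨rfl⟩
  obtain ⟨Q', hQ'1, hQ'2, hQ'3⟩ := Ideal.exists_ideal_le_liesOver_of_le (S := GenLocHat A d hPA) (P.comap Θ) hle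
  have hover := hQ'3.over
  rw [Ideal.under] at hover
  have := g6 Q' hQ'2 (by
    intro a ha
    rw [Ideal.mem_comap, IsScalarTower.algebraMap_apply A (GenPoly A d) (GenLocHat A d hPA), ← Ideal.mem_comap, ← hover]
    exact Ideal.mem_map_of_mem _ ha) hQ'1
  choose y hy using fun i => hφ (x i)
  have hm : genElt A d y ∈ ((P.comap (algebraMap R (GenLocHat R d hP))).comap φ).map (C : A →+* GenPoly A d) := by
    rw [hover, this, Ideal.mem_comap, Ideal.mem_comap, h1]
    have : MvPolynomial.map φ (genElt A d y) = genElt R d x := by simp [genElt, hy]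
    rw [this, ← genEltHat_eq]
    exact hx
  have hm := genElt_mem_C _ d y hm
  apply hne
  have hpp : maximalIdeal R ≤ P.comap (algebraMap R (GenLocHat R d hP)) := by
    refine hrad.trans (Ideal.IsPrime.radical_le_iff inferInstance |>.2 ?_)
    rw [hQ, Ideal.span_le]
    rintro _ ⟨i, rfl⟩
    have := hm i
    rw [Ideal.mem_comap, hy] at this
    exact this
  refine ((maximalIdeal.isMaximal _).eq_of_le (Ideal.IsPrime.ne_top ‹_›) ?_).symm
  rw [glh_max, Ideal.map_le_iff_le_comap]
  exact hpp

end Fib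

end X11

namespace X11
universe v w
open IsLocalRing RingTheory.Sequence

theorem S2_of {R : Type u} [CommRing R] (hS2 : SerreS2 R) (P : Ideal R) [hP : P.IsPrime] (k : ℕ) (hk : k ≤ 2) (h : (k : ℕ∞) ≤ P.height) :
    HD (Localization.AtPrime P) k := by
  rw [← HD_iff]
  refine hS2 P hP k (le_min (by exact_mod_cast hk) ?_)
  rw [IsLocalization.AtPrime.ringKrullDim_eq_height P (Localization.AtPrime P)]
  exact_mod_cast h

theorem HD_two {R : Type u} [CommRing R] [IsLocalRing R] (hS2 : SerreS2 R) (d : ℕ) (hd2 : 2 ≤ d) (hd : ringKrullDim R = d) : HD R 2 := by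
  have h := S2_of hS2 (maximalIdeal R) 2 le_rfl (by
    have := maximalIdeal_height_eq_ringKrullDim (R := R)
    rw [hd] at this
    have h2 : (maximalIdeal R).height = (d : ℕ∞) := by exact_mod_cast this
    rw [h2]; exact_mod_cast hd2)
  have e : R ≃+* Localization.AtPrime (maximalIdeal R) :=
    (IsLocalization.atUnits R (maximalIdeal R).primeCompl (S := Localization.AtPrime (maximalIdeal R)) (by
      intro u hu
      exact notMem_maximalIdeal.1 hu)).toRingEquiv
  exact HD_congr e.symm h

/-- localizing twice -/
theorem loc_loc {B : Type u} [CommRing B] (p : Ideal B) [p.IsPrime] (q : Ideal (Localization.AtPrime p)) [q.IsPrime] :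
    Nonempty (Localization.AtPrime (q.comap (algebraMap B (Localization.AtPrime p))) ≃+* Localization.AtPrime q) := by
  have := IsLocalization.isLocalization_isLocalization_atPrime_isLocalization p.primeCompl (Localization.AtPrime q) q
  exact ⟨(IsLocalization.algEquiv (q.comap (algebraMap B (Localization.AtPrime p))).primeCompl _ _).toRingEquiv⟩

theorem S2_loc {B : Type u} [CommRing B] (p : Ideal B) [p.IsPrime]
    (h : ∀ (q : Ideal B) [q.IsPrime], q ≤ p → ∀ k : ℕ, (k : WithBot ℕ∞) ≤ min 2 (ringKrullDim (Localization.AtPrime q)) → HD (Localization.AtPrime q) k) :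
    SerreS2 (Localization.AtPrime p) := by
  intro q hq k hk
  obtain ⟨e⟩ := loc_loc p q
  rw [HD_iff]
  refine HD_congr e (h _ ?_ k ?_)
  · have hle : q ≤ maximalIdeal _ := le_maximalIdeal hq.ne_top
    refine (Ideal.comap_mono hle).trans ?_
    intro b hb
    rw [Ideal.mem_comap] at hb
    exact (IsLocalization.AtPrime.to_map_mem_maximal_iff (Localization.AtPrime p) p b).1 hb
  · rw [ringKrullDim_eq_of_ringEquiv e]; exact hk

theorem equi_quot {S : Type u} [CommRing S] [IsLocalRing S] [IsNoetherianRing S] (x : S) (hx : x ∈ maximalIdeal S)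
    (hr : ∀ s, x * s = 0 → s = 0) (d : ℕ) (hd : ringKrullDim S = d)
    (h : ∀ P ∈ (Ideal.span {x}).minimalPrimes, ringKrullDim (S ⧸ P) + 1 = d) : IsEquidimensional (S ⧸ Ideal.span {x}) := by
  intro P hP
  have hPp : P.IsPrime := hP.1.1
  have h1 : ringKrullDim (S ⧸ Ideal.span {x}) + 1 = d := by
    rw [← hd]
    exact ringKrullDim_quotient_span_singleton_succ_eq_ringKrullDim_of_mem_nonZeroDivisors
      (mem_nonZeroDivisors_iff.2 ⟨fun s hs => hr s hs, fun s hs => hr s (by rw [mul_comm]; exact hs)⟩) hx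
  have h2 : P.comap (Ideal.Quotient.mk (Ideal.span {x})) ∈ (Ideal.span {x}).minimalPrimes := by
    refine ⟨⟨inferInstance, ?_⟩, ?_⟩
    · intro s hs
      rw [Ideal.mem_comap, Ideal.Quotient.eq_zero_iff_mem.2 hs]; exact zero_mem _
    · rintro Q ⟨hQ1, hQ2⟩ hQ3
      have hQ' : (Q.map (Ideal.Quotient.mk (Ideal.span {x}))).IsPrime :=
        Ideal.map_isPrime_of_surjective Ideal.Quotient.mk_surjective (by rw [Ideal.mk_ker]; exact hQ2)
      have := hP.2 ⟨hQ', bot_le⟩ (Ideal.map_le_iff_le_comap.2 hQ3)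
      refine (Ideal.comap_mono this).trans ?_
      rw [Ideal.comap_map_of_surjective _ Ideal.Quotient.mk_surjective, ← RingHom.ker_eq_comap_bot, Ideal.mk_ker]
      exact sup_le le_rfl hQ2
  have h3 := h _ h2
  obtain ⟨e⟩ := quot_iso (Ideal.Quotient.mk (Ideal.span {x})) Ideal.Quotient.mk_surjective (P.comap (Ideal.Quotient.mk (Ideal.span {x})))
    (by rw [Ideal.mk_ker]; exact h2.1.2)
  rw [ringKrullDim_eq_of_ringEquiv e, Ideal.map_comap_of_surjective _ Ideal.Quotient.mk_surjective, ← h1] at h3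
  have hl : IsLocalRing (S ⧸ Ideal.span {x}) := quot_local _ fun h => by
    have h1 := (Ideal.span_singleton_le_iff_mem (maximalIdeal S)).2 hx
    rw [h] at h1
    exact (maximalIdeal.isMaximal S).ne_top (top_le_iff.1 h1)
  have hl' := quot_local P hPp.ne_top
  obtain ⟨a, ha⟩ := exists_dim (S ⧸ Ideal.span {x})
  obtain ⟨b, hb⟩ := exists_dim ((S ⧸ Ideal.span {x}) ⧸ P)
  rw [ha, hb] at h3 ⊢
  have h4 : b + 1 = a + 1 := by exact_mod_cast h3
  rw [Nat.succ_injective h4]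

theorem final (R : Type u) [CommRing R] [IsLocalRing R] [IsNoetherianRing R]
    (hcomp : IsAdicComplete (maximalIdeal R) R)
    [IsReduced R] (hS2 : SerreS2 R)
    (d : ℕ) (hd2 : 2 ≤ d) (x : Fin d → R) (hx : IsSOP R x)
    (Q : Ideal R) (hQ : Q = Ideal.span (Set.range x))
    (Jbar : ℕ → Ideal R) (hJbar : ∀ n, (Jbar n : Set R) = intClSet R (Q ^ n))
    (ebar : ℕ → ℤ) (hebar : HasHilbertSeries R d Jbar ebar) (h1 : ebar 1 = 0)
    (hP : (genPrime R d).IsPrime) :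
    IsReduced (GenQuot R d hP x) ∧
    IsEquidimensional (GenQuot R d hP x) ∧
    (∀ (p : Ideal (GenQuot R d hP x)) (hp : p.IsPrime), ¬ p.IsMaximal →
      SerreS2 (Localization.AtPrime p)) ∧
    (∀ (J'' : ℕ → Ideal (GenQuot R d hP x)) (e'' : ℕ → ℤ),
      (∀ n, (J'' n : Set (GenQuot R d hP x)) =
        intClSet (GenQuot R d hP x) (Q.map (genMap R d hP x) ^ n)) →
      HasHilbertSeries (GenQuot R d hP x) (d - 1) J'' e'' →
      e'' 1 = 0) := by
  obtain ⟨c, hc⟩ := rees R Q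
  have hdim := hx.1
  have hrad : maximalIdeal R ≤ Q.radical := by rw [hQ]; exact hx.2.ge
  have hxm : ∀ i, x i ∈ maximalIdeal R := fun i => by
    rw [← hx.2]; exact Ideal.le_radical (Ideal.subset_span ⟨i, rfl⟩)
  have hd := HD_two hS2 d hd2 hdim
  have hc' : ∀ n, Jbar n ≤ Q ^ (n - c) := fun n b hb => hc n b (by rw [← hJbar]; exact hb)
  have hn := glh_noeth R d hP
  have hf := gl_flat R d hP
  have hSd : ringKrullDim (GenLocHat R d hP) = d := (flat_dim (glh_max R d hP)).trans hdim
  have hr := gen_nzdS R d hP hd x Q hQ hrad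
  have hm := genEltHat_mem R d hP x hxm
  obtain ⟨A, _, _, _, _, n, φ, hA, hφ⟩ := exists_surj R
  have hAn := hA.HD
  have hAd := hA.dim
  have hfib := fun (P : Ideal (GenLocHat R d hP)) (hPp : P.IsPrime) => gen_fib d hP x Q hQ hrad hAn hAd φ hφ P
  have hS := fun (P : Ideal R) [P.IsPrime] => S2_of hS2 P
  refine ⟨gq_reduced R d hP x hxm Q hQ hrad Jbar hJbar c hc' hd, ?_, ?_,
    fun J'' e'' => m6 R d hP x hxm Q hQ hrad Jbar hJbar c hc' hd hd2 ebar hebar h1 J'' e''⟩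
  · refine equi_quot _ hm hr d hSd fun P hPm => ?_
    refine M9core hAn hAd φ hφ _ hS hd2 hdim hSd ?_ P hPm
    intro P _ hxP hne
    obtain ⟨h, f, h1, h2, h3, h4, h5⟩ := hfib P inferInstance hxP hne
    exact ⟨h, f, h1, h2, h4, h5⟩
  · intro p hp hpm
    refine S2_loc p fun P' _ hle k hk => ?_
    have hxP : genEltHat R d hP x ∈ P'.comap (Ideal.Quotient.mk _) := by
      rw [Ideal.mem_comap, Ideal.Quotient.eq_zero_iff_mem.2 (Ideal.mem_span_singleton_self _)]; exact zero_mem _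
    have hne : P'.comap (Ideal.Quotient.mk _) ≠ maximalIdeal (GenLocHat R d hP) := by
      intro h
      have hmax : (P'.comap (Ideal.Quotient.mk (Ideal.span {genEltHat R d hP x}))).IsMaximal := by rw [h]; infer_instance
      have : P'.IsMaximal := by
        rw [← Ideal.map_comap_of_surjective _ Ideal.Quotient.mk_surjective P']
        exact Ideal.IsMaximal.map_of_surjective_of_ker_le Ideal.Quotient.mk_surjective (by
          rw [Ideal.mk_ker, Ideal.span_singleton_le_iff_mem]; exact hxP)
      exact hpm (this.eq_of_le hp.ne_top hle ▸ this)
    obtain ⟨h, f, h1, h2, h3, h4, h5⟩ := hfib _ inferInstance hxP hne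
    exact M10core _ hr hS _ hxP f h1 h3 h4 P' rfl k hk

end X11

/-- **Claim in Theorem 3.4.** Let `(R,m)` be complete Noetherian local, reduced, `S₂`,
of dimension `d ≥ 2`, and `Q = (x₁,…,x_d)` a parameter ideal with `ē₁(Q) = 0`. With
`R′ = R[t₁,…,t_d]_{mR[t₁,…,t_d]}`, `x = t₁x₁+⋯+t_dx_d` and `R″ = R̂′/xR̂′`, the ring
`R″` is reduced, equidimensional, `S₂` on the punctured spectrum, and `ē₁(QR″) = 0`. -/
theorem stmt11 (R : Type u) [CommRing R] [IsLocalRing R] [IsNoetherianRing R]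
    (hcomp : IsAdicComplete (maximalIdeal R) R)
    [IsReduced R] (hS2 : SerreS2 R)
    (d : ℕ) (hd2 : 2 ≤ d) (x : Fin d → R) (hx : IsSOP R x)
    (Q : Ideal R) (hQ : Q = Ideal.span (Set.range x))
    (Jbar : ℕ → Ideal R) (hJbar : ∀ n, (Jbar n : Set R) = intClSet R (Q ^ n))
    (ebar : ℕ → ℤ) (hebar : HasHilbertSeries R d Jbar ebar) (h1 : ebar 1 = 0)
    (hP : (genPrime R d).IsPrime) :
    IsReduced (GenQuot R d hP x) ∧
    IsEquidimensional (GenQuot R d hP x) ∧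
    (∀ (p : Ideal (GenQuot R d hP x)) (hp : p.IsPrime), ¬ p.IsMaximal →
      SerreS2 (Localization.AtPrime p)) ∧
    (∀ (J'' : ℕ → Ideal (GenQuot R d hP x)) (e'' : ℕ → ℤ),
      (∀ n, (J'' n : Set (GenQuot R d hP x)) =
        intClSet (GenQuot R d hP x) (Q.map (genMap R d hP x) ^ n)) →
      HasHilbertSeries (GenQuot R d hP x) (d - 1) J'' e'' →
      e'' 1 = 0) := by
  exact X11.final R hcomp hS2 d hd2 x hx Q hQ Jbar hJbar ebar hebar h1 hP
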